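/- Let n ≥ 2 and 0 < α < 1. Let Ω ⊂ ℝⁿ be a bounded domain and let u solve the one-phase problem: Δu = 1 in Ω∩B₁, u = 0 on ∂Ω∩B₁, and |Du| = 1 on ∂Ω∩B₁ (u continuous on Ω̄∩B₁, twice differentiable in Ω∩B₁, and C¹ up to ∂Ω∩B₁). If ∂Ω∩B₁ ∈ C^{1,α}, then u ∈ C^∞(Ω̄∩B₁) and ∂Ω∩B₁ ∈ C^∞. -/

import Mathlib

open MvPolynomial Metric Set MeasureTheory Bornology

noncomputable section

/-- `ℝⁿ` with the Euclidean norm. -/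
abbrev En (n : ℕ) := EuclideanSpace ℝ (Fin n)

variable {n : ℕ}

/-- Evaluation of a multivariate polynomial at a point of `ℝⁿ`. -/
def peval (P : MvPolynomial (Fin n) ℝ) (x : En n) : ℝ :=
  MvPolynomial.eval (fun i => x i) P

/-- Total degree of a monomial (multi-index). -/
def mdeg (d : Fin n →₀ ℕ) : ℕ := d.sum fun _ e => e

/-- `σ!` for a multi-index `σ`. -/
def mfact (d : Fin n →₀ ℕ) : ℕ := d.prod fun _ e => Nat.factorial e

/-- The norm `‖P‖ = Σ_σ |a_σ|` of a polynomial `P = Σ_σ (a_σ/σ!) x^σ`. -/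
def pnorm (P : MvPolynomial (Fin n) ℝ) : ℝ :=
  ∑ d ∈ P.support, (mfact d : ℝ) * |MvPolynomial.coeff d P|

/-- `|D^i P(0)|`, the Euclidean norm of the `i`-th derivative of `P` at `0`. -/
def derivNorm (i : ℕ) (P : MvPolynomial (Fin n) ℝ) : ℝ :=
  Real.sqrt (∑ d ∈ P.support.filter (fun d => mdeg d = i),
    ((mfact d : ℝ) * MvPolynomial.coeff d P) ^ 2)

/-- Polynomial Laplacian. -/
def plap (P : MvPolynomial (Fin n) ℝ) : MvPolynomial (Fin n) ℝ :=
  ∑ i, MvPolynomial.pderiv i (MvPolynomial.pderiv i P)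

/-- The index of the last coordinate. -/
def lastIdx (n : ℕ) [NeZero n] : Fin n :=
  ⟨n - 1, Nat.sub_lt (Nat.pos_of_ne_zero (NeZero.ne n)) Nat.one_pos⟩

variable [NeZero n]

/-- The last coordinate `x_n`. -/
def xn (x : En n) : ℝ := x (lastIdx n)

/-- `|x′|`, the norm of the first `n-1` coordinates. -/
def xpn (x : En n) : ℝ :=
  Real.sqrt (∑ i ∈ Finset.univ.erase (lastIdx n), (x i) ^ 2)

/-- Substitution of the polynomial `q` for the last variable `x_n`. -/
def substLast (q P : MvPolynomial (Fin n) ℝ) : MvPolynomial (Fin n) ℝ :=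
  MvPolynomial.aeval (fun i => if i = lastIdx n then q else MvPolynomial.X i) P

/-- The pointwise Laplacian of `u` at `x` (sum of pure second derivatives). -/
def lapAt (u : En n → ℝ) (x : En n) : ℝ :=
  ∑ i, fderiv ℝ (fderiv ℝ u) x (EuclideanSpace.single i 1) (EuclideanSpace.single i 1)

/-- `u` is a (classical) solution of `Δu = f` in `Ω ∩ B₁`, `u = g` on `∂Ω ∩ B₁`. -/
def SolvesDirichlet (Ω : Set (En n)) (u f g : En n → ℝ) : Prop :=
  ContinuousOn u (closure Ω ∩ ball 0 1) ∧
  (∀ x ∈ Ω ∩ ball (0 : En n) 1,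
    DifferentiableAt ℝ u x ∧ DifferentiableAt ℝ (fderiv ℝ u) x ∧ lapAt u x = f x) ∧
  (∀ x ∈ frontier Ω ∩ ball (0 : En n) 1, u x = g x)

/-- `u` is a (classical) solution of the oblique derivative problem `Δu = f` in `Ω ∩ B₁`,
`β·Du = g` on `∂Ω ∩ B₁`, with `‖β‖_∞ ≤ 1` and `β·e_n ≥ a₀`; `Du` is the (continuous up to the
boundary) gradient of `u`. -/
def SolvesOblique (Ω : Set (En n)) (u f g : En n → ℝ) (β Du : En n → En n) (a₀ : ℝ) : Prop :=
  ContinuousOn u (closure Ω ∩ ball 0 1) ∧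
  ContinuousOn Du (closure Ω ∩ ball 0 1) ∧
  (∀ x ∈ Ω ∩ ball (0 : En n) 1,
    DifferentiableAt ℝ u x ∧ (∀ i, fderiv ℝ u x (EuclideanSpace.single i 1) = Du x i) ∧
    DifferentiableAt ℝ (fderiv ℝ u) x ∧ lapAt u x = f x) ∧
  (∀ x ∈ frontier Ω ∩ ball (0 : En n) 1,
    (∑ i, β x i * Du x i) = g x ∧ ‖β x‖ ≤ 1 ∧ a₀ ≤ β x (lastIdx n))

/-- `∂Ω ∈ C^{m,α}(0)` with polynomial `P_Ω = P` and constant `K`. -/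
def DomainCmα (m : ℕ) (α K : ℝ) (P : MvPolynomial (Fin n) ℝ) (Ω : Set (En n)) : Prop :=
  P.totalDegree ≤ m ∧ MvPolynomial.coeff 0 P = 0 ∧
  MvPolynomial.pderiv (lastIdx n) P = 0 ∧
  (1 ≤ m → ∀ i, MvPolynomial.coeff (Finsupp.single i 1) P = 0) ∧
  (∀ x : En n, ‖x‖ < 1 → xn x > peval P x + K * (xpn x) ^ ((m : ℝ) + α) → x ∈ Ω) ∧
  (∀ x : En n, ‖x‖ < 1 → xn x < peval P x - K * (xpn x) ^ ((m : ℝ) + α) → x ∉ Ω)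

/-- `∂Ω ∈ C^{1,α}(0)` with constant `K` (the degree-one polynomial is necessarily `0`). -/
def Domain1α (α K : ℝ) (Ω : Set (En n)) : Prop :=
  (∀ x : En n, ‖x‖ < 1 → xn x > K * (xpn x) ^ ((1 : ℝ) + α) → x ∈ Ω) ∧
  (∀ x : En n, ‖x‖ < 1 → xn x < -(K * (xpn x) ^ ((1 : ℝ) + α)) → x ∉ Ω)

/-- `[∂Ω∩B₁]_{C^{0,1}(0)} ≤ δ`. -/
def DomainLip (δ : ℝ) (Ω : Set (En n)) : Prop :=
  (∀ x : En n, ‖x‖ < 1 → xn x > δ * xpn x → x ∈ Ω) ∧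
  (∀ x : En n, ‖x‖ < 1 → xn x < -(δ * xpn x) → x ∉ Ω)

/-- `osc_{B₁} ∂Ω ≤ δ`. -/
def FrontierOscLe (Ω : Set (En n)) (δ : ℝ) : Prop :=
  ∀ x ∈ frontier Ω ∩ ball (0 : En n) 1, ∀ y ∈ frontier Ω ∩ ball (0 : En n) 1,
    xn x - xn y ≤ δ

/-- The `L^n` norm of `f` on a set `S ⊆ ℝⁿ`. -/
def LnNorm (n : ℕ) (S : Set (En n)) (f : En n → ℝ) : ℝ :=
  (∫ x in S, |f x| ^ (n : ℝ)) ^ ((n : ℝ)⁻¹)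

/-- `∂Ω` is `C^{m,α}` at the point `x₀` with constants `K, r₀`: after an isometric change of
coordinates `φ` taking `x₀` to `0`, the boundary is trapped between `P_Ω(x′) ± K|x′|^{m+α}`. -/
def BoundaryPtCmα (m : ℕ) (α K r₀ : ℝ) (Ω : Set (En n)) (x₀ : En n) : Prop :=
  ∃ (φ : En n ≃ᵢ En n) (P : MvPolynomial (Fin n) ℝ), φ x₀ = 0 ∧
    P.totalDegree ≤ m ∧ MvPolynomial.coeff 0 P = 0 ∧
    MvPolynomial.pderiv (lastIdx n) P = 0 ∧
    (1 ≤ m → ∀ i, MvPolynomial.coeff (Finsupp.single i 1) P = 0) ∧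
    (∀ y : En n, ‖y‖ < r₀ → xn y > peval P y + K * (xpn y) ^ ((m : ℝ) + α) → φ.symm y ∈ Ω) ∧
    (∀ y : En n, ‖y‖ < r₀ → xn y < peval P y - K * (xpn y) ^ ((m : ℝ) + α) → φ.symm y ∉ Ω)

/-- `∂Ω ∩ B₁ ∈ C^{m,α}`: pointwise `C^{m,α}` with constants uniform on compact subsets. -/
def BoundaryCmα (m : ℕ) (α : ℝ) (Ω : Set (En n)) : Prop :=
  ∀ S : Set (En n), IsCompact S → S ⊆ frontier Ω ∩ ball (0 : En n) 1 →
    ∃ K r₀ : ℝ, 0 ≤ K ∧ 0 < r₀ ∧ ∀ x₀ ∈ S, BoundaryPtCmα m α K r₀ Ω x₀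

/-- `∂Ω ∩ B₁ ∈ C^∞`. -/
def BoundarySmooth (Ω : Set (En n)) : Prop :=
  ∀ m : ℕ, 1 ≤ m → ∀ α : ℝ, 0 < α → α ≤ 1 → BoundaryCmα m α Ω

/-- `u ∈ C^∞(Ω̄ ∩ B₁)`: near every point of `Ω̄ ∩ B₁`, `u` agrees on `Ω` with a globally
smooth function. -/
def SmoothUpToBoundary (Ω : Set (En n)) (u : En n → ℝ) : Prop :=
  ∀ x₀ ∈ closure Ω ∩ ball (0 : En n) 1, ∃ ε : ℝ, 0 < ε ∧ ∃ v : En n → ℝ,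
    ContDiff ℝ (⊤ : ℕ∞) v ∧ ∀ x ∈ Ω ∩ ball x₀ ε, v x = u x

notation "ℓ" => Fin.last _
notation "⊤∞" => (⊤ : ℕ∞)

lemma young3 {x y z al be ga l : ℝ} (hx : 0 ≤ x) (hy : 0 ≤ y) (hz : 0 ≤ z) (hal : 0 ≤ al)
    (hbe : 0 < be) (hga : 0 < ga) (hs : al + be + ga = 1) (hl : 0 < l) (h0 : al = 0 → x ≤ 1) :
    x * y * z ≤ l * (al * x ^ (1 / al) + y ^ (1 / be)) + l ^ (-((al + be) / ga)) * z ^ (1 / ga) := by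
  have key := Real.geom_mean_le_arith_mean3_weighted hal hbe.le hga.le
    (mul_nonneg hl.le (Real.rpow_nonneg hx (1 / al))) (mul_nonneg hl.le (Real.rpow_nonneg hy (1 / be)))
    (mul_nonneg (Real.rpow_nonneg hl.le (-((al + be) / ga))) (Real.rpow_nonneg hz (1 / ga))) hs
  have e2 : (l * y ^ (1 / be)) ^ be = l ^ be * y := by
    rw [Real.mul_rpow hl.le (Real.rpow_nonneg hy _), ← Real.rpow_mul hy]; field_simp; simp
  have e3 : (l ^ (-((al + be) / ga)) * z ^ (1 / ga)) ^ ga = l ^ (-(al + be)) * z := by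
    rw [Real.mul_rpow (Real.rpow_nonneg hl.le _) (Real.rpow_nonneg hz _), ← Real.rpow_mul hz,
      ← Real.rpow_mul hl.le]; field_simp; simp
  have e1 : l ^ al * x ≤ (l * x ^ (1 / al)) ^ al := by
    rcases hal.eq_or_lt with h | h
    · subst h; simpa using h0 rfl
    · rw [Real.mul_rpow hl.le (Real.rpow_nonneg hx _), ← Real.rpow_mul hx]; field_simp; simp
  have e4 : x * y * z = (l ^ al * x) * (l ^ be * y) * (l ^ (-(al + be)) * z) := by
    have : l ^ al * l ^ be * l ^ (-(al + be)) = 1 := by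
      rw [← Real.rpow_add hl, ← Real.rpow_add hl]; simp
    linear_combination (-x * y * z) * this
  rw [e2, e3] at key
  have hb1 : be ≤ 1 := by linarith
  have hg1 : ga ≤ 1 := by linarith
  have p1 := mul_nonneg hl.le (Real.rpow_nonneg hy (1 / be))
  have p2 := mul_nonneg (Real.rpow_nonneg hl.le (-((al + be) / ga))) (Real.rpow_nonneg hz (1 / ga))
  calc x * y * z = _ := e4
    _ ≤ (l * x ^ (1 / al)) ^ al * (l ^ be * y) * (l ^ (-(al + be)) * z) := by gcongr
    _ ≤ _ := key
    _ ≤ _ := by nlinarith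

lemma rpow_lip {c m x y : ℝ} (hc : 1 ≤ c) (hx : x ∈ Icc 0 m) (hy : y ∈ Icc 0 m) :
    |x ^ c - y ^ c| ≤ c * m ^ (c - 1) * |x - y| := by
  refine Convex.norm_image_sub_le_of_norm_hasDerivWithin_le (f := fun x : ℝ ↦ x ^ c)
    (f' := fun x ↦ c * x ^ (c - 1)) (s := Icc 0 m)
    (fun z hz ↦ (Real.hasDerivAt_rpow_const (Or.inr hc)).hasDerivWithinAt) (fun z hz ↦ ?_)
    (convex_Icc 0 m) hy hx
  rw [Real.norm_eq_abs, abs_of_nonneg (by have := Real.rpow_nonneg hz.1 (c-1); positivity)]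
  have := Real.rpow_le_rpow hz.1 hz.2 (by linarith : 0 ≤ c - 1)
  gcongr

noncomputable def phc (c s : ℝ) : ℝ := (max s 0) ^ c - (max (-s) 0) ^ c

lemma phc_mul {c : ℝ} (hc : 1 ≤ c) (s : ℝ) : phc c s * s = |s| ^ (c + 1) := by
  unfold phc
  rcases le_total 0 s with h | h
  · rw [max_eq_left h, max_eq_right (by linarith), Real.zero_rpow (by linarith), abs_of_nonneg h,
      Real.rpow_add_one' h (by linarith)]; ring
  · rw [max_eq_right h, max_eq_left (by linarith), Real.zero_rpow (by linarith), abs_of_nonpos h,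
      Real.rpow_add_one' (by linarith) (by linarith)]; ring

lemma phc_abs {c : ℝ} (hc : 1 ≤ c) (s : ℝ) : |phc c s| = |s| ^ c := by
  unfold phc
  rcases le_total 0 s with h | h
  · rw [max_eq_left h, max_eq_right (by linarith), Real.zero_rpow (by linarith), abs_of_nonneg h,
      sub_zero, abs_of_nonneg (Real.rpow_nonneg h _)]
  · rw [max_eq_right h, max_eq_left (by linarith), Real.zero_rpow (by linarith), abs_of_nonpos h,
      zero_sub, abs_neg, abs_of_nonneg (Real.rpow_nonneg (by linarith) _)]

lemma phc_lip {c : ℝ} (hc : 1 ≤ c) (s s' : ℝ) :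
    |phc c s - phc c s'| ≤ 2 * c * (|s| + |s'|) ^ (c - 1) * |s - s'| := by
  unfold phc
  have a0 := abs_nonneg s
  have a1 := abs_nonneg s'
  have h1 := rpow_lip (m := |s| + |s'|) hc (x := max s 0) (y := max s' 0)
    ⟨le_max_right _ _, max_le (by linarith [le_abs_self s]) (by linarith)⟩
    ⟨le_max_right _ _, max_le (by linarith [le_abs_self s']) (by linarith)⟩
  have h2 := rpow_lip (m := |s| + |s'|) hc (x := max (-s) 0) (y := max (-s') 0)
    ⟨le_max_right _ _, max_le (by linarith [neg_abs_le s]) (by linarith)⟩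
    ⟨le_max_right _ _, max_le (by linarith [neg_abs_le s']) (by linarith)⟩
  have h3 : |max s 0 - max s' 0| ≤ |s - s'| := by
    have := abs_max_sub_max_le_abs s s' 0; simpa using this
  have h4 : |max (-s) 0 - max (-s') 0| ≤ |s - s'| := by
    have := abs_max_sub_max_le_abs (-s) (-s') 0; rw [abs_sub_comm s s', show s' - s = -s - -s' by ring]; simpa using this
  have hp : 0 ≤ c * (|s| + |s'|) ^ (c - 1) := by
    have := Real.rpow_nonneg (by linarith : 0 ≤ |s| + |s'|) (c-1); positivity
  have := abs_sub (max s 0 ^ c - max s' 0 ^ c) (max (-s) 0 ^ c - max (-s') 0 ^ c)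
  calc _ = |(max s 0 ^ c - max s' 0 ^ c) - (max (-s) 0 ^ c - max (-s') 0 ^ c)| := by congr 1; ring
    _ ≤ _ := this
    _ ≤ c * (|s| + |s'|) ^ (c - 1) * |s - s'| + c * (|s| + |s'|) ^ (c - 1) * |s - s'| := by
        gcongr
        · exact h1.trans (by gcongr)
        · exact h2.trans (by gcongr)
    _ = _ := by ring

lemma phc_meas (c : ℝ) : Measurable (phc c) := by unfold phc; fun_prop

set_option maxHeartbeats 1000000 in
lemma gn_pt (p : ℕ) (j l : ℝ) (hj : 1 ≤ j) (hp : 2 * j < p) (hl : 0 < l) :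
    ∃ C : ℝ, 0 ≤ C ∧ ∀ L M : ℝ, 0 ≤ L → 0 ≤ M → ∃ C' : ℝ, 0 ≤ C' ∧ ∀ t w w' e d d' r : ℝ, 0 < t →
      0 ≤ w → w ≤ 1 → 0 ≤ w' → |w' - w| ≤ L * t → 0 ≤ e → e ≤ M → (j = 1 → e ≤ 1) →
      |d| ≤ M → |d'| ≤ M → |r| ≤ L * t → (j ≠ 1 → r = 0) →
      e * |w ^ p * phc (p / j - 1) d - w' ^ p * phc (p / j - 1) d'| + w ^ p * |d| ^ ((p:ℝ) / j - 1) * |r| ≤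
        l * ((j - 1) * (w' ^ p * e ^ ((p:ℝ) / (j - 1))) + w ^ p * |d| ^ ((p:ℝ) / j) + w' ^ p * |d'| ^ ((p:ℝ) / j))
        + C * (w ^ p * |d' - d| ^ ((p:ℝ) / (j + 1))) + C' * t ^ p := by
  have hp0 : (0:ℝ) < p := by linarith
  have hj0 : 0 < j := by linarith
  set a : ℝ := p / j with ha
  set c : ℝ := a - 1 with hc
  have ha2 : 2 < a := by rw [ha, lt_div_iff₀ hj0]; linarith
  have hc1 : 1 ≤ c := by linarith
  set D : ℝ := 2 ^ p * (2 * c * 2 ^ a + p + 1) with hD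
  have h2a : (0:ℝ) < 2 ^ a := by positivity
  have hD0 : 0 < D := by positivity
  set m : ℝ := l / D with hm
  have hm0 : 0 < m := by positivity
  have hq : ∃ G : ℝ, 0 ≤ G ∧ ∀ x y z : ℝ, 0 ≤ x → 0 ≤ y → 0 ≤ z → (j = 1 → x ≤ 1) →
      x * y ^ (c - 1) * z ≤ m * ((j - 1) / p * x ^ ((p:ℝ) / (j - 1)) + y ^ a) + G * z ^ ((p:ℝ) / (j + 1)) := by
    refine ⟨_, Real.rpow_nonneg hm0.le (-(((j - 1) / p + (p - 2 * j) / p) / ((j + 1) / p))), fun x y z hx hy hz h ↦ ?_⟩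
    have := young3 hx (Real.rpow_nonneg hy (c - 1)) hz (al := (j - 1) / p) (be := (p - 2 * j) / p)
      (ga := (j + 1) / p) (div_nonneg (by linarith) hp0.le) (div_pos (by linarith) hp0)
      (div_pos (by linarith) hp0) (by field_simp; ring) hm0
      (fun h' ↦ h (by rw [div_eq_zero_iff] at h'; rcases h' with h' | h' <;> linarith))
    rw [← Real.rpow_mul hy, one_div_div, one_div_div, one_div_div] at this
    have e : (c - 1) * ((p:ℝ) / (p - 2 * j)) = a := by
      have : (p:ℝ) - 2 * j ≠ 0 := by linarith
      have h2 : c - 1 = (p - 2 * j) / j := by rw [hc, ha]; field_simp; ring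
      rw [h2, ha]; field_simp
    rwa [e] at this
  have hq2 : ∃ G : ℝ, 0 ≤ G ∧ ∀ x y z : ℝ, 0 ≤ x → 0 ≤ y → 0 ≤ z → (j = 1 → x ≤ 1) →
      x * y ^ c * z ≤ m * ((j - 1) / p * x ^ ((p:ℝ) / (j - 1)) + y ^ a) + G * z ^ p := by
    refine ⟨_, Real.rpow_nonneg hm0.le (-(((j - 1) / p + (p - j) / p) / (1 / p))), fun x y z hx hy hz h ↦ ?_⟩
    have := young3 hx (Real.rpow_nonneg hy c) hz (al := (j - 1) / p) (be := (p - j) / p)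
      (ga := 1 / p) (div_nonneg (by linarith) hp0.le) (div_pos (by linarith) hp0)
      (div_pos (by linarith) hp0) (by field_simp; ring) hm0
      (fun h' ↦ h (by rw [div_eq_zero_iff] at h'; rcases h' with h' | h' <;> linarith))
    rw [← Real.rpow_mul hy, one_div_div, one_div_div, one_div_div, div_one, Real.rpow_natCast] at this
    have e : c * ((p:ℝ) / (p - j)) = a := by
      have : (p:ℝ) - j ≠ 0 := by linarith
      rw [hc, ha]; field_simp
    rwa [e] at this
  obtain ⟨G, hG, hq⟩ := hq
  obtain ⟨G', hG', hq'⟩ := hq2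
  refine ⟨2 * c * G, by positivity, fun L M hL hM ↦ ?_⟩
  set V : ℝ := M ^ a + M ^ ((p:ℝ) / (j - 1)) with hV
  have hV0 : 0 ≤ V := by positivity
  refine ⟨l * L ^ p * ((j - 1 + 2) * V) + (p + 1) * G' * L ^ p, by
    have : 0 ≤ j - 1 := by linarith
    positivity, ?_⟩
  intro t w w' e d d' r ht hw hw1 hw' hww he heM he1 hd hd' hr hrj
  set θ := max w w' with hθ
  have hθ0 : 0 ≤ θ := hw.trans (le_max_left _ _)
  set X := e ^ ((p:ℝ) / (j - 1)) with hX
  have hX0 : 0 ≤ X := Real.rpow_nonneg he _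
  have hXV : X ≤ V := by
    have := Real.rpow_le_rpow he heM (div_nonneg hp0.le (by linarith) : 0 ≤ (p:ℝ) / (j - 1))
    have h3 : 0 ≤ M ^ a := by positivity
    linarith
  have hdV : ∀ z : ℝ, |z| ≤ M → |z| ^ a ≤ V := fun z hz ↦ by
    have := Real.rpow_le_rpow (abs_nonneg z) hz (by linarith : 0 ≤ a)
    have h3 : 0 ≤ M ^ ((p:ℝ) / (j - 1)) := by positivity
    linarith
  have htp : 0 < t ^ p := by positivity
  have hθp : ∀ v : ℝ, 0 ≤ v → θ ≤ v + L * t → θ ^ p ≤ 2 ^ p * (v ^ p + L ^ p * t ^ p) := by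
    intro v hv h
    have hLt : 0 ≤ L * t := by positivity
    have h5 : θ ^ p ≤ (2 * max v (L * t)) ^ p := by
      gcongr; linarith [le_max_left v (L * t), le_max_right v (L * t)]
    have h6 : (max v (L * t)) ^ p ≤ v ^ p + (L * t) ^ p := by
      rcases max_cases v (L * t) with ⟨h, _⟩ | ⟨h, _⟩ <;> rw [h] <;> nlinarith [pow_nonneg hv p, pow_nonneg hLt p]
    rw [mul_pow] at h5; rw [mul_pow] at h6
    exact h5.trans (by gcongr)
  have hLt : 0 ≤ L * t := by positivity
  have hθw := hθp w hw (max_le (by linarith) (by linarith [le_abs_self (w' - w)]))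
  have hθw' := hθp w' hw' (max_le (by linarith [neg_abs_le (w' - w)]) (by linarith))
  have hwθ : w ^ p ≤ θ ^ p := by gcongr; exact le_max_left _ _
  have hw'θ : w' ^ p ≤ θ ^ p := by gcongr; exact le_max_right _ _
  set s := |d' - d| with hs
  have hs0 : 0 ≤ s := abs_nonneg _
  have T1 : e * (w ^ p * |phc c d - phc c d'|) ≤
      2 * c * (m * (θ ^ p * ((j - 1) / p * X) + 2 ^ a * (θ ^ p * (|d| ^ a + |d'| ^ a)))) + 2 * c * G * (w ^ p * s ^ ((p:ℝ) / (j + 1))) := by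
    have h1 := phc_lip hc1 d d'
    rw [abs_sub_comm d d'] at h1
    have h2 := hq e (|d| + |d'|) s he (by positivity) hs0 he1
    have h3 : (|d| + |d'|) ^ a ≤ 2 ^ a * (|d| ^ a + |d'| ^ a) := by
      have h5 : (|d| + |d'|) ^ a ≤ (2 * max (|d|) (|d'|)) ^ a :=
        Real.rpow_le_rpow (by positivity) (by linarith [le_max_left (|d|) (|d'|), le_max_right (|d|) (|d'|)]) (by linarith)
      rw [Real.mul_rpow (by norm_num) (le_max_of_le_left (abs_nonneg d))] at h5
      refine h5.trans ?_
      gcongr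
      rcases max_cases (|d|) (|d'|) with ⟨h, _⟩ | ⟨h, _⟩ <;> rw [h] <;>
        linarith [Real.rpow_nonneg (abs_nonneg d) a, Real.rpow_nonneg (abs_nonneg d') a]
    have hj1 : 0 ≤ (j - 1) / p := div_nonneg (by linarith) hp0.le
    have hda := Real.rpow_nonneg (abs_nonneg d) a
    have hda' := Real.rpow_nonneg (abs_nonneg d') a
    calc e * (w ^ p * |phc c d - phc c d'|) ≤ e * (w ^ p * (2 * c * (|d| + |d'|) ^ (c - 1) * s)) := by gcongr
      _ = 2 * c * (w ^ p * (e * (|d| + |d'|) ^ (c - 1) * s)) := by ring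
      _ ≤ 2 * c * (w ^ p * (m * ((j - 1) / p * X + 2 ^ a * (|d| ^ a + |d'| ^ a)) + G * s ^ ((p:ℝ) / (j + 1)))) := by
          gcongr
          exact h2.trans (by gcongr)
      _ = 2 * c * (m * (w ^ p * ((j - 1) / p * X) + 2 ^ a * (w ^ p * (|d| ^ a + |d'| ^ a)))) + 2 * c * G * (w ^ p * s ^ ((p:ℝ) / (j + 1))) := by ring
      _ ≤ _ := by gcongr
  have T2 : e * (|w ^ p - w' ^ p| * |d'| ^ c) ≤
      p * (m * (θ ^ p * ((j - 1) / p * X) + θ ^ p * |d'| ^ a)) + p * G' * L ^ p * t ^ p := by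
    have h1 : |w ^ p - w' ^ p| ≤ p * θ ^ (p - 1) * (L * t) := by
      have := abs_pow_sub_pow_le w w' p
      rw [abs_of_nonneg hw, abs_of_nonneg hw', abs_sub_comm w w'] at this
      calc _ ≤ _ := this
        _ ≤ (L * t) * p * θ ^ (p - 1) := by gcongr
        _ = _ := by ring
    have hj1 : 0 ≤ (j - 1) / p := div_nonneg (by linarith) hp0.le
    have hda' := Real.rpow_nonneg (abs_nonneg d') a
    have hdc' := Real.rpow_nonneg (abs_nonneg d') c
    have hpn : p ≠ 0 := by rintro rfl; simp at hp0
    rcases hθ0.eq_or_lt with h0 | h0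
    · have : w = 0 := le_antisymm (h0 ▸ le_max_left _ _) hw
      have h' : w' = 0 := le_antisymm (h0 ▸ le_max_right _ _) hw'
      rw [this, h', ← h0]; simp [hpn]; positivity
    · have h2 := hq' e (|d'|) (L * t / θ) he (abs_nonneg _) (by positivity) he1
      have e1 : θ ^ p * (L * t / θ) ^ p = L ^ p * t ^ p := by
        rw [← mul_pow, ← mul_pow]; congr 1; field_simp
      have e2 : θ ^ p * (L * t / θ) = θ ^ (p - 1) * (L * t) := by
        conv_lhs => rw [show p = p - 1 + 1 by omega, pow_succ]
        field_simp
      calc e * (|w ^ p - w' ^ p| * |d'| ^ c) ≤ e * ((p * θ ^ (p - 1) * (L * t)) * |d'| ^ c) := by gcongr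
        _ = p * (θ ^ p * (e * |d'| ^ c * (L * t / θ))) := by linear_combination (-p * e * |d'| ^ c) * e2
        _ ≤ p * (θ ^ p * (m * ((j - 1) / p * X + |d'| ^ a) + G' * (L * t / θ) ^ p)) := by gcongr
        _ = _ := by linear_combination (p * G') * e1
  have T3 : w ^ p * |d| ^ c * |r| ≤ m * (θ ^ p * |d| ^ a) + G' * L ^ p * t ^ p := by
    have hda := Real.rpow_nonneg (abs_nonneg d) a
    by_cases h1 : j = 1
    · have h2 := hq' 1 (|d|) (|r|) zero_le_one (abs_nonneg _) (abs_nonneg _) (fun _ ↦ le_rfl)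
      rw [h1] at h2
      simp only [sub_self, zero_div, zero_mul, zero_add, one_mul] at h2
      have hw1p : w ^ p ≤ 1 := pow_le_one₀ hw hw1
      have hrp : |r| ^ p ≤ (L * t) ^ p := by gcongr
      calc w ^ p * |d| ^ c * |r| = w ^ p * (|d| ^ c * |r|) := by ring
        _ ≤ w ^ p * (m * |d| ^ a + G' * |r| ^ p) := by gcongr
        _ = m * (w ^ p * |d| ^ a) + G' * (w ^ p * |r| ^ p) := by ring
        _ ≤ m * (θ ^ p * |d| ^ a) + G' * (1 * (L * t) ^ p) := by gcongr
        _ = _ := by ring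
    · rw [hrj h1]; simp; positivity
  have hsum : e * |w ^ p * phc c d - w' ^ p * phc c d'| ≤
      e * (w ^ p * |phc c d - phc c d'|) + e * (|w ^ p - w' ^ p| * |d'| ^ c) := by
    rw [← mul_add]
    gcongr
    have : w ^ p * phc c d - w' ^ p * phc c d' = w ^ p * (phc c d - phc c d') + (w ^ p - w' ^ p) * phc c d' := by ring
    rw [this, ← phc_abs hc1]
    refine (abs_add_le _ _).trans ?_
    rw [abs_mul, abs_mul, abs_of_nonneg (pow_nonneg hw p)]
  have hda := Real.rpow_nonneg (abs_nonneg d) a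
  have hda' := Real.rpow_nonneg (abs_nonneg d') a
  have hj1 : 0 ≤ j - 1 := by linarith
  have hj1p : (j - 1) / p ≤ j - 1 := div_le_self hj1 (by linarith)
  have hB : 0 ≤ 2 * c * 2 ^ a + p + 1 := by positivity
  have h2a1 : (1:ℝ) ≤ 2 ^ a := Real.one_le_rpow (by norm_num) (by linarith)
  have hfin : 2 * c * (m * (θ ^ p * ((j - 1) / p * X) + 2 ^ a * (θ ^ p * (|d| ^ a + |d'| ^ a))))
      + p * (m * (θ ^ p * ((j - 1) / p * X) + θ ^ p * |d'| ^ a)) + m * (θ ^ p * |d| ^ a) ≤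
      m * (2 * c * 2 ^ a + p + 1) * ((j - 1) * (θ ^ p * X) + θ ^ p * |d| ^ a + θ ^ p * |d'| ^ a) := by
    have u1 : θ ^ p * ((j - 1) / p * X) ≤ (j - 1) * (θ ^ p * X) := by
      rw [mul_left_comm]; gcongr
    have u0 : 0 ≤ (j - 1) * (θ ^ p * X) := by positivity
    have u2 : 0 ≤ θ ^ p * |d| ^ a := by positivity
    have u3 : 0 ≤ θ ^ p * |d'| ^ a := by positivity
    set A := (j - 1) * (θ ^ p * X)
    set B := θ ^ p * |d| ^ a
    set B' := θ ^ p * |d'| ^ a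
    have : θ ^ p * (|d| ^ a + |d'| ^ a) = B + B' := by simp only [B, B']; ring
    rw [this]
    have v1 : 2 * c * (m * (θ ^ p * ((j - 1) / p * X) + 2 ^ a * (B + B'))) ≤ 2 * c * (m * (2 ^ a * A + 2 ^ a * (B + B'))) := by
      have := u1.trans (le_mul_of_one_le_left u0 h2a1)
      refine mul_le_mul_of_nonneg_left (mul_le_mul_of_nonneg_left ?_ hm0.le) (by positivity)
      linarith
    have v2 : p * (m * (θ ^ p * ((j - 1) / p * X) + B')) ≤ p * (m * (A + B')) := by gcongr
    have w1 := mul_nonneg hm0.le u0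
    have w2 := mul_nonneg hm0.le u2
    have w3 := mul_nonneg hm0.le u3
    have w4 := mul_nonneg hp0.le w2
    nlinarith
  have hfin2 : (j - 1) * (θ ^ p * X) + θ ^ p * |d| ^ a + θ ^ p * |d'| ^ a ≤
      2 ^ p * ((j - 1) * (w' ^ p * X) + w ^ p * |d| ^ a + w' ^ p * |d'| ^ a + L ^ p * t ^ p * ((j - 1 + 2) * V)) := by
    calc _ ≤ (j - 1) * (2 ^ p * (w' ^ p + L ^ p * t ^ p) * X) + 2 ^ p * (w ^ p + L ^ p * t ^ p) * |d| ^ a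
          + 2 ^ p * (w' ^ p + L ^ p * t ^ p) * |d'| ^ a := by gcongr
      _ = 2 ^ p * ((j - 1) * (w' ^ p * X) + w ^ p * |d| ^ a + w' ^ p * |d'| ^ a
          + L ^ p * t ^ p * ((j - 1) * X + |d| ^ a + |d'| ^ a)) := by ring
      _ ≤ 2 ^ p * ((j - 1) * (w' ^ p * X) + w ^ p * |d| ^ a + w' ^ p * |d'| ^ a
          + L ^ p * t ^ p * ((j - 1) * V + V + V)) := by
            gcongr
            · exact hdV d hd
            · exact hdV d' hd'
      _ = _ := by ring
  have hmD : m * (2 * c * 2 ^ a + p + 1) * 2 ^ p = l := by rw [hm, hD]; field_simp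
  have hmB : 0 ≤ m * (2 * c * 2 ^ a + p + 1) := by positivity
  have := mul_le_mul_of_nonneg_left hfin2 hmB
  rw [← mul_assoc (m * _) (2 ^ p), hmD] at this
  linarith

structure GNS {X : Type} [MeasurableSpace X] (μ : Measure X) (A : Set X) (T : X → X) (η : X → ℝ)
    (t L : ℝ) : Prop where
  mp : MeasurePreserving T μ μ
  mA : MeasurableSet A
  fin : μ A ≠ ⊤
  ηm : Measurable η
  η0 : ∀ x, 0 ≤ η x
  η1 : ∀ x, η x ≤ 1
  t0 : 0 < t
  L0 : 0 ≤ L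
  lip : ∀ x, |η (T x) - η x| ≤ L * t
  sup : ∀ x, x ∉ A → η x = 0
  sup' : ∀ x, x ∉ A → η (T x) = 0

lemma nice_int {X : Type} [MeasurableSpace X] {μ : Measure X} {A : Set X} (_mA : MeasurableSet A)
    (fin : μ A ≠ ⊤) {f : X → ℝ} (hf : Measurable f) {C : ℝ} (hC : ∀ x, |f x| ≤ C)
    (h0 : ∀ x, x ∉ A → f x = 0) : Integrable f μ := by
  rw [← integrableOn_iff_integrable_of_support_subset (s := A)]
  · exact Measure.integrableOn_of_bounded fin hf.aestronglyMeasurable (M := C)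
      (Filter.Eventually.of_forall hC)
  · intro x hx; by_contra h; exact hx (h0 x h)

lemma GNS.int {X : Type} [MeasurableSpace X] {μ : Measure X} {A : Set X} {T : X → X} {η : X → ℝ}
    {t L : ℝ} (S : GNS μ A T η t L) {p : ℕ} (hp : p ≠ 0) {f : X → ℝ} (hf : Measurable f) {C : ℝ}
    (hC : ∀ x, |f x| ≤ C) : Integrable (fun x ↦ η x ^ p * f x) μ := by
  refine nice_int S.mA S.fin (by have := S.ηm; fun_prop) (C := C) (fun x ↦ ?_)
    (fun x hx ↦ by simp [S.sup x hx, hp])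
  rw [abs_mul, abs_of_nonneg (pow_nonneg (S.η0 x) p)]
  calc _ ≤ 1 * |f x| := by gcongr; exact pow_le_one₀ (S.η0 x) (S.η1 x)
    _ ≤ C := by linarith [hC x]

lemma mp_int {X : Type} [MeasurableSpace X] {μ : Measure X} {T : X → X} (h : MeasurePreserving T μ μ)
    {f : X → ℝ} (hf : Measurable f) : ∫ x, f (T x) ∂μ = ∫ x, f x ∂μ := by
  have := integral_map (μ := μ) h.measurable.aemeasurable (f := f) (by rw [h.map_eq]; exact hf.aestronglyMeasurable)
  rw [h.map_eq] at this; exact this.symm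

lemma iadd {X : Type} [MeasurableSpace X] {μ : Measure X} {f g : X → ℝ} (hf : Integrable f μ)
    (hg : Integrable g μ) : Integrable (fun x ↦ f x + g x) μ := hf.add hg

lemma isub {X : Type} [MeasurableSpace X] {μ : Measure X} {f g : X → ℝ} (hf : Integrable f μ)
    (hg : Integrable g μ) : Integrable (fun x ↦ f x - g x) μ := hf.sub hg

lemma rpow_bd {M c x : ℝ} (hx : |x| ≤ M) (hc : 0 ≤ c) : |(|x| ^ c)| ≤ M ^ c := by
  rw [abs_of_nonneg (Real.rpow_nonneg (abs_nonneg x) c)]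
  exact Real.rpow_le_rpow (abs_nonneg x) hx hc

set_option maxHeartbeats 1000000 in
lemma gn_step {X : Type} [MeasurableSpace X] (μ : Measure X) (A : Set X) (p : ℕ) (j l : ℝ)
    (hj : 1 ≤ j) (hp : 2 * j < p) (hl : 0 < l) :
    ∃ C : ℝ, 0 ≤ C ∧ ∀ L M : ℝ, 0 ≤ L → 0 ≤ M → ∃ C' : ℝ, 0 ≤ C' ∧ ∀ (T : X → X) (η : X → ℝ) (t : ℝ)
      (E D : X → ℝ), GNS μ A T η t L → Measurable E → Measurable D → (∀ x, |E x| ≤ M) →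
      (∀ x, |D x| ≤ M) → (j = 1 → ∀ x, |E x| ≤ 1) → (∀ x, |D x - (E (T x) - E x)| ≤ L * t) →
      (j ≠ 1 → ∀ x, D x = E (T x) - E x) →
      ∫ x, η x ^ p * |D x| ^ ((p:ℝ) / j) ∂μ ≤
        l * ((j - 1) * ∫ x, η x ^ p * |E x| ^ ((p:ℝ) / (j - 1)) ∂μ + 2 * ∫ x, η x ^ p * |D x| ^ ((p:ℝ) / j) ∂μ)
        + C * ∫ x, η x ^ p * |D (T x) - D x| ^ ((p:ℝ) / (j + 1)) ∂μ + C' * t ^ p := by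
  obtain ⟨C, hC, H⟩ := gn_pt p j l hj hp hl
  refine ⟨C, hC, fun L M hL hM ↦ ?_⟩
  obtain ⟨C', hC', H⟩ := H L M hL hM
  refine ⟨C' * (μ A).toReal, by positivity, fun T η t E D S mE mD hE hD hE1 hr hr0 ↦ ?_⟩
  have hp0 : (0:ℝ) < p := by linarith
  have hpn : p ≠ 0 := by rintro rfl; simp at hp0
  set a : ℝ := p / j with ha
  have ha2 : 2 < a := by rw [ha, lt_div_iff₀ (by linarith)]; linarith
  have mT := S.mp.measurable
  have mη := S.ηm
  have mph := phc_meas (a - 1)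
  have hphb : ∀ x, |phc (a - 1) (D x)| ≤ M ^ (a - 1) := fun x ↦ by
    rw [phc_abs (by linarith)]; exact Real.rpow_le_rpow (abs_nonneg _) (hD x) (by linarith)
  have I1 : Integrable (fun x ↦ η x ^ p * |D x| ^ a) μ :=
    S.int hpn (by fun_prop) (fun x ↦ rpow_bd (hD x) (by linarith))
  have I0 : Integrable (fun x ↦ η x ^ p * |E x| ^ ((p:ℝ) / (j - 1))) μ :=
    S.int hpn (by fun_prop) (fun x ↦ rpow_bd (hE x) (div_nonneg hp0.le (by linarith)))
  have hDD : ∀ x, |D (T x) - D x| ≤ 2 * M := fun x ↦ (abs_sub _ _).trans (by linarith [hD x, hD (T x)])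
  have I2 : Integrable (fun x ↦ η x ^ p * |D (T x) - D x| ^ ((p:ℝ) / (j + 1))) μ :=
    S.int hpn (by fun_prop) (fun x ↦ rpow_bd (hDD x) (div_nonneg hp0.le (by linarith)))
  have IA : Integrable (A.indicator fun _ ↦ C' * t ^ p) μ :=
    (integrable_indicator_iff S.mA).2 (integrableOn_const S.fin)
  have J1 : Integrable (fun x ↦ η x ^ p * (phc (a - 1) (D x) * E x)) μ :=
    S.int hpn (by fun_prop) (C := M ^ (a - 1) * M) (fun x ↦ by
      rw [abs_mul]; gcongr; exacts [hphb x, hE x])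
  have J2 : Integrable (fun x ↦ η x ^ p * (phc (a - 1) (D x) * E (T x))) μ :=
    S.int hpn (by fun_prop) (C := M ^ (a - 1) * M) (fun x ↦ by
      rw [abs_mul]; gcongr; exacts [hphb x, hE _])
  have J3 : Integrable (fun x ↦ η x ^ p * (phc (a - 1) (D x) * (D x - (E (T x) - E x)))) μ :=
    S.int hpn (by fun_prop) (C := M ^ (a - 1) * (L * t)) (fun x ↦ by
      rw [abs_mul]; gcongr; exacts [hphb x, hr _])
  have cmp : ∀ {f : X → ℝ}, Integrable f μ → Integrable (fun x ↦ f (T x)) μ := fun h ↦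
    S.mp.integrable_comp_of_integrable h
  have key : ∫ x, η x ^ p * |D x| ^ a ∂μ = ∫ x, (E (T x) * (η x ^ p * phc (a - 1) (D x) -
      η (T x) ^ p * phc (a - 1) (D (T x))) + η x ^ p * (phc (a - 1) (D x) * (D x - (E (T x) - E x)))) ∂μ := by
    have e1 : ∀ x, η x ^ p * |D x| ^ a = (η x ^ p * (phc (a - 1) (D x) * E (T x)) -
        η x ^ p * (phc (a - 1) (D x) * E x)) + η x ^ p * (phc (a - 1) (D x) * (D x - (E (T x) - E x))) := fun x ↦ by
      have := phc_mul (c := a - 1) (by linarith) (D x)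
      rw [sub_add_cancel] at this; rw [← this]; ring
    have e2 : ∀ x, (E (T x) * (η x ^ p * phc (a - 1) (D x) -
      η (T x) ^ p * phc (a - 1) (D (T x))) + η x ^ p * (phc (a - 1) (D x) * (D x - (E (T x) - E x)))) =
       (η x ^ p * (phc (a - 1) (D x) * E (T x)) - η (T x) ^ p * (phc (a - 1) (D (T x)) * E (T x)))
        + η x ^ p * (phc (a - 1) (D x) * (D x - (E (T x) - E x))) := fun x ↦ by ring
    simp_rw [e1, e2]
    rw [integral_add (isub J2 J1) J3, integral_sub J2 J1, integral_add (isub J2 (cmp J1)) J3,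
      integral_sub J2 (cmp J1)]
    rw [mp_int S.mp (f := fun x ↦ η x ^ p * (phc (a - 1) (D x) * E x)) (by fun_prop)]
  refine (le_of_eq key).trans ?_
  have pt : ∀ x, (E (T x) * (η x ^ p * phc (a - 1) (D x) -
      η (T x) ^ p * phc (a - 1) (D (T x))) + η x ^ p * (phc (a - 1) (D x) * (D x - (E (T x) - E x)))) ≤
      (l * ((j - 1) * (η (T x) ^ p * |E (T x)| ^ ((p:ℝ) / (j - 1))) + η x ^ p * |D x| ^ a + η (T x) ^ p * |D (T x)| ^ a)
        + C * (η x ^ p * |D (T x) - D x| ^ ((p:ℝ) / (j + 1)))) + A.indicator (fun _ ↦ C' * t ^ p) x := by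
    intro x
    by_cases hx : x ∈ A
    · rw [indicator_of_mem hx]
      refine le_trans ?_ (H t (η x) (η (T x)) (|E (T x)|) (D x) (D (T x)) (D x - (E (T x) - E x)) S.t0
        (S.η0 x) (S.η1 x) (S.η0 _) (S.lip x) (abs_nonneg _) (hE _) (fun h ↦ hE1 h _) (hD x) (hD _) (hr x)
        (fun h ↦ by rw [hr0 h x]; ring))
      refine add_le_add ?_ ?_
      · rw [← abs_mul]; exact le_abs_self _
      · rw [mul_assoc]
        refine mul_le_mul_of_nonneg_left ?_ (pow_nonneg (S.η0 x) p)
        rw [← phc_abs (by linarith), ← abs_mul]; exact le_abs_self _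
    · simp [S.sup x hx, S.sup' x hx, hpn, hx]
  have IR := (iadd (iadd ((cmp I0).const_mul (j - 1)) I1) (cmp I1)).const_mul l
  have IL : Integrable (fun x ↦ E (T x) * (η x ^ p * phc (a - 1) (D x) -
      η (T x) ^ p * phc (a - 1) (D (T x))) + η x ^ p * (phc (a - 1) (D x) * (D x - (E (T x) - E x)))) μ := by
    refine (((J2.sub (cmp J1)).add J3)).congr (Filter.Eventually.of_forall fun x ↦ ?_)
    simp only [Pi.add_apply, Pi.sub_apply]; ring
  have := integral_mono IL (iadd (iadd IR (I2.const_mul C)) IA) pt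
  refine this.trans (le_of_eq ?_)
  have ee : ∫ x, A.indicator (fun _ ↦ C' * t ^ p) x ∂μ = C' * (μ A).toReal * t ^ p := by
    rw [integral_indicator S.mA, setIntegral_const, smul_eq_mul, Measure.real]; ring
  rw [integral_add (iadd IR (I2.const_mul C)) IA, integral_add IR (I2.const_mul C), ee, integral_const_mul,
    integral_const_mul, integral_add (iadd ((cmp I0).const_mul (j - 1)) I1) (cmp I1),
    integral_add ((cmp I0).const_mul (j - 1)) I1, integral_const_mul,
    mp_int S.mp (f := fun x ↦ η x ^ p * |E x| ^ ((p:ℝ) / (j - 1))) (by fun_prop),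
    mp_int S.mp (f := fun x ↦ η x ^ p * |D x| ^ a) (by fun_prop)]
  ring

noncomputable def dl {X : Type} (T : X → X) (f : X → ℝ) : X → ℝ := fun x ↦ f (T x) - f x

lemma dl_meas {X : Type} [MeasurableSpace X] {T : X → X} (hT : Measurable T) {f : X → ℝ}
    (hf : Measurable f) (j : ℕ) : Measurable ((dl T)^[j] f) := by
  induction j with
  | zero => exact hf
  | succ j ih => rw [Function.iterate_succ_apply']; unfold dl at *; fun_prop

lemma dl_bd {X : Type} {T : X → X} {f : X → ℝ} {M : ℝ} (hf : ∀ x, |f x| ≤ M) (j : ℕ) (x : X) :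
    |(dl T)^[j] f x| ≤ 2 ^ j * M := by
  induction j generalizing x with
  | zero => simpa using hf x
  | succ j ih =>
    rw [Function.iterate_succ_apply', dl, pow_succ]
    exact (abs_sub _ _).trans (by linarith [ih x, ih (T x)])

lemma gn_chain {X : Type} [MeasurableSpace X] (μ : Measure X) (A : Set X) (k : ℕ) (j : ℕ)
    (hj : 1 ≤ j) (hjk : j < k) :
    ∃ C : ℝ, 0 ≤ C ∧ ∀ L M : ℝ, 0 ≤ L → 0 ≤ M → ∃ C' : ℝ, 0 ≤ C' ∧ ∀ (T : X → X) (η : X → ℝ) (t : ℝ)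
      (F g : X → ℝ), GNS μ A T η t L → Measurable F → Measurable g → (∀ x, |F x| ≤ M) →
      (∀ x, |g x| ≤ 1) → (∀ x, |dl T F x - dl T g x| ≤ L * t) →
      ∫ x, η x ^ (2 * k) * |(dl T)^[j] F x| ^ (((2 * k : ℕ):ℝ) / j) ∂μ ≤
        C * ∫ x, η x ^ (2 * k) * |(dl T)^[j + 1] F x| ^ (((2 * k : ℕ):ℝ) / (j + 1 : ℕ)) ∂μ + C' * t ^ (2 * k) := by
  have hp : ∀ j : ℕ, j < k → 2 * (j:ℝ) < ((2 * k : ℕ) : ℝ) := fun j h ↦ by exact_mod_cast (by omega : 2 * j < 2 * k)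
  induction j, hj using Nat.le_induction with
  | base =>
    obtain ⟨C, hC, H⟩ := gn_step μ A (2 * k) 1 (1 / 4) le_rfl (by simpa using hp 1 hjk) (by norm_num)
    refine ⟨2 * C, by positivity, fun L M hL hM ↦ ?_⟩
    obtain ⟨C', hC', H⟩ := H L (2 * M + 1) hL (by positivity)
    refine ⟨2 * C', by positivity, fun T η t F g S mF mg hF hg hFg ↦ ?_⟩
    have := H T η t g (dl T F) S mg (dl_meas S.mp.measurable mF 1) (fun x ↦ (hg x).trans (by linarith))
      (fun x ↦ (dl_bd hF 1 x).trans (by linarith)) (fun _ ↦ hg) hFg (fun h ↦ absurd rfl h)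
    simp only [sub_self, zero_mul, zero_add] at this
    simp only [Function.iterate_succ_apply', Function.iterate_zero, id, Nat.cast_one, Nat.cast_add] at this ⊢
    simp only [dl] at this ⊢
    linarith
  | succ j hj ih =>
    obtain ⟨C1, hC1, ih⟩ := ih (by omega)
    have hl : 0 < 1 / (2 * (j * C1 + 2 + j)) := by positivity
    obtain ⟨C, hC, H⟩ := gn_step μ A (2 * k) (j + 1 : ℕ) (1 / (2 * (j * C1 + 2 + j)))
      (by exact_mod_cast (by omega : 1 ≤ j + 1)) (hp _ hjk) hl
    refine ⟨2 * C, by positivity, fun L M hL hM ↦ ?_⟩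
    obtain ⟨C1', hC1', ih⟩ := ih L M hL hM
    obtain ⟨C', hC', H⟩ := H L (2 ^ (j + 1) * M) hL (by positivity)
    refine ⟨2 * (C' + C1'), by positivity, fun T η t F g S mF mg hF hg hFg ↦ ?_⟩
    have i1 := ih T η t F g S mF mg hF hg hFg
    have mT := S.mp.measurable
    have hb : (2:ℝ) ^ j * M ≤ 2 ^ (j + 1) * M := by
      gcongr <;> norm_num
    have Lt : 0 ≤ L * t := by have := S.t0; positivity
    have i2 := H T η t ((dl T)^[j] F) ((dl T)^[j + 1] F) S (dl_meas mT mF _) (dl_meas mT mF _)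
      (fun x ↦ (dl_bd hF j x).trans hb) (fun x ↦ dl_bd hF (j + 1) x)
      (fun h ↦ by
        have : j + 1 = 1 := by exact_mod_cast h
        omega)
      (fun x ↦ by rw [Function.iterate_succ_apply']; simp [dl]; exact Lt)
      (fun _ x ↦ by rw [Function.iterate_succ_apply', dl])
    have e1 : ((j + 1 : ℕ) : ℝ) - 1 = j := by push_cast; ring
    rw [e1] at i2
    have e2 : ((j + 1 : ℕ) : ℝ) + 1 = (j + 1 + 1 : ℕ) := by push_cast; ring
    rw [e2] at i2
    have e3 : ∀ x, (dl T)^[j + 1] F (T x) - (dl T)^[j + 1] F x = (dl T)^[j + 1 + 1] F x := fun x ↦ by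
      rw [Function.iterate_succ_apply' _ (j + 1), dl]
    simp only [e3] at i2
    set Y0 := ∫ x, η x ^ (2 * k) * |(dl T)^[j] F x| ^ (((2 * k : ℕ):ℝ) / j) ∂μ
    set Y1 := ∫ x, η x ^ (2 * k) * |(dl T)^[j + 1] F x| ^ (((2 * k : ℕ):ℝ) / (j + 1 : ℕ)) ∂μ
    set Y2 := ∫ x, η x ^ (2 * k) * |(dl T)^[j + 1 + 1] F x| ^ (((2 * k : ℕ):ℝ) / (j + 1 + 1 : ℕ)) ∂μ
    have hjn : (0:ℝ) ≤ j := by positivity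
    have tp : 0 < t ^ (2 * k) := pow_pos S.t0 _
    have h3 : j * Y0 + 2 * Y1 ≤ (j * C1 + 2) * Y1 + j * (C1' * t ^ (2 * k)) := by nlinarith
    have h4 := mul_le_mul_of_nonneg_left h3 hl.le
    have Y1n : 0 ≤ Y1 := integral_nonneg fun x ↦ mul_nonneg (pow_nonneg (S.η0 x) _) (Real.rpow_nonneg (abs_nonneg _) _)
    have Q0 : 0 ≤ C1' * t ^ (2 * k) := by positivity
    have h5 : 1 / (2 * (j * C1 + 2 + j)) * ((j * C1 + 2) * Y1 + j * (C1' * t ^ (2 * k))) ≤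
       Y1 / 2 + C1' * t ^ (2 * k) := by
      rw [one_div_mul_eq_div, div_le_iff₀ (by positivity)]
      have := mul_nonneg hjn Y1n
      have := mul_nonneg (mul_nonneg hjn hC1) Q0
      have := mul_nonneg hjn Q0
      nlinarith
    linarith

lemma gn_all {X : Type} [MeasurableSpace X] (μ : Measure X) (A : Set X) (k : ℕ) (j : ℕ)
    (hj : 1 ≤ j) (hjk : j ≤ k) :
    ∃ C : ℝ, 0 ≤ C ∧ ∀ L M : ℝ, 0 ≤ L → 0 ≤ M → ∃ C' : ℝ, 0 ≤ C' ∧ ∀ (T : X → X) (η : X → ℝ) (t : ℝ)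
      (F g : X → ℝ), GNS μ A T η t L → Measurable F → Measurable g → (∀ x, |F x| ≤ M) →
      (∀ x, |g x| ≤ 1) → (∀ x, |dl T F x - dl T g x| ≤ L * t) →
      ∫ x, η x ^ (2 * k) * |(dl T)^[j] F x| ^ (((2 * k : ℕ):ℝ) / j) ∂μ ≤
        C * ∫ x, η x ^ (2 * k) * |(dl T)^[k] F x| ^ 2 ∂μ + C' * t ^ (2 * k) := by
  induction hjk using Nat.decreasingInduction with
  | self =>
    refine ⟨1, zero_le_one, fun L M hL hM ↦ ⟨0, le_rfl, fun T η t F g S mF mg hF hg hFg ↦ ?_⟩⟩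
    have : ((2 * k : ℕ):ℝ) / k = (2:ℕ) := by
      have : (k:ℝ) ≠ 0 := by positivity
      push_cast; field_simp
    rw [this]; simp only [Real.rpow_natCast]; linarith
  | of_succ j hjk ih =>
    obtain ⟨C1, hC1, ih⟩ := ih (by omega)
    obtain ⟨C, hC, H⟩ := gn_chain μ A k j hj hjk
    refine ⟨C * C1, by positivity, fun L M hL hM ↦ ?_⟩
    obtain ⟨C1', hC1', ih⟩ := ih L M hL hM
    obtain ⟨C', hC', H⟩ := H L M hL hM
    refine ⟨C * C1' + C', by positivity, fun T η t F g S mF mg hF hg hFg ↦ ?_⟩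
    have i1 := ih T η t F g S mF mg hF hg hFg
    have i2 := H T η t F g S mF mg hF hg hFg
    nlinarith [mul_le_mul_of_nonneg_left i1 hC]

/-- Lipschitz approximation of bounded uniformly continuous functions. -/
lemma lip_approx {X : Type} [PseudoMetricSpace X] {f : X → ℝ} {M : ℝ} (hM : ∀ x, |f x| ≤ M)
    (hf : UniformContinuous f) {e : ℝ} (he : 0 < e) :
    ∃ (L : ℝ) (c : X → ℝ), 0 ≤ L ∧ (∀ x y, |c x - c y| ≤ L * dist x y) ∧ ∀ x, |f x - c x| ≤ e := by
  obtain ⟨δ, hδ, H⟩ := Metric.uniformContinuous_iff.1 hf e he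
  rcases isEmpty_or_nonempty X with hX | ⟨⟨x0⟩⟩
  · exact ⟨0, f, le_rfl, fun x ↦ hX.elim x, fun x ↦ hX.elim x⟩
  have hM0 : 0 ≤ M := (abs_nonneg _).trans (hM x0)
  have hne : Nonempty X := ⟨x0⟩
  set L := 2 * M / δ
  have hL : 0 ≤ L := by positivity
  have bdd : ∀ x, BddBelow (range fun y ↦ f y + L * dist x y) := fun x ↦ ⟨-M, by
    rintro _ ⟨y, rfl⟩
    have := neg_abs_le (f y)
    have := hM y
    have : 0 ≤ L * dist x y := by positivity
    show -M ≤ f y + L * dist x y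
    linarith⟩
  have le1 : ∀ x y, ⨅ z, (f z + L * dist x z) ≤ (⨅ z, (f z + L * dist y z)) + L * dist x y := by
    intro x y
    rw [← sub_le_iff_le_add]
    refine le_ciInf fun z ↦ ?_
    have h1 := ciInf_le (bdd x) z
    have h2 : L * dist x z ≤ L * (dist x y + dist y z) := by gcongr; exact dist_triangle _ _ _
    linarith
  refine ⟨L, fun x ↦ ⨅ y, (f y + L * dist x y), hL, fun x y ↦ ?_, fun x ↦ ?_⟩
  · rw [abs_sub_le_iff]
    exact ⟨by linarith [le1 x y], by have := le1 y x; rw [dist_comm y x] at this; linarith⟩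
  · have h1 := ciInf_le (bdd x) x
    simp only [dist_self, mul_zero, add_zero] at h1
    rw [abs_of_nonneg (by linarith)]
    suffices f x - e ≤ ⨅ y, (f y + L * dist x y) by linarith
    refine le_ciInf fun y ↦ ?_
    by_cases h : dist x y < δ
    · have := H h
      rw [Real.dist_eq] at this
      have h3 := le_abs_self (f x - f y)
      have : 0 ≤ L * dist x y := by positivity
      linarith
    · have : 2 * M ≤ L * dist x y := by
        calc 2 * M = L * δ := by simp only [L]; field_simp
          _ ≤ _ := by gcongr; exact not_lt.1 h
      have h2 := hM x
      have h3 := hM y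
      rw [abs_le] at h2 h3
      linarith

lemma dl_div {X : Type} (T : X → X) (f : X → ℝ) (l : ℝ) (j : ℕ) (x : X) :
    (dl T)^[j] (fun x ↦ f x / l) x = (dl T)^[j] f x / l := by
  induction j generalizing x with
  | zero => rfl
  | succ j ih => rw [Function.iterate_succ_apply', Function.iterate_succ_apply', dl, dl, ih, ih]; ring

lemma dl_mul {X : Type} (T : X → X) (f g : X → ℝ) (k : ℕ) (x : X) :
    (dl T)^[k] (fun x ↦ f x * g x) x = ∑ ij ∈ Finset.HasAntidiagonal.antidiagonal k,
      (k.choose ij.1 : ℝ) * ((dl T)^[ij.2] f (T^[ij.1] x) * (dl T)^[ij.1] g x) := by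
  induction k generalizing x with
  | zero => simp
  | succ k ih =>
    rw [Function.iterate_succ_apply', dl, ih, ih, Finset.sum_antidiagonal_choose_succ_mul
      (fun i j ↦ (dl T)^[j] f (T^[i] x) * (dl T)^[i] g x), ← Finset.sum_sub_distrib, ← Finset.sum_add_distrib]
    refine Finset.sum_congr rfl fun ij hij ↦ ?_
    have h1 : ij.1 + ij.2 = k := by simpa using hij
    have h2 : k.choose ij.2 = k.choose ij.1 := by
      rw [← h1]; exact (Nat.choose_symm_add).symm
    have h3 : T^[ij.1] (T x) = T (T^[ij.1] x) :=
      (Function.iterate_succ_apply T _ x).symm.trans (Function.iterate_succ_apply' T _ x)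
    simp only [h2, h3, Function.iterate_succ_apply', dl]
    ring

noncomputable def sh {X : Type} [NormedAddCommGroup X] [NormedSpace ℝ X] (τ : X) (t : ℝ) : X → X :=
  fun x ↦ x + t • τ

notation:max "𝔡" τ:max t:max k:max => (dl (sh τ t))^[k]

lemma sh_iter {X : Type} [NormedAddCommGroup X] [NormedSpace ℝ X] (τ : X) (t : ℝ) (i : ℕ) :
    (sh τ t)^[i] = sh τ (i * t) := by
  induction i with
  | zero => funext x; simp [sh]
  | succ i ih =>
    funext x
    rw [Function.iterate_succ_apply', ih]
    simp only [sh, add_assoc, ← add_smul]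
    push_cast; congr 2; ring

structure Cut {X : Type} [NormedAddCommGroup X] [NormedSpace ℝ X] [MeasurableSpace X]
    (μ : Measure X) (A : Set X) (τ : X) (η : X → ℝ) (L t1 : ℝ) : Prop where
  mp : ∀ t, MeasurePreserving (sh τ t) μ μ
  mA : MeasurableSet A
  fin : μ A ≠ ⊤
  ηm : Measurable η
  η0 : ∀ x, 0 ≤ η x
  η1 : ∀ x, η x ≤ 1
  L0 : 0 ≤ L
  t10 : 0 < t1
  lip : ∀ x t, 0 ≤ t → |η (x + t • τ) - η x| ≤ L * t
  sup : ∀ x, x ∉ A → ∀ s ∈ Icc 0 t1, η (x + s • τ) = 0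

section
variable {X : Type} [NormedAddCommGroup X] [NormedSpace ℝ X] [MeasurableSpace X] [BorelSpace X]
  {μ : Measure X} {A : Set X} {τ : X} {η : X → ℝ} {L t1 : ℝ}

lemma Cut.gns (S : Cut μ A τ η L t1) {t L' : ℝ} (ht : 0 < t) (ht1 : t ≤ t1) (hL : L ≤ L') :
    GNS μ A (sh τ t) η t L' where
  mp := S.mp t
  mA := S.mA
  fin := S.fin
  ηm := S.ηm
  η0 := S.η0
  η1 := S.η1
  t0 := ht
  L0 := S.L0.trans hL
  lip x := (S.lip x t ht.le).trans (by gcongr)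
  sup x hx := by simpa using S.sup x hx 0 ⟨le_rfl, S.t10.le⟩
  sup' x hx := S.sup x hx t ⟨ht.le, ht1⟩

noncomputable def en (μ : Measure X) (η : X → ℝ) (τ : X) (k : ℕ) (t : ℝ) (f : X → ℝ) : ℝ :=
  ∫ x, η x ^ (2 * k) * |𝔡 τ t k f x| ^ 2 ∂μ

lemma Cut.gn_small (S : Cut μ A τ η L t1) (k j : ℕ) (hj : 1 ≤ j) (hjk : j < k) {f : X → ℝ} {M : ℝ}
    (hM : ∀ x, |f x| ≤ M) (hf : UniformContinuous f) {κ : ℝ} (hκ : 0 < κ) :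
    ∃ C : ℝ, 0 ≤ C ∧ ∀ t, 0 < t → t ≤ t1 →
      ∫ x, η x ^ (2 * k) * |𝔡 τ t j f x| ^ (((2 * k : ℕ):ℝ) / j) ∂μ ≤
        κ * en μ η τ k t f + C * t ^ (2 * k) := by
  obtain ⟨C, hC, H⟩ := gn_all μ A k j hj hjk.le
  set q : ℝ := ((2 * k : ℕ):ℝ) / j with hq
  have hj0 : (0:ℝ) < j := by positivity
  have hb : 0 < q - 2 := by
    rw [hq, sub_pos, lt_div_iff₀ hj0]; exact_mod_cast (by omega : 2 * j < 2 * k)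
  obtain ⟨l, hl, hl1, hlC⟩ : ∃ l : ℝ, 0 < l ∧ l ≤ 1 ∧ C * l ^ (q - 2) ≤ κ := by
    have : 0 < κ / (C + 1) := by positivity
    refine ⟨min 1 ((κ / (C + 1)) ^ (1 / (q - 2))), by positivity, min_le_left _ _, ?_⟩
    calc C * (min 1 ((κ / (C + 1)) ^ (1 / (q - 2)))) ^ (q - 2) ≤ C * ((κ / (C + 1)) ^ (1 / (q - 2))) ^ (q - 2) := by
          gcongr; exact min_le_right _ _
      _ = C * (κ / (C + 1)) := by rw [← Real.rpow_mul this.le, one_div_mul_cancel hb.ne', Real.rpow_one]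
      _ = κ * (C / (C + 1)) := by ring
      _ ≤ κ * 1 := by gcongr; rw [div_le_one (by positivity)]; linarith
      _ = κ := mul_one _
  obtain ⟨L0, c, hL0, hc, hfc⟩ := lip_approx hM hf hl
  have mf : Measurable f := hf.continuous.measurable
  have mc : Measurable c := by
    have : LipschitzWith (Real.toNNReal L0) c := LipschitzWith.of_dist_le_mul fun x y ↦ by
      rw [Real.dist_eq, Real.coe_toNNReal _ hL0]; exact hc x y
    exact this.continuous.measurable
  rcases isEmpty_or_nonempty X with hX | ⟨⟨x0⟩⟩
  · exact (hX.elim (0:X))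
  have hM0 : 0 ≤ M := (abs_nonneg _).trans (hM x0)
  obtain ⟨C', hC', H⟩ := H (L + L0 * ‖τ‖ / l) (M / l) (by have := S.L0; positivity) (by positivity)
  refine ⟨C' * l ^ q, by positivity, fun t ht ht1 ↦ ?_⟩
  have key := H (sh τ t) η t (fun x ↦ f x / l) (fun x ↦ (f x - c x) / l)
    (S.gns ht ht1 (by have : 0 ≤ L0 * ‖τ‖ / l := by positivity
                      linarith)) (by fun_prop) (by fun_prop)
    (fun x ↦ by rw [abs_div, abs_of_pos hl]; gcongr; exact hM x)
    (fun x ↦ by rw [abs_div, abs_of_pos hl, div_le_one hl]; exact hfc x)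
    (fun x ↦ by
      have e1 : dl (sh τ t) (fun x ↦ f x / l) x - dl (sh τ t) (fun x ↦ (f x - c x) / l) x =
        (c (sh τ t x) - c x) / l := by simp only [dl]; ring
      rw [e1, abs_div, abs_of_pos hl]
      have := hc (sh τ t x) x
      have e2 : dist (sh τ t x) x = t * ‖τ‖ := by
        simp [sh, dist_eq_norm, norm_smul, abs_of_pos ht]
      rw [e2] at this
      have hLt : 0 ≤ L * t := mul_nonneg S.L0 ht.le
      calc |c (sh τ t x) - c x| / l ≤ L0 * (t * ‖τ‖) / l := by gcongr
        _ = L0 * ‖τ‖ / l * t := by ring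
        _ ≤ _ := by rw [add_mul]; linarith)
  simp only [dl_div] at key
  have e3 : ∀ x, η x ^ (2 * k) * |𝔡 τ t j f x / l| ^ q =
      (l ^ q)⁻¹ * (η x ^ (2 * k) * |𝔡 τ t j f x| ^ q) := fun x ↦ by
    rw [abs_div, abs_of_pos hl, Real.div_rpow (abs_nonneg _) hl.le]; ring
  have e4 : ∀ x, η x ^ (2 * k) * |𝔡 τ t k f x / l| ^ 2 =
      (l ^ 2)⁻¹ * (η x ^ (2 * k) * |𝔡 τ t k f x| ^ 2) := fun x ↦ by
    rw [abs_div, abs_of_pos hl, div_pow]; ring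
  simp only [e3, e4, integral_const_mul] at key
  change _ ≤ C * ((l ^ 2)⁻¹ * en μ η τ k t f) + _ at key
  have en0 : 0 ≤ en μ η τ k t f := integral_nonneg fun x ↦ mul_nonneg (pow_nonneg (S.η0 x) _) (sq_nonneg _)
  have hlq : 0 < l ^ q := by positivity
  have hlq2 : l ^ (q - 2) = l ^ q * (l ^ 2)⁻¹ := by
    rw [Real.rpow_sub hl, div_eq_mul_inv]; norm_cast
  rw [inv_mul_le_iff₀ hlq] at key
  refine key.trans ?_
  calc _ = (C * l ^ (q - 2)) * en μ η τ k t f + C' * l ^ q * t ^ (2 * k) := by rw [hlq2]; ring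
    _ ≤ _ := by gcongr
end

section
variable {X : Type} [NormedAddCommGroup X] [NormedSpace ℝ X] [MeasurableSpace X] [BorelSpace X]
  {μ : Measure X} {A : Set X} {τ : X} {η : X → ℝ} {L t1 : ℝ}

lemma Cut.int (S : Cut μ A τ η L t1) {p : ℕ} (hp : p ≠ 0) {f : X → ℝ} (hf : Measurable f) {C : ℝ}
    (hC : ∀ x, |f x| ≤ C) : Integrable (fun x ↦ η x ^ p * f x) μ :=
  (S.gns S.t10 le_rfl le_rfl).int hp hf hC

structure Ng (μ : Measure X) (η : X → ℝ) (k : ℕ) (Z : ℝ → ℝ) (R : ℝ → X → ℝ) : Prop where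
  m : ∀ t, Measurable (R t)
  bd : ∃ M, ∀ t x, |R t x| ≤ M
  sm : ∀ κ : ℝ, 0 < κ → ∃ C : ℝ, 0 ≤ C ∧ ∃ t0 : ℝ, 0 < t0 ∧ ∀ t, 0 < t → t ≤ t0 →
    ∫ x, η x ^ (2 * k) * (R t x) ^ 2 ∂μ ≤ κ * Z t + C * t ^ (2 * k)

lemma sq_bd {a M : ℝ} (h : |a| ≤ M) : |a ^ 2| ≤ M ^ 2 := by
  rw [abs_pow]; exact pow_le_pow_left₀ (abs_nonneg _) h 2

lemma Ng.add (S : Cut μ A τ η L t1) {k : ℕ} (hk : 1 ≤ k) {Z : ℝ → ℝ} {R R' : ℝ → X → ℝ}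
    (h : Ng μ η k Z R) (h' : Ng μ η k Z R') : Ng μ η k Z (fun t x ↦ R t x + R' t x) := by
  obtain ⟨M, hM⟩ := h.bd
  obtain ⟨M', hM'⟩ := h'.bd
  have hk2 : 2 * k ≠ 0 := by omega
  refine ⟨fun t ↦ (h.m t).add (h'.m t), ⟨M + M', fun t x ↦ (abs_add_le _ _).trans (add_le_add (hM t x) (hM' t x))⟩,
    fun κ hκ ↦ ?_⟩
  obtain ⟨C, hC, t0, ht0, H⟩ := h.sm (κ / 4) (by positivity)
  obtain ⟨C', hC', t0', ht0', H'⟩ := h'.sm (κ / 4) (by positivity)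
  refine ⟨2 * C + 2 * C', by positivity, min t0 t0', lt_min ht0 ht0', fun t ht htt ↦ ?_⟩
  have h1 := H t ht (htt.trans (min_le_left _ _))
  have h2 := H' t ht (htt.trans (min_le_right _ _))
  have i1 := S.int hk2 ((h.m t).pow_const 2) (fun x ↦ sq_bd (hM t x))
  have i2 := S.int hk2 ((h'.m t).pow_const 2) (fun x ↦ sq_bd (hM' t x))
  calc _ ≤ ∫ x, (2 * (η x ^ (2 * k) * (R t x) ^ 2) + 2 * (η x ^ (2 * k) * (R' t x) ^ 2)) ∂μ := by
        refine integral_mono (S.int hk2 (((h.m t).add (h'.m t)).pow_const 2) (C := (M + M') ^ 2)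
          (fun x ↦ sq_bd ((abs_add_le _ _).trans (add_le_add (hM t x) (hM' t x)))))
          (iadd (i1.const_mul 2) (i2.const_mul 2)) fun x ↦ ?_
        have := pow_nonneg (S.η0 x) (2 * k)
        simp only [Pi.add_apply]
        nlinarith [mul_nonneg this (sq_nonneg (R t x - R' t x))]
    _ ≤ _ := by
        rw [integral_add (i1.const_mul 2) (i2.const_mul 2), integral_const_mul, integral_const_mul]
        linarith

lemma Ng.mul (S : Cut μ A τ η L t1) {k : ℕ} (hk : 1 ≤ k) {Z : ℝ → ℝ} {R : ℝ → X → ℝ}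
    (h : Ng μ η k Z R) {c : ℝ → X → ℝ} (hc : ∀ t, Measurable (c t)) {M' : ℝ} (hb : ∀ t x, |c t x| ≤ M') :
    Ng μ η k Z (fun t x ↦ c t x * R t x) := by
  obtain ⟨M, hM⟩ := h.bd
  have hk2 : 2 * k ≠ 0 := by omega
  have hb' : ∀ t x, |c t x * R t x| ≤ M' * M := fun t x ↦ by
    rw [abs_mul]; exact mul_le_mul (hb t x) (hM t x) (abs_nonneg _) ((abs_nonneg _).trans (hb t x))
  refine ⟨fun t ↦ (hc t).mul (h.m t), ⟨M' * M, hb'⟩, fun κ hκ ↦ ?_⟩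
  obtain ⟨C, hC, t0, ht0, H⟩ := h.sm (κ / (M' ^ 2 + 1)) (by positivity)
  refine ⟨(M' ^ 2 + 1) * C, by positivity, t0, ht0, fun t ht htt ↦ ?_⟩
  have i1 := S.int hk2 ((h.m t).pow_const 2) (fun x ↦ sq_bd (hM t x))
  calc _ ≤ ∫ x, (M' ^ 2 + 1) * (η x ^ (2 * k) * (R t x) ^ 2) ∂μ := by
        refine integral_mono (S.int hk2 (((hc t).mul (h.m t)).pow_const 2) (fun x ↦ sq_bd (hb' t x)))
          (i1.const_mul _) fun x ↦ ?_
        have := pow_nonneg (S.η0 x) (2 * k)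
        have h1 := (abs_le.1 ((sq_bd (hb t x)))).2
        simp only [Pi.mul_apply]
        nlinarith [mul_nonneg (mul_nonneg this (sq_nonneg (R t x))) (sub_nonneg.2 h1),
          mul_nonneg this (sq_nonneg (R t x))]
    _ ≤ (M' ^ 2 + 1) * (κ / (M' ^ 2 + 1) * Z t + C * t ^ (2 * k)) := by
        rw [integral_const_mul]; gcongr; exact H t ht htt
    _ = _ := by field_simp

lemma Ng.mono {k : ℕ} {Z Z' : ℝ → ℝ} {R : ℝ → X → ℝ} (h : Ng μ η k Z R) (hZ : ∀ t, Z t ≤ Z' t) :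
    Ng μ η k Z' R :=
  ⟨h.m, h.bd, fun κ hκ ↦ by
    obtain ⟨C, hC, t0, ht0, H⟩ := h.sm κ hκ
    exact ⟨C, hC, t0, ht0, fun t ht htt ↦ (H t ht htt).trans (by have := hZ t; gcongr)⟩⟩

lemma Ng.zero {k : ℕ} {Z : ℝ → ℝ} (hZ : ∀ t, 0 ≤ Z t) : Ng μ η k Z (fun _ _ ↦ 0) :=
  ⟨fun _ ↦ measurable_const, ⟨0, by simp⟩, fun κ hκ ↦ ⟨0, le_rfl, 1, one_pos, fun t _ _ ↦ by
    have := hZ t; simp; positivity⟩⟩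

lemma Ng.sum (S : Cut μ A τ η L t1) {k : ℕ} (hk : 1 ≤ k) {Z : ℝ → ℝ} (hZ : ∀ t, 0 ≤ Z t) {ι : Type}
    (s : Finset ι) {R : ι → ℝ → X → ℝ} (h : ∀ i ∈ s, Ng μ η k Z (R i)) :
    Ng μ η k Z (fun t x ↦ ∑ i ∈ s, R i t x) := by
  classical
  induction s using Finset.induction_on with
  | empty => simpa using Ng.zero hZ
  | insert a s ha ih =>
    simp only [Finset.sum_insert ha]
    exact (h a (Finset.mem_insert_self _ _)).add S hk (ih fun i hi ↦ h i (Finset.mem_insert_of_mem hi))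

lemma en_nonneg (S : Cut μ A τ η L t1) (k : ℕ) (t : ℝ) (f : X → ℝ) : 0 ≤ en μ η τ k t f :=
  integral_nonneg fun x ↦ mul_nonneg (pow_nonneg (S.η0 x) _) (sq_nonneg _)

lemma sh_meas (τ : X) (t : ℝ) : Measurable (sh τ t) := by
  have : Continuous (sh τ t) := by unfold sh; fun_prop
  exact this.measurable

lemma Ng.mid (S : Cut μ A τ η L t1) {k i j : ℕ} (hi : 1 ≤ i) (hj : 1 ≤ j) (hij : i + j = k) {f g : X → ℝ} {M : ℝ}
    (hf : ∀ x, |f x| ≤ M) (hg : ∀ x, |g x| ≤ M) (uf : UniformContinuous f) (ug : UniformContinuous g) :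
    Ng μ η k (fun t ↦ en μ η τ k t f + en μ η τ k t g)
      (fun t x ↦ 𝔡 τ t j f ((sh τ t)^[i] x) * (dl (sh τ t))^[i] g x) := by
  have hk2 : 2 * k ≠ 0 := by omega
  have mf : ∀ t, Measurable (𝔡 τ t j f) := fun t ↦ dl_meas (sh_meas τ t) uf.continuous.measurable j
  have mg : ∀ t, Measurable ((dl (sh τ t))^[i] g) := fun t ↦ dl_meas (sh_meas τ t) ug.continuous.measurable i
  have mi : ∀ t, Measurable ((sh τ t)^[i]) := fun t ↦ by rw [sh_iter]; exact sh_meas _ _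
  have hM0 : 0 ≤ M := (abs_nonneg _).trans (hf 0)
  have bdd : ∀ t x, |𝔡 τ t j f ((sh τ t)^[i] x) * (dl (sh τ t))^[i] g x| ≤ (2 ^ j * M) * (2 ^ i * M) := fun t x ↦ by
    rw [abs_mul]; exact mul_le_mul (dl_bd hf _ _) (dl_bd hg _ _) (abs_nonneg _) (by positivity)
  have m0 : ∀ t, Measurable fun x ↦ 𝔡 τ t j f ((sh τ t)^[i] x) * (dl (sh τ t))^[i] g x :=
    fun t ↦ ((mf t).comp (mi t)).mul (mg t)
  refine ⟨m0, ⟨_, bdd⟩, fun κ hκ ↦ ?_⟩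
  set pf : ℝ := ((2 * k : ℕ):ℝ) / j with hpf
  set pg : ℝ := ((2 * k : ℕ):ℝ) / i with hpg
  have hi0 : (0:ℝ) < i := by positivity
  have hj0 : (0:ℝ) < j := by positivity
  have hkr : (k:ℝ) = i + j := by exact_mod_cast hij.symm
  obtain ⟨C1, hC1, H1⟩ := S.gn_small k j hj (by omega) hf uf (κ := κ / 2 ^ (2 * k)) (by positivity)
  obtain ⟨C2, hC2, H2⟩ := S.gn_small k i hi (by omega) hg ug hκ
  set B : ℝ := (2 ^ j * M) ^ pf with hB
  have hB0 : 0 ≤ B := by positivity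
  have L0 := S.L0
  refine ⟨2 ^ (2 * k) * (C1 + (L * i) ^ (2 * k) * (B * μ.real A)) + C2, by positivity,
    t1 / i, div_pos S.t10 hi0, fun t ht htt ↦ ?_⟩
  have hit : (i:ℝ) * t ≤ t1 := by rw [le_div_iff₀ hi0] at htt; linarith
  have ht1 : t ≤ t1 := htt.trans (div_le_self S.t10.le (by exact_mod_cast hi))
  set F : X → ℝ := fun x ↦ |𝔡 τ t j f x| ^ pf with hF
  set G : X → ℝ := fun x ↦ |(dl (sh τ t))^[i] g x| ^ pg with hG
  have mF : Measurable F := by have := mf t; fun_prop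
  have mG : Measurable G := by have := mg t; fun_prop
  have bF : ∀ x, |F x| ≤ B := fun x ↦ rpow_bd (dl_bd hf j x) (by positivity)
  have bG : ∀ x, |G x| ≤ (2 ^ i * M) ^ pg := fun x ↦ rpow_bd (dl_bd hg i x) (by positivity)
  have F0 : ∀ x, 0 ≤ F x := fun x ↦ Real.rpow_nonneg (abs_nonneg _) _
  have G0 : ∀ x, 0 ≤ G x := fun x ↦ Real.rpow_nonneg (abs_nonneg _) _
  have young : ∀ x, (𝔡 τ t j f ((sh τ t)^[i] x) * (dl (sh τ t))^[i] g x) ^ 2 ≤ F ((sh τ t)^[i] x) + G x := by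
    intro x
    set a := 𝔡 τ t j f ((sh τ t)^[i] x)
    set b := (dl (sh τ t))^[i] g x
    have hc : (((k:ℝ) / j)).HolderConjugate ((k:ℝ) / i) := by
      rw [Real.holderConjugate_iff]
      refine ⟨by rw [lt_div_iff₀ hj0]; linarith, ?_⟩
      have : (i:ℝ) + j ≠ 0 := by positivity
      rw [hkr]; field_simp; ring
    have := Real.young_inequality_of_nonneg (sq_nonneg a) (sq_nonneg b) hc
    have e1 : (a ^ 2) ^ ((k:ℝ) / j) = F ((sh τ t)^[i] x) := by
      rw [hF, ← sq_abs, ← Real.rpow_natCast, ← Real.rpow_mul (abs_nonneg _), hpf]; push_cast; congr 1; ring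
    have e2 : (b ^ 2) ^ ((k:ℝ) / i) = G x := by
      rw [hG, ← sq_abs, ← Real.rpow_natCast, ← Real.rpow_mul (abs_nonneg _), hpg]; push_cast; congr 1; ring
    rw [e1, e2] at this
    rw [mul_pow]
    refine this.trans (add_le_add (div_le_self (F0 _) hc.lt.le) (div_le_self (G0 _) hc.symm.lt.le))
  have wt : ∀ x, η x ^ (2 * k) ≤ 2 ^ (2 * k) * (η ((sh τ t)^[i] x) ^ (2 * k) + A.indicator (fun _ ↦ (L * i * t) ^ (2 * k)) x) := by
    intro x
    by_cases hx : x ∈ A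
    · rw [indicator_of_mem hx]
      have h1 := S.lip x (i * t) (by positivity)
      rw [sh_iter]; change _ ≤ 2 ^ (2 * k) * (η (x + (i * t) • τ) ^ (2 * k) + _)
      set y := η (x + ((i:ℝ) * t) • τ)
      have hy : 0 ≤ y := S.η0 _
      have hL : 0 ≤ L * i * t := by positivity
      have h2 : η x ≤ 2 * max y (L * i * t) := by
        rw [abs_le] at h1
        linarith [le_max_left y (L * i * t), le_max_right y (L * i * t), h1.1]
      calc η x ^ (2 * k) ≤ (2 * max y (L * i * t)) ^ (2 * k) := pow_le_pow_left₀ (S.η0 x) h2 _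
        _ = 2 ^ (2 * k) * (max y (L * i * t)) ^ (2 * k) := mul_pow _ _ _
        _ ≤ _ := by
          gcongr
          rcases max_cases y (L * i * t) with h | h <;> rw [h.1]
          · linarith [pow_nonneg hL (2 * k)]
          · linarith [pow_nonneg hy (2 * k)]
    · have := S.sup x hx 0 ⟨le_rfl, S.t10.le⟩
      simp only [zero_smul, add_zero] at this
      rw [this, zero_pow hk2, indicator_of_notMem hx]
      have := S.η0 ((sh τ t)^[i] x)
      positivity
  have iF := S.int hk2 mF bF
  have iG := S.int hk2 mG bG
  have mpi : MeasurePreserving ((sh τ t)^[i]) μ μ := by rw [sh_iter]; exact S.mp _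
  have iFs : Integrable (fun x ↦ η ((sh τ t)^[i] x) ^ (2 * k) * F ((sh τ t)^[i] x)) μ :=
    (mpi.integrable_comp iF.aestronglyMeasurable).2 iF
  have iA : Integrable (fun x ↦ A.indicator (fun _ ↦ (L * i * t) ^ (2 * k) * B) x) μ := by
    rw [integrable_indicator_iff S.mA]; exact integrableOn_const S.fin
  have e1 : ∫ x, η ((sh τ t)^[i] x) ^ (2 * k) * F ((sh τ t)^[i] x) ∂μ = ∫ x, η x ^ (2 * k) * F x ∂μ :=
    mp_int mpi (f := fun x ↦ η x ^ (2 * k) * F x) (by have := S.ηm; fun_prop)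
  have e2 : ∫ x, A.indicator (fun _ ↦ (L * i * t) ^ (2 * k) * B) x ∂μ = μ.real A * ((L * i * t) ^ (2 * k) * B) := by
    rw [integral_indicator_const _ S.mA]; rfl
  calc _ ≤ ∫ x, (2 ^ (2 * k) * ((η ((sh τ t)^[i] x) ^ (2 * k) * F ((sh τ t)^[i] x)) + A.indicator (fun _ ↦ (L * i * t) ^ (2 * k) * B) x)
          + η x ^ (2 * k) * G x) ∂μ := by
        refine integral_mono (S.int hk2 ((m0 t).pow_const 2) (fun x ↦ sq_bd (bdd t x)))
          (iadd ((iadd iFs iA).const_mul _) iG) fun x ↦ ?_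
        have h0 := pow_nonneg (S.η0 x) (2 * k)
        have h1 := mul_le_mul_of_nonneg_left (young x) h0
        have h2 := mul_le_mul_of_nonneg_right (wt x) (F0 ((sh τ t)^[i] x))
        have h3 : A.indicator (fun _ ↦ (L * i * t) ^ (2 * k)) x * F ((sh τ t)^[i] x) ≤ A.indicator (fun _ ↦ (L * i * t) ^ (2 * k) * B) x := by
          by_cases hx : x ∈ A
          · simp only [indicator_of_mem hx]; have := (abs_le.1 (bF ((sh τ t)^[i] x))).2; gcongr
          · simp [indicator_of_notMem hx]
        have h4 : (0:ℝ) ≤ 2 ^ (2 * k) := by positivity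
        dsimp only
        nlinarith [mul_le_mul_of_nonneg_left h3 h4]
    _ = 2 ^ (2 * k) * (∫ x, η x ^ (2 * k) * F x ∂μ + μ.real A * ((L * i * t) ^ (2 * k) * B)) + ∫ x, η x ^ (2 * k) * G x ∂μ := by
        rw [integral_add ((iadd iFs iA).const_mul _) iG, integral_const_mul, integral_add iFs iA, e1, e2]
    _ ≤ 2 ^ (2 * k) * ((κ / 2 ^ (2 * k) * en μ η τ k t f + C1 * t ^ (2 * k)) + μ.real A * ((L * i * t) ^ (2 * k) * B))
        + (κ * en μ η τ k t g + C2 * t ^ (2 * k)) := by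
        gcongr
        · exact H1 t ht ht1
        · exact H2 t ht ht1
    _ = _ := by rw [mul_pow (L * (i:ℝ)) t]; field_simp; ring

lemma Ng.small (S : Cut μ A τ η L t1) {k : ℕ} (hk : 1 ≤ k) {g : X → ℝ} {M : ℝ} (hg : ∀ x, |g x| ≤ M) (mg : Measurable g)
    {s : ℝ → X → ℝ} (ms : ∀ t, Measurable (s t)) {M' : ℝ} (hs : ∀ t x, |s t x| ≤ M')
    (hs0 : ∀ ε > 0, ∃ t0 > 0, ∀ t, 0 < t → t ≤ t0 → ∀ x, |s t x| ≤ ε) :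
    Ng μ η k (fun t ↦ en μ η τ k t g) (fun t x ↦ s t x * 𝔡 τ t k g x) := by
  have hk2 : 2 * k ≠ 0 := by omega
  have mg' : ∀ t, Measurable (𝔡 τ t k g) := fun t ↦ dl_meas (sh_meas τ t) mg k
  have hM0 : 0 ≤ M' := (abs_nonneg _).trans (hs 0 0)
  have bdd : ∀ t x, |s t x * 𝔡 τ t k g x| ≤ M' * (2 ^ k * M) := fun t x ↦ by
    rw [abs_mul]; exact mul_le_mul (hs t x) (dl_bd hg _ _) (abs_nonneg _) hM0
  refine ⟨fun t ↦ (ms t).mul (mg' t), ⟨_, bdd⟩, fun κ hκ ↦ ?_⟩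
  obtain ⟨t0, ht0, H⟩ := hs0 (Real.sqrt κ) (Real.sqrt_pos.2 hκ)
  refine ⟨0, le_rfl, t0, ht0, fun t ht htt ↦ ?_⟩
  rw [zero_mul, add_zero, en, ← integral_const_mul]
  refine integral_mono (S.int hk2 (((ms t).mul (mg' t)).pow_const 2) (fun x ↦ sq_bd (bdd t x)))
    ((S.int hk2 (f := fun x ↦ |𝔡 τ t k g x| ^ 2) (by have := mg' t; fun_prop)
      (fun x ↦ sq_bd (by rw [abs_abs]; exact dl_bd hg k x))).const_mul _) fun x ↦ ?_
  have h1 := (abs_le.1 (sq_bd (H t ht htt x))).2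
  rw [Real.sq_sqrt hκ.le] at h1
  have h2 := pow_nonneg (S.η0 x) (2 * k)
  simp only [Pi.mul_apply, sq_abs]
  calc _ = s t x ^ 2 * (η x ^ (2 * k) * 𝔡 τ t k g x ^ 2) := by ring
    _ ≤ _ := by gcongr

lemma Ng.leib (S : Cut μ A τ η L t1) {k : ℕ} (hk : 1 ≤ k) {f g : X → ℝ} {M : ℝ}
    (hf : ∀ x, |f x| ≤ M) (hg : ∀ x, |g x| ≤ M) (uf : UniformContinuous f) (ug : UniformContinuous g) :
    Ng μ η k (fun t ↦ en μ η τ k t f + en μ η τ k t g)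
      (fun t x ↦ 𝔡 τ t k (fun x ↦ f x * g x) x - g x * 𝔡 τ t k f x - f x * 𝔡 τ t k g x) := by
  have Z0 : ∀ t, 0 ≤ en μ η τ k t f + en μ η τ k t g := fun t ↦ add_nonneg (en_nonneg S _ _ _) (en_nonneg S _ _ _)
  have e : (fun t x ↦ 𝔡 τ t k (fun x ↦ f x * g x) x - g x * 𝔡 τ t k f x - f x * 𝔡 τ t k g x) =
      fun t x ↦ ∑ ij ∈ Finset.HasAntidiagonal.antidiagonal k, (if ij = (0, k) then 0 else if ij = (k, 0) then
        (f ((sh τ t)^[k] x) - f x) * 𝔡 τ t k g x else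
        (k.choose ij.1 : ℝ) * ((dl (sh τ t))^[ij.2] f ((sh τ t)^[ij.1] x) * (dl (sh τ t))^[ij.1] g x)) := by
    funext t x
    have h1 : g x * 𝔡 τ t k f x = ∑ ij ∈ Finset.HasAntidiagonal.antidiagonal k, if ij = (0, k) then g x * 𝔡 τ t k f x else 0 := by
      rw [Finset.sum_ite_eq']; simp
    have h2 : f x * 𝔡 τ t k g x = ∑ ij ∈ Finset.HasAntidiagonal.antidiagonal k, if ij = (k, 0) then f x * 𝔡 τ t k g x else 0 := by
      rw [Finset.sum_ite_eq']; simp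
    rw [dl_mul, h1, h2, ← Finset.sum_sub_distrib, ← Finset.sum_sub_distrib]
    refine Finset.sum_congr rfl fun ij _ ↦ ?_
    by_cases c1 : ij = (0, k)
    · have : ¬ (k = 0) := by omega
      subst c1; simp [Ne.symm this]; ring
    · by_cases c2 : ij = (k, 0)
      · subst c2; simp [c1]; ring
      · simp [c1, c2]
  rw [e]
  refine Ng.sum S hk Z0 _ fun ij hij ↦ ?_
  have hij' : ij.1 + ij.2 = k := by simpa using hij
  by_cases c1 : ij = (0, k)
  · simp only [c1, if_true]; exact Ng.zero Z0
  by_cases c2 : ij = (k, 0)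
  · simp only [c1, c2, if_true]
    have : ¬ (k = 0) := by omega
    simp only [Prod.mk.injEq, this, false_and, if_false]
    refine (Ng.small S hk hg ug.continuous.measurable (s := fun t x ↦ f ((sh τ t)^[k] x) - f x) (M' := M + M)
      (fun t ↦ ?_) (fun t x ↦ (abs_sub _ _).trans (add_le_add (hf _) (hf _))) ?_).mono
      (fun t ↦ le_add_of_nonneg_left (en_nonneg S _ _ _))
    · have h1 := uf.continuous.measurable
      have h2 : Measurable ((sh τ t)^[k]) := by rw [sh_iter]; exact sh_meas _ _
      fun_prop
    · intro ε hε
      obtain ⟨δ, hδ, H⟩ := Metric.uniformContinuous_iff.1 uf ε hε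
      refine ⟨δ / (k * ‖τ‖ + 1) / 2, by positivity, fun t ht htt x ↦ ?_⟩
      have : dist ((sh τ t)^[k] x) x < δ := by
        rw [sh_iter]; simp only [sh, dist_eq_norm, add_sub_cancel_left, norm_smul, norm_mul, Real.norm_eq_abs, Nat.abs_cast, abs_of_pos ht]
        calc k * t * ‖τ‖ = (k * ‖τ‖) * t := by ring
          _ ≤ (k * ‖τ‖) * (δ / (k * ‖τ‖ + 1) / 2) := by gcongr
          _ ≤ (k * ‖τ‖ + 1) * (δ / (k * ‖τ‖ + 1) / 2) := by gcongr; linarith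
          _ = δ / 2 := by field_simp
          _ < δ := by linarith
      exact (H this).le
  · simp only [c1, c2, if_false]
    have hi : ij.1 ≠ 0 := fun h ↦ c1 (Prod.ext h (by simpa [h] using hij'))
    have hj : ij.2 ≠ 0 := fun h ↦ c2 (Prod.ext (by simpa [h] using hij') h)
    exact (Ng.mid S (by omega) (by omega) hij' hf hg uf ug).mul S hk (c := fun _ _ ↦ (k.choose ij.1 : ℝ))
      (fun _ ↦ measurable_const) (fun _ _ ↦ le_rfl)
end

lemma div_zero_box {N : ℕ} (a b : Fin (N+1) → ℝ) (hle : a ≤ b) (F : Fin (N+1) → (Fin (N+1) → ℝ) → ℝ)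
    (g : (Fin (N+1) → ℝ) → ℝ) (Hc : ∀ i, ContinuousOn (F i) (Icc a b))
    (Hd : ∀ x, (∀ i, x i ∈ Ioo (a i) (b i)) → (∀ i, DifferentiableAt ℝ (F i) x) ∧
      ∑ i, fderiv ℝ (F i) x (Pi.single i 1) = g x)
    (Hi : IntegrableOn g (Icc a b)) (h0 : ∀ i, ∀ x ∈ Icc a b, x i = a i ∨ x i = b i → F i x = 0) :
    ∫ x in Icc a b, g x = 0 := by
  have hae : (fun x ↦ ∑ i, fderiv ℝ (F i) x (Pi.single i 1)) =ᵐ[volume.restrict (Icc a b)] g := by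
    rw [volume_pi, ← Measure.restrict_congr_set (Measure.univ_pi_Ioo_ae_eq_Icc (f := a) (g := b)), ← volume_pi]
    exact (ae_restrict_iff' (MeasurableSet.univ_pi fun i ↦ measurableSet_Ioo)).2
      (Filter.Eventually.of_forall fun x hx ↦ (Hd x fun i ↦ hx i (mem_univ i)).2)
  rw [← integral_congr_ae hae, integral_divergence_of_hasFDerivAt_off_countable' a b hle F (fun i x ↦ fderiv ℝ (F i) x)
    ∅ countable_empty Hc (fun x hx i ↦ ((Hd x fun i ↦ hx.1 i (mem_univ i)).1 i).hasFDerivAt) (Hi.congr hae.symm)]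
  refine Finset.sum_eq_zero fun i _ ↦ ?_
  have key : ∀ c, a i ≤ c → c ≤ b i → ∀ x ∈ Icc (a ∘ i.succAbove) (b ∘ i.succAbove), i.insertNth c x ∈ Icc a b := by
    intro c h1 h2 x hx
    rw [Fin.insertNth_mem_Icc]; exact ⟨⟨h1, h2⟩, hx⟩
  rw [setIntegral_congr_fun (g := fun _ ↦ 0) measurableSet_Icc, setIntegral_congr_fun (s := Icc (a ∘ i.succAbove) (b ∘ i.succAbove))
    (f := fun x ↦ F i (i.insertNth (a i) x)) (g := fun _ ↦ 0) measurableSet_Icc]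
  · simp
  · intro x hx; exact h0 i _ (key _ le_rfl (hle i) x hx) (by simp)
  · intro x hx; exact h0 i _ (key _ (hle i) le_rfl x hx) (by simp)

section
variable {X : Type}

lemma dl_add (T : X → X) (f g : X → ℝ) (j : ℕ) (x : X) :
    (dl T)^[j] (fun x ↦ f x + g x) x = (dl T)^[j] f x + (dl T)^[j] g x := by
  induction j generalizing x with
  | zero => rfl
  | succ j ih => simp only [Function.iterate_succ_apply', dl, ih]; ring

lemma dl_cmul (T : X → X) (c : ℝ) (f : X → ℝ) (j : ℕ) (x : X) :
    (dl T)^[j] (fun x ↦ c * f x) x = c * (dl T)^[j] f x := by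
  induction j generalizing x with
  | zero => rfl
  | succ j ih => simp only [Function.iterate_succ_apply', dl, ih]; ring

lemma dl_sum (T : X → X) {ι : Type} (s : Finset ι) (f : ι → X → ℝ) (j : ℕ) (x : X) :
    (dl T)^[j] (fun x ↦ ∑ i ∈ s, f i x) x = ∑ i ∈ s, (dl T)^[j] (f i) x := by
  induction j generalizing x with
  | zero => rfl
  | succ j ih => simp only [Function.iterate_succ_apply', dl, ih, Finset.sum_sub_distrib]

lemma dl_eq_zero (T : X → X) (f : X → ℝ) (j : ℕ) (x : X) (h : ∀ i ≤ j, f (T^[i] x) = 0) : (dl T)^[j] f x = 0 := by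
  induction j generalizing x with
  | zero => exact h 0 le_rfl
  | succ j ih =>
    rw [Function.iterate_succ_apply', dl, ih x (fun i hi ↦ h i (by omega)),
      ih (T x) (fun i hi ↦ by rw [← Function.iterate_succ_apply]; exact h (i+1) (by omega)), sub_zero]

lemma dl_inv (T : X → X) (f : X → ℝ) (j : ℕ) (hj : 1 ≤ j) (x : X) (h : ∀ x, f (T x) = f x) : (dl T)^[j] f x = 0 := by
  obtain ⟨j, rfl⟩ := Nat.exists_eq_add_of_le' hj
  rw [Function.iterate_succ_apply]
  exact dl_eq_zero T _ j x fun i _ ↦ by simp [dl, h]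

end

lemma dl_hasFDeriv {X : Type} [NormedAddCommGroup X] [NormedSpace ℝ X] (τ : X) (t : ℝ) {f : X → ℝ} {f' : X → X →L[ℝ] ℝ} (j : ℕ) (x : X)
    (h : ∀ i ≤ j, HasFDerivAt f (f' ((sh τ t)^[i] x)) ((sh τ t)^[i] x)) :
    ∃ L : X →L[ℝ] ℝ, HasFDerivAt (𝔡 τ t j f) L x ∧ ∀ e, L e = 𝔡 τ t j (fun y ↦ f' y e) x := by
  induction j generalizing x with
  | zero => exact ⟨f' x, h 0 le_rfl, fun e ↦ rfl⟩
  | succ j ih =>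
    obtain ⟨L, h1, h2⟩ := ih x (fun i hi ↦ h i (by omega))
    obtain ⟨L', h1', h2'⟩ := ih (sh τ t x) (fun i hi ↦ by rw [← Function.iterate_succ_apply]; exact h (i+1) (by omega))
    refine ⟨L' - L, ?_, fun e ↦ ?_⟩
    · rw [Function.iterate_succ_apply']
      have : HasFDerivAt (sh τ t) (ContinuousLinearMap.id ℝ X) x := (hasFDerivAt_id x).add_const _
      exact (h1'.comp x this).sub h1
    · rw [Function.iterate_succ_apply']; simp [dl, h2, h2']

lemma coer {N : ℕ} (a A R1 R3 P : Fin N → ℝ) (b c B C R2 R4 Bn : ℝ) (hbc : (1 + b) * (1 + c) = 1)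
    (hb : 1 / 2 ≤ 1 + b) (hb2 : 1 + b ≤ 2) (hc : 1 / 2 ≤ 1 + c) (h1 : ∀ j, P j = -((1 + c) * A j + a j * C + R1 j))
    (h2 : (1 + c) * B + (1 + b) * C = -R2) (h3 : Bn = -(∑ j, (2 * a j * A j + R3 j)) - 2 * (1 + b) * B - R4) :
    ∑ j, A j ^ 2 + B ^ 2 + C ^ 2 ≤ 1000 * (∑ j, (-2 * A j) * P j + Bn * C) +
      10000000 * (∑ j, R1 j ^ 2 + R2 ^ 2 + (∑ j, R3 j + R4) ^ 2) := by
  set S := ∑ j, R3 j + R4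
  have hB : B = -(1 + b) ^ 2 * C - (1 + b) * R2 := by linear_combination (1 + b) * h2 - B * hbc
  have e : ∑ j, (-2 * A j) * P j + Bn * C = ∑ j, (2 * (1 + c) * A j ^ 2 + 2 * A j * R1 j) + 2 * (1 + b) ^ 3 * C ^ 2
      + C * (2 * (1 + b) ^ 2 * R2 - S) := by
    have : ∑ j, (-2 * A j) * P j = ∑ j, (2 * (1 + c) * A j ^ 2 + 2 * A j * R1 j) + (∑ j, 2 * a j * A j) * C := by
      rw [Finset.sum_mul, ← Finset.sum_add_distrib]; exact Finset.sum_congr rfl fun j _ ↦ by rw [h1 j]; ring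
    have e0 : ∑ j, (2 * a j * A j + R3 j) = ∑ j, 2 * a j * A j + ∑ j, R3 j := Finset.sum_add_distrib
    rw [this, h3, hB, e0]; simp only [S]; ring
  have e1 : ∑ j, A j ^ 2 ≤ 10 * ∑ j, (2 * (1 + c) * A j ^ 2 + 2 * A j * R1 j) + 100 * ∑ j, R1 j ^ 2 := by
    rw [Finset.mul_sum, Finset.mul_sum, ← Finset.sum_add_distrib]
    refine Finset.sum_le_sum fun j _ ↦ ?_
    nlinarith [sq_nonneg (A j + 2 * R1 j), mul_nonneg (sub_nonneg.2 hc) (sq_nonneg (A j)), sq_nonneg (R1 j)]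
  have hβ : 1 / 8 ≤ (1 + b) ^ 3 := by
    calc (1:ℝ) / 8 = (1 / 2) ^ 3 := by norm_num
      _ ≤ _ := by gcongr
  have e2 : C ^ 2 ≤ 10 * (2 * (1 + b) ^ 3 * C ^ 2 + C * (2 * (1 + b) ^ 2 * R2 - S)) + 100 * (2 * (1 + b) ^ 2 * R2 - S) ^ 2 := by
    nlinarith [sq_nonneg (C + 10 * (2 * (1 + b) ^ 2 * R2 - S)), mul_nonneg (sub_nonneg.2 hβ) (sq_nonneg C)]
  have hb4 : (1 + b) ^ 2 ≤ 4 := by nlinarith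
  have e3 : (2 * (1 + b) ^ 2 * R2 - S) ^ 2 ≤ 128 * R2 ^ 2 + 2 * S ^ 2 := by
    have : (1 + b) ^ 4 ≤ 16 := by nlinarith [sq_nonneg (1 + b)]
    nlinarith [sq_nonneg (2 * (1 + b) ^ 2 * R2 + S), mul_nonneg (sub_nonneg.2 this) (sq_nonneg R2)]
  have e4 : B ^ 2 ≤ 32 * C ^ 2 + 8 * R2 ^ 2 := by
    have : (1 + b) ^ 4 ≤ 16 := by nlinarith [sq_nonneg (1 + b)]
    rw [hB]
    nlinarith [sq_nonneg ((1 + b) ^ 2 * C - (1 + b) * R2), mul_nonneg (sub_nonneg.2 this) (sq_nonneg C),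
      mul_nonneg (sub_nonneg.2 hb4) (sq_nonneg R2)]
  have p1 : 0 ≤ ∑ j, R1 j ^ 2 := Finset.sum_nonneg fun j _ ↦ sq_nonneg _
  have p2 : 0 ≤ ∑ j, A j ^ 2 := Finset.sum_nonneg fun j _ ↦ sq_nonneg _
  rw [e]
  nlinarith [sq_nonneg S, sq_nonneg R2, sq_nonneg C]

lemma bnd_B {N : ℕ} (a A R3 : Fin N → ℝ) (b B R4 Bn M : ℝ) (hM : ∀ j, |a j| ≤ M) (hb2 : |1 + b| ≤ 2)
    (h3 : Bn = -(∑ j, (2 * a j * A j + R3 j)) - 2 * (1 + b) * B - R4) :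
    ∑ j, (-2 * A j) ^ 2 + Bn ^ 2 ≤ (12 * N * M ^ 2 + 52) * (∑ j, A j ^ 2 + B ^ 2 + (∑ j, R3 j + R4) ^ 2) := by
  set S := ∑ j, R3 j + R4
  have e : Bn = -(∑ j, 2 * a j * A j) - 2 * (1 + b) * B - S := by rw [h3, Finset.sum_add_distrib]; ring
  have h4 : (∑ j, 2 * a j * A j) ^ 2 ≤ 4 * N * M ^ 2 * ∑ j, A j ^ 2 := by
    calc _ ≤ (Finset.univ.card : ℝ) * ∑ j, (2 * a j * A j) ^ 2 := by
          exact sq_sum_le_card_mul_sum_sq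
      _ ≤ N * ∑ j, 4 * M ^ 2 * A j ^ 2 := by
          rw [Finset.card_univ, Fintype.card_fin]; gcongr with j
          have := (abs_le.1 (sq_bd (hM j))).2
          nlinarith [mul_nonneg (sub_nonneg.2 this) (sq_nonneg (A j))]
      _ = _ := by rw [← Finset.mul_sum]; ring
  have h5 : (1 + b) ^ 2 ≤ 4 := by nlinarith [sq_abs (1 + b), abs_nonneg (1 + b)]
  have h6 : ∑ j, (-2 * A j) ^ 2 = 4 * ∑ j, A j ^ 2 := by rw [Finset.mul_sum]; exact Finset.sum_congr rfl fun j _ ↦ by ring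
  set Q := ∑ j, 2 * a j * A j
  have p2 : 0 ≤ ∑ j, A j ^ 2 := Finset.sum_nonneg fun j _ ↦ sq_nonneg _
  set A2 := ∑ j, A j ^ 2
  have h7 : Bn ^ 2 ≤ 3 * Q ^ 2 + 3 * (2 * (1 + b) * B) ^ 2 + 3 * S ^ 2 := by
    rw [e]; nlinarith [sq_nonneg (Q - 2 * (1 + b) * B), sq_nonneg (Q - S), sq_nonneg (2 * (1 + b) * B - S)]
  have h8 : 0 ≤ 12 * (N:ℝ) * M ^ 2 := by positivity
  have h9 : 3 * (2 * (1 + b) * B) ^ 2 ≤ 48 * B ^ 2 := by nlinarith [mul_nonneg (sub_nonneg.2 h5) (sq_nonneg B)]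
  rw [h6]
  nlinarith [mul_nonneg h8 (sq_nonneg B), mul_nonneg h8 (sq_nonneg S), sq_nonneg S, sq_nonneg B]

abbrev Yn (N : ℕ) := Fin (N+1) → ℝ
notation "𝟎" N:max => (0 : Yn N)
noncomputable def eb {N : ℕ} (i : Fin (N+1)) : Yn N := Pi.single i 1
def half (N : ℕ) : Set (Yn N) := {y | 0 ≤ y ℓ}
def Qb (N : ℕ) (r : ℝ) : Set (Yn N) := {y | ‖y‖ < r ∧ 0 < y ℓ}

lemma half_meas (N : ℕ) : MeasurableSet (half N) := measurableSet_le measurable_const (measurable_pi_apply _)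

lemma sh_iter_Q {N : ℕ} {τ : Yn N} (hτ : τ ℓ = 0) {ρ r t : ℝ} (ht : 0 < t) {k i : ℕ} (hi : i ≤ k)
    (hk : k * t * ‖τ‖ ≤ r - ρ) {x : Yn N} (hx : x ∈ Qb N ρ) : (sh τ t)^[i] x ∈ Qb N r := by
  rw [sh_iter]
  refine ⟨?_, by simpa [sh, hτ] using hx.2⟩
  calc ‖x + ((i:ℝ) * t) • τ‖ ≤ ‖x‖ + i * t * ‖τ‖ := by
        refine (norm_add_le _ _).trans ?_; rw [norm_smul, Real.norm_eq_abs, abs_of_nonneg (by positivity)]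
    _ ≤ ‖x‖ + k * t * ‖τ‖ := by gcongr
    _ < r := by linarith [hx.1]

lemma sh_cont {X : Type} [NormedAddCommGroup X] [NormedSpace ℝ X] (τ : X) (t : ℝ) : Continuous (sh τ t) := by unfold sh; fun_prop

lemma dl_cont {X : Type} [NormedAddCommGroup X] [NormedSpace ℝ X] (τ : X) (t : ℝ) {f : X → ℝ} (hf : Continuous f) (j : ℕ) :
    Continuous (𝔡 τ t j f) := by
  induction j with
  | zero => exact hf
  | succ j ih =>
    have := sh_cont τ t
    rw [Function.iterate_succ_apply']; unfold dl at *; fun_prop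

lemma energy_id {N : ℕ} {r ρ : ℝ} (hρ : 0 < ρ) {v : Yn N → ℝ} {B q : Fin (N+1) → Yn N → ℝ} (cv : Continuous v)
    (cB : ∀ i, Continuous (B i)) (cq : ∀ i, Continuous (q i))
    (hv : ∀ y ∈ Qb N r, DifferentiableAt ℝ v y ∧ ∀ i, fderiv ℝ v y (eb i) = q i y)
    (hB : ∀ y ∈ Qb N r, (∀ i, DifferentiableAt ℝ (B i) y) ∧ ∑ i, fderiv ℝ (B i) y (eb i) = 0)
    (hB0 : ∀ y, y ℓ = 0 → B ℓ y = 0) {η : Yn N → ℝ} (cη : ContDiff ℝ 1 η)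
    (hη : ∀ x, ρ ≤ ‖x‖ → η x = 0) {τ : Yn N} (hτ : τ ℓ = 0) {k : ℕ} (hk : 1 ≤ k) {t : ℝ} (ht : 0 < t)
    (htk : k * t * ‖τ‖ ≤ r - ρ) :
    ∫ x in half N, (η x ^ (2 * k) * (∑ i, 𝔡 τ t k (B i) x * 𝔡 τ t k (q i) x) +
      𝔡 τ t k v x * (((2 * k : ℕ) : ℝ) * η x ^ (2 * k - 1)) *
        ∑ i, fderiv ℝ η x (eb i) * 𝔡 τ t k (B i) x) = 0 := by
  have cdv := dl_cont τ t cv k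
  have cdB := fun i ↦ dl_cont τ t (cB i) k
  have cdq := fun i ↦ dl_cont τ t (cq i) k
  have c0 : Continuous η := cη.continuous
  have c1 : ∀ i, Continuous fun x ↦ fderiv ℝ η x (eb i) := fun i ↦ (cη.continuous_fderiv one_ne_zero).clm_apply continuous_const
  set a : Yn N := fun i ↦ if i = Fin.last N then 0 else -ρ with ha
  set b : Yn N := fun _ ↦ ρ with hb
  set g : Yn N → ℝ := fun x ↦ (η x ^ (2 * k) * (∑ i, 𝔡 τ t k (B i) x * 𝔡 τ t k (q i) x) +
      𝔡 τ t k v x * (((2 * k : ℕ) : ℝ) * η x ^ (2 * k - 1)) *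
        ∑ i, fderiv ℝ η x (eb i) * 𝔡 τ t k (B i) x) with hg
  have hab : a ≤ b := fun i ↦ by simp only [ha, hb]; split_ifs <;> linarith
  have cg : Continuous g := by fun_prop
  have hsub : Icc a b ⊆ half N := fun x hx ↦ by have := hx.1 ℓ; simp only [ha, if_true] at this; exact this
  have hout : ∀ x, ρ ≤ ‖x‖ → g x = 0 := fun x hx ↦ by
    simp only [hg, hη x hx]; rw [zero_pow (by omega), zero_pow (by omega)]; ring
  rw [setIntegral_eq_of_subset_of_forall_sdiff_eq_zero (half_meas N) hsub]
  · refine div_zero_box a b hab (fun i x ↦ η x ^ (2 * k) * (𝔡 τ t k v x * 𝔡 τ t k (B i) x)) g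
      (fun i ↦ by have := cdB i; fun_prop) (fun x hx ↦ ?_) cg.integrableOn_Icc (fun i x hx hi ↦ ?_)
    · have hxQ : x ∈ Qb N ρ := by
        refine ⟨(pi_norm_lt_iff hρ).2 fun i ↦ ?_, by have := (hx ℓ).1; simpa [ha] using this⟩
        have h1 := hx i
        simp only [ha, hb] at h1
        rw [Real.norm_eq_abs, abs_lt]; constructor
        · split_ifs at h1 <;> linarith [h1.1]
        · exact h1.2
      obtain ⟨Lv, hLv, hLv'⟩ := dl_hasFDeriv τ t (f := v) (f' := fderiv ℝ v) k x
        (fun i hi ↦ (hv _ (sh_iter_Q hτ ht hi htk hxQ)).1.hasFDerivAt)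
      choose LB hLB hLB' using fun i ↦ dl_hasFDeriv τ t (f := B i) (f' := fderiv ℝ (B i)) k x
        (fun j hj ↦ ((hB _ (sh_iter_Q hτ ht hj htk hxQ)).1 i).hasFDerivAt)
      have hW : HasFDerivAt (fun x ↦ η x ^ (2 * k)) ((((2 * k : ℕ) : ℝ) * η x ^ (2 * k - 1)) • fderiv ℝ η x) x := by
        have := ((cη.differentiable one_ne_zero) x).hasFDerivAt.pow (2 * k)
        simpa using this
      have hF := fun i ↦ hW.mul (hLv.mul (hLB i))
      refine ⟨fun i ↦ (hF i).differentiableAt, ?_⟩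
      have e1 : ∀ i, Lv (eb i) = 𝔡 τ t k (q i) x := fun i ↦ by
        have h0 := dl_eq_zero (sh τ t) (fun y ↦ fderiv ℝ v y (eb i) + (-1) * q i y) k x (fun j hj ↦ by
          rw [(hv _ (sh_iter_Q hτ ht hj htk hxQ)).2 i]; ring)
        rw [dl_add, dl_cmul] at h0
        rw [hLv']; linarith
      have e2 : ∑ i, LB i (eb i) = 0 := by
        simp only [hLB']
        rw [← dl_sum]
        exact dl_eq_zero _ _ _ _ fun j hj ↦ (hB _ (sh_iter_Q hτ ht hj htk hxQ)).2
      have e3 : ∀ i, (η x ^ (2 * k) • (𝔡 τ t k v x • LB i + 𝔡 τ t k (B i) x • Lv) +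
        (𝔡 τ t k v x * 𝔡 τ t k (B i) x) • (((2 * k : ℕ) : ℝ) * η x ^ (2 * k - 1)) • fderiv ℝ η x) (Pi.single i 1) =
        η x ^ (2 * k) * 𝔡 τ t k v x * LB i (eb i) + η x ^ (2 * k) * (𝔡 τ t k (B i) x * 𝔡 τ t k (q i) x) +
        𝔡 τ t k v x * (((2 * k : ℕ) : ℝ) * η x ^ (2 * k - 1)) * (fderiv ℝ η x (eb i) * 𝔡 τ t k (B i) x) := fun i ↦ by
        rw [← e1 i]
        simp only [ContinuousLinearMap.add_apply, ContinuousLinearMap.smul_apply, smul_eq_mul, eb]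
        ring
      have e4 : ∀ i, fderiv ℝ (fun x ↦ η x ^ (2 * k) * (𝔡 τ t k v x * 𝔡 τ t k (B i) x)) x (Pi.single i 1) = _ :=
        fun i ↦ (congrArg (fun L : Yn N →L[ℝ] ℝ ↦ L (Pi.single i 1)) (HasFDerivAt.fderiv (hF i))).trans (e3 i)
      simp only [e4]
      rw [Finset.sum_add_distrib, Finset.sum_add_distrib, ← Finset.mul_sum, ← Finset.mul_sum, ← Finset.mul_sum, e2, hg]
      ring
    · have hz : ρ ≤ ‖x‖ → η x ^ (2 * k) * (𝔡 τ t k v x * 𝔡 τ t k (B i) x) = 0 := fun h ↦ by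
        rw [hη x h, zero_pow (by omega), zero_mul]
      have hn := norm_le_pi_norm x i
      rw [Real.norm_eq_abs] at hn
      rcases hi with hi | hi
      · by_cases hil : i = Fin.last N
        · have : 𝔡 τ t k (B i) x = 0 := dl_eq_zero _ _ _ _ fun j _ ↦ by
            rw [hil]; apply hB0; rw [sh_iter]; simp only [ha, hil] at hi; simp [sh, hτ, hi]
          rw [this]; ring
        · refine hz ?_; rw [hi] at hn; simp only [ha, hil, if_false, abs_neg] at hn; rwa [abs_of_pos hρ] at hn
      · refine hz ?_; rw [hi] at hn; simp only [hb] at hn; rwa [abs_of_pos hρ] at hn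
  · intro x hx
    refine hout x ?_
    by_contra hlt
    rw [not_le, pi_norm_lt_iff hρ] at hlt
    refine hx.2 ⟨fun i ↦ ?_, fun i ↦ (abs_lt.1 (hlt i)).2.le⟩
    simp only [ha]; split_ifs with h
    · rw [h]; exact hx.1
    · exact (abs_lt.1 (hlt i)).1.le

def hp (N : ℕ) : Set (Yn N) := {y | 0 < y ℓ}

lemma hp_meas (N : ℕ) : MeasurableSet (hp N) := measurableSet_lt measurable_const (measurable_pi_apply _)

lemma hp_ae (N : ℕ) : hp N =ᵐ[volume] half N := by
  have h0 : (volume : Measure (Yn N)) {y | y ℓ = 0} = 0 := Measure.pi_hyperplane (fun _ ↦ volume) ℓ 0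
  have : ∀ᵐ y : Yn N, y ℓ ≠ 0 := by rw [ae_iff]; simpa using h0
  filter_upwards [this] with y hy
  apply propext
  exact ⟨fun h ↦ le_of_lt h, fun h ↦ lt_of_le_of_ne h (Ne.symm hy)⟩

lemma Qb_meas (N : ℕ) (r : ℝ) : MeasurableSet (Qb N r) :=
  (measurableSet_lt measurable_norm measurable_const).inter (hp_meas N)

lemma Qb_open (N : ℕ) (r : ℝ) : IsOpen (Qb N r) :=
  (isOpen_lt continuous_norm continuous_const).inter (isOpen_lt continuous_const (continuous_apply _))

lemma Qb_fin (N : ℕ) (r : ℝ) : volume (Qb N r) ≠ ⊤ :=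
  ((measure_mono (fun y hy ↦ by simpa using hy.1)).trans_lt (measure_ball_lt_top (x := (𝟎 N)) (r := r))).ne

def IV (N : ℕ) (r : ℝ) (τ : Yn N) (k : ℕ) (w : Yn N → ℝ) : Prop :=
  ∀ ρ, ρ < r → ∃ C t0 : ℝ, 0 ≤ C ∧ 0 < t0 ∧ ∀ t, 0 < t → t ≤ t0 →
    ∫ x in Qb N ρ, (𝔡 τ t k w x) ^ 2 ≤ C * t ^ (2 * k)

lemma cs1 {f : ℝ → ℝ} (hf : Continuous f) {t : ℝ} (ht : 0 < t) :
    (∫ s in (0:ℝ)..t, f s) ^ 2 ≤ t * ∫ s in (0:ℝ)..t, f s ^ 2 := by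
  set m := (∫ s in (0:ℝ)..t, f s) / t with hm
  have h0 : 0 ≤ ∫ s in (0:ℝ)..t, (f s - m) ^ 2 := intervalIntegral.integral_nonneg ht.le fun _ _ ↦ sq_nonneg _
  have e : ∫ s in (0:ℝ)..t, (f s - m) ^ 2 = (∫ s in (0:ℝ)..t, f s ^ 2) - 2 * m * (∫ s in (0:ℝ)..t, f s) + m ^ 2 * t := by
    have : ∀ s, (f s - m) ^ 2 = f s ^ 2 - 2 * m * f s + m ^ 2 := fun s ↦ by ring
    simp only [this]
    rw [intervalIntegral.integral_add, intervalIntegral.integral_sub, intervalIntegral.integral_const_mul, intervalIntegral.integral_const]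
    · simp; ring
    all_goals exact Continuous.intervalIntegrable (by fun_prop) _ _
  have hmt : m * t = ∫ s in (0:ℝ)..t, f s := by rw [hm]; field_simp
  rw [e, ← hmt] at h0
  rw [← hmt]
  nlinarith

lemma set_shift {N : ℕ} {τ : Yn N} (hτ : τ ℓ = 0) {ρ r s : ℝ} (hs : |s| * ‖τ‖ ≤ r - ρ) {F : Yn N → ℝ}
    (F0 : ∀ x, 0 ≤ F x) (hF : Measurable F) {M : ℝ} (hM : ∀ x, F x ≤ M) :
    ∫ x in Qb N ρ, F (x + s • τ) ≤ ∫ x in Qb N r, F x := by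
  have hsub : ∀ x ∈ Qb N ρ, x + s • τ ∈ Qb N r := fun x hx ↦ by
    refine ⟨?_, by simpa [hτ] using hx.2⟩
    calc ‖x + s • τ‖ ≤ ‖x‖ + |s| * ‖τ‖ := by
          refine (norm_add_le _ _).trans ?_; rw [norm_smul, Real.norm_eq_abs]
      _ < r := by linarith [hx.1]
  have mp : MeasurePreserving (fun x : Yn N ↦ x + s • τ) volume volume := measurePreserving_add_right _ _
  have hb : ∀ x, |F x| ≤ M := fun x ↦ by rw [abs_of_nonneg (F0 x)]; exact hM x
  have mg : Measurable ((Qb N r).indicator F) := hF.indicator (Qb_meas N r)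
  rw [← integral_indicator (Qb_meas N ρ), ← integral_indicator (Qb_meas N r), ← mp_int mp mg]
  refine integral_mono ?_ ?_ fun x ↦ ?_
  · rw [integrable_indicator_iff (Qb_meas N ρ)]
    exact Measure.integrableOn_of_bounded (Qb_fin N ρ) (hF.comp mp.measurable).aestronglyMeasurable
      (M := M) (Filter.Eventually.of_forall fun x ↦ hb _)
  · refine (mp.integrable_comp mg.aestronglyMeasurable).2 ?_
    rw [integrable_indicator_iff (Qb_meas N r)]
    exact Measure.integrableOn_of_bounded (Qb_fin N r) hF.aestronglyMeasurable (M := M) (Filter.Eventually.of_forall hb)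
  · by_cases hx : x ∈ Qb N ρ
    · simp only [indicator_of_mem hx, indicator_of_mem (hsub x hx)]; exact le_rfl
    · rw [indicator_of_notMem hx]; exact indicator_nonneg (fun y _ ↦ F0 y) _

lemma IV_prim {N : ℕ} {r : ℝ} {τ : Yn N} (hτ : τ ℓ = 0) {v p : Yn N → ℝ} (cp : Continuous p)
    {M : ℝ} (hM : ∀ x, |p x| ≤ M) (hv : ∀ y ∈ Qb N r, DifferentiableAt ℝ v y ∧ fderiv ℝ v y τ = p y) {k : ℕ}
    (h : IV N r τ k p) : IV N r τ (k+1) v := by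
  intro ρ hρ
  obtain ⟨C, t0, hC, ht0, H⟩ := h ((ρ + r) / 2) (by linarith)
  refine ⟨C, min t0 ((r - ρ) / 2 / ((k + 1) * ‖τ‖ + 1)), hC, lt_min ht0 (by have : 0 < r - ρ := by linarith
                                                                            positivity), fun t ht htt ↦ ?_⟩
  have h1 : ((k:ℝ) + 1) * t * ‖τ‖ ≤ (r - ρ) / 2 := by
    have h2 := htt.trans (min_le_right _ _)
    rw [le_div_iff₀ (by positivity)] at h2
    nlinarith
  have h1' : t * ‖τ‖ ≤ (r - ρ) / 2 := by
    have : 0 ≤ k * t * ‖τ‖ := by positivity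
    nlinarith
  set F : Yn N → ℝ := fun x ↦ (𝔡 τ t k p x) ^ 2 with hF
  have cdp := dl_cont τ t cp k
  have cF : Continuous F := by fun_prop
  have hM0 : 0 ≤ M := (abs_nonneg _).trans (hM 0)
  have bF : ∀ x, F x ≤ (2 ^ k * M) ^ 2 := fun x ↦ (le_abs_self _).trans (sq_bd (dl_bd hM k x))
  have F0 : ∀ x, 0 ≤ F x := fun x ↦ sq_nonneg _
  have pt : ∀ x ∈ Qb N ρ, (𝔡 τ t (k+1) v x) ^ 2 ≤ t * ∫ s in (0:ℝ)..t, F (x + s • τ) := by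
    intro x hx
    have e : 𝔡 τ t (k+1) v x = ∫ s in (0:ℝ)..t, 𝔡 τ t k p (x + s • τ) := by
      rw [intervalIntegral.integral_eq_sub_of_hasDerivAt (f := fun s ↦ 𝔡 τ t k v (x + s • τ))]
      · rw [Function.iterate_succ_apply']; simp [dl, sh]
      · intro s hs
        rw [uIcc_of_le ht.le] at hs
        have hxs : x + s • τ ∈ Qb N ((ρ + r) / 2) := by
          refine ⟨?_, by simpa [hτ] using hx.2⟩
          have : ‖s • τ‖ ≤ t * ‖τ‖ := by
            rw [norm_smul, Real.norm_eq_abs, abs_of_nonneg hs.1]; gcongr; exact hs.2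
          linarith [norm_add_le x (s • τ), hx.1]
        have hi : ∀ i ≤ k, (sh τ t)^[i] (x + s • τ) ∈ Qb N r := fun i hi ↦ sh_iter_Q hτ ht hi (by
          have : 0 ≤ t * ‖τ‖ := by positivity
          nlinarith) hxs
        obtain ⟨Lv, hLv, hLv'⟩ := dl_hasFDeriv τ t (f := v) (f' := fderiv ℝ v) k (x + s • τ)
          (fun i hk ↦ (hv _ (hi i hk)).1.hasFDerivAt)
        have e1 : Lv τ = 𝔡 τ t k p (x + s • τ) := by
          have h0 := dl_eq_zero (sh τ t) (fun y ↦ fderiv ℝ v y τ + (-1) * p y) k (x + s • τ) (fun j hj ↦ by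
            rw [(hv _ (hi j hj)).2]; ring)
          rw [dl_add, dl_cmul] at h0
          rw [hLv']; linarith
        rw [← e1]
        have h2 : HasDerivAt (fun s : ℝ ↦ x + s • τ) τ s := by
          simpa using ((hasDerivAt_id s).smul_const τ).const_add x
        exact hLv.comp_hasDerivAt s h2
      · exact (cdp.comp (by fun_prop)).intervalIntegrable _ _
    rw [e]
    exact cs1 (f := fun s ↦ 𝔡 τ t k p (x + s • τ)) (cdp.comp (by fun_prop)) ht
  have fm : IsFiniteMeasure ((volume : Measure (Yn N)).restrict (Qb N ρ)) :=
    ⟨by rw [Measure.restrict_apply_univ]; exact (Qb_fin N ρ).lt_top⟩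
  have cFs : Continuous fun z : Yn N × ℝ ↦ F (z.1 + z.2 • τ) := cF.comp (by fun_prop)
  have ip : Integrable (Function.uncurry fun (x : Yn N) (s : ℝ) ↦ F (x + s • τ))
      (((volume : Measure (Yn N)).restrict (Qb N ρ)).prod ((volume : Measure ℝ).restrict (Ioc 0 t))) :=
    Integrable.of_bound cFs.aestronglyMeasurable ((2 ^ k * M) ^ 2) (Filter.Eventually.of_forall fun z ↦ by
      simp only [Function.uncurry]; rw [Real.norm_of_nonneg (F0 _)]; exact bF _)
  calc _ ≤ ∫ x in Qb N ρ, t * ∫ s in (0:ℝ)..t, F (x + s • τ) := by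
        refine integral_mono_of_nonneg (Filter.Eventually.of_forall fun x ↦ sq_nonneg _) ?_
          ((ae_restrict_iff' (Qb_meas N ρ)).2 (Filter.Eventually.of_forall pt))
        simp only [intervalIntegral.integral_of_le ht.le]
        exact (ip.integral_prod_left).const_mul t
    _ = t * ∫ s in Ioc 0 t, ∫ x in Qb N ρ, F (x + s • τ) := by
        rw [integral_const_mul]; simp only [intervalIntegral.integral_of_le ht.le]
        rw [integral_integral_swap ip]
    _ ≤ t * ∫ s in Ioc 0 t, C * t ^ (2 * k) := by
        refine mul_le_mul_of_nonneg_left ?_ ht.le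
        refine setIntegral_mono_on ip.integral_prod_right (integrable_const _) measurableSet_Ioc fun s hs ↦ ?_
        refine (set_shift hτ (r := (ρ + r) / 2) ?_ F0 cF.measurable bF).trans (H t ht (htt.trans (min_le_left _ _)))
        rw [abs_of_pos hs.1]
        have : s * ‖τ‖ ≤ t * ‖τ‖ := by gcongr; exact hs.2
        linarith
    _ = _ := by simp [ht.le]; ring

structure HD (N : ℕ) (r M : ℝ) (v b c H Bn : Yn N → ℝ) (a : Fin N → Yn N → ℝ) : Prop where
  r0 : 0 < r
  bv : ∀ y, |v y| ≤ M
  bb : ∀ y, |b y| ≤ M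
  bc : ∀ y, |c y| ≤ M
  ba : ∀ j y, |a j y| ≤ M
  bH : ∀ y, |H y| ≤ M
  cv : Continuous v
  ub : UniformContinuous b
  uc : UniformContinuous c
  ua : ∀ j, UniformContinuous (a j)
  cH : Continuous H
  hbc : ∀ y, (1 + b y) * (1 + c y) = 1
  b1 : ∀ y, 1 / 2 ≤ 1 + b y
  b2 : ∀ y, 1 + b y ≤ 2
  Hinv : ∀ y z, y ℓ = z ℓ → H y = H z
  hB : ∀ y, Bn y = 1 + H y - ∑ j, a j y * a j y - (1 + b y) ^ 2
  B0 : ∀ y, y ℓ = 0 → Bn y = 0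
  dv : ∀ y ∈ Qb N r, DifferentiableAt ℝ v y ∧ (∀ j : Fin N, fderiv ℝ v y (eb j.castSucc) = -(a j y * (1 + c y))) ∧
    fderiv ℝ v y (eb ℓ) = 1 + c y
  dB : ∀ y ∈ Qb N r, (∀ j, DifferentiableAt ℝ (a j) y) ∧ DifferentiableAt ℝ Bn y ∧
    ∑ j : Fin N, -2 * fderiv ℝ (a j) y (eb j.castSucc) + fderiv ℝ Bn y (eb ℓ) = 0

lemma IV_zero {N : ℕ} {r : ℝ} {τ : Yn N} (w : Yn N → ℝ) : IV N r τ 0 w := fun ρ _ ↦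
  ⟨∫ x in Qb N ρ, w x ^ 2, 1, integral_nonneg fun _ ↦ sq_nonneg _, one_pos, fun t _ _ ↦ by simp⟩

lemma IV_int {N : ℕ} {τ : Yn N} {t ρ : ℝ} {k : ℕ} {w : Yn N → ℝ} (cw : Continuous w) {M : ℝ} (hM : ∀ x, |w x| ≤ M) :
    IntegrableOn (fun x ↦ (𝔡 τ t k w x) ^ 2) (Qb N ρ) :=
  Measure.integrableOn_of_bounded (Qb_fin N ρ) ((dl_cont τ t cw k).pow 2).aestronglyMeasurable
    (M := (2 ^ k * M) ^ 2) (Filter.Eventually.of_forall fun x ↦ sq_bd (dl_bd hM k x))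

lemma IV_comb {N : ℕ} {r : ℝ} {τ : Yn N} {k : ℕ} {p : Fin N → Yn N → ℝ} (cp : ∀ j, Continuous (p j)) {M : ℝ}
    (hM : ∀ j x, |p j x| ≤ M) (h : ∀ j, IV N r τ k (p j)) (s : Fin N → ℝ) : IV N r τ k (fun y ↦ ∑ j, s j * p j y) := by
  intro ρ hρ
  choose C t0 hC ht0 H using fun j ↦ h j ρ hρ
  refine ⟨N * ∑ j, s j ^ 2 * C j, Finset.univ.inf' Finset.univ_nonempty (fun o : Option (Fin N) ↦ o.elim 1 t0),
    mul_nonneg (by positivity) (Finset.sum_nonneg fun j _ ↦ mul_nonneg (sq_nonneg _) (hC j)), ?_, fun t ht htt ↦ ?_⟩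
  · rw [Finset.lt_inf'_iff]; rintro (_ | j) _ <;> simp [ht0]
  · have hj : ∀ j, t ≤ t0 j := fun j ↦ htt.trans (Finset.inf'_le (f := fun o : Option (Fin N) ↦ o.elim 1 t0) (Finset.mem_univ (some j)))
    have ii := fun j ↦ (IV_int (τ := τ) (t := t) (ρ := ρ) (k := k) (cp j) (hM j)).const_mul (s j ^ 2)
    calc _ ≤ ∫ x in Qb N ρ, (N:ℝ) * ∑ j, s j ^ 2 * (𝔡 τ t k (p j) x) ^ 2 := by
          refine integral_mono_of_nonneg (Filter.Eventually.of_forall fun x ↦ sq_nonneg _)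
            ((integrable_finsetSum _ fun j _ ↦ ii j).const_mul _) (Filter.Eventually.of_forall fun x ↦ ?_)
          simp only [dl_sum, dl_cmul, ← mul_pow]
          have := sq_sum_le_card_mul_sum_sq (s := Finset.univ) (f := fun j ↦ s j * 𝔡 τ t k (p j) x)
          simpa using this
      _ = N * ∑ j, s j ^ 2 * ∫ x in Qb N ρ, (𝔡 τ t k (p j) x) ^ 2 := by
          rw [integral_const_mul, integral_finsetSum _ fun j _ ↦ ii j]; simp only [integral_const_mul]
      _ ≤ N * ∑ j, s j ^ 2 * (C j * t ^ (2 * k)) := by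
          gcongr with j; exact H j t ht (hj j)
      _ = _ := by rw [mul_assoc, Finset.sum_mul]; simp only [mul_assoc]

lemma IV_pos {N : ℕ} {r : ℝ} (hr : 0 < r) {τ : Yn N} {k : ℕ} {w : Yn N → ℝ} (cw : Continuous w) {M : ℝ} (hM : ∀ x, |w x| ≤ M)
    (h : ∀ ρ, 0 < ρ → ρ < r → ∃ C t0 : ℝ, 0 ≤ C ∧ 0 < t0 ∧ ∀ t, 0 < t → t ≤ t0 →
    ∫ x in Qb N ρ, (𝔡 τ t k w x) ^ 2 ≤ C * t ^ (2 * k)) : IV N r τ k w := by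
  intro ρ hρ
  obtain ⟨C, t0, hC, ht0, H⟩ := h (max ρ (r / 2)) (lt_max_of_lt_right (by linarith)) (max_lt hρ (by linarith))
  refine ⟨C, t0, hC, ht0, fun t ht htt ↦ le_trans ?_ (H t ht htt)⟩
  exact setIntegral_mono_set (IV_int cw hM) (Filter.Eventually.of_forall fun x ↦ sq_nonneg _)
    (LE.le.eventuallyLE fun x hx ↦ ⟨hx.1.trans_le (le_max_left _ _), hx.2⟩)

lemma cross_bd {n : ℕ} {η δ κ G ε : ℝ} (K : ℕ) (hK : 1 ≤ K) (d B : Fin n → ℝ) (hd : ∀ i, |d i| ≤ G) (η0 : 0 ≤ η) (hε : 0 < ε)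
    (hκ : η ^ (2 * K - 2) * δ ^ 2 ≤ κ) :
    -(δ * (((2 * K : ℕ) : ℝ) * η ^ (2 * K - 1)) * ∑ i, d i * B i) ≤ ε * (η ^ (2 * K) * ∑ i, B i ^ 2) + n * (K ^ 2 * G ^ 2 / ε) * κ := by
  obtain ⟨k, rfl⟩ := Nat.exists_eq_add_of_le' hK
  have e1 : 2 * (k + 1) - 1 = 2 * k + 1 := by omega
  have e2 : 2 * (k + 1) - 2 = 2 * k := by omega
  rw [e1]; rw [e2] at hκ
  have : ∀ i ∈ (Finset.univ : Finset (Fin n)), -(δ * (((2 * (k+1) : ℕ) : ℝ) * η ^ (2 * k + 1)) * (d i * B i)) ≤ ε * (η ^ (2 * (k + 1)) * B i ^ 2) + (((k+1 : ℕ):ℝ) ^ 2 * G ^ 2 / ε) * κ := by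
    intro i _
    have h1 := (abs_le.1 (sq_bd (hd i))).2
    have h2 : ((k+1 : ℕ):ℝ) ^ 2 * (d i ^ 2 / ε) * (η ^ (2 * k) * δ ^ 2) ≤ (((k+1 : ℕ):ℝ) ^ 2 * G ^ 2 / ε) * κ := by
      rw [mul_div_assoc]
      have : 0 ≤ η ^ (2 * k) * δ ^ 2 := by positivity
      gcongr
    refine le_trans ?_ (add_le_add_right h2 _)
    have h3 : 0 ≤ η ^ (2 * k) / ε * (ε * η * B i + ((k+1 : ℕ):ℝ) * d i * δ) ^ 2 := by positivity
    have h4 : η ^ (2 * k) / ε * (ε * η * B i + ((k+1 : ℕ):ℝ) * d i * δ) ^ 2 = ε * (η ^ (2 * (k + 1)) * B i ^ 2) +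
        ((k+1 : ℕ):ℝ) ^ 2 * (d i ^ 2 / ε) * (η ^ (2 * k) * δ ^ 2) + δ * (((2 * (k+1) : ℕ) : ℝ) * η ^ (2 * k + 1)) * (d i * B i) := by
      have : 2 * (k + 1) = 2 * k + 2 := by ring
      rw [this, pow_add, pow_succ]; push_cast; field_simp; ring
    linarith
  have := Finset.sum_le_sum this
  rw [Finset.sum_add_distrib, Finset.sum_neg_distrib, ← Finset.mul_sum, ← Finset.mul_sum, ← Finset.mul_sum] at this
  simp only [Finset.sum_const, Finset.card_univ, Fintype.card_fin, nsmul_eq_mul] at this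
  linarith

lemma cut_ex {N : ℕ} {ρ ρ2 ρ3 : ℝ} (h0 : 0 < ρ) (h1 : ρ < ρ2) (h2 : ρ2 < ρ3) {τ : Yn N} (hτ : τ ℓ = 0) :
    ∃ (η : Yn N → ℝ) (L t1 G : ℝ), Cut (volume.restrict (hp N)) (ball 0 ρ3) τ η L t1 ∧ ContDiff ℝ 1 η ∧
      (∀ x, ‖x‖ < ρ → η x = 1) ∧ (∀ x, ρ2 ≤ ‖x‖ → η x = 0) ∧ ∀ x i, |fderiv ℝ η x (eb i)| ≤ G := by
  let f : ContDiffBump (𝟎 N) := ⟨ρ, ρ2, h0, h1⟩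
  have cf : ContDiff ℝ 1 (f : Yn N → ℝ) := f.contDiff
  have z : ∀ x, ρ2 ≤ ‖x‖ → f x = 0 := fun x hx ↦ f.zero_of_le_dist (by simpa using hx)
  obtain ⟨L, hL⟩ := ContDiff.lipschitzWith_of_hasCompactSupport (𝕂 := ℝ) f.hasCompactSupport cf one_ne_zero
  have hlip : ∀ x s, 0 ≤ s → |f (x + s • τ) - f x| ≤ L * ‖τ‖ * s := fun x s hs ↦ by
    have := hL.dist_le_mul (x + s • τ) x
    rw [Real.dist_eq, dist_eq_norm] at this
    rw [add_sub_cancel_left, norm_smul, Real.norm_eq_abs, abs_of_nonneg hs] at this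
    calc _ ≤ _ := this
      _ = _ := by ring
  refine ⟨f, L * ‖τ‖, (ρ3 - ρ2) / (‖τ‖ + 1), L, ⟨fun t ↦ ?_, measurableSet_ball, ?_, f.continuous.measurable, fun x ↦ f.nonneg,
    fun x ↦ f.le_one, by positivity, div_pos (by linarith) (by positivity), hlip, ?_⟩, cf, fun x hx ↦ f.one_of_mem_closedBall (by simpa using hx.le), z, ?_⟩
  · have mp : MeasurePreserving (sh τ t) (volume : Measure (Yn N)) volume := measurePreserving_add_right _ _
    have := mp.restrict_preimage (hp_meas N)
    have e : sh τ t ⁻¹' hp N = hp N := by ext x; simp [hp, sh, hτ]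
    rwa [e] at this
  · exact ((Measure.restrict_apply_le _ _).trans_lt measure_ball_lt_top).ne
  · intro x hx s hs
    apply z
    have h3 : ρ3 ≤ ‖x‖ := by simpa using hx
    have h4 : s * ‖τ‖ ≤ ρ3 - ρ2 := by
      have := hs.2; rw [le_div_iff₀ (by positivity)] at this; nlinarith [hs.1]
    have : ‖x‖ ≤ ‖x + s • τ‖ + s * ‖τ‖ := by
      have := norm_sub_le (x + s • τ) (s • τ)
      rwa [add_sub_cancel_right, norm_smul, Real.norm_eq_abs, abs_of_nonneg hs.1] at this
    linarith
  · intro x i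
    have h5 := (fderiv ℝ (f : Yn N → ℝ) x).le_opNorm (eb i)
    have h6 := norm_fderiv_le_of_lipschitz ℝ hL (x₀ := x)
    have h7 : ‖(eb i : Yn N)‖ = 1 := by rw [eb, Pi.norm_single]; simp
    rw [h7, mul_one, Real.norm_eq_abs] at h5
    exact h5.trans h6

lemma Ng.fam {X : Type} [NormedAddCommGroup X] [NormedSpace ℝ X] [MeasurableSpace X] {μ : Measure X} {η : X → ℝ} {k : ℕ} {Z : ℝ → ℝ}
    {ι : Type} [Fintype ι] [Nonempty ι] {R : ι → ℝ → X → ℝ} (h : ∀ i, Ng μ η k Z (R i)) {κ : ℝ} (hκ : 0 < κ) :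
    ∃ C : ℝ, 0 ≤ C ∧ ∃ t0 : ℝ, 0 < t0 ∧ ∀ t, 0 < t → t ≤ t0 →
      ∑ i, ∫ x, η x ^ (2 * k) * (R i t x) ^ 2 ∂μ ≤ κ * Z t + C * t ^ (2 * k) := by
  have hc : 0 < (Fintype.card ι : ℝ) := by exact_mod_cast Fintype.card_pos
  choose C hC t0 ht0 H using fun i ↦ (h i).sm (κ / Fintype.card ι) (by positivity)
  refine ⟨∑ i, C i, Finset.sum_nonneg fun i _ ↦ hC i, Finset.univ.inf' Finset.univ_nonempty t0, (Finset.lt_inf'_iff _).2 fun i _ ↦ ht0 i, fun t ht htt ↦ ?_⟩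
  calc _ ≤ ∑ i, (κ / Fintype.card ι * Z t + C i * t ^ (2 * k)) :=
        Finset.sum_le_sum fun i _ ↦ H i t ht (htt.trans (Finset.inf'_le _ (Finset.mem_univ i)))
    _ = _ := by
        rw [Finset.sum_add_distrib, Finset.sum_const, Finset.card_univ, nsmul_eq_mul, ← Finset.sum_mul]; field_simp

section
variable {N : ℕ} {r M : ℝ} {v b c H Bn : Yn N → ℝ} {a : Fin N → Yn N → ℝ}

noncomputable def HR (b c : Yn N → ℝ) (a : Fin N → Yn N → ℝ) (τ : Yn N) (k : ℕ) : Option (Option (Fin N)) → ℝ → Yn N → ℝ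
  | none, t, x => ∑ j, (𝔡 τ t k (fun x ↦ a j x * a j x) x - a j x * 𝔡 τ t k (a j) x - a j x * 𝔡 τ t k (a j) x)
      + (𝔡 τ t k (fun x ↦ b x * b x) x - b x * 𝔡 τ t k b x - b x * 𝔡 τ t k b x)
  | some none, t, x => 𝔡 τ t k (fun x ↦ b x * c x) x - c x * 𝔡 τ t k b x - b x * 𝔡 τ t k c x
  | some (some j), t, x => 𝔡 τ t k (fun x ↦ a j x * c x) x - c x * 𝔡 τ t k (a j) x - a j x * 𝔡 τ t k c x

noncomputable def HS (b c : Yn N → ℝ) (a : Fin N → Yn N → ℝ) (τ : Yn N) (k : ℕ) (t : ℝ) (x : Yn N) : ℝ :=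
  ∑ j, 𝔡 τ t k (a j) x ^ 2 + 𝔡 τ t k b x ^ 2 + 𝔡 τ t k c x ^ 2

lemma HD.c1 (D : HD N r M v b c H Bn a) (y : Yn N) : 1 / 2 ≤ 1 + c y ∧ 1 + c y ≤ 2 := by
  have h := D.hbc y; have h1 := D.b1 y; have h2 := D.b2 y
  constructor <;> nlinarith

lemma HD.M0 (D : HD N r M v b c H Bn a) : 0 ≤ M := (abs_nonneg _).trans (D.bv 0)

lemma HD.NgR (D : HD N r M v b c H Bn a) {A : Set (Yn N)} {τ : Yn N} {η : Yn N → ℝ} {L t1 : ℝ} {μ : Measure (Yn N)}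
    (S : Cut μ A τ η L t1) {k : ℕ} (hk : 1 ≤ k) (i : Option (Option (Fin N))) :
    Ng μ η k (fun t ↦ 2 * (∑ j, en μ η τ k t (a j) + en μ η τ k t b + en μ η τ k t c)) (HR b c a τ k i) := by
  have p : ∀ t f, 0 ≤ en μ η τ k t f := en_nonneg S k
  have ps : ∀ t, 0 ≤ ∑ j, en μ η τ k t (a j) := fun t ↦ Finset.sum_nonneg fun j _ ↦ p t _
  have pj : ∀ t j, en μ η τ k t (a j) ≤ ∑ j, en μ η τ k t (a j) := fun t j ↦
    Finset.single_le_sum (f := fun j ↦ en μ η τ k t (a j)) (fun i _ ↦ p t _) (Finset.mem_univ j)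
  rcases i with _ | _ | j
  · refine Ng.add S hk (Ng.sum S hk (fun t ↦ ?_) _ fun j _ ↦ (Ng.leib S hk (D.ba j) (D.ba j) (D.ua j) (D.ua j)).mono fun t ↦ ?_)
      ((Ng.leib S hk D.bb D.bb D.ub D.ub).mono fun t ↦ ?_)
    · linarith [p t b, p t c, ps t]
    · linarith [p t b, p t c, pj t j]
    · linarith [p t b, p t c, ps t]
  · exact (Ng.leib S hk D.bb D.bc D.ub D.uc).mono fun t ↦ by linarith [p t b, p t c, ps t]
  · exact (Ng.leib S hk (D.ba j) D.bc (D.ua j) D.uc).mono fun t ↦ by linarith [p t b, p t c, ps t, pj t j]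

lemma HD.ids (D : HD N r M v b c H Bn a) {τ : Yn N} (hτ : τ ℓ = 0) {k : ℕ} (hk : 1 ≤ k) (t : ℝ) (x : Yn N) :
    (∀ j, 𝔡 τ t k (fun y ↦ -(a j y * (1 + c y))) x = -((1 + c x) * 𝔡 τ t k (a j) x + a j x * 𝔡 τ t k c x + HR b c a τ k (some (some j)) t x)) ∧
    ((1 + c x) * 𝔡 τ t k b x + (1 + b x) * 𝔡 τ t k c x = -HR b c a τ k (some none) t x) ∧
    𝔡 τ t k Bn x = -(∑ j, (2 * a j x * 𝔡 τ t k (a j) x + (𝔡 τ t k (fun x ↦ a j x * a j x) x - a j x * 𝔡 τ t k (a j) x - a j x * 𝔡 τ t k (a j) x))) - 2 * (1 + b x) * 𝔡 τ t k b x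
      - (𝔡 τ t k (fun x ↦ b x * b x) x - b x * 𝔡 τ t k b x - b x * 𝔡 τ t k b x) ∧
    𝔡 τ t k (fun y ↦ 1 + c y) x = 𝔡 τ t k c x := by
  refine ⟨fun j ↦ ?_, ?_, ?_, ?_⟩
  · have : (fun y ↦ -(a j y * (1 + c y))) = fun y ↦ (-1) * a j y + (-1) * (a j y * c y) := by funext y; ring
    rw [this, dl_add _ (fun y ↦ (-1) * a j y) (fun y ↦ (-1) * (a j y * c y)), dl_cmul, dl_cmul, HR]; ring
  · have h0 : 𝔡 τ t k (fun y ↦ (b y + c y) + b y * c y) x = 0 :=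
      dl_inv _ _ k hk x fun y ↦ by linarith [D.hbc y, D.hbc (sh τ t y)]
    rw [dl_add _ (fun y ↦ b y + c y) (fun y ↦ b y * c y), dl_add] at h0
    rw [HR]; linear_combination h0
  · have : Bn = fun y ↦ H y + ((∑ j, (-1) * (a j y * a j y)) + ((-2) * b y + (-1) * (b y * b y))) := by
      funext y; rw [D.hB y, ← Finset.mul_sum]; ring
    rw [this, dl_add _ H, dl_add _ (fun y ↦ ∑ j, (-1) * (a j y * a j y)), dl_add _ (fun y ↦ (-2) * b y), dl_sum, dl_cmul, dl_cmul,
      dl_inv _ H k hk x fun y ↦ D.Hinv _ _ (by simp [sh, hτ])]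
    simp only [dl_cmul]
    rw [← Finset.mul_sum]
    have : ∑ j, (2 * a j x * 𝔡 τ t k (a j) x + (𝔡 τ t k (fun x ↦ a j x * a j x) x - a j x * 𝔡 τ t k (a j) x - a j x * 𝔡 τ t k (a j) x)) = ∑ j, 𝔡 τ t k (fun x ↦ a j x * a j x) x :=
      Finset.sum_congr rfl fun j _ ↦ by ring
    rw [this]; ring
  · rw [dl_add _ (fun _ ↦ 1) c, dl_inv _ (fun _ ↦ (1:ℝ)) k hk x fun y ↦ rfl, zero_add]

lemma HD.ptw (D : HD N r M v b c H Bn a) {τ : Yn N} (hτ : τ ℓ = 0) {k : ℕ} (hk : 1 ≤ k) {G : ℝ} {κ : ℝ} (t η : ℝ) (x : Yn N) (d : Fin (N+1) → ℝ)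
    (hd : ∀ i, |d i| ≤ G) (η0 : 0 ≤ η) (hκ : η ^ (2 * k - 2) * 𝔡 τ t k v x ^ 2 ≤ κ) :
    η ^ (2 * k) * (HS b c a τ k t x + ∑ i, HR b c a τ k i t x ^ 2) ≤
      2000 * (η ^ (2 * k) * (∑ j, (-2 * 𝔡 τ t k (a j) x) * 𝔡 τ t k (fun y ↦ -(a j y * (1 + c y))) x + 𝔡 τ t k Bn x * 𝔡 τ t k c x)
        + 𝔡 τ t k v x * (((2 * k : ℕ) : ℝ) * η ^ (2 * k - 1)) *
          (∑ j : Fin N, d j.castSucc * (-2 * 𝔡 τ t k (a j) x) + d ℓ * 𝔡 τ t k Bn x))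
      + 20000002 * (η ^ (2 * k) * ∑ i, HR b c a τ k i t x ^ 2) + 2000 * ((N + 1 : ℕ) * (k ^ 2 * G ^ 2 / (1 / (2000 * (12 * N * M ^ 2 + 52))))) * κ := by
  obtain ⟨h1, h2, h3, _⟩ := D.ids hτ hk t x
  have hK : 0 < 12 * (N:ℝ) * M ^ 2 + 52 := by positivity
  have E1 := coer (fun j ↦ a j x) (fun j ↦ 𝔡 τ t k (a j) x) _ _ _ (b x) (c x) _ _ _ _ _ (D.hbc x) (D.b1 x) (D.b2 x) (D.c1 x).1 h1 h2 h3
  have E2 := bnd_B (fun j ↦ a j x) (fun j ↦ 𝔡 τ t k (a j) x) _ (b x) _ _ _ M (fun j ↦ D.ba j x)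
    (by rw [abs_of_nonneg (by linarith [D.b1 x])]; exact D.b2 x) h3
  have E3 := cross_bd (δ := 𝔡 τ t k v x) k hk d (Fin.snoc (α := fun _ ↦ ℝ) (fun j ↦ -2 * 𝔡 τ t k (a j) x) (𝔡 τ t k Bn x)) hd η0
    (ε := 1 / (2000 * (12 * N * M ^ 2 + 52))) (by positivity) hκ
  simp only [Fin.sum_univ_castSucc, Fin.snoc_castSucc, Fin.snoc_last] at E3
  have eR : ∑ i, HR b c a τ k i t x ^ 2 = HR b c a τ k none t x ^ 2 + (HR b c a τ k (some none) t x ^ 2 + ∑ j, HR b c a τ k (some (some j)) t x ^ 2) := by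
    rw [Fintype.sum_option, Fintype.sum_option]
  rw [show ∑ j, (𝔡 τ t k (fun x ↦ a j x * a j x) x - a j x * 𝔡 τ t k (a j) x - a j x * 𝔡 τ t k (a j) x)
      + (𝔡 τ t k (fun x ↦ b x * b x) x - b x * 𝔡 τ t k b x - b x * 𝔡 τ t k b x) = HR b c a τ k none t x from rfl] at E1 E2
  have p1 : 0 ≤ ∑ j, HR b c a τ k (some (some j)) t x ^ 2 := Finset.sum_nonneg fun _ _ ↦ sq_nonneg _
  have hw : 0 ≤ η ^ (2 * k) := by positivity
  rw [HS, eR]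
  set W := η ^ (2 * k)
  set SA := ∑ j, 𝔡 τ t k (a j) x ^ 2
  set cr := 𝔡 τ t k v x * (((2 * k : ℕ) : ℝ) * η ^ (2 * k - 1)) *
          (∑ j : Fin N, d j.castSucc * (-2 * 𝔡 τ t k (a j) x) + d ℓ * 𝔡 τ t k Bn x)
  set E := ∑ j, (-2 * 𝔡 τ t k (a j) x) * 𝔡 τ t k (fun y ↦ -(a j y * (1 + c y))) x + 𝔡 τ t k Bn x * 𝔡 τ t k c x
  set R1 := ∑ j, HR b c a τ k (some (some j)) t x ^ 2
  set B := 𝔡 τ t k b x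
  set Cc := 𝔡 τ t k c x
  set R2 := HR b c a τ k (some none) t x
  set R3 := HR b c a τ k none t x
  have F1 := mul_le_mul_of_nonneg_left E1 hw
  have F2 : 1 / (2000 * (12 * N * M ^ 2 + 52)) * (W * (∑ j, (-2 * 𝔡 τ t k (a j) x) ^ 2 + 𝔡 τ t k Bn x ^ 2)) ≤
      1 / 2000 * (W * (SA + B ^ 2 + R3 ^ 2)) := by
    have := mul_le_mul_of_nonneg_left E2 (mul_nonneg (by positivity : 0 ≤ 1 / (2000 * (12 * (N:ℝ) * M ^ 2 + 52))) hw)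
    rw [← mul_assoc]; refine this.trans (le_of_eq ?_); field_simp
  have q1 := mul_nonneg hw p1
  have q2 := mul_nonneg hw (sq_nonneg R2)
  have q4 := mul_nonneg hw (sq_nonneg Cc)
  push_cast at E3 ⊢
  linarith

lemma HR_cont (D : HD N r M v b c H Bn a) (τ : Yn N) (k : ℕ) (t : ℝ) (i : Option (Option (Fin N))) : Continuous (HR b c a τ k i t) := by
  have ca := fun j ↦ (D.ua j).continuous
  have cb := D.ub.continuous
  have cc := D.uc.continuous
  have c1 := fun j ↦ dl_cont τ t (ca j) k
  have c2 := dl_cont τ t cb k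
  have c3 := dl_cont τ t cc k
  have c4 := fun j ↦ dl_cont τ t ((ca j).mul (ca j)) k
  have c5 := fun j ↦ dl_cont τ t ((ca j).mul cc) k
  have c6 := dl_cont τ t (cb.mul cc) k
  have c7 := dl_cont τ t (cb.mul cb) k
  rcases i with _ | _ | j
  · refine (continuous_finsetSum _ fun j _ ↦ ((c4 j).sub ((ca j).mul (c1 j))).sub ((ca j).mul (c1 j))).add ((c7.sub (cb.mul c2)).sub (cb.mul c2))
  · exact (c6.sub (cc.mul c2)).sub (cb.mul c3)
  · exact ((c5 j).sub (cc.mul (c1 j))).sub ((ca j).mul c3)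
end

section
variable {N : ℕ} {r M : ℝ} {v b c H Bn : Yn N → ℝ} {a : Fin N → Yn N → ℝ}

lemma HD.step (D : HD N r M v b c H Bn a) {τ : Yn N} (hτ : τ ℓ = 0) {k : ℕ} (hk : 1 ≤ k) (hv : IV N r τ k v)
    {ρ : ℝ} (h0 : 0 < ρ) (hρ : ρ < r) :
    ∃ C t0 : ℝ, 0 ≤ C ∧ 0 < t0 ∧ ∀ t, 0 < t → t ≤ t0 →
      IntegrableOn (fun x ↦ HS b c a τ k t x + ∑ i, HR b c a τ k i t x ^ 2) (Qb N ρ) ∧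
      ∫ x in Qb N ρ, (HS b c a τ k t x + ∑ i, HR b c a τ k i t x ^ 2) ≤ C * t ^ (2 * k) := by
  have ca := fun j ↦ (D.ua j).continuous
  have cb := D.ub.continuous
  have cc := D.uc.continuous
  have cBn : Continuous Bn := by
    have : Bn = fun y ↦ 1 + H y - ∑ j, a j y * a j y - (1 + b y) ^ 2 := funext D.hB
    rw [this]; have := D.cH; fun_prop
  obtain ⟨η, L, t1, G, S, cη, e1, e0, hG⟩ := cut_ex (ρ2 := (2 * ρ + r) / 3) (ρ3 := (ρ + 2 * r) / 3) h0 (by linarith) (by linarith) hτ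
  set ρ2 := (2 * ρ + r) / 3 with hρ2
  set μ := (volume : Measure (Yn N)).restrict (hp N) with hμ
  have hk2 : 2 * k ≠ 0 := by omega
  obtain ⟨C0, t0, hC0, ht0, I0⟩ := hv ρ2 (by linarith)
  obtain ⟨C1, hC1, s0, hs0, I1⟩ := Ng.fam (D.NgR S hk) (κ := 1 / 100000000) (by norm_num)
  set C2 : ℝ := 2000 * ((N + 1 : ℕ) * (k ^ 2 * G ^ 2 / (1 / (2000 * (12 * N * M ^ 2 + 52))))) with hC2
  have hC2' : 0 ≤ C2 := by positivity
  refine ⟨2 * (20000002 * C1 + C2 * C0), min (min t0 s0) ((r - ρ2) / (k * ‖τ‖ + 1)), by positivity,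
    lt_min (lt_min ht0 hs0) (div_pos (by linarith) (by positivity)), fun t ht htt ↦ ?_⟩
  have htt1 : t ≤ t0 := htt.trans ((min_le_left _ _).trans (min_le_left _ _))
  have htt2 : t ≤ s0 := htt.trans ((min_le_left _ _).trans (min_le_right _ _))
  have htt3 : k * t * ‖τ‖ ≤ r - ρ2 := by
    have := htt.trans (min_le_right _ _)
    rw [le_div_iff₀ (by positivity)] at this
    nlinarith
  have cHR := HR_cont D τ k t
  have cHS : Continuous (HS b c a τ k t) := by
    have c1 := fun j ↦ dl_cont τ t (ca j) k
    have c2 := dl_cont τ t cb k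
    have c3 := dl_cont τ t cc k
    unfold HS; fun_prop
  have iA : ∀ f : Yn N → ℝ, Continuous f → (∃ K, ∀ x, |f x| ≤ K) → Integrable (fun x ↦ η x ^ (2 * k) * f x ^ 2) μ :=
    fun f cf ⟨K, hK⟩ ↦ S.int hk2 (cf.measurable.pow_const 2) fun x ↦ sq_bd (hK x)
  have bR : ∀ i, ∃ K, ∀ x, |HR b c a τ k i t x| ≤ K := fun i ↦ by
    obtain ⟨K, hK⟩ := (D.NgR S hk i).bd
    exact ⟨K, hK t⟩
  have ia := fun j ↦ iA _ (dl_cont τ t (ca j) k) ⟨_, dl_bd (D.ba j) k⟩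
  have ib := iA _ (dl_cont τ t cb k) ⟨_, dl_bd D.bb k⟩
  have ic := iA _ (dl_cont τ t cc k) ⟨_, dl_bd D.bc k⟩
  have iR := fun i ↦ iA _ (cHR i) (bR i)
  have iS : Integrable (fun x ↦ η x ^ (2 * k) * HS b c a τ k t x) μ := by
    have := ((integrable_finsetSum Finset.univ fun j _ ↦ ia j).add ib).add ic
    refine this.congr (Filter.Eventually.of_forall fun x ↦ ?_)
    simp only [HS, Pi.add_apply, mul_add, Finset.mul_sum]
  have iRR : Integrable (fun x ↦ η x ^ (2 * k) * ∑ i, HR b c a τ k i t x ^ 2) μ := by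
    refine (integrable_finsetSum Finset.univ fun j _ ↦ iR j).congr (Filter.Eventually.of_forall fun x ↦ ?_)
    simp only [Finset.mul_sum]
  have sS : ∫ x, η x ^ (2 * k) * HS b c a τ k t x ∂μ = ∑ j, en μ η τ k t (a j) + en μ η τ k t b + en μ η τ k t c := by
    simp only [HS, mul_add, Finset.mul_sum, en, sq_abs]
    rw [integral_add, integral_add, integral_finsetSum]
    · exact fun j _ ↦ ia j
    · exact integrable_finsetSum Finset.univ fun j _ ↦ ia j
    · exact ib
    · exact (integrable_finsetSum Finset.univ fun j _ ↦ ia j).add ib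
    · exact ic
  have sR : ∫ x, η x ^ (2 * k) * ∑ i, HR b c a τ k i t x ^ 2 ∂μ = ∑ i, ∫ x, η x ^ (2 * k) * HR b c a τ k i t x ^ 2 ∂μ := by
    simp only [Finset.mul_sum]; rw [integral_finsetSum _ fun i _ ↦ iR i]
  have J1 := I1 t ht htt2
  rw [← sR, ← sS] at J1
  have En := energy_id (r := r) (ρ := ρ2) (by linarith) D.cv (B := Fin.snoc (α := fun _ ↦ Yn N → ℝ) (fun j y ↦ -2 * a j y) Bn)
    (q := Fin.snoc (α := fun _ ↦ Yn N → ℝ) (fun j y ↦ -(a j y * (1 + c y))) (fun y ↦ 1 + c y))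
    (fun i ↦ by
      refine Fin.lastCases ?_ (fun j ↦ ?_) i
      · simpa using cBn
      · simp only [Fin.snoc_castSucc]; have := ca j; fun_prop)
    (fun i ↦ by
      refine Fin.lastCases ?_ (fun j ↦ ?_) i
      · simp only [Fin.snoc_last]; fun_prop
      · simp only [Fin.snoc_castSucc]; have := ca j; fun_prop)
    (fun y hy ↦ ⟨(D.dv y hy).1, fun i ↦ by
      refine Fin.lastCases ?_ (fun j ↦ ?_) i
      · simpa using (D.dv y hy).2.2
      · simpa using (D.dv y hy).2.1 j⟩)
    (fun y hy ↦ ⟨fun i ↦ by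
      refine Fin.lastCases ?_ (fun j ↦ ?_) i
      · simpa using (D.dB y hy).2.1
      · simp only [Fin.snoc_castSucc]; exact ((D.dB y hy).1 j).const_mul _, by
      rw [Fin.sum_univ_castSucc]; simp only [Fin.snoc_castSucc, Fin.snoc_last]
      rw [← (D.dB y hy).2.2]; congr 1
      refine Finset.sum_congr rfl fun j _ ↦ ?_
      rw [fderiv_const_mul ((D.dB y hy).1 j)]; simp⟩)
    (fun y hy ↦ by simpa using D.B0 y hy) cη e0 hτ hk ht htt3
  simp only [Fin.sum_univ_castSucc, Fin.snoc_castSucc, Fin.snoc_last, dl_cmul, fun x ↦ (D.ids hτ hk t x).2.2.2] at En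
  rw [← setIntegral_congr_set (hp_ae N), ← hμ] at En
  set e : Yn N → ℝ := fun x ↦ (η x ^ (2 * k) * (∑ j, (-2 * 𝔡 τ t k (a j) x) * 𝔡 τ t k (fun y ↦ -(a j y * (1 + c y))) x + 𝔡 τ t k Bn x * 𝔡 τ t k c x)
        + 𝔡 τ t k v x * (((2 * k : ℕ) : ℝ) * η x ^ (2 * k - 1)) *
          (∑ j : Fin N, fderiv ℝ η x (eb j.castSucc) * (-2 * 𝔡 τ t k (a j) x) + fderiv ℝ η x (eb ℓ) * 𝔡 τ t k Bn x)) with he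
  have ie : Integrable e μ := by
    have : Continuous e := by
      have c1 := fun j ↦ dl_cont τ t (ca j) k
      have c2 := dl_cont τ t cBn k
      have c3 := dl_cont τ t cc k
      have c4 := fun j ↦ dl_cont τ t (f := fun y ↦ -(a j y * (1 + c y))) (by have := ca j; fun_prop) k
      have c5 := dl_cont τ t D.cv k
      have c6 : ∀ i, Continuous fun x ↦ fderiv ℝ η x (eb i) := fun i ↦ (cη.continuous_fderiv one_ne_zero).clm_apply continuous_const
      have c7 := cη.continuous
      rw [he]; fun_prop
    refine (this.integrable_of_hasCompactSupport ?_).restrict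
    refine HasCompactSupport.of_support_subset_isCompact (isCompact_closedBall (𝟎 N) ρ2) fun x hx ↦ ?_
    by_contra hc
    apply hx
    have : η x = 0 := e0 x (by simpa using (not_le.1 (by simpa using hc)).le)
    rw [he]; simp [this, zero_pow (by omega : 2 * k ≠ 0), zero_pow (by omega : 2 * k - 1 ≠ 0)]
  have iv : Integrable ((Qb N ρ2).indicator fun x ↦ 𝔡 τ t k v x ^ 2) μ :=
    ((integrable_indicator_iff (Qb_meas N ρ2)).2 (IV_int D.cv D.bv)).restrict
  have Iv : ∫ x, (Qb N ρ2).indicator (fun x ↦ 𝔡 τ t k v x ^ 2) x ∂μ ≤ C0 * t ^ (2 * k) := by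
    rw [hμ, setIntegral_indicator (Qb_meas N ρ2)]
    have : hp N ∩ Qb N ρ2 = Qb N ρ2 := inter_eq_right.2 fun x hx ↦ hx.2
    rw [this]; exact I0 t ht htt1
  have P : ∀ x ∈ hp N, η x ^ (2 * k) * (HS b c a τ k t x + ∑ i, HR b c a τ k i t x ^ 2) ≤ 2000 * e x +
      20000002 * (η x ^ (2 * k) * ∑ i, HR b c a τ k i t x ^ 2) + C2 * (Qb N ρ2).indicator (fun x ↦ 𝔡 τ t k v x ^ 2) x := by
    intro x hx
    by_cases hx2 : ‖x‖ < ρ2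
    · have hxQ : x ∈ Qb N ρ2 := ⟨hx2, hx⟩
      rw [indicator_of_mem hxQ]
      exact D.ptw hτ hk t (η x) x (fun i ↦ fderiv ℝ η x (eb i)) (hG x) (S.η0 x)
        (mul_le_of_le_one_left (sq_nonneg _) (pow_le_one₀ (S.η0 x) (S.η1 x)))
    · rw [indicator_of_notMem (fun h ↦ hx2 h.1)]
      have : η x = 0 := e0 x (not_lt.1 hx2)
      rw [he]; simp [this, zero_pow (by omega : 2 * k ≠ 0), zero_pow (by omega : 2 * k - 1 ≠ 0)]
  have iT : Integrable (fun x ↦ η x ^ (2 * k) * (HS b c a τ k t x + ∑ i, HR b c a τ k i t x ^ 2)) μ := by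
    refine (iS.add iRR).congr (Filter.Eventually.of_forall fun x ↦ ?_)
    simp only [Pi.add_apply, mul_add]
  have hX : ∫ x, η x ^ (2 * k) * (HS b c a τ k t x + ∑ i, HR b c a τ k i t x ^ 2) ∂μ ≤
      20000002 * (∫ x, η x ^ (2 * k) * ∑ i, HR b c a τ k i t x ^ 2 ∂μ) + C2 * (C0 * t ^ (2 * k)) := by
    calc _ ≤ ∫ x, (2000 * e x + 20000002 * (η x ^ (2 * k) * ∑ i, HR b c a τ k i t x ^ 2) + C2 * (Qb N ρ2).indicator (fun x ↦ 𝔡 τ t k v x ^ 2) x) ∂μ := by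
          refine integral_mono_ae iT (((ie.const_mul _).add (iRR.const_mul _)).add (iv.const_mul _)) ?_
          exact (ae_restrict_iff' (hp_meas N)).2 (Filter.Eventually.of_forall P)
      _ ≤ _ := by
          rw [integral_add (f := fun x ↦ 2000 * e x + 20000002 * (η x ^ (2 * k) * ∑ i, HR b c a τ k i t x ^ 2)) ((ie.const_mul _).add (iRR.const_mul _)) (iv.const_mul _), integral_add (ie.const_mul _) (iRR.const_mul _), integral_const_mul, integral_const_mul, integral_const_mul, En, mul_zero, zero_add]
          gcongr
  have T0 : ∀ x, 0 ≤ HS b c a τ k t x + ∑ i, HR b c a τ k i t x ^ 2 := fun x ↦ by unfold HS; positivity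
  have hSR : ∫ x, η x ^ (2 * k) * HS b c a τ k t x ∂μ ≤ ∫ x, η x ^ (2 * k) * (HS b c a τ k t x + ∑ i, HR b c a τ k i t x ^ 2) ∂μ := by
    refine integral_mono iS iT fun x ↦ ?_
    have : 0 ≤ ∑ i, HR b c a τ k i t x ^ 2 := by positivity
    have h9 := pow_nonneg (S.η0 x) (2 * k)
    simp only; gcongr; linarith
  have X0 : 0 ≤ ∫ x, η x ^ (2 * k) * HS b c a τ k t x ∂μ := integral_nonneg fun x ↦ mul_nonneg (pow_nonneg (S.η0 x) _) (by unfold HS; positivity)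
  have sub : Qb N ρ ⊆ hp N := fun x hx ↦ hx.2
  have eqQ : EqOn (fun x ↦ η x ^ (2 * k) * (HS b c a τ k t x + ∑ i, HR b c a τ k i t x ^ 2)) (fun x ↦ HS b c a τ k t x + ∑ i, HR b c a τ k i t x ^ 2) (Qb N ρ) :=
    fun x hx ↦ by simp [e1 x hx.1]
  have iT' : IntegrableOn (fun x ↦ η x ^ (2 * k) * (HS b c a τ k t x + ∑ i, HR b c a τ k i t x ^ 2)) (hp N) := iT
  refine ⟨(integrableOn_congr_fun eqQ (Qb_meas N ρ)).1 (iT'.mono_set sub), ?_⟩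
  calc _ = ∫ x in Qb N ρ, η x ^ (2 * k) * (HS b c a τ k t x + ∑ i, HR b c a τ k i t x ^ 2) :=
        setIntegral_congr_fun (Qb_meas N ρ) eqQ.symm
    _ ≤ ∫ x, η x ^ (2 * k) * (HS b c a τ k t x + ∑ i, HR b c a τ k i t x ^ 2) ∂μ :=
        setIntegral_mono_set iT' (Filter.Eventually.of_forall fun x ↦ mul_nonneg (pow_nonneg (S.η0 x) _) (T0 x)) (LE.le.eventuallyLE sub)
    _ ≤ _ := by
        have : 0 ≤ t ^ (2 * k) := by positivity
        nlinarith

lemma HD.main (D : HD N r M v b c H Bn a) {τ : Yn N} (hτ : τ ℓ = 0) (k : ℕ) :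
    ((∀ j, IV N r τ k (a j)) ∧ IV N r τ k b ∧ IV N r τ k c) ∧ (∀ j, IV N r τ k (fun y ↦ -(a j y * (1 + c y)))) ∧ IV N r τ k Bn := by
  have ca := fun j ↦ (D.ua j).continuous
  have cb := D.ub.continuous
  have cc := D.uc.continuous
  have cBn : Continuous Bn := by
    have : Bn = fun y ↦ 1 + H y - ∑ j, a j y * a j y - (1 + b y) ^ 2 := funext D.hB
    rw [this]; have := D.cH; fun_prop
  have bBn : ∀ y, |Bn y| ≤ 1 + M + N * M ^ 2 + 4 := fun y ↦ by
    have h1 := abs_le.1 (D.bH y)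
    have h2 : ∑ j, a j y * a j y ≤ N * M ^ 2 := by
      calc _ ≤ ∑ j : Fin N, M ^ 2 := Finset.sum_le_sum fun j _ ↦ by
            rw [← sq]; exact (abs_le.1 (sq_bd (D.ba j y))).2
        _ = _ := by simp
    have h3 : 0 ≤ ∑ j, a j y * a j y := Finset.sum_nonneg fun j _ ↦ mul_self_nonneg _
    have h4 : (1 + b y) ^ 2 ≤ 4 := by nlinarith [D.b1 y, D.b2 y]
    have h5 : 0 ≤ (N:ℝ) * M ^ 2 := by positivity
    rw [D.hB y, abs_le]; constructor <;> nlinarith [sq_nonneg (1 + b y)]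
  have cp : ∀ j, Continuous (fun y ↦ -(a j y * (1 + c y))) := fun j ↦ by have := ca j; fun_prop
  have bp : ∀ j y, |-(a j y * (1 + c y))| ≤ M * 2 := fun j y ↦ by
    rw [abs_neg, abs_mul]; refine mul_le_mul (D.ba j y) ?_ (abs_nonneg _) D.M0
    rw [abs_of_nonneg (by linarith [D.c1 y])]; exact (D.c1 y).2
  induction k with
  | zero => exact ⟨⟨fun _ ↦ IV_zero _, IV_zero _, IV_zero _⟩, fun _ ↦ IV_zero _, IV_zero _⟩
  | succ k ih =>
    have hv : IV N r τ (k+1) v := by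
      refine IV_prim hτ (p := fun y ↦ ∑ j : Fin N, τ j.castSucc * -(a j y * (1 + c y))) (M := ∑ j : Fin N, |τ j.castSucc| * (M * 2)) (by fun_prop) (fun y ↦ ?_) (fun y hy ↦ ⟨(D.dv y hy).1, ?_⟩)
        (IV_comb cp bp ih.2.1 _)
      · refine (Finset.abs_sum_le_sum_abs _ _).trans (Finset.sum_le_sum fun j _ ↦ ?_)
        rw [abs_mul]; exact mul_le_mul_of_nonneg_left (bp j y) (abs_nonneg _)
      · have e : τ = ∑ i, τ i • (eb i : Yn N) := by
          conv_lhs => rw [← Finset.univ_sum_single τ]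
          refine Finset.sum_congr rfl fun i _ ↦ ?_
          rw [eb, ← Pi.single_smul]; simp
        conv_lhs => rw [e]
        rw [map_sum, Fin.sum_univ_castSucc]
        simp only [map_smul, smul_eq_mul, hτ, zero_mul, add_zero, (D.dv y hy).2.1]
    have fin : ∀ w : Yn N → ℝ, Continuous w → (∃ K, ∀ y, |w y| ≤ K) → (∃ C, 0 ≤ C ∧ ∀ t x, 𝔡 τ t (k+1) w x ^ 2 ≤ C * (HS b c a τ (k+1) t x + ∑ i, HR b c a τ (k+1) i t x ^ 2)) → IV N r τ (k+1) w := by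
      rintro w cw ⟨K, hK⟩ ⟨C, hC, hw⟩
      refine IV_pos D.r0 cw hK fun ρ h0 hρ ↦ ?_
      obtain ⟨C', t0, hC', ht0, I⟩ := D.step hτ (Nat.le_add_left 1 k) hv h0 hρ
      refine ⟨C * C', t0, by positivity, ht0, fun t ht htt ↦ ?_⟩
      obtain ⟨i1, i2⟩ := I t ht htt
      calc _ ≤ ∫ x in Qb N ρ, C * (HS b c a τ (k+1) t x + ∑ i, HR b c a τ (k+1) i t x ^ 2) :=
            setIntegral_mono (IV_int cw hK) (i1.const_mul C) (hw t)
        _ ≤ _ := by rw [integral_const_mul, mul_assoc]; gcongr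
    have R0 : ∀ t x, 0 ≤ ∑ i, HR b c a τ (k+1) i t x ^ 2 := fun t x ↦ by positivity
    have A0 : ∀ t x, 0 ≤ ∑ j, 𝔡 τ t (k+1) (a j) x ^ 2 := fun t x ↦ by positivity
    have Aj : ∀ j t x, 𝔡 τ t (k+1) (a j) x ^ 2 ≤ HS b c a τ (k+1) t x := fun j t x ↦ by
      have := Finset.single_le_sum (f := fun j ↦ 𝔡 τ t (k+1) (a j) x ^ 2) (fun i _ ↦ sq_nonneg _) (Finset.mem_univ j)
      unfold HS; nlinarith [sq_nonneg (𝔡 τ t (k+1) b x), sq_nonneg (𝔡 τ t (k+1) c x)]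
    have Ab : ∀ t x, 𝔡 τ t (k+1) b x ^ 2 ≤ HS b c a τ (k+1) t x := fun t x ↦ by
      have := A0 t x
      unfold HS; nlinarith [sq_nonneg (𝔡 τ t (k+1) c x)]
    have Ac : ∀ t x, 𝔡 τ t (k+1) c x ^ 2 ≤ HS b c a τ (k+1) t x := fun t x ↦ by
      have := A0 t x
      unfold HS; nlinarith [sq_nonneg (𝔡 τ t (k+1) b x)]
    refine ⟨⟨fun j ↦ fin _ (ca j) ⟨_, D.ba j⟩ ⟨1, zero_le_one, fun t x ↦ by linarith [Aj j t x, R0 t x]⟩,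
      fin _ cb ⟨_, D.bb⟩ ⟨1, zero_le_one, fun t x ↦ by linarith [Ab t x, R0 t x]⟩,
      fin _ cc ⟨_, D.bc⟩ ⟨1, zero_le_one, fun t x ↦ by linarith [Ac t x, R0 t x]⟩⟩,
      fun j ↦ fin _ (cp j) ⟨_, bp j⟩ ⟨15 + 3 * M ^ 2, by positivity, fun t x ↦ ?_⟩, fin _ cBn ⟨_, bBn⟩ ⟨12 * N * M ^ 2 + 52, by positivity, fun t x ↦ ?_⟩⟩
    · have h1 := (D.ids hτ (Nat.le_add_left 1 k) t x).1 j
      have h2 := Finset.single_le_sum (f := fun i ↦ HR b c a τ (k+1) i t x ^ 2) (fun i _ ↦ sq_nonneg _) (Finset.mem_univ (some (some j)))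
      have h3 := Aj j t x
      have h4 := Ac t x
      have h5 : a j x ^ 2 ≤ M ^ 2 := (abs_le.1 (sq_bd (D.ba j x))).2
      have h6 : (1 + c x) ^ 2 ≤ 4 := by nlinarith [D.c1 x]
      rw [h1]
      generalize 𝔡 τ t (k+1) (a j) x = A at *
      generalize 𝔡 τ t (k+1) c x = C at *
      generalize HR b c a τ (k+1) (some (some j)) t x = R at *
      generalize HS b c a τ (k+1) t x = HSS at *
      have h7 : (-((1 + c x) * A + a j x * C + R)) ^ 2 ≤ 3 * (((1 + c x) * A) ^ 2 + (a j x * C) ^ 2 + R ^ 2) := by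
        nlinarith [sq_nonneg ((1 + c x) * A - a j x * C), sq_nonneg ((1 + c x) * A - R), sq_nonneg (a j x * C - R)]
      have h8 : ((1 + c x) * A) ^ 2 ≤ 4 * HSS := by
        rw [mul_pow]; exact mul_le_mul h6 h3 (sq_nonneg _) (by norm_num)
      have h9 : (a j x * C) ^ 2 ≤ M ^ 2 * HSS := by
        rw [mul_pow]; exact mul_le_mul h5 h4 (sq_nonneg _) (sq_nonneg _)
      have h10 : 0 ≤ HSS := (sq_nonneg _).trans h3
      have h11 := R0 t x
      nlinarith [mul_nonneg (sq_nonneg M) h11]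
    · have h3 := bnd_B (fun j ↦ a j x) (fun j ↦ 𝔡 τ t (k+1) (a j) x) _ (b x) _ _ _ M (fun j ↦ D.ba j x)
        (by rw [abs_of_nonneg (by linarith [D.b1 x])]; exact D.b2 x) (D.ids hτ (Nat.le_add_left 1 k) t x).2.2.1
      have h2 := Finset.single_le_sum (f := fun i ↦ HR b c a τ (k+1) i t x ^ 2) (fun i _ ↦ sq_nonneg _) (Finset.mem_univ none)
      have h4 : 0 ≤ ∑ j, (-2 * 𝔡 τ t (k+1) (a j) x) ^ 2 := by positivity
      refine (le_trans (by linarith) h3).trans (mul_le_mul_of_nonneg_left ?_ (by positivity))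
      refine add_le_add ?_ h2
      unfold HS; linarith [sq_nonneg (𝔡 τ t (k+1) c x)]
end

section
variable {N : ℕ} {Q : TopologicalSpace.Opens (Yn N)}

def SA (Q : TopologicalSpace.Opens (Yn N)) : Subalgebra ℝ (Yn N → ℝ) where
  carrier := {f | ContDiffOn ℝ ⊤∞ f Q}
  mul_mem' hf hg := ContDiffOn.mul hf hg
  add_mem' hf hg := ContDiffOn.add hf hg
  algebraMap_mem' _ := contDiffOn_const

lemma SAat (f : SA Q) {y : Yn N} (hy : y ∈ Q) : ContDiffAt ℝ ⊤∞ f.1 y :=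
  (show ContDiffOn ℝ ⊤∞ f.1 Q from f.2).contDiffAt (Q.isOpen.mem_nhds hy)

lemma SAdiff (f : SA Q) {y : Yn N} (hy : y ∈ Q) : DifferentiableAt ℝ f.1 y := (SAat f hy).differentiableAt (by simp)

lemma SAfd (f : SA Q) {y : Yn N} (hy : y ∈ Q) : ContDiffAt ℝ ⊤∞ (fderiv ℝ f.1) y :=
  (SAat f hy).fderiv_right (by simp)

open Classical in
noncomputable def dQ (Q : TopologicalSpace.Opens (Yn N)) (τ : Yn N) : SA Q →ₗ[ℝ] SA Q where
  toFun f := ⟨(Q : Set (Yn N)).indicator fun y ↦ fderiv ℝ f.1 y τ, by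
    have : ContDiffOn ℝ ⊤∞ (fun y ↦ fderiv ℝ f.1 y τ) Q := fun y hy ↦ ((SAfd f hy).clm_apply contDiffAt_const).contDiffWithinAt
    exact this.congr fun y hy ↦ indicator_of_mem hy _⟩
  map_add' f g := by
    apply Subtype.ext; funext y
    by_cases hy : y ∈ (Q : Set (Yn N))
    · have : fderiv ℝ (f.1 + g.1) y = _ := fderiv_add (SAdiff f hy) (SAdiff g hy)
      simp [indicator_of_mem hy, this]
    · simp [indicator_of_notMem hy]
  map_smul' c f := by
    apply Subtype.ext; funext y
    by_cases hy : y ∈ (Q : Set (Yn N))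
    · have : fderiv ℝ (c • f.1) y = _ := fderiv_const_smul (SAdiff f hy) c
      simp [indicator_of_mem hy, this]
    · simp [indicator_of_notMem hy]

lemma dQ_in (τ : Yn N) (f : SA Q) {y : Yn N} (hy : y ∈ Q) : (dQ Q τ f).1 y = fderiv ℝ f.1 y τ := by
  show (Q : Set (Yn N)).indicator (fun y ↦ fderiv ℝ f.1 y τ) y = _
  exact indicator_of_mem hy _
lemma dQ_out (τ : Yn N) (f : SA Q) {y : Yn N} (hy : y ∉ Q) : (dQ Q τ f).1 y = 0 := by
  show (Q : Set (Yn N)).indicator (fun y ↦ fderiv ℝ f.1 y τ) y = _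
  exact indicator_of_notMem hy _

lemma SA_ext {f g : SA Q} (h : ∀ y, f.1 y = g.1 y) : f = g := Subtype.ext (funext h)

lemma dQ_ext {τ : Yn N} {f g : SA Q} (h : ∀ y ∈ Q, f.1 y = g.1 y) : dQ Q τ f = dQ Q τ g := by
  refine SA_ext fun y ↦ ?_
  by_cases hy : y ∈ Q
  · rw [dQ_in _ _ hy, dQ_in _ _ hy, Filter.EventuallyEq.fderiv_eq]
    filter_upwards [Q.isOpen.mem_nhds hy] with z hz using h z hz
  · rw [dQ_out _ _ hy, dQ_out _ _ hy]

lemma dQ_mul (τ : Yn N) (f g : SA Q) : dQ Q τ (f * g) = dQ Q τ f * g + f * dQ Q τ g := by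
  refine SA_ext fun y ↦ ?_
  have e : ∀ p q : SA Q, (p * q).1 y = p.1 y * q.1 y := fun _ _ ↦ rfl
  have e' : ∀ p q : SA Q, (p + q).1 y = p.1 y + q.1 y := fun _ _ ↦ rfl
  rw [e', e, e]
  by_cases hy : y ∈ Q
  · rw [dQ_in _ _ hy, dQ_in _ _ hy, dQ_in _ _ hy]
    have : fderiv ℝ (f.1 * g.1) y = _ := fderiv_mul (SAdiff f hy) (SAdiff g hy)
    show fderiv ℝ (f.1 * g.1) y τ = _
    rw [this]; simp; ring
  · rw [dQ_out _ _ hy, dQ_out _ _ hy, dQ_out _ _ hy]; simp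

lemma dQ_comm (σ τ : Yn N) (f : SA Q) : dQ Q σ (dQ Q τ f) = dQ Q τ (dQ Q σ f) := by
  refine SA_ext fun y ↦ ?_
  by_cases hy : y ∈ Q
  · have key : ∀ σ τ : Yn N, (dQ Q σ (dQ Q τ f)).1 y = fderiv ℝ (fderiv ℝ f.1) y σ τ := fun σ τ ↦ by
      rw [dQ_in _ _ hy]
      have e : (dQ Q τ f).1 =ᶠ[nhds y] fun z ↦ fderiv ℝ f.1 z τ := by
        filter_upwards [Q.isOpen.mem_nhds hy] with z hz using dQ_in τ f hz
      rw [e.fderiv_eq, fderiv_clm_apply ((SAfd f hy).differentiableAt (by simp)) (differentiableAt_const _)]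
      simp
    rw [key, key]
    exact ((SAat f hy).isSymmSndFDerivAt (by rw [minSmoothness_of_isRCLikeNormedField]; exact WithTop.coe_le_coe.2 le_top)).eq σ τ
  · rw [dQ_out _ _ hy, dQ_out _ _ hy]

lemma dQ_add (σ τ : Yn N) (s : ℝ) : dQ Q (σ + s • τ) = dQ Q σ + s • dQ Q τ := by
  refine LinearMap.ext fun f ↦ SA_ext fun y ↦ ?_
  show _ = (dQ Q σ f).1 y + s * (dQ Q τ f).1 y
  by_cases hy : y ∈ Q
  · rw [dQ_in _ _ hy, dQ_in _ _ hy, dQ_in _ _ hy]; simp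
  · rw [dQ_out _ _ hy, dQ_out _ _ hy, dQ_out _ _ hy]; simp

lemma dQ_const (τ : Yn N) (s : ℝ) : dQ Q τ (algebraMap ℝ (SA Q) s) = 0 := by
  refine SA_ext fun y ↦ ?_
  by_cases hy : y ∈ Q
  · rw [dQ_in _ _ hy]
    have : (algebraMap ℝ (SA Q) s).1 = fun _ ↦ s := rfl
    rw [this]; simp
  · rw [dQ_out _ _ hy]; rfl

/-- `f = D^k` finite difference mean value -/
lemma dl_mvt {τ : Yn N} {t : ℝ} (ht : 0 < t) (k : ℕ) : ∀ (Q : TopologicalSpace.Opens (Yn N)) (f : SA Q) (x : Yn N),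
    (∀ s ∈ Icc 0 (k * t), x + s • τ ∈ Q) → ∃ s ∈ Icc 0 (k * t), 𝔡 τ t k f.1 x = t ^ k * ((dQ Q τ)^[k] f).1 (x + s • τ) := by
  induction k with
  | zero => intro Q f x hx; exact ⟨0, by simp, by simp⟩
  | succ k ih =>
    intro Q f x hx
    let Q' : TopologicalSpace.Opens (Yn N) := ⟨{y | y ∈ Q ∧ sh τ t y ∈ Q}, Q.isOpen.inter (Q.isOpen.preimage (sh_cont τ t))⟩
    have shf : ∀ g : SA Q, ContDiffOn ℝ ⊤∞ (fun y ↦ g.1 (sh τ t y) - g.1 y) Q' := fun g ↦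
      (ContDiffOn.comp (t := (Q : Set (Yn N))) g.2 (by unfold sh; fun_prop) fun y hy ↦ hy.2).sub (ContDiffOn.mono g.2 fun y hy ↦ hy.1)
    let Df : SA Q → SA Q' := fun g ↦ ⟨fun y ↦ g.1 (sh τ t y) - g.1 y, shf g⟩
    have comm : ∀ j, ∀ y ∈ Q', ((dQ Q' τ)^[j] (Df f)).1 y = (Df ((dQ Q τ)^[j] f)).1 y := by
      intro j
      induction j with
      | zero => intro y _; rfl
      | succ j ihj =>
        intro y hy
        rw [Function.iterate_succ_apply', Function.iterate_succ_apply', dQ_ext ihj, dQ_in _ _ hy]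
        set g := (dQ Q τ)^[j] f
        have h1 : HasFDerivAt (fun y ↦ g.1 (sh τ t y) - g.1 y) (fderiv ℝ g.1 (sh τ t y) - fderiv ℝ g.1 y) y := by
          refine HasFDerivAt.sub ?_ (SAdiff g hy.1).hasFDerivAt
          unfold sh
          have h0 := (SAdiff g hy.2).hasFDerivAt
          exact (hasFDerivAt_comp_add_right (t • τ)).2 h0
        show fderiv ℝ (fun y ↦ g.1 (sh τ t y) - g.1 y) y τ = (dQ Q τ g).1 (sh τ t y) - (dQ Q τ g).1 y
        rw [h1.fderiv, dQ_in _ _ hy.1, dQ_in _ _ hy.2]; rfl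
    have hst : ∀ s ∈ Icc 0 (k * t), x + s • τ ∈ Q' := fun s hs ↦ ⟨hx s ⟨hs.1, hs.2.trans (by push_cast; nlinarith)⟩, by
      have := hx (s + t) ⟨by linarith [hs.1], by push_cast; nlinarith [hs.2]⟩
      unfold sh; rwa [add_assoc, ← add_smul]⟩
    obtain ⟨s, hs, h⟩ := ih Q' (Df f) x hst
    set g := (dQ Q τ)^[k] f with hg
    rw [comm k _ (hst s hs)] at h
    have e1 : 𝔡 τ t (k+1) f.1 x = t ^ k * (g.1 (x + (s + t) • τ) - g.1 (x + s • τ)) := by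
      rw [Function.iterate_succ_apply]
      have : dl (sh τ t) f.1 = (Df f).1 := rfl
      rw [this, h]
      show _ * (g.1 (sh τ t (x + s • τ)) - _) = _
      unfold sh; rw [add_assoc, ← add_smul]
    have hd : ∀ z ∈ Icc s (s + t), HasDerivAt (fun z ↦ g.1 (x + z • τ)) ((dQ Q τ g).1 (x + z • τ)) z := fun z hz ↦ by
      have hz' : x + z • τ ∈ Q := hx z ⟨by linarith [hs.1, hz.1], by push_cast; nlinarith [hs.2, hz.2]⟩
      rw [dQ_in _ _ hz']
      have h2 : HasDerivAt (fun z : ℝ ↦ x + z • τ) τ z := by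
        simpa using ((hasDerivAt_id z).smul_const τ).const_add x
      exact ((SAdiff g hz').hasFDerivAt).comp_hasDerivAt z h2
    obtain ⟨z, hz, e2⟩ := exists_hasDerivAt_eq_slope (fun z ↦ g.1 (x + z • τ)) (fun z ↦ (dQ Q τ g).1 (x + z • τ)) (by linarith : s < s + t)
      (fun z hz ↦ (hd z hz).continuousAt.continuousWithinAt) (fun z hz ↦ hd z (Ioo_subset_Icc_self hz))
    refine ⟨z, ⟨by linarith [hs.1, hz.1], by push_cast; nlinarith [hs.2, hz.2]⟩, ?_⟩
    rw [Function.iterate_succ_apply' (dQ Q τ), ← hg]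
    rw [e2, e1, add_sub_cancel_left, pow_succ]; field_simp
end

section
variable {N : ℕ} {r : ℝ}

def QO (N : ℕ) (r : ℝ) : TopologicalSpace.Opens (Yn N) := ⟨Qb N r, Qb_open N r⟩
local notation "𝒬" => QO N r

lemma SAm (f : SA 𝒬) {ρ : ℝ} (h : ρ ≤ r) : Measurable ((Qb N ρ).indicator fun y ↦ ‖f.1 y‖ₑ) := by
  have : ContinuousOn (fun y ↦ ‖f.1 y‖ₑ) (Qb N ρ) :=
    (ContDiffOn.continuousOn (show ContDiffOn ℝ ⊤∞ f.1 _ from f.2)).enorm.mono fun y hy ↦ ⟨hy.1.trans_le h, hy.2⟩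
  classical
  rw [← piecewise_eq_indicator]
  exact this.measurable_piecewise continuousOn_const (Qb_meas N ρ)

def VL (N : ℕ) (r : ℝ) : Submodule ℝ (SA (QO N r)) where
  carrier := {f | ∀ ρ < r, ∫⁻ x in Qb N ρ, ‖f.1 x‖ₑ ≠ ⊤}
  zero_mem' := fun ρ _ ↦ by
    have : ∀ x, (0 : SA (QO N r)).1 x = 0 := fun _ ↦ rfl
    simp [this]
  add_mem' {f g} hf hg := fun ρ hρ ↦ by
    have h1 : ∫⁻ x in Qb N ρ, ‖(f + g).1 x‖ₑ ≤ ∫⁻ x in Qb N ρ, (‖f.1 x‖ₑ + ‖g.1 x‖ₑ) :=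
      lintegral_mono fun x ↦ enorm_add_le _ _
    refine ne_top_of_le_ne_top (ENNReal.add_ne_top.2 ⟨hf ρ hρ, hg ρ hρ⟩) (h1.trans ?_)
    rw [← lintegral_indicator (Qb_meas N ρ), ← lintegral_indicator (Qb_meas N ρ), ← lintegral_indicator (Qb_meas N ρ), ← lintegral_add_left (SAm f hρ.le)]
    rw [indicator_add]
  smul_mem' s f hf := fun ρ hρ ↦ by
    have h1 : ∫⁻ x in Qb N ρ, ‖(s • f).1 x‖ₑ = ∫⁻ x in Qb N ρ, ‖s‖ₑ * ‖f.1 x‖ₑ :=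
      lintegral_congr fun x ↦ by rw [← enorm_mul]; rfl
    rw [h1, lintegral_const_mul' _ _ (by simp)]
    exact ENNReal.mul_ne_top (by simp) (hf ρ hρ)

def TL (f : SA 𝒬) : Prop := ∀ τ : Yn N, τ ℓ = 0 → ∀ k, ((dQ 𝒬 τ) ^ k : Module.End ℝ _) f ∈ VL N r

lemma TL_of_IV {w : Yn N → ℝ} (cw : Continuous w) {M : ℝ} (hM : ∀ x, |w x| ≤ M) (f : SA 𝒬) (hf : f.1 = w)
    (h : ∀ τ : Yn N, τ ℓ = 0 → ∀ k, IV N r τ k w) : TL f := by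
  intro τ hτ k ρ hρ
  obtain ⟨C, t0, hC, ht0, hI⟩ := h τ hτ k ρ hρ
  rw [Module.End.coe_pow]
  set g := (dQ 𝒬 τ)^[k] f
  let t : ℕ → ℝ := fun m ↦ t0 / (m + 1)
  have tp : ∀ m, 0 < t m := fun m ↦ by positivity
  have tl : Filter.Tendsto t Filter.atTop (nhds 0) := by
    simpa [t, Function.comp_def] using (tendsto_const_div_atTop_nhds_zero_nat t0).comp (Filter.tendsto_add_atTop_nat 1)
  let F : ℕ → Yn N → ENNReal := fun m x ↦ ‖(dl (sh τ (t m)))^[k] w x / t m ^ k‖ₑ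
  have lim : ∀ x ∈ Qb N ρ, Filter.Tendsto (fun m ↦ F m x) Filter.atTop (nhds ‖g.1 x‖ₑ) := by
    intro x hx
    have hxr : x ∈ QO N r := ⟨hx.1.trans hρ, hx.2⟩
    have hl0 : Filter.Tendsto (fun m ↦ k * t m * ‖τ‖) Filter.atTop (nhds 0) := by
      simpa using (tl.const_mul (k:ℝ)).mul_const ‖τ‖
    have ev : ∀ᶠ m in Filter.atTop, k * t m * ‖τ‖ < r - ρ := hl0.eventually (gt_mem_nhds (by linarith))
    have ev2 : ∀ᶠ m in Filter.atTop, ∃ s ∈ Icc 0 (k * t m), (dl (sh τ (t m)))^[k] w x / t m ^ k = g.1 (x + s • τ) := by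
      filter_upwards [ev] with m hm
      obtain ⟨s, hs, e⟩ := dl_mvt (τ := τ) (tp m) k 𝒬 f x fun s hs ↦ by
        refine ⟨?_, by simpa [hτ] using hx.2⟩
        calc ‖x + s • τ‖ ≤ ‖x‖ + s * ‖τ‖ := by
              refine (norm_add_le _ _).trans ?_; rw [norm_smul, Real.norm_eq_abs, abs_of_nonneg hs.1]
          _ ≤ ‖x‖ + k * t m * ‖τ‖ := by gcongr; exact hs.2
          _ < r := by linarith [hx.1]
      refine ⟨s, hs, ?_⟩
      rw [← hf, e, mul_div_cancel_left₀ _ (pow_pos (tp m) k).ne']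
    have hcg : ContinuousAt g.1 x := (SAdiff g hxr).continuousAt
    refine (continuous_enorm.tendsto _).comp ?_
    rw [Metric.tendsto_nhds]
    intro ε hε
    obtain ⟨δ, hδ, hg⟩ := Metric.continuousAt_iff.1 hcg ε hε
    filter_upwards [ev2, hl0.eventually (gt_mem_nhds hδ)] with m ⟨s, hs, e⟩ hm
    rw [e]; apply hg
    rw [dist_eq_norm, add_sub_cancel_left, norm_smul, Real.norm_eq_abs, abs_of_nonneg hs.1]
    exact (mul_le_mul_of_nonneg_right hs.2 (norm_nonneg _)).trans_lt hm
  have bd : ∀ m, ∫⁻ x in Qb N ρ, F m x ≤ volume (Qb N ρ) + ENNReal.ofReal C := by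
    intro m
    have h1 : ∀ x, F m x ≤ 1 + ENNReal.ofReal (((dl (sh τ (t m)))^[k] w x) ^ 2 / t m ^ (2 * k)) := fun x ↦ by
      simp only [F]
      rw [← ofReal_norm, ← ENNReal.ofReal_one, ← ENNReal.ofReal_add zero_le_one (div_nonneg (sq_nonneg _) (pow_pos (tp m) _).le)]
      apply ENNReal.ofReal_le_ofReal
      rw [mul_comm 2 k, pow_mul, ← div_pow, Real.norm_eq_abs, ← sq_abs]
      nlinarith [sq_nonneg (|(dl (sh τ (t m)))^[k] w x / t m ^ k| - 1)]
    refine (lintegral_mono h1).trans ?_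
    rw [lintegral_add_left measurable_const]
    simp only [lintegral_one, Measure.restrict_apply_univ]
    gcongr
    rw [← ofReal_integral_eq_lintegral_ofReal ((IV_int cw hM).div_const _) (Filter.Eventually.of_forall fun x ↦ div_nonneg (sq_nonneg _) (pow_pos (tp m) _).le)]
    apply ENNReal.ofReal_le_ofReal
    rw [integral_div, div_le_iff₀ (pow_pos (tp m) _)]
    exact hI _ (tp m) (div_le_self ht0.le (by linarith [Nat.cast_nonneg (α := ℝ) m]))
  have hm : ∀ m, Measurable (F m) := fun m ↦ ((dl_cont τ (t m) cw k).div_const _).enorm.measurable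
  have fat := lintegral_liminf_le (u := Filter.atTop) (μ := volume.restrict (Qb N ρ)) hm
  have e : ∫⁻ x in Qb N ρ, ‖g.1 x‖ₑ = ∫⁻ x in Qb N ρ, Filter.liminf (fun m ↦ F m x) Filter.atTop :=
    setLIntegral_congr_fun (Qb_meas N ρ) fun x hx ↦ (lim x hx).liminf_eq.symm
  rw [e]
  refine ne_top_of_le_ne_top (ENNReal.add_ne_top.2 ⟨Qb_fin N ρ, ENNReal.ofReal_ne_top (r := C)⟩) (fat.trans ?_)
  exact (Filter.liminf_le_liminf (Filter.Eventually.of_forall bd)).trans (by simp)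

lemma pol_mem {E : Type*} [AddCommGroup E] [Module ℝ E] (V : Submodule ℝ E) (c : ℕ → E) (K : ℕ)
    (h : ∀ s : ℝ, ∑ i ∈ Finset.range K, s ^ i • c i ∈ V) : ∀ i < K, c i ∈ V := by
  intro i hi
  rw [← Submodule.Quotient.mk_eq_zero, ← Module.forall_dual_apply_eq_zero_iff ℝ]
  intro φ
  let P : Polynomial ℝ := ∑ i ∈ Finset.range K, Polynomial.monomial i (φ (Submodule.Quotient.mk (c i)))
  have hP : P = 0 := Polynomial.funext fun s ↦ by
    have h1 := (Submodule.Quotient.mk_eq_zero V).2 (h s)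
    have h2 : φ (V.mkQ (∑ i ∈ Finset.range K, s ^ i • c i)) = 0 := by
      show φ (Submodule.Quotient.mk _) = 0
      rw [h1, map_zero]
    simp only [map_sum, map_smul, smul_eq_mul] at h2
    simp only [P, Polynomial.eval_finsetSum, Polynomial.eval_monomial, Polynomial.eval_zero]
    rw [← h2]; exact Finset.sum_congr rfl fun _ _ ↦ mul_comm _ _
  have := congrArg (fun p ↦ Polynomial.coeff p i) hP
  simpa [P, Polynomial.finsetSum_coeff, Polynomial.coeff_monomial, hi] using this

lemma TL_D {f : SA 𝒬} (hf : TL f) {σ : Yn N} (hσ : σ ℓ = 0) : TL (dQ 𝒬 σ f) := by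
  intro τ hτ k
  set A : Module.End ℝ (SA 𝒬) := dQ 𝒬 τ
  set B : Module.End ℝ (SA 𝒬) := dQ 𝒬 σ
  have hc : Commute A B := LinearMap.ext fun g ↦ dQ_comm τ σ g
  have := pol_mem (VL N r) (fun i ↦ ((B ^ i * A ^ (k + 1 - i) * (((k+1).choose i : ℕ) : Module.End ℝ (SA 𝒬))) : Module.End ℝ _) f) (k+2) (fun s ↦ by
    have h1 := hf (τ + s • σ) (by simp [hτ, hσ]) (k+1)
    rw [dQ_add] at h1
    change ((A + s • B) ^ (k+1)) f ∈ _ at h1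
    rw [add_comm, Commute.add_pow ((hc.smul_right s).symm), LinearMap.sum_apply] at h1
    simp only [smul_pow, smul_mul_assoc, LinearMap.smul_apply] at h1
    exact h1) 1 (by omega)
  have h2 := (VL N r).smul_mem ((k+1:ℝ)⁻¹) this
  convert h2 using 1
  have e : ((((k+1).choose 1 : ℕ) : Module.End ℝ (SA 𝒬))) f = ((k:ℝ)+1) • f := by
    rw [Nat.choose_one_right, Module.End.natCast_apply, ← Nat.cast_smul_eq_nsmul ℝ]; simp
  show (A ^ k) (B f) = (k+1:ℝ)⁻¹ • (B ^ 1) ((A ^ (k + 1 - 1)) ((((k+1).choose 1 : ℕ) : Module.End ℝ (SA 𝒬)) f))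
  rw [e, map_smul, map_smul, smul_smul, inv_mul_cancel₀ (by positivity), one_smul, pow_one, Nat.add_sub_cancel]
  exact congrArg (fun L : Module.End ℝ (SA 𝒬) ↦ L f) (hc.pow_left k).eq

lemma TL_smul {f : SA 𝒬} (hf : TL f) (s : ℝ) : TL (s • f) := fun τ hτ k ↦ by
  rw [map_smul]; exact (VL N r).smul_mem _ (hf τ hτ k)
lemma TL_sum {ι : Type*} (S : Finset ι) {f : ι → SA 𝒬} (hf : ∀ i ∈ S, TL (f i)) : TL (∑ i ∈ S, f i) := fun τ hτ k ↦ by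
  rw [map_sum]; exact (VL N r).sum_mem fun i hi ↦ hf i hi τ hτ k
end

lemma sob1 {a b ρ : ℝ} (hρ : 0 < ρ) (hab : ρ ≤ b - a) {g : ℝ → ℝ} (hg : ContDiffOn ℝ 1 g (Ioo a b)) {y : ℝ} (hy : y ∈ Ioo a b) :
    ‖g y‖ₑ ≤ (∫⁻ x in Ioo a b, ‖g x‖ₑ) / ENNReal.ofReal ρ + ∫⁻ x in Ioo a b, ‖deriv g x‖ₑ := by
  have h1 : ∀ x ∈ Ioo a b, ∀ z ∈ Ioo a b, x ≤ z → ‖g z - g x‖ₑ ≤ ∫⁻ x in Ioo a b, ‖deriv g x‖ₑ := fun x hx z hz hxz ↦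
    (enorm_sub_le_lintegral_deriv_of_contDiffOn_Icc (hg.mono (Icc_subset_Ioo hx.1 hz.2)) hxz).trans
      (lintegral_mono_set (Icc_subset_Ioo hx.1 hz.2))
  rw [← tsub_le_iff_right, ENNReal.le_div_iff_mul_le (by simp [hρ]) (by simp)]
  calc _ ≤ (‖g y‖ₑ - ∫⁻ x in Ioo a b, ‖deriv g x‖ₑ) * volume (Ioo a b) := by
        rw [Real.volume_Ioo]; gcongr
    _ = ∫⁻ x in Ioo a b, (‖g y‖ₑ - ∫⁻ x in Ioo a b, ‖deriv g x‖ₑ) := by rw [setLIntegral_const]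
    _ ≤ _ := by
        refine setLIntegral_mono' measurableSet_Ioo fun x hx ↦ ?_
        rw [tsub_le_iff_right]
        have h2 : ‖g y‖ₑ ≤ ‖g x‖ₑ + ‖g y - g x‖ₑ := by
          calc _ = ‖g x + (g y - g x)‖ₑ := by ring_nf
            _ ≤ _ := enorm_add_le _ _
        refine h2.trans ?_
        gcongr
        rcases le_total x y with h | h
        · exact h1 x hx y hy h
        · rw [← enorm_neg, neg_sub]; exact h1 y hy x hx h

section
variable {N : ℕ} {r : ℝ}
local notation "𝒬" => QO N r

lemma Qb_upd {ρ : ℝ} (hρ : 0 < ρ) {y : Yn N} (hy : y ∈ Qb N ρ) (i : Fin (N+1)) (s : ℝ) :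
    Function.update y i s ∈ Qb N ρ ↔ s ∈ Ioo (if i = Fin.last N then 0 else -ρ) ρ := by
  unfold Qb at *
  simp only [mem_ofPred_eq, pi_norm_lt_iff hρ, mem_Ioo, Real.norm_eq_abs] at *
  constructor
  · intro h
    have h1 := h.1 i; rw [Function.update_self, abs_lt] at h1
    refine ⟨?_, h1.2⟩
    split_ifs with hi
    · subst hi; simpa using h.2
    · exact h1.1
  · intro h
    constructor
    · intro j
      by_cases hj : j = i
      · subst hj; rw [Function.update_self, abs_lt]; refine ⟨?_, h.2⟩
        have := h.1; split_ifs at this <;> linarith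
      · rw [Function.update_of_ne hj]; exact hy.1 j
    · by_cases hi : i = Fin.last N
      · subst hi; simpa using h.1
      · rw [Function.update_of_ne (Ne.symm hi)]; exact hy.2

noncomputable def Es (ρ : ℝ) : List (Fin (N+1)) → SA 𝒬 → Yn N → ENNReal
  | [], f => (Qb N ρ).indicator fun y ↦ ‖f.1 y‖ₑ
  | i :: l, f => fun y ↦ Es ρ l f y + Es ρ l (dQ 𝒬 (eb i) f) y

lemma Es_m {ρ : ℝ} (h : ρ ≤ r) : ∀ (l : List (Fin (N+1))) (f : SA 𝒬), Measurable (Es ρ l f)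
  | [], f => SAm f h
  | _ :: l, f => (Es_m h l f).add (Es_m h l _)

lemma sob_step {ρ : ℝ} (hρ : 0 < ρ) (h : ρ < r) (f : SA 𝒬) (i : Fin (N+1)) (y : Yn N) :
    Es ρ [] f y ≤ (1 + (ENNReal.ofReal ρ)⁻¹) * ∫⁻ s, (Es ρ [] f (Function.update y i s) + Es ρ [] (dQ 𝒬 (eb i) f) (Function.update y i s)) := by
  by_cases hy : y ∈ Qb N ρ
  swap
  · simp [Es, indicator_of_notMem hy]
  have hQ : ∀ s ∈ Ioo (if i = Fin.last N then 0 else -ρ) ρ, Function.update y i s ∈ QO N r := fun s hs ↦ by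
    have := (Qb_upd hρ hy i s).2 hs; exact ⟨this.1.trans h, this.2⟩
  have hu : ∀ s, HasDerivAt (fun s ↦ Function.update y i s) (eb i) s := fun s ↦ hasDerivAt_update y i s
  have hd : ∀ s ∈ Ioo (if i = Fin.last N then 0 else -ρ) ρ, deriv (fun s ↦ f.1 (Function.update y i s)) s = (dQ 𝒬 (eb i) f).1 (Function.update y i s) := fun s hs ↦ by
    rw [dQ_in _ _ (hQ s hs)]
    exact ((SAdiff f (hQ s hs)).hasFDerivAt.comp_hasDerivAt s (hu s)).deriv
  have hc : ContDiffOn ℝ 1 (fun s ↦ f.1 (Function.update y i s)) (Ioo (if i = Fin.last N then 0 else -ρ) ρ) := by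
    have h1 : ContDiffOn ℝ 1 f.1 𝒬 := ContDiffOn.of_le f.2 (by exact_mod_cast le_top)
    exact h1.comp (contDiff_update 1 y i).contDiffOn hQ
  have hmem : y i ∈ Ioo (if i = Fin.last N then 0 else -ρ) ρ := (Qb_upd hρ hy i (y i)).1 (by simpa using hy)
  have hl := sob1 hρ (by split_ifs <;> linarith) hc hmem
  have e : ∀ g : SA 𝒬, ∫⁻ s in Ioo (if i = Fin.last N then 0 else -ρ) ρ, ‖g.1 (Function.update y i s)‖ₑ =
      ∫⁻ s, Es ρ [] g (Function.update y i s) := fun g ↦ by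
    rw [← lintegral_indicator measurableSet_Ioo]
    refine lintegral_congr fun s ↦ ?_
    by_cases hs : s ∈ Ioo (if i = Fin.last N then 0 else -ρ) ρ
    · rw [indicator_of_mem hs, Es, indicator_of_mem ((Qb_upd hρ hy i s).2 hs)]
    · rw [indicator_of_notMem hs, Es, indicator_of_notMem (mt (Qb_upd hρ hy i s).1 hs)]
  rw [setLIntegral_congr_fun (f := fun s ↦ ‖deriv (fun s ↦ f.1 (Function.update y i s)) s‖ₑ) (g := fun s ↦ ‖(dQ 𝒬 (eb i) f).1 (Function.update y i s)‖ₑ) measurableSet_Ioo (fun s hs ↦ by simp only [hd s hs]), e, e] at hl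
  simp only [Function.update_eq_self] at hl
  rw [lintegral_add_left (f := fun s ↦ Es ρ [] f (Function.update y i s)) ((Es_m h.le [] f).comp (measurable_update y))]
  have : Es ρ [] f y = ‖f.1 y‖ₑ := indicator_of_mem hy _
  rw [this]
  refine hl.trans ?_
  rw [div_eq_mul_inv, add_mul, one_mul, mul_comm, mul_add]
  generalize ENNReal.ofReal ρ = t
  rw [add_comm]
  exact add_le_add (le_add_of_nonneg_left zero_le) (le_add_of_nonneg_right zero_le)

lemma sob_l {ρ : ℝ} (hρ : 0 < ρ) (h : ρ < r) : ∀ (l : List (Fin (N+1))) (_ : l.Nodup) (f : SA 𝒬) (y : Yn N),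
    Es ρ [] f y ≤ (1 + (ENNReal.ofReal ρ)⁻¹) ^ l.length * lmarginal (fun _ ↦ volume) l.toFinset (Es ρ l f) y
  | [], _, f, y => by simp
  | i :: l, hl, f, y => by
    rw [List.nodup_cons] at hl
    have ih := sob_l hρ h l hl.2
    have hi : i ∉ l.toFinset := by simpa using hl.1
    refine (sob_step hρ h f i y).trans ?_
    rw [List.toFinset_cons, lmarginal_insert _ (Es_m h.le _ _) hi, List.length_cons, pow_succ', mul_assoc]
    gcongr
    rw [← lintegral_const_mul' _ _ (by simp [hρ])]
    refine lintegral_mono fun s ↦ ?_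
    set z := Function.update y i s
    refine (add_le_add (ih f z) (ih _ z)).trans ?_
    rw [← mul_add]
    gcongr
    unfold lmarginal
    exact (lintegral_add_left ((Es_m h.le l f).comp measurable_updateFinset) _).ge

lemma Es_fin {ρ : ℝ} (h : ρ < r) : ∀ (l : List (Fin (N+1))) (_ : Fin.last N ∉ l) (f : SA 𝒬), TL f → ∫⁻ y, Es ρ l f y ≠ ⊤
  | [], _, f, hf => by
    have := hf 0 rfl 0 ρ h
    rwa [← lintegral_indicator (Qb_meas N ρ)] at this
  | i :: l, hi, f, hf => by
    rw [List.mem_cons, not_or] at hi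
    show ∫⁻ y, (Es ρ l f y + Es ρ l (dQ 𝒬 (eb i) f) y) ≠ ⊤
    rw [lintegral_add_left (Es_m h.le _ _)]
    exact ENNReal.add_ne_top.2 ⟨Es_fin h l hi.2 f hf, Es_fin h l hi.2 _ (TL_D hf (by simp [eb, hi.1]))⟩

/-- boundedness of functions tangentially regular together with normal derivative -/
lemma ZB {f : SA 𝒬} (hf : TL f) (hfn : TL (dQ 𝒬 (eb ℓ) f)) {ρ : ℝ} (h : ρ < r) :
    ∃ C : ℝ, ∀ y ∈ Qb N ρ, |f.1 y| ≤ C := by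
  rcases le_or_gt ρ 0 with hρ | hρ
  · exact ⟨0, fun y hy ↦ absurd (norm_nonneg y) (by linarith [hy.1])⟩
  set l : List (Fin (N+1)) := (Finset.univ.erase ℓ).toList
  have hl : Fin.last N ∉ l := by simp [l]
  have hnd : (Fin.last N :: l).Nodup := List.nodup_cons.2 ⟨hl, Finset.nodup_toList _⟩
  have hu : (Fin.last N :: l).toFinset = Finset.univ := by simp [l]
  have key := sob_l hρ h _ hnd f
  rw [hu] at key
  simp only [lmarginal_univ] at key
  set K := (1 + (ENNReal.ofReal ρ)⁻¹) ^ (Fin.last N :: l).length * ∫⁻ x, Es ρ (Fin.last N :: l) f x ∂Measure.pi fun _ ↦ volume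
  have hK : K ≠ ⊤ := by
    refine ENNReal.mul_ne_top (ENNReal.pow_ne_top (by simp [hρ])) ?_
    rw [← volume_pi]
    show ∫⁻ y, (Es ρ l f y + Es ρ l (dQ 𝒬 (eb ℓ) f) y) ≠ ⊤
    rw [lintegral_add_left (Es_m h.le _ _)]
    exact ENNReal.add_ne_top.2 ⟨Es_fin h l hl f hf, Es_fin h l hl _ hfn⟩
  refine ⟨K.toReal, fun y hy ↦ ?_⟩
  have h1 := key y
  rw [Es, indicator_of_mem hy] at h1
  have := ENNReal.toReal_mono hK h1
  simpa using this
end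

section
variable {N : ℕ} {r M : ℝ}
local notation "𝒬" => QO N r

def LB (N : ℕ) (r : ℝ) : Subalgebra ℝ (SA (QO N r)) where
  carrier := {f | ∀ ρ < r, ∃ C : ℝ, ∀ y ∈ Qb N ρ, |f.1 y| ≤ C}
  mul_mem' {f g} hf hg := fun ρ hρ ↦ by
    obtain ⟨C, h⟩ := hf ρ hρ
    obtain ⟨C', h'⟩ := hg ρ hρ
    exact ⟨C * C', fun y hy ↦ by
      show |f.1 y * g.1 y| ≤ _
      rw [abs_mul]; exact mul_le_mul (h y hy) (h' y hy) (abs_nonneg _) ((abs_nonneg _).trans (h y hy))⟩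
  add_mem' {f g} hf hg := fun ρ hρ ↦ by
    obtain ⟨C, h⟩ := hf ρ hρ
    obtain ⟨C', h'⟩ := hg ρ hρ
    exact ⟨C + C', fun y hy ↦ (abs_add_le _ _).trans (add_le_add (h y hy) (h' y hy))⟩
  algebraMap_mem' s := fun ρ _ ↦ ⟨|s|, fun _ _ ↦ le_rfl⟩

def op (A : Subalgebra ℝ (SA 𝒬)) (S : Set (Fin (N+1))) : Subalgebra ℝ (SA 𝒬) where
  carrier := {f | f ∈ A ∧ ∀ i ∈ S, dQ 𝒬 (eb i) f ∈ A}
  mul_mem' {f g} hf hg := ⟨A.mul_mem hf.1 hg.1, fun i hi ↦ by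
    rw [dQ_mul]; exact A.add_mem (A.mul_mem (hf.2 i hi) hg.1) (A.mul_mem hf.1 (hg.2 i hi))⟩
  add_mem' {f g} hf hg := ⟨A.add_mem hf.1 hg.1, fun i hi ↦ by
    rw [map_add]; exact A.add_mem (hf.2 i hi) (hg.2 i hi)⟩
  algebraMap_mem' s := ⟨A.algebraMap_mem s, fun i hi ↦ by rw [dQ_const]; exact A.zero_mem⟩

def opk (A : Subalgebra ℝ (SA 𝒬)) (S : Set (Fin (N+1))) : ℕ → Subalgebra ℝ (SA 𝒬)
  | 0 => A
  | k+1 => op (opk A S k) S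

def opl (A : Subalgebra ℝ (SA 𝒬)) (S : Set (Fin (N+1))) : Subalgebra ℝ (SA 𝒬) := ⨅ k, opk A S k

lemma opl_iff {A : Subalgebra ℝ (SA 𝒬)} {S : Set (Fin (N+1))} {f : SA 𝒬} : f ∈ opl A S ↔ ∀ k, f ∈ opk A S k := by
  unfold opl; rw [Algebra.mem_iInf]

lemma opl_D {A : Subalgebra ℝ (SA 𝒬)} {S : Set (Fin (N+1))} {f : SA 𝒬} (h : f ∈ opl A S) {i : Fin (N+1)} (hi : i ∈ S) :
    dQ 𝒬 (eb i) f ∈ opl A S := opl_iff.2 fun k ↦ (opl_iff.1 h (k+1)).2 i hi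

lemma opl_D' {A : Subalgebra ℝ (SA 𝒬)} {S : Set (Fin (N+1))} {i : Fin (N+1)} (hA : ∀ f ∈ A, dQ 𝒬 (eb i) f ∈ A) :
    ∀ k, ∀ f ∈ opk A S k, dQ 𝒬 (eb i) f ∈ opk A S k
  | 0 => hA
  | k+1 => fun f hf ↦ ⟨opl_D' hA k f hf.1, fun j hj ↦ by rw [dQ_comm]; exact opl_D' hA k _ (hf.2 j hj)⟩

def EX (A : Subalgebra ℝ (SA 𝒬)) : Prop := ∀ f g : SA 𝒬, (∀ y ∈ QO N r, f.1 y = g.1 y) → f ∈ A → g ∈ A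

lemma EX_LB : EX (LB N r) := fun f g h hf ρ hρ ↦ by
  obtain ⟨C, hC⟩ := hf ρ hρ
  exact ⟨C, fun y hy ↦ by rw [← h y ⟨hy.1.trans hρ, hy.2⟩]; exact hC y hy⟩

lemma EX_opk {A : Subalgebra ℝ (SA 𝒬)} {S : Set (Fin (N+1))} (hA : EX A) : ∀ k, EX (opk A S k)
  | 0 => hA
  | k+1 => fun f g h hf ↦ ⟨EX_opk hA k f g h hf.1, fun i hi ↦ by rw [← dQ_ext h]; exact hf.2 i hi⟩

lemma EX_opl {A : Subalgebra ℝ (SA 𝒬)} {S : Set (Fin (N+1))} (hA : EX A) : EX (opl A S) := fun f g h hf ↦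
  opl_iff.2 fun k ↦ EX_opk hA k f g h (opl_iff.1 hf k)

lemma opl_const {A : Subalgebra ℝ (SA 𝒬)} {S : Set (Fin (N+1))} {f : SA 𝒬} (hf : f ∈ A) (h : ∀ i, dQ 𝒬 (eb i) f = 0) :
    f ∈ opl A S := opl_iff.2 fun k ↦ by
  induction k with
  | zero => exact hf
  | succ k ih => exact ⟨ih, fun i _ ↦ by rw [h]; exact Subalgebra.zero_mem _⟩

lemma dQ_one (τ : Yn N) : dQ 𝒬 τ 1 = 0 := by simpa using dQ_const (Q := QO N r) τ 1

theorem HD.words {v b c H Bn : Yn N → ℝ} {a : Fin N → Yn N → ℝ} (D : HD N r M v b c H Bn a) {σ : ℝ}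
    (hH : ∀ y ∈ Qb N r, H y = 2 * σ * y ℓ) (sv : ContDiffOn ℝ ⊤∞ v (Qb N r)) (sb : ContDiffOn ℝ ⊤∞ b (Qb N r))
    (sc : ContDiffOn ℝ ⊤∞ c (Qb N r)) (sa : ∀ j, ContDiffOn ℝ ⊤∞ (a j) (Qb N r)) :
    ∃ W : Subalgebra ℝ (SA 𝒬), ⟨v, sv⟩ ∈ W ∧ (∀ f ∈ W, f ∈ LB N r) ∧ ∀ f ∈ W, ∀ i, dQ 𝒬 (eb i) f ∈ W := by
  let vS : SA 𝒬 := ⟨v, sv⟩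
  let cS : SA 𝒬 := ⟨c, sc⟩
  let g : SA 𝒬 := 1 + cS
  let h : SA 𝒬 := 1 + ⟨b, sb⟩
  let aS : Fin N → SA 𝒬 := fun j ↦ ⟨a j, sa j⟩
  let HS : SA 𝒬 := ⟨H, ContDiffOn.congr (by fun_prop) hH⟩
  let d : SA 𝒬 := ∑ j, aS j * aS j + h * h
  have dv : ∀ y, d.1 y = ∑ j, a j y * a j y + (1 + b y) ^ 2 := fun y ↦ by
    have : d.1 y = ((∑ j, aS j * aS j : SA 𝒬)).1 y + (1 + b y) * (1 + b y) := rfl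
    rw [this, AddSubmonoidClass.coe_finsetSum, Finset.sum_apply, sq]; rfl
  have dpos : ∀ y, 1 / 4 ≤ d.1 y := fun y ↦ by
    rw [dv]; have := D.b1 y
    have h2 : 0 ≤ ∑ j, a j y * a j y := Finset.sum_nonneg fun j _ ↦ mul_self_nonneg _
    nlinarith
  let e : SA 𝒬 := ⟨fun y ↦ (d.1 y)⁻¹, ContDiffOn.inv d.2 fun y _ ↦ by linarith [dpos y]⟩
  let p : Fin N → SA 𝒬 := fun j ↦ -(aS j * g)
  let B : SA 𝒬 := 1 + HS - d
  have BB : B.1 = Bn := funext fun y ↦ by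
    show 1 + H y - d.1 y = _
    rw [dv, D.hB]; ring
  have pp : ∀ j, (p j).1 = fun y ↦ -(a j y * (1 + c y)) := fun j ↦ rfl
  have ed : e * d = 1 := SA_ext fun y ↦ inv_mul_cancel₀ (by linarith [dpos y])
  have hg : h * g = 1 := SA_ext fun y ↦ D.hbc y
  have nl : ∀ j : Fin N, (eb j.castSucc : Yn N) ℓ = 0 := fun j ↦ by
    simp [eb, Pi.single_apply, (Fin.castSucc_lt_last j).ne']
  have M0 : 0 ≤ M := (abs_nonneg _).trans (D.bv 0)
  have rv : ∀ j : Fin N, ∀ y ∈ QO N r, (p j).1 y = (dQ 𝒬 (eb j.castSucc) vS).1 y := fun j y hy ↦ by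
    rw [dQ_in _ _ hy]; exact ((D.dv y hy).2.1 j).symm
  have rvn : ∀ y ∈ QO N r, g.1 y = (dQ 𝒬 (eb ℓ) vS).1 y := fun y hy ↦ by
    rw [dQ_in _ _ hy]; exact (D.dv y hy).2.2.symm
  have rp : ∀ j : Fin N, dQ 𝒬 (eb ℓ) (p j) = dQ 𝒬 (eb j.castSucc) g := fun j ↦ by
    rw [dQ_ext (rv j), dQ_comm, dQ_ext rvn]
  have rH0 : ∀ (τ y : Yn N), y ∈ QO N r → (dQ 𝒬 τ HS).1 y = 2 * σ * τ ℓ := fun τ y hy ↦ by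
    rw [dQ_in _ _ hy]
    have ev : HS.1 =ᶠ[nhds y] fun y ↦ 2 * σ * y ℓ := by
      filter_upwards [(QO N r).isOpen.mem_nhds hy] with z hz using hH z hz
    have hd : HasFDerivAt (fun y : Yn N ↦ 2 * σ * y ℓ) ((2 * σ) • ContinuousLinearMap.proj (R := ℝ) (φ := fun _ ↦ ℝ) ℓ) y :=
      (ContinuousLinearMap.proj (R := ℝ) (φ := fun _ ↦ ℝ) ℓ).hasFDerivAt.const_mul (2 * σ)
    rw [ev.fderiv_eq, hd.fderiv]; simp
  have rHj : ∀ j : Fin N, dQ 𝒬 (eb j.castSucc) HS = 0 := fun j ↦ SA_ext fun y ↦ by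
    by_cases hy : y ∈ QO N r
    · rw [rH0 _ y hy, nl]; simp
    · rw [dQ_out _ _ hy]; rfl
  have rB : dQ 𝒬 (eb ℓ) B = (2:ℝ) • ∑ j : Fin N, dQ 𝒬 (eb j.castSucc) (aS j) := SA_ext fun y ↦ by
    have es : ((2:ℝ) • ∑ j : Fin N, dQ 𝒬 (eb j.castSucc) (aS j)).1 y = 2 * ∑ j : Fin N, (dQ 𝒬 (eb j.castSucc) (aS j)).1 y := by
      show 2 * (∑ j : Fin N, dQ 𝒬 (eb j.castSucc) (aS j)).1 y = _
      rw [AddSubmonoidClass.coe_finsetSum, Finset.sum_apply]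
    rw [es]
    by_cases hy : y ∈ QO N r
    · rw [dQ_in _ _ hy, BB]
      have := (D.dB y hy).2.2
      rw [← Finset.mul_sum] at this
      simp only [dQ_in _ _ hy]
      linarith
    · simp only [dQ_out _ _ hy]; simp
  have cg1 := D.uc.continuous
  have ca1 := fun j ↦ (D.ua j).continuous
  have TLp : ∀ j, TL (p j) := fun j ↦ TL_of_IV (M := M * (1 + M)) (w := (p j).1) (by rw [pp]; have := ca1 j; fun_prop)
    (fun y ↦ by
      rw [pp, abs_neg, abs_mul]
      exact mul_le_mul (D.ba j y) ((abs_add_le _ _).trans (by rw [abs_one]; linarith [D.bc y])) (abs_nonneg _) M0) _ rfl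
    fun τ hτ k ↦ (D.main hτ k).2.1 j
  have TLc : TL cS := TL_of_IV cg1 D.bc _ rfl fun τ hτ k ↦ (D.main hτ k).1.2.2
  have TLa : ∀ j, TL (aS j) := fun j ↦ TL_of_IV (ca1 j) (D.ba j) _ rfl fun τ hτ k ↦ (D.main hτ k).1.1 j
  have TLB : TL B := by
    have cB : Continuous Bn := by
      have := D.ub.continuous; have := D.cH
      rw [show Bn = _ from funext D.hB]; fun_prop
    have hb : ∀ y, |Bn y| ≤ 1 + M + N * (M * M) + 4 := fun y ↦ by
      have h1 : ∑ j, a j y * a j y ≤ N * (M * M) := by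
        have : ∑ j, a j y * a j y ≤ ∑ j : Fin N, M * M := Finset.sum_le_sum fun j _ ↦ by
          rw [← abs_mul_abs_self]; exact mul_le_mul (D.ba j y) (D.ba j y) (abs_nonneg _) M0
        simpa using this
      have h2 : 0 ≤ ∑ j, a j y * a j y := Finset.sum_nonneg fun j _ ↦ mul_self_nonneg _
      have h3 := abs_le.1 (D.bH y); have h4 := D.b1 y; have h5 := D.b2 y
      have h6 : (1 + b y) ^ 2 ≤ 4 := by nlinarith
      have h7 := sq_nonneg (1 + b y)
      rw [D.hB, abs_le]; constructor <;> linarith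
    exact TL_of_IV cB hb _ BB fun τ hτ k ↦ (D.main hτ k).2.2
  let S : Set (Fin (N+1)) := range Fin.castSucc
  have Zk : ∀ k, ∀ f : SA 𝒬, TL f → TL (dQ 𝒬 (eb ℓ) f) → f ∈ opk (LB N r) S k := by
    intro k
    induction k with
    | zero => exact fun f h1 h2 ρ hρ ↦ ZB h1 h2 hρ
    | succ k ih =>
      refine fun f h1 h2 ↦ ⟨ih f h1 h2, ?_⟩
      rintro _ ⟨j, rfl⟩
      exact ih _ (TL_D h1 (nl j)) (by rw [dQ_comm]; exact TL_D h2 (nl j))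
  let T := opl (LB N r) S
  have dg : ∀ τ, dQ 𝒬 τ g = dQ 𝒬 τ cS := fun τ ↦ by
    show dQ 𝒬 τ (1 + cS) = _
    rw [map_add, dQ_one, zero_add]
  have pT : ∀ j, p j ∈ T := fun j ↦ opl_iff.2 fun k ↦ Zk k _ (TLp j) (by rw [rp, dg]; exact TL_D TLc (nl j))
  have BT : B ∈ T := opl_iff.2 fun k ↦ Zk k _ TLB (by
    rw [rB]; exact TL_smul (TL_sum _ fun j _ ↦ TL_D (TLa j) (nl j)) 2)
  have De : ∀ τ, dQ 𝒬 τ e = -(e * e * dQ 𝒬 τ d) := fun τ ↦ by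
    have h1 := dQ_mul τ e d
    rw [ed, dQ_one] at h1
    linear_combination (-e) * h1 - dQ 𝒬 τ e * ed
  have Dd : ∀ τ, dQ 𝒬 τ d = dQ 𝒬 τ HS - dQ 𝒬 τ B := fun τ ↦ by
    have : B = 1 + HS - d := rfl
    have h2 : dQ 𝒬 τ (1 + HS) = dQ 𝒬 τ HS := by rw [map_add, dQ_one, zero_add]
    rw [this, map_sub, h2]; ring
  have eT : e ∈ T := opl_iff.2 fun k ↦ by
    induction k with
    | zero => exact fun ρ _ ↦ ⟨4, fun y _ ↦ by
        show |(d.1 y)⁻¹| ≤ 4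
        rw [abs_of_nonneg (by have := dpos y; positivity)]
        exact (inv_anti₀ (by norm_num) (dpos y)).trans (by norm_num)⟩
    | succ k ih =>
      refine ⟨ih, ?_⟩
      rintro _ ⟨j, rfl⟩
      rw [De, Dd, rHj, zero_sub]
      exact neg_mem (mul_mem (mul_mem ih ih) (neg_mem (opl_iff.1 (opl_D BT ⟨j, rfl⟩) k)))
  let F := e * (1 + ∑ j, p j * p j)
  have FT : F ∈ T := mul_mem eT (add_mem (one_mem T) (sum_mem fun j _ ↦ mul_mem (pT j) (pT j)))
  have Fg : F = g * g := by
    have : ∑ j, p j * p j = g * g * ∑ j, aS j * aS j := by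
      rw [Finset.mul_sum]; exact Finset.sum_congr rfl fun j _ ↦ by simp only [p]; ring
    have h2 : (1:SA 𝒬) + ∑ j, p j * p j = g * g * d := by
      rw [this]; simp only [d]; linear_combination (- (1 + h * g)) * hg
    simp only [F]; rw [h2]; linear_combination (g * g) * ed
  have Dg : ∀ τ, dQ 𝒬 τ g = (1/2:ℝ) • (h * dQ 𝒬 τ F) := fun τ ↦ by
    have h1 := dQ_mul τ g g
    rw [← Fg] at h1
    rw [h1, show dQ 𝒬 τ g * g + g * dQ 𝒬 τ g = (2:ℝ) • (g * dQ 𝒬 τ g) by rw [two_smul]; ring, mul_smul_comm, smul_smul]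
    norm_num
    linear_combination (- dQ 𝒬 τ g) * hg
  have Dh : ∀ τ, dQ 𝒬 τ h = -(h * h * dQ 𝒬 τ g) := fun τ ↦ by
    have h1 := dQ_mul τ h g
    rw [hg, dQ_one] at h1
    linear_combination (-h) * h1 - dQ 𝒬 τ h * hg
  have gb : g ∈ LB N r := fun ρ _ ↦ ⟨1 + M, fun y _ ↦ (abs_add_le _ _).trans (by
    show |(1:ℝ)| + |c y| ≤ _
    rw [abs_one]; linarith [D.bc y])⟩
  have hb : h ∈ LB N r := fun ρ _ ↦ ⟨1 + M, fun y _ ↦ (abs_add_le _ _).trans (by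
    show |(1:ℝ)| + |b y| ≤ _
    rw [abs_one]; linarith [D.bb y])⟩
  have ghT : ∀ k, g ∈ opk (LB N r) S k ∧ h ∈ opk (LB N r) S k := fun k ↦ by
    induction k with
    | zero => exact ⟨gb, hb⟩
    | succ k ih =>
      have hh : ∀ i ∈ S, dQ 𝒬 (eb i) g ∈ opk (LB N r) S k := fun i hi ↦ by
        rw [Dg]; exact Subalgebra.smul_mem _ (mul_mem ih.2 (opl_iff.1 (opl_D FT hi) k)) _
      refine ⟨⟨ih.1, hh⟩, ⟨ih.2, fun i hi ↦ ?_⟩⟩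
      rw [Dh]; exact neg_mem (mul_mem (mul_mem ih.2 ih.2) (hh i hi))
  have gT : g ∈ T := opl_iff.2 fun k ↦ (ghT k).1
  have hT : h ∈ T := opl_iff.2 fun k ↦ (ghT k).2
  have ap : ∀ j, aS j = -(p j * h) := fun j ↦ by
    simp only [p]; linear_combination (-aS j) * hg
  have aT : ∀ j, aS j ∈ T := fun j ↦ by rw [ap]; exact neg_mem (mul_mem (pT j) hT)
  have EXT : EX T := EX_opl EX_LB
  have vT : vS ∈ T := opl_iff.2 fun k ↦ by
    induction k with
    | zero => exact fun ρ _ ↦ ⟨M, fun y _ ↦ D.bv y⟩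
    | succ k ih =>
      refine ⟨ih, ?_⟩
      rintro _ ⟨j, rfl⟩
      exact opl_iff.1 (EXT _ _ (rv j) (pT j)) k
  set Hn := dQ 𝒬 (eb ℓ) HS
  have Hc : ∀ i, dQ 𝒬 (eb i) Hn = 0 := fun i ↦ by
    rw [← dQ_const (eb i) (2 * σ * (eb ℓ : Yn N) ℓ)]
    exact dQ_ext fun y hy ↦ rH0 _ y hy
  have HT : Hn ∈ T := opl_const (EX_LB _ _ (fun y hy ↦ (rH0 (eb ℓ) y hy).symm) ((LB N r).algebraMap_mem _)) Hc
  let W := opl T {Fin.last N}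
  have WT : ∀ k, ∀ j : Fin N, ∀ f ∈ opk T {Fin.last N} k, dQ 𝒬 (eb j.castSucc) f ∈ opk T {Fin.last N} k := fun k j ↦
    opl_D' (fun f hf ↦ opl_D hf (mem_range_self j)) k
  let n := eb (N := N) ℓ
  have Da : ∀ j, dQ 𝒬 n (aS j) = -(h * dQ 𝒬 (eb j.castSucc) g) - p j * dQ 𝒬 n h := fun j ↦ by
    rw [ap, map_neg, dQ_mul, rp]; ring
  have D2 : dQ 𝒬 n d = Hn - (2:ℝ) • ∑ j : Fin N, dQ 𝒬 (eb j.castSucc) (aS j) := by rw [Dd, rB]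
  have Dn : dQ 𝒬 n h = h * e * ((1/2:ℝ) • Hn + h * ∑ j, aS j * dQ 𝒬 (eb j.castSucc) g - ∑ j : Fin N, dQ 𝒬 (eb j.castSucc) (aS j)) := by
    have e1 : dQ 𝒬 n d = (2:ℝ) • (∑ j, aS j * dQ 𝒬 n (aS j) + h * dQ 𝒬 n h) := by
      simp only [d]; rw [map_add, map_sum, dQ_mul, smul_add, Finset.smul_sum, two_smul]
      congr 1
      · exact Finset.sum_congr rfl fun j _ ↦ by rw [dQ_mul, two_smul]; ring
      · ring
    have e2 : ∑ j, aS j * dQ 𝒬 n (aS j) = -(h * ∑ j, aS j * dQ 𝒬 (eb j.castSucc) g) + g * dQ 𝒬 n h * ∑ j, aS j * aS j := by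
      rw [Finset.mul_sum, Finset.mul_sum, ← Finset.sum_neg_distrib, ← Finset.sum_add_distrib]
      exact Finset.sum_congr rfl fun j _ ↦ by rw [Da]; simp only [p]; ring
    have e3 : (1/2:ℝ) • dQ 𝒬 n d = ∑ j, aS j * dQ 𝒬 n (aS j) + h * dQ 𝒬 n h := by rw [e1, smul_smul]; norm_num
    have e4 : (1/2:ℝ) • dQ 𝒬 n d = (1/2:ℝ) • Hn - ∑ j : Fin N, dQ 𝒬 (eb j.castSucc) (aS j) := by
      rw [D2, smul_sub, smul_smul]; norm_num
    set X := dQ 𝒬 n h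
    rw [e4, e2] at e3
    linear_combination (-h * e) * e3 - (X * h * g) * ed - X * hg + h * h * e * X * hg
  have all : ∀ k, (∀ j, p j ∈ opk T {Fin.last N} k) ∧ g ∈ opk T {Fin.last N} k ∧ h ∈ opk T {Fin.last N} k ∧ e ∈ opk T {Fin.last N} k := fun k ↦ by
    induction k with
    | zero => exact ⟨pT, gT, hT, eT⟩
    | succ k ih =>
      obtain ⟨h1, h2, h3, h4⟩ := ih
      have h5 : ∀ j, aS j ∈ opk T {Fin.last N} k := fun j ↦ by rw [ap]; exact neg_mem (mul_mem (h1 j) h3)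
      have h6 : Hn ∈ opk T {Fin.last N} k := opl_iff.1 (opl_const HT Hc) k
      have h7 : ∑ j : Fin N, dQ 𝒬 (eb j.castSucc) (aS j) ∈ opk T {Fin.last N} k := sum_mem fun j _ ↦ WT k j _ (h5 j)
      have h8 : dQ 𝒬 n h ∈ opk T {Fin.last N} k := by
        rw [Dn]
        exact mul_mem (mul_mem h3 h4) (sub_mem (add_mem (Subalgebra.smul_mem _ h6 _) (mul_mem h3 (sum_mem fun j _ ↦ mul_mem (h5 j) (WT k j _ h2)))) h7)
      refine ⟨fun j ↦ ⟨h1 j, ?_⟩, ⟨h2, ?_⟩, ⟨h3, ?_⟩, ⟨h4, ?_⟩⟩ <;> rintro _ rfl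
      · rw [rp]; exact WT k j _ h2
      · have : dQ 𝒬 n g = -(g * g * dQ 𝒬 n h) := by
          rw [Dh]; linear_combination (-(1 + h * g) * dQ 𝒬 n g) * hg
        change dQ 𝒬 n g ∈ _
        rw [this]; exact neg_mem (mul_mem (mul_mem h2 h2) h8)
      · exact h8
      · change dQ 𝒬 n e ∈ _
        rw [De, D2]; exact neg_mem (mul_mem (mul_mem h4 h4) (sub_mem h6 (Subalgebra.smul_mem _ h7 _)))
  have EXW := fun k ↦ EX_opk (S := {Fin.last N}) EXT k
  refine ⟨W, opl_iff.2 fun k ↦ ?_, fun f hf ↦ opl_iff.1 (opl_iff.1 hf 0) 0, fun f hf i ↦ ?_⟩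
  · induction k with
    | zero => exact vT
    | succ k ih =>
      refine ⟨ih, ?_⟩
      rintro _ rfl
      exact EXW k _ _ rvn (all k).2.1
  · induction i using Fin.lastCases with
    | last => exact opl_D hf rfl
    | cast j => exact opl_iff.2 fun k ↦ WT k j f (opl_iff.1 hf k)
end

noncomputable def tq (m : ℤ) : ℝ := (64:ℝ) ^ m
noncomputable def aq (m : ℤ) : ℝ := (-1:ℝ) ^ m * (8:ℝ) ^ (-(m * (m + 1)))

lemma tq_pos (m : ℤ) : 0 < tq m := zpow_pos (by norm_num) m

lemma tq_pow (m : ℤ) (j : ℕ) : tq m ^ j = (8:ℝ) ^ (2 * m * j) := by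
  unfold tq
  rw [show (64:ℝ) = 8 ^ (2:ℤ) by norm_num, ← zpow_mul, ← zpow_natCast, ← zpow_mul]

lemma aq_sum (j : ℕ) : Summable fun m ↦ |aq m| * tq m ^ j := by
  have hs : Summable fun m : ℤ ↦ (8:ℝ) ^ (((j:ℤ) + 1) ^ 2) * (8:ℝ) ^ (-|m|) := by
    refine Summable.mul_left _ (Summable.of_nat_of_neg ?_ ?_) <;>
    · have : ∀ n : ℕ, (8:ℝ) ^ (-(n:ℤ)) = (1/8) ^ n := fun n ↦ by rw [zpow_neg, zpow_natCast, one_div, inv_pow]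
      simp only [abs_neg, Nat.abs_cast, this]
      exact summable_geometric_of_lt_one (by norm_num) (by norm_num)
  refine Summable.of_nonneg_of_le (fun m ↦ mul_nonneg (abs_nonneg _) (pow_nonneg (tq_pos m).le _)) (fun m ↦ ?_) hs
  unfold aq
  rw [abs_mul, abs_zpow, abs_neg, abs_one, one_zpow, one_mul, abs_of_pos (zpow_pos (by norm_num) _), tq_pow, ← zpow_add₀ (by norm_num), ← zpow_add₀ (by norm_num)]
  apply zpow_le_zpow_right₀ (by norm_num)
  rcases abs_cases m with ⟨h, _⟩ | ⟨h, _⟩ <;> rw [h]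
  · nlinarith [sq_nonneg (m - (j:ℤ))]
  · nlinarith [sq_nonneg (m - (j:ℤ)+1), sq_nonneg (m - (j:ℤ)), Nat.cast_nonneg (α := ℤ) j]

lemma aq_zero (j : ℕ) : ∑' m, aq m * tq m ^ j = 0 := by
  have h := (Equiv.subLeft (2 * (j:ℤ) - 1)).tsum_eq fun m ↦ aq m * tq m ^ j
  have e : ∀ m : ℤ, aq (Equiv.subLeft (2 * (j:ℤ) - 1) m) * tq (Equiv.subLeft (2 * (j:ℤ) - 1) m) ^ j = -(aq m * tq m ^ j) := fun m ↦ by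
    simp only [Equiv.subLeft_apply, aq, tq_pow]
    rw [mul_assoc (_ ^ _), mul_assoc ((-1:ℝ) ^ m), ← zpow_add₀ (by norm_num), ← zpow_add₀ (by norm_num), ← neg_mul]
    have h1 : (-1:ℝ) ^ (2 * (j:ℤ) - 1 - m) = -(-1) ^ m := by
      rw [show 2 * (j:ℤ) - 1 - m = 2 * (j - m - 1) + (m + 1) by ring, zpow_add₀ (by norm_num), zpow_mul, zpow_add₀ (by norm_num)]
      norm_num
    rw [h1]; ring_nf
  simp only [e, tsum_neg] at h
  linarith

lemma refl_coeff : ∃ β t : ℤ → ℝ, (∀ m, 0 < t m) ∧ (∀ j : ℕ, Summable fun m ↦ |β m| * t m ^ j) ∧ ∀ j : ℕ, ∑' m, β m * (-t m) ^ j = 1 := by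
  have t1 : ∀ m, 1 < 1 + tq m := fun m ↦ by linarith [tq_pos m]
  have le1 : ∀ m, |aq m / (1 + tq m)| ≤ |aq m| := fun m ↦ by
    rw [abs_div, abs_of_pos (zero_lt_one.trans (t1 m))]; exact div_le_self (abs_nonneg _) (t1 m).le
  have sa : ∀ j : ℕ, Summable fun m ↦ |aq m / (1 + tq m)| * tq m ^ j := fun j ↦
    Summable.of_nonneg_of_le (fun m ↦ mul_nonneg (abs_nonneg _) (pow_nonneg (tq_pos m).le _))
      (fun m ↦ mul_le_mul_of_nonneg_right (le1 m) (pow_nonneg (tq_pos m).le _)) (aq_sum j)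
  have sb : ∀ j : ℕ, Summable fun m ↦ aq m / (1 + tq m) * tq m ^ j := fun j ↦ by
    refine Summable.of_norm ((sa j).congr fun m ↦ ?_)
    rw [norm_mul, Real.norm_eq_abs, Real.norm_eq_abs, abs_of_pos (pow_pos (tq_pos m) j)]
  set s : ℕ → ℝ := fun j ↦ ∑' m, aq m / (1 + tq m) * tq m ^ j with hs
  have recc : ∀ j, s (j+1) = - s j := fun j ↦ by
    rw [eq_neg_iff_add_eq_zero, hs]
    simp only
    rw [← (sb (j+1)).tsum_add (sb j), ← aq_zero j]
    refine tsum_congr fun m ↦ ?_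
    have := (zero_lt_one.trans (t1 m)).ne'
    field_simp; ring
  have sj : ∀ j, s j = (-1) ^ j * s 0 := fun j ↦ by
    induction j with
    | zero => simp
    | succ j ih => rw [recc, ih, pow_succ]; ring
  have s0 : s 0 < 0 := by
    set f : ℤ → ℝ := fun m ↦ aq m / (1 + tq m) * tq m ^ 0
    have hf : Summable f := sb 0
    have e : s 0 = ∑' n : ℕ, (f n + f (-(n + 1))) := by
      have h1 := hf.comp_injective (f := f) (i := fun n : ℕ ↦ (n:ℤ)) Nat.cast_injective
      have h2 := hf.comp_injective (f := f) (i := fun n : ℕ ↦ -((n:ℤ) + 1)) (fun a b h ↦ by simpa using h)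
      exact (tsum_of_nat_of_neg_add_one h1 h2).trans (h1.tsum_add h2).symm
    have bd : ∀ n : ℕ, |f (n+1 : ℕ) + f (-((n+1 : ℕ) + 1))| ≤ (1/8) * (1/8:ℝ) ^ n := fun n ↦ by
      set A : ℝ := 8 ^ (-(((n:ℤ)+1) * ((n:ℤ) + 2)))
      have hA : A ≤ (1/8) * (1/8:ℝ) ^ n := by
        rw [← pow_succ', one_div, inv_pow, ← zpow_natCast, ← zpow_neg]
        apply zpow_le_zpow_right₀ (by norm_num); push_cast; nlinarith
      have hA0 : 0 < A := zpow_pos (by norm_num) _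
      have key : ∀ x y : ℝ, 0 < x → 0 < y → |1 / (1 + x) - 1 / (1 + y)| ≤ 1 := fun x y hx hy ↦ by
        have h1 : 0 < 1 / (1 + x) := by positivity
        have h2 : 0 < 1 / (1 + y) := by positivity
        have h3 : 1 / (1 + x) ≤ 1 := by rw [div_le_one (by linarith)]; linarith
        have h4 : 1 / (1 + y) ≤ 1 := by rw [div_le_one (by linarith)]; linarith
        rw [abs_le]; constructor <;> linarith
      have e1 : aq (n+1 : ℕ) = (-1) ^ (n+1) * A := by
        unfold aq; rw [zpow_natCast]; congr 2
      have e2 : aq (-((n+1 : ℕ) + 1)) = -((-1) ^ (n+1) * A) := by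
        unfold aq
        rw [zpow_neg, ← inv_zpow, show ((-1:ℝ))⁻¹ = -1 by norm_num, ← neg_mul]
        rw [zpow_add₀ (by norm_num), zpow_natCast, zpow_one, mul_neg_one]
        simp only [A]; push_cast; ring_nf
      have : f (n+1 : ℕ) + f (-((n+1 : ℕ) + 1)) = (-1) ^ (n+1) * A * (1 / (1 + tq (n+1 : ℕ)) - 1 / (1 + tq (-((n+1 : ℕ) + 1)))) := by
        simp only [f, e1, e2]; ring
      rw [this, abs_mul, abs_mul, abs_pow, abs_neg, abs_one, one_pow, one_mul, abs_of_pos hA0]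
      exact (mul_le_of_le_one_right hA0.le (key _ _ (tq_pos _) (tq_pos _))).trans hA
    have gs : HasSum (fun n : ℕ ↦ (1/8) * (1/8:ℝ) ^ n) ((1/8) * (1 - 1/8)⁻¹) :=
      (hasSum_geometric_of_lt_one (by norm_num) (by norm_num)).mul_left _
    have sm : Summable fun n : ℕ ↦ f (n+1 : ℕ) + f (-((n+1 : ℕ) + 1)) := Summable.of_norm_bounded gs.summable bd
    have sm' : Summable fun n : ℕ ↦ f n + f (-(n + 1)) := (summable_nat_add_iff (f := fun n : ℕ ↦ f n + f (-((n:ℤ) + 1))) 1).1 sm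
    have le := tsum_of_norm_bounded (f := fun n : ℕ ↦ f (n+1 : ℕ) + f (-((n+1 : ℕ) + 1))) gs bd
    rw [e, sm'.tsum_eq_zero_add]
    have h0 : f ((0:ℕ):ℤ) + f (-(((0:ℕ):ℤ) + 1)) = -63/130 := by
      simp [f, aq, tq]; norm_num
    rw [h0]
    have := (abs_le.1 le).2
    norm_num at this ⊢
    linarith
  refine ⟨fun m ↦ (s 0)⁻¹ * (aq m / (1 + tq m)), tq, tq_pos, fun j ↦ ?_, fun j ↦ ?_⟩
  · refine ((sa j).mul_left |(s 0)⁻¹|).congr fun m ↦ ?_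
    rw [abs_mul]; ring
  · have : ∀ m, (s 0)⁻¹ * (aq m / (1 + tq m)) * (-tq m) ^ j = ((s 0)⁻¹ * (-1) ^ j) * (aq m / (1 + tq m) * tq m ^ j) := fun m ↦ by
      rw [neg_pow]; ring
    simp only [this]
    rw [tsum_mul_left]
    change (s 0)⁻¹ * (-1) ^ j * s j = 1
    rw [sj j]
    have h1 : ((-1:ℝ) ^ j) * (-1) ^ j = 1 := by rw [← mul_pow]; norm_num
    linear_combination (s 0)⁻¹ * s 0 * h1 + inv_mul_cancel₀ s0.ne

section
variable {N : ℕ}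

noncomputable def prj (i : Fin (N+1)) : Yn N →L[ℝ] ℝ := ContinuousLinearMap.proj i

lemma prj_ap (i : Fin (N+1)) (y : Yn N) : prj i y = y i := rfl

noncomputable def Lr (s : ℝ) : Yn N →L[ℝ] Yn N :=
  ContinuousLinearMap.id ℝ _ - (s+1) • (prj ℓ).smulRight (eb ℓ)

lemma Lr_last (s : ℝ) (y : Yn N) : Lr s y ℓ = - s * y ℓ := by
  simp [Lr, eb, prj_ap]; ring
lemma Lr_ne (s : ℝ) (y : Yn N) {i : Fin (N+1)} (hi : i ≠ Fin.last N) : Lr s y i = y i := by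
  simp [Lr, eb, prj_ap, Pi.single_apply, hi]
lemma Lr_zero (s : ℝ) {y : Yn N} (h : y ℓ = 0) : Lr s y = y := by
  simp [Lr, prj_ap, h]

noncomputable def Sr (β t : ℤ → ℝ) (j : ℕ) (g : Yn N → ℝ) (y : Yn N) : ℝ := ∑' m, β m * (-t m) ^ j * g (Lr (t m) y)

noncomputable def Er (β t : ℤ → ℝ) (j : ℕ) (g : Yn N → ℝ) (y : Yn N) : ℝ :=
  if 0 ≤ y ℓ then g y else Sr β t j g y

variable {β t : ℤ → ℝ}

lemma Sr_sum (ht : ∀ m, 0 < t m) (hs : ∀ j : ℕ, Summable fun m ↦ |β m| * t m ^ j) {g : Yn N → ℝ} {M : ℝ}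
    (hM : ∀ y, |g y| ≤ M) (j : ℕ) (y : Yn N) : HasSum (fun m ↦ β m * (-t m) ^ j * g (Lr (t m) y)) (Sr β t j g y) := by
  refine Summable.hasSum (Summable.of_norm_bounded ((hs j).mul_right M) fun m ↦ ?_)
  rw [norm_mul, norm_mul, norm_pow, norm_neg, Real.norm_eq_abs, Real.norm_eq_abs, Real.norm_eq_abs, abs_of_pos (ht m)]
  exact mul_le_mul_of_nonneg_left (hM _) (by have := ht m; positivity)

lemma Sr_cont (ht : ∀ m, 0 < t m) (hs : ∀ j : ℕ, Summable fun m ↦ |β m| * t m ^ j) {g : Yn N → ℝ} {M : ℝ} (cg : Continuous g)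
    (hM : ∀ y, |g y| ≤ M) (j : ℕ) : Continuous (Sr β t j g) := by
  refine continuous_tsum (fun m ↦ ?_) ((hs j).mul_right M) fun m y ↦ ?_
  · exact continuous_const.mul (cg.comp (Lr (t m)).continuous)
  rw [norm_mul, norm_mul, norm_pow, norm_neg, Real.norm_eq_abs, Real.norm_eq_abs, Real.norm_eq_abs, abs_of_pos (ht m)]
  exact mul_le_mul_of_nonneg_left (hM _) (by have := ht m; positivity)

lemma Sr_zero (h1 : ∀ j : ℕ, ∑' m, β m * (-t m) ^ j = 1) (g : Yn N → ℝ) (j : ℕ) {y : Yn N} (hy : y ℓ = 0) :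
    Sr β t j g y = g y := by
  unfold Sr; simp_rw [Lr_zero _ hy]; rw [tsum_mul_right, h1, one_mul]

lemma Er_cont (ht : ∀ m, 0 < t m) (hs : ∀ j : ℕ, Summable fun m ↦ |β m| * t m ^ j) (h1 : ∀ j : ℕ, ∑' m, β m * (-t m) ^ j = 1)
    {g : Yn N → ℝ} {M : ℝ} (cg : Continuous g) (hM : ∀ y, |g y| ≤ M) (j : ℕ) : Continuous (Er β t j g) :=
  Continuous.if_le cg (Sr_cont ht hs cg hM j) continuous_const (continuous_apply _) fun y hy ↦ (Sr_zero h1 g j hy.symm).symm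

lemma prj_Lr (i : Fin (N+1)) (s : ℝ) : (prj i).comp (Lr s) = (-s) ^ (if i = Fin.last N then 1 else 0) • prj i := by
  ext y
  show Lr s y i = _
  by_cases h : i = Fin.last N
  · subst h; simp [Lr_last, prj_ap]
  · simp [Lr_ne _ _ h, h, prj_ap]

lemma Er_der (ht : ∀ m, 0 < t m) (hs : ∀ j : ℕ, Summable fun m ↦ |β m| * t m ^ j) (h1 : ∀ j : ℕ, ∑' m, β m * (-t m) ^ j = 1)
    {g : Yn N → ℝ} {G : Fin (N+1) → Yn N → ℝ} (cg : Continuous g) (hg : ∃ M, ∀ y, |g y| ≤ M)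
    (cG : ∀ i, Continuous (G i)) (hG : ∃ M, ∀ i y, |G i y| ≤ M)
    (hd : ∀ y : Yn N, 0 < y ℓ → HasFDerivAt g (∑ i, G i y • prj i) y) (j : ℕ) (y : Yn N) :
    HasFDerivAt (Er β t j g) (∑ i, Er β t (j + if i = Fin.last N then 1 else 0) (G i) y • prj i) y := by
  obtain ⟨M, hM⟩ := hg
  obtain ⟨M', hM'⟩ := hG
  have hM0 : 0 ≤ M' := (abs_nonneg _).trans (hM' 0 0)
  have cl : Continuous fun y : Yn N ↦ y ℓ := continuous_apply _
  have cE := Er_cont ht hs h1 cg hM j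
  have cD : Continuous fun y ↦ ∑ i, Er β t (j + if i = Fin.last N then 1 else 0) (G i) y • (prj i : Yn N →L[ℝ] ℝ) :=
    continuous_finsetSum _ fun i _ ↦ (Er_cont ht hs h1 (cG i) (hM' i) _).smul continuous_const
  have op : IsOpen {y : Yn N | 0 < y ℓ} := isOpen_lt continuous_const cl
  have on : IsOpen {y : Yn N | y ℓ < 0} := isOpen_lt cl continuous_const
  have xp : Convex ℝ {y : Yn N | 0 < y ℓ} := convex_halfSpace_gt (prj ℓ).isLinear 0
  have xn' : Convex ℝ {y : Yn N | y ℓ < 0} := convex_halfSpace_lt (prj ℓ).isLinear 0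
  have pos : ∀ y : Yn N, 0 < y ℓ →
      HasFDerivAt (Er β t j g) (∑ i, Er β t (j + if i = Fin.last N then 1 else 0) (G i) y • prj i) y := fun y hy ↦ by
    have : ∀ i, Er β t (j + if i = Fin.last N then 1 else 0) (G i) y = G i y := fun i ↦ if_pos hy.le
    simp_rw [this]
    refine (hd y hy).congr_of_eventuallyEq ?_
    filter_upwards [op.mem_nhds hy] with z hz using if_pos (le_of_lt hz)
  have neg : ∀ y : Yn N, y ℓ < 0 →
      HasFDerivAt (Er β t j g) (∑ i, Er β t (j + if i = Fin.last N then 1 else 0) (G i) y • prj i) y := fun y hy ↦ by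
    have : ∀ i, Er β t (j + if i = Fin.last N then 1 else 0) (G i) y = Sr β t (j + if i = Fin.last N then 1 else 0) (G i) y := fun i ↦ if_neg hy.not_ge
    simp_rw [this]
    have e : Er β t j g =ᶠ[nhds y] Sr β t j g := by
      filter_upwards [on.mem_nhds hy] with z hz using if_neg (not_le.2 hz)
    refine HasFDerivAt.congr_of_eventuallyEq ?_ e
    have hsm : ∀ y, HasSum (fun m ↦ ∑ i, (β m * (-t m) ^ (j + if i = Fin.last N then 1 else 0) * G i (Lr (t m) y)) • (prj i : Yn N →L[ℝ] ℝ))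
        (∑ i, Sr β t (j + if i = Fin.last N then 1 else 0) (G i) y • prj i) := fun y ↦
      hasSum_sum fun i _ ↦ (Sr_sum ht hs (hM' i) _ y).smul_const _
    rw [← (hsm y).tsum_eq]
    refine hasFDerivAt_tsum_of_isPreconnected (𝕜 := ℝ) (u := fun m ↦ ∑ i : Fin (N+1), |β m| * t m ^ (j + if i = Fin.last N then 1 else 0) * M' * ‖(prj i : Yn N →L[ℝ] ℝ)‖)
      ?_ on xn'.isPreconnected (f := fun m y ↦ β m * (-t m) ^ j * g (Lr (t m) y))
      (f' := fun m y ↦ ∑ i, (β m * (-t m) ^ (j + if i = Fin.last N then 1 else 0) * G i (Lr (t m) y)) • (prj i : Yn N →L[ℝ] ℝ)) (fun m z hz ↦ ?_) (fun m z hz ↦ ?_) hy (Sr_sum ht hs hM j y).summable hy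
    · exact summable_sum fun i _ ↦ ((hs _).mul_right M').mul_right _
    · have hz' : 0 < Lr (t m) z ℓ := by
        rw [Lr_last]; have := ht m; have hz : z ℓ < 0 := hz; nlinarith
      have := ((hd _ hz').comp z (Lr (t m)).hasFDerivAt).const_mul (β m * (-t m) ^ j)
      refine HasFDerivAt.congr_fderiv this ?_
      rw [ContinuousLinearMap.finsetSum_comp, Finset.smul_sum]
      refine Finset.sum_congr rfl fun i _ ↦ ?_
      rw [ContinuousLinearMap.smul_comp, prj_Lr, smul_smul, smul_smul]
      congr 1; rw [pow_add]; ring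
    · refine (norm_sum_le _ _).trans (Finset.sum_le_sum fun i _ ↦ ?_)
      rw [norm_smul, norm_mul, norm_mul, norm_pow, norm_neg, Real.norm_eq_abs, Real.norm_eq_abs, Real.norm_eq_abs, abs_of_pos (ht m)]
      refine mul_le_mul_of_nonneg_right (mul_le_mul_of_nonneg_left (hM' i _) (by have := ht m; positivity)) (norm_nonneg _)
  rcases lt_trichotomy (y ℓ) 0 with h | h | h
  · exact neg y h
  · have cln : y ∈ closure {y : Yn N | y ℓ < 0} := by
      refine mem_closure_of_tendsto (f := fun s : ℝ ↦ y + s • eb ℓ) (b := nhdsWithin 0 (Iio 0)) ?_ ?_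
      · have : Filter.Tendsto (fun s : ℝ ↦ y + s • (eb ℓ : Yn N)) (nhds 0) (nhds (y + (0:ℝ) • eb ℓ)) := Continuous.tendsto (by fun_prop) 0
        rw [zero_smul, add_zero] at this
        exact this.mono_left nhdsWithin_le_nhds
      · filter_upwards [self_mem_nhdsWithin] with s hs
        show _ < 0; simpa [eb, h] using hs
    have A := hasFDerivWithinAt_closure_of_tendsto_fderiv (s := {y : Yn N | 0 < y ℓ}) (x := y) (fun z hz ↦ (pos z hz).differentiableAt.differentiableWithinAt) xp op
      (fun z _ ↦ cE.continuousWithinAt) (f' := ∑ i, Er β t (j + if i = Fin.last N then 1 else 0) (G i) y • prj i) (by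
        refine Filter.Tendsto.congr' ?_ ((cD.tendsto y).mono_left nhdsWithin_le_nhds)
        filter_upwards [self_mem_nhdsWithin] with z hz using (pos z hz).fderiv.symm)
    have B := hasFDerivWithinAt_closure_of_tendsto_fderiv (s := {y : Yn N | y ℓ < 0}) (x := y) (fun z hz ↦ (neg z hz).differentiableAt.differentiableWithinAt) xn' on
      (fun z _ ↦ cE.continuousWithinAt) (f' := ∑ i, Er β t (j + if i = Fin.last N then 1 else 0) (G i) y • prj i) (by
        refine Filter.Tendsto.congr' ?_ ((cD.tendsto y).mono_left nhdsWithin_le_nhds)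
        filter_upwards [self_mem_nhdsWithin] with z hz using (neg z hz).fderiv.symm)
    have C := A.union B
    have : closure {y : Yn N | 0 < y ℓ} ∪ closure {y : Yn N | y ℓ < 0} = univ := by
      refine eq_univ_of_forall fun z ↦ ?_
      have cz : ∀ z : Yn N, z ℓ = 0 → z ∈ closure {y : Yn N | 0 < y ℓ} := fun z h ↦ by
        refine mem_closure_of_tendsto (f := fun s : ℝ ↦ z + s • eb ℓ) (b := nhdsWithin 0 (Ioi 0)) ?_ ?_
        · have : Filter.Tendsto (fun s : ℝ ↦ z + s • (eb ℓ : Yn N)) (nhds 0) (nhds (z + (0:ℝ) • eb ℓ)) := Continuous.tendsto (by fun_prop) 0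
          rw [zero_smul, add_zero] at this
          exact this.mono_left nhdsWithin_le_nhds
        · filter_upwards [self_mem_nhdsWithin] with s hs
          show 0 < _; simpa [eb, h] using hs
      rcases lt_trichotomy (z ℓ) 0 with h | h | h
      · exact Or.inr (subset_closure h)
      · exact Or.inl (cz z h)
      · exact Or.inl (subset_closure h)
    rw [this] at C
    exact hasFDerivWithinAt_univ.1 C
  · exact pos y h

/-- family extension -/
lemma fam_ext {ι : Type*} (F : ι → Yn N → ℝ) (d : Fin (N+1) → ι → ι) (cF : ∀ a, Continuous (F a)) (bF : ∀ a, ∃ M, ∀ y, |F a y| ≤ M)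
    (hd : ∀ a, ∀ y : Yn N, 0 < y ℓ → HasFDerivAt (F a) (∑ i, F (d i a) y • prj i) y) (a : ι) :
    ∃ V : Yn N → ℝ, ContDiff ℝ ⊤∞ V ∧ ∀ y, 0 ≤ y ℓ → V y = F a y := by
  obtain ⟨β, t, ht, hs, h1⟩ := refl_coeff
  refine ⟨Er β t 0 (F a), contDiff_infty.2 fun k ↦ ?_, fun y hy ↦ if_pos hy⟩
  have : ∀ k : ℕ, ∀ j a, ContDiff ℝ k (Er β t j (F a)) := by
    intro k
    induction k with
    | zero => intro j a; obtain ⟨M, hM⟩ := bF a; exact contDiff_zero.2 (Er_cont ht hs h1 (cF a) hM j)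
    | succ k ih =>
      intro j a
      push_cast
      refine contDiff_succ_iff_hasFDerivAt.2 ⟨_, ?_, Er_der ht hs h1 (cF a) (bF a) (G := fun i ↦ F (d i a)) (fun i ↦ cF _) ?_ (hd a) j⟩
      · exact ContDiff.sum fun i _ ↦ (ih _ _).smul contDiff_const
      · choose M hM using fun i ↦ bF (d i a)
        exact ⟨∑ i, |M i|, fun i y ↦ (hM i y).trans ((le_abs_self _).trans (Finset.single_le_sum (f := fun i ↦ |M i|) (fun _ _ ↦ abs_nonneg _) (Finset.mem_univ i)))⟩
  exact this k 0 a
end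

section
variable {N : ℕ} {r : ℝ}
local notation "𝒬" => QO N r

lemma clm_sum (L : Yn N →L[ℝ] ℝ) : L = ∑ i, L (eb i) • prj i := by
  ext x
  have : x = ∑ i, x i • (eb i : Yn N) := by
    ext j; simp [eb, Finset.sum_apply, Pi.single_apply]
  conv_lhs => rw [this, map_sum]
  simp [prj_ap, mul_comm]

lemma prj_norm (i : Fin (N+1)) : ‖(prj i : Yn N →L[ℝ] ℝ)‖ ≤ 1 :=
  ContinuousLinearMap.opNorm_le_bound _ zero_le_one fun x ↦ by rw [one_mul]; exact norm_le_pi_norm x i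

lemma smooth_opl (χ : Yn N → ℝ) (hχ : ContDiff ℝ ⊤∞ χ) : (⟨χ, hχ.contDiffOn⟩ : SA 𝒬) ∈ opl (LB N r) univ := by
  refine opl_iff.2 fun k ↦ ?_
  induction k generalizing χ with
  | zero =>
    intro ρ _
    obtain ⟨C, hC⟩ := (isCompact_closedBall (𝟎 N) ρ).exists_bound_of_continuousOn hχ.continuous.continuousOn
    exact ⟨C, fun y hy ↦ hC y (by rw [mem_closedBall_zero_iff]; exact hy.1.le)⟩
  | succ k ih =>
    refine ⟨ih χ hχ, fun i _ ↦ ?_⟩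
    have c : ContDiff ℝ ⊤∞ (fun y ↦ fderiv ℝ χ y (eb i)) := (hχ.fderiv_right (by simp)).clm_apply contDiff_const
    exact EX_opk EX_LB k _ _ (fun y hy ↦ (dQ_in (eb i) ⟨χ, hχ.contDiffOn⟩ hy).symm) (ih _ c)

lemma words_ext {v : Yn N → ℝ} (sv : ContDiffOn ℝ ⊤∞ v (Qb N r)) {W : Subalgebra ℝ (SA 𝒬)}
    (hv : (⟨v, sv⟩ : SA 𝒬) ∈ W) (hW : ∀ f ∈ W, f ∈ LB N r) (hD : ∀ f ∈ W, ∀ i, dQ 𝒬 (eb i) f ∈ W)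
    {ρ : ℝ} (h0 : 0 < ρ) (hρ : ρ < r) : ∃ V : Yn N → ℝ, ContDiff ℝ ⊤∞ V ∧ ∀ y, ‖y‖ < ρ → 0 < y ℓ → V y = v y := by
  classical
  obtain ⟨ρ', h1, h2⟩ := exists_between hρ
  let bf : ContDiffBump (𝟎 N) := ⟨ρ, ρ', h0, h1⟩
  have cb : ContDiff ℝ ⊤∞ (bf : Yn N → ℝ) := bf.contDiff
  have op : IsOpen {y : Yn N | 0 < y ℓ} := isOpen_lt continuous_const (continuous_apply _)
  have xp : Convex ℝ {y : Yn N | 0 < y ℓ} := convex_halfSpace_gt (prj ℓ).isLinear 0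
  have Wo : ∀ f ∈ W, f ∈ opl (LB N r) univ := fun f hf ↦ opl_iff.2 fun k ↦ by
    induction k generalizing f with
    | zero => exact hW f hf
    | succ k ih => exact ⟨ih f hf, fun i _ ↦ ih _ (hD f hf i)⟩
  let ι := {w : SA 𝒬 // (∀ y ∈ QO N r, ρ' < ‖y‖ → w.1 y = 0) ∧ w ∈ opl (LB N r) univ}
  let d : Fin (N+1) → ι → ι := fun i w ↦ ⟨dQ 𝒬 (eb i) w.1, fun y hy hy' ↦ by
    rw [dQ_in _ _ hy]
    have : w.1.1 =ᶠ[nhds y] fun _ ↦ 0 := by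
      filter_upwards [(QO N r).isOpen.mem_nhds hy, (isOpen_lt continuous_const continuous_norm).mem_nhds hy'] with z hz hz' using w.2.1 z hz hz'
    rw [this.fderiv_eq]; simp, opl_D w.2.2 (mem_univ i)⟩
  let F0 : ι → Yn N → ℝ := fun w ↦ (Qb N r).indicator w.1.1
  have F0z : ∀ w : ι, ∀ y : Yn N, 0 < y ℓ → ρ' < ‖y‖ → F0 w y = 0 := fun w y hy hy' ↦ by
    by_cases h : y ∈ Qb N r
    · exact (indicator_of_mem h _).trans (w.2.1 y h hy')
    · exact indicator_of_notMem h _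
  have F0d : ∀ w : ι, ∀ y : Yn N, 0 < y ℓ → HasFDerivAt (F0 w) (∑ i, F0 (d i w) y • prj i) y := fun w y hy ↦ by
    by_cases h : ‖y‖ < r
    · have hy' : y ∈ QO N r := ⟨h, hy⟩
      have e : ∀ i, F0 (d i w) y = fderiv ℝ w.1.1 y (eb i) := fun i ↦ (indicator_of_mem (show y ∈ Qb N r from hy') _).trans (dQ_in _ _ hy')
      simp_rw [e]
      rw [← clm_sum]
      refine (SAdiff w.1 hy').hasFDerivAt.congr_of_eventuallyEq ?_
      filter_upwards [(QO N r).isOpen.mem_nhds hy'] with z hz using indicator_of_mem (show z ∈ Qb N r from hz) _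
    · have hl : ρ' < ‖y‖ := by linarith
      have e : ∀ i, F0 (d i w) y = 0 := fun i ↦ F0z _ _ hy hl
      simp_rw [e, zero_smul, Finset.sum_const_zero]
      refine (hasFDerivAt_const (0:ℝ) y).congr_of_eventuallyEq ?_
      filter_upwards [op.mem_nhds hy, (isOpen_lt continuous_const continuous_norm).mem_nhds hl] with z hz hz' using F0z w z hz hz'
  have F0b : ∀ w : ι, ∃ C : ℝ, 0 ≤ C ∧ ∀ y : Yn N, 0 < y ℓ → |F0 w y| ≤ C := fun w ↦ by
    obtain ⟨ρ'', h3, h4⟩ := exists_between h2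
    obtain ⟨C, hC⟩ := (show w.1 ∈ LB N r from opl_iff.1 w.2.2 0) ρ'' h4
    refine ⟨|C|, abs_nonneg _, fun y hy ↦ ?_⟩
    by_cases h : ‖y‖ < ρ''
    · rw [show F0 w y = _ from indicator_of_mem (show y ∈ Qb N r from ⟨h.trans h4, hy⟩) _]
      exact (hC y ⟨h, hy⟩).trans (le_abs_self _)
    · rw [F0z w y hy (by linarith)]; simp
  have ex : ∀ w : ι, ∃ G : Yn N → ℝ, Continuous G ∧ (∃ M, ∀ y, |G y| ≤ M) ∧ ∀ y : Yn N, 0 < y ℓ → G y = F0 w y := fun w ↦ by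
    obtain ⟨C, C0, hC⟩ := F0b w
    choose B B0 hB using fun i ↦ F0b (d i w)
    have lip : LipschitzOnWith (∑ i, (B i).toNNReal) (F0 w) {y : Yn N | 0 < y ℓ} := by
      refine Convex.lipschitzOnWith_of_nnnorm_hasFDerivWithin_le (𝕜 := ℝ) (fun y hy ↦ (F0d w y hy).hasFDerivWithinAt) (fun y hy ↦ ?_) xp
      rw [← NNReal.coe_le_coe, coe_nnnorm, NNReal.coe_sum]
      refine (norm_sum_le _ _).trans (Finset.sum_le_sum fun i _ ↦ ?_)
      rw [norm_smul]
      rw [Real.coe_toNNReal _ (B0 i)]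
      calc _ ≤ B i * 1 := mul_le_mul (hB i y hy) (prj_norm i) (norm_nonneg _) (B0 i)
        _ = _ := mul_one _
    obtain ⟨G, hG, eG⟩ := lip.extend_real
    refine ⟨fun y ↦ max (-C) (min C (G y)), continuous_const.max (continuous_const.min hG.continuous), ⟨C, fun y ↦ abs_le.2 ⟨le_max_left _ _, max_le (by linarith) (min_le_left _ _)⟩⟩, fun y hy ↦ ?_⟩
    have := abs_le.1 (hC y hy)
    show max (-C) (min C (G y)) = _
    rw [← eG hy, min_eq_right this.2, max_eq_right this.1]
  choose F cF bF eF using ex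
  let w0 : ι := ⟨⟨bf, cb.contDiffOn⟩ * ⟨v, sv⟩, fun y _ hy ↦ by
    show bf y * v y = 0
    rw [bf.zero_of_le_dist (by rw [dist_zero_right]; exact hy.le), zero_mul], mul_mem (smooth_opl _ cb) (Wo _ hv)⟩
  obtain ⟨V, cV, hV⟩ := fam_ext F d cF bF (fun w y hy ↦ by
    simp_rw [fun i ↦ eF (d i w) y hy]
    refine (F0d w y hy).congr_of_eventuallyEq ?_
    filter_upwards [op.mem_nhds hy] with z hz using eF w z hz) w0
  refine ⟨V, cV, fun y hy hy' ↦ ?_⟩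
  rw [hV y hy'.le, eF _ _ hy', show F0 w0 y = _ from indicator_of_mem (show y ∈ Qb N r from ⟨hy.trans hρ, hy'⟩) _]
  show bf y * v y = _
  rw [bf.one_of_mem_closedBall (by rw [mem_closedBall_zero_iff]; exact hy.le), one_mul]

end

section
variable {N : ℕ}

noncomputable abbrev el (N : ℕ) : Yn N := eb ℓ

structure LD (N : ℕ) (O : Set (Yn N)) (U : Yn N → ℝ) (G : Fin (N+1) → Yn N → ℝ) (R σ : ℝ) : Prop where
  R0 : 0 < R
  oO : IsOpen O
  cU : ContinuousOn U (closure O ∩ ball 0 R)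
  cG : ∀ i, ContinuousOn (G i) (closure O ∩ ball 0 R)
  sU : ContDiffOn ℝ ⊤∞ U (O ∩ ball 0 R)
  dU : ∀ y ∈ O ∩ ball 0 R, ∀ i, fderiv ℝ U y (eb i) = G i y
  lap : ∀ y ∈ O ∩ ball 0 R, ∑ i, fderiv ℝ (G i) y (eb i) = σ
  fU : ∀ y ∈ frontier O ∩ ball 0 R, U y = 0
  fG : ∀ y ∈ frontier O ∩ ball 0 R, ∑ i, G i y ^ 2 = 1
  gn : ∀ y ∈ closure O ∩ ball 0 R, |G ℓ y - 1| ≤ 1 / 10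
  up : ∀ y, ‖y‖ < R → ‖y‖ / 4 < y ℓ → y ∈ O
  dn : ∀ y, ‖y‖ < R → y ℓ < - (‖y‖ / 4) → y ∉ O

lemma first_exit {O : Set (Yn N)} (oO : IsOpen O) {y d : Yn N} (hy : y ∈ O) {T : ℝ} (hT : 0 ≤ T) (h : y + T • d ∉ O) :
    ∃ s, 0 < s ∧ s ≤ T ∧ y + s • d ∈ frontier O ∧ ∀ t, 0 ≤ t → t < s → y + t • d ∈ O := by
  have cf : Continuous fun s : ℝ ↦ y + s • d := by fun_prop
  set S : Set ℝ := Icc 0 T ∩ {s | y + s • d ∉ O} with hS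
  have cS : IsCompact S := isCompact_Icc.inter_right (oO.isClosed_compl.preimage cf)
  obtain ⟨s, hs, hm⟩ := cS.exists_isLeast ⟨T, ⟨hT, le_rfl⟩, h⟩
  have s0 : 0 < s := lt_of_le_of_ne hs.1.1 (by rintro rfl; exact hs.2 (by simpa using hy))
  have hb : ∀ t, 0 ≤ t → t < s → y + t • d ∈ O := fun t ht hts ↦ by
    by_contra hc
    exact absurd (hm ⟨⟨ht, hts.le.trans hs.1.2⟩, hc⟩) (not_le.2 hts)
  refine ⟨s, s0, hs.1.2, ?_, hb⟩
  rw [oO.frontier_eq]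
  refine ⟨?_, hs.2⟩
  refine mem_closure_of_tendsto (f := fun t : ℝ ↦ y + t • d) (b := nhdsWithin s (Iio s)) ((cf.tendsto s).mono_left nhdsWithin_le_nhds) ?_
  filter_upwards [self_mem_nhdsWithin, mem_nhdsWithin_of_mem_nhds (Ioi_mem_nhds s0)] with t ht ht' using hb t (le_of_lt ht') ht

variable {O : Set (Yn N)} {U : Yn N → ℝ} {G : Fin (N+1) → Yn N → ℝ} {R σ : ℝ}

lemma seg_ball {y e : Yn N} {a b s : ℝ} (ha : y + a • e ∈ ball (𝟎 N) R) (hb : y + b • e ∈ ball (𝟎 N) R) (hs : s ∈ Icc a b) :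
    y + s • e ∈ ball (𝟎 N) R := by
  have : Convex ℝ {s : ℝ | y + s • e ∈ ball (𝟎 N) R} := by
    intro p hp q hq s t hs ht hst
    have h2 := convex_ball (𝟎 N) R hp hq hs ht hst
    show y + (s • p + t • q) • e ∈ ball (𝟎 N) R
    convert h2 using 1
    simp only [smul_add, add_smul, smul_smul, smul_eq_mul]
    have : y = s • y + t • y := by rw [← add_smul, hst, one_smul]
    nth_rewrite 1 [this]; abel
  exact this.ordConnected.out ha hb hs

namespace LD

lemma dff (D : LD N O U G R σ) {y : Yn N} (hy : y ∈ O) (hb : y ∈ ball (𝟎 N) R) : ContDiffAt ℝ ⊤∞ U y :=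
  D.sU.contDiffAt ((D.oO.inter isOpen_ball).mem_nhds ⟨hy, hb⟩)

lemma seg (D : LD N O U G R σ) {y : Yn N} {a b : ℝ} (h : a ≤ b) (hb : ∀ s ∈ Icc a b, y + s • el N ∈ closure O ∩ ball 0 R)
    (ho : ∀ s ∈ Ioo a b, y + s • el N ∈ O) : 9 / 10 * (b - a) ≤ U (y + b • el N) - U (y + a • el N) := by
  have cf : ContinuousOn (fun s : ℝ ↦ U (y + s • el N)) (Icc a b) := D.cU.comp (by fun_prop) hb
  have df : ∀ s ∈ Ioo a b, HasDerivAt (fun s : ℝ ↦ U (y + s • el N)) (G ℓ (y + s • el N)) s := fun s hs ↦ by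
    have h1 := hb s (Ioo_subset_Icc_self hs)
    have h2 := ((D.dff (ho s hs) h1.2).differentiableAt (by simp)).hasFDerivAt
    have h3 : HasDerivAt (fun s : ℝ ↦ y + s • el N) (el N) s := by
      simpa using ((hasDerivAt_id s).smul_const (el N)).const_add y
    have := h2.comp_hasDerivAt s h3
    rwa [D.dU _ ⟨ho s hs, h1.2⟩] at this
  refine Convex.mul_sub_le_image_sub_of_le_deriv (convex_Icc a b) cf (fun s hs ↦ ?_) (fun s hs ↦ ?_) a ⟨le_rfl, h⟩ b ⟨h, le_rfl⟩ h
  · rw [interior_Icc] at hs; exact (df s hs).differentiableAt.differentiableWithinAt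
  · rw [interior_Icc] at hs; rw [(df s hs).deriv]
    have := abs_le.1 (D.gn _ (hb s (Ioo_subset_Icc_self hs))); linarith

lemma zero_notMem (D : LD N O U G R σ) : (𝟎 N) ∉ O := fun h ↦ by
  have cf : Continuous fun s : ℝ ↦ (-s) • el N := by fun_prop
  have h1 : ∀ᶠ s in nhds (0:ℝ), (-s) • el N ∈ O := cf.continuousAt.eventually_mem (D.oO.mem_nhds (by simpa using h))
  have h2 : ∀ᶠ s in nhds (0:ℝ), s < R := Iio_mem_nhds D.R0
  obtain ⟨s, ⟨h3, h4⟩, h5⟩ := ((((h1.and h2).filter_mono nhdsWithin_le_nhds)).and (self_mem_nhdsWithin (s := Ioi (0:ℝ)))).exists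
  have h5 : 0 < s := h5
  have e : ‖(-s) • el N‖ = s := by rw [norm_smul, show ‖el N‖ = 1 by simp [el, eb, Pi.norm_single]]; simp [abs_of_pos h5]
  exact D.dn _ (by rwa [e]) (by rw [e]; simp [el, eb]; linarith) h3

lemma pos (D : LD N O U G R σ) {y : Yn N} (hy : y ∈ O) (hb : y ∈ ball (𝟎 N) R) : 0 < U y := by
  have y0 : 0 < ‖y‖ := norm_pos_iff.2 (by rintro rfl; exact D.zero_notMem hy)
  have yl : |y ℓ| ≤ ‖y‖ := norm_le_pi_norm y _
  have hT : 0 ≤ y ℓ + ‖y‖ := by have := (abs_le.1 yl).1; linarith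
  set T := y ℓ + ‖y‖ with hTd
  have zn : ‖y + T • (-el N)‖ ≤ ‖y‖ := by
    refine (pi_norm_le_iff_of_nonneg y0.le).2 fun i ↦ ?_
    by_cases hi : i = Fin.last N
    · subst hi; simp [el, eb, hTd]
    · have : (y + T • (-el N)) i = y i := by simp [el, eb, Pi.single_apply, hi]
      rw [this]; exact norm_le_pi_norm y i
  have zb : y + T • (-el N) ∈ ball (𝟎 N) R := by rw [mem_ball_zero_iff] at hb ⊢; linarith
  have zl : (y + T • (-el N)) ℓ = -‖y‖ := by simp [el, eb, hTd]
  obtain ⟨s, s0, sT, sf, so⟩ := first_exit D.oO hy (d := -el N) hT (D.dn _ (mem_ball_zero_iff.1 zb) (by rw [zl]; linarith))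
  have sb : ∀ t ∈ Icc 0 s, y + t • (-el N) ∈ ball (𝟎 N) R := fun t ht ↦ seg_ball (a := 0) (b := T) (by simpa using hb) zb ⟨ht.1, ht.2.trans sT⟩
  have e : ∀ t : ℝ, y + (-t) • el N = y + t • (-el N) := fun t ↦ by rw [neg_smul, smul_neg]
  have := D.seg (y := y) (a := -s) (b := 0) (by linarith) (fun t ht ↦ by
    have h1 : y + t • el N = y + (-t) • (-el N) := by rw [smul_neg, neg_smul, neg_neg]
    rw [h1]
    refine ⟨?_, sb (-t) ⟨by linarith [ht.2], by linarith [ht.1]⟩⟩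
    rcases eq_or_lt_of_le ht.1 with h | h
    · rw [← h, neg_neg]; exact frontier_subset_closure sf
    · exact subset_closure (so _ (by linarith [ht.2]) (by linarith))) (fun t ht ↦ by
    have h1 : y + t • el N = y + (-t) • (-el N) := by rw [smul_neg, neg_smul, neg_neg]
    rw [h1]
    exact so _ (by linarith [ht.2]) (by linarith [ht.1]))
  rw [e, D.fU _ ⟨sf, sb s ⟨s0.le, le_rfl⟩⟩, zero_smul, add_zero] at this
  linarith

lemma mono0 (D : LD N O U G R σ) {y : Yn N} (hy : y ∈ O) (hb : y ∈ ball (𝟎 N) R) {s : ℝ} (hs : 0 < s) (hb' : y + s • el N ∈ ball (𝟎 N) R) :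
    y + s • el N ∈ O := by
  by_contra hc
  obtain ⟨t, t0, tT, tf, tO⟩ := first_exit D.oO hy hs.le hc
  have sb : ∀ τ ∈ Icc 0 t, y + τ • el N ∈ ball (𝟎 N) R := fun τ hτ ↦ seg_ball (a := 0) (b := s) (by simpa using hb) hb' ⟨hτ.1, hτ.2.trans tT⟩
  have := D.seg (y := y) (a := 0) (b := t) t0.le (fun τ hτ ↦ ⟨by
    rcases eq_or_lt_of_le hτ.2 with h | h
    · rw [h]; exact frontier_subset_closure tf
    · exact subset_closure (tO _ hτ.1 h), sb τ hτ⟩) (fun τ hτ ↦ tO τ hτ.1.le hτ.2)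
  rw [D.fU _ ⟨tf, sb t ⟨t0.le, le_rfl⟩⟩, zero_smul, add_zero] at this
  have := D.pos hy hb
  linarith

lemma monoU0 (D : LD N O U G R σ) {y : Yn N} (hy : y ∈ O) (hb : y ∈ ball (𝟎 N) R) {s : ℝ} (hs : 0 < s) (hb' : y + s • el N ∈ ball (𝟎 N) R) :
    9 / 10 * s ≤ U (y + s • el N) := by
  have sb : ∀ τ ∈ Icc 0 s, y + τ • el N ∈ O ∩ ball (𝟎 N) R := fun τ hτ ↦ by
    have := seg_ball (a := 0) (b := s) (by simpa using hb) hb' hτ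
    refine ⟨?_, this⟩
    rcases eq_or_lt_of_le hτ.1 with h | h
    · rw [← h]; simpa using hy
    · exact D.mono0 hy hb h this
  have := D.seg hs.le (fun τ hτ ↦ ⟨subset_closure (sb τ hτ).1, (sb τ hτ).2⟩) (fun τ hτ ↦ (sb τ (Ioo_subset_Icc_self hτ)).1)
  rw [zero_smul, add_zero] at this
  have := D.pos hy hb
  linarith

lemma mono (D : LD N O U G R σ) {y : Yn N} (hy : y ∈ closure O) (hb : y ∈ ball (𝟎 N) R) {s : ℝ} (hs : 0 < s) (hb' : y + s • el N ∈ ball (𝟎 N) R) :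
    y + s • el N ∈ O := by
  have cf : Continuous fun z : Yn N ↦ z + s • el N := by fun_prop
  have t1 : Filter.Tendsto (fun z : Yn N ↦ z + s • el N) (nhdsWithin y O) (nhds (y + s • el N)) := (cf.tendsto y).mono_left nhdsWithin_le_nhds
  have ev : ∀ᶠ z in nhdsWithin y O, z ∈ O ∧ z ∈ ball (𝟎 N) R ∧ z + s • el N ∈ ball (𝟎 N) R := by
    filter_upwards [self_mem_nhdsWithin, mem_nhdsWithin_of_mem_nhds (isOpen_ball.mem_nhds hb), t1 (isOpen_ball.mem_nhds hb')] with z h1 h2 h3 using ⟨h1, h2, h3⟩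
  have : (nhdsWithin y O).NeBot := mem_closure_iff_nhdsWithin_neBot.1 hy
  have hc : y + s • el N ∈ closure O := mem_closure_of_tendsto t1 (ev.mono fun z h ↦ D.mono0 h.1 h.2.1 hs h.2.2)
  have t2 : Filter.Tendsto (fun z ↦ U (z + s • el N)) (nhdsWithin y O) (nhds (U (y + s • el N))) :=
    (D.cU _ ⟨hc, hb'⟩).tendsto.comp (tendsto_nhdsWithin_iff.2 ⟨t1, ev.mono fun z h ↦ ⟨subset_closure (D.mono0 h.1 h.2.1 hs h.2.2), h.2.2⟩⟩)
  have := ge_of_tendsto t2 (ev.mono fun z h ↦ D.monoU0 h.1 h.2.1 hs h.2.2)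
  by_contra hn
  have := D.fU _ ⟨by rw [D.oO.frontier_eq]; exact ⟨hc, hn⟩, hb'⟩
  linarith

lemma monoU (D : LD N O U G R σ) {y : Yn N} (hy : y ∈ closure O) (hb : y ∈ ball (𝟎 N) R) {s : ℝ} (hs : 0 < s) (hb' : y + s • el N ∈ ball (𝟎 N) R) :
    9 / 10 * s ≤ U (y + s • el N) - U y := by
  have sb : ∀ τ ∈ Icc 0 s, y + τ • el N ∈ ball (𝟎 N) R := fun τ hτ ↦ seg_ball (a := 0) (b := s) (by simpa using hb) hb' hτ
  have so : ∀ τ ∈ Ioc 0 s, y + τ • el N ∈ O := fun τ hτ ↦ D.mono hy hb hτ.1 (sb τ ⟨hτ.1.le, hτ.2⟩)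
  have := D.seg hs.le (fun τ hτ ↦ ⟨by
    rcases eq_or_lt_of_le hτ.1 with h | h
    · rw [← h]; simpa using hy
    · exact subset_closure (so τ ⟨h, hτ.2⟩), sb τ hτ⟩) (fun τ hτ ↦ so τ ⟨hτ.1, hτ.2.le⟩)
  rw [zero_smul, add_zero] at this
  linarith

lemma U_nonneg (D : LD N O U G R σ) {y : Yn N} (hy : y ∈ closure O) (hb : y ∈ ball (𝟎 N) R) : 0 ≤ U y ∧ (U y = 0 → y ∈ frontier O) ∧ (0 < U y → y ∈ O) := by
  by_cases h : y ∈ O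
  · have := D.pos h hb
    exact ⟨this.le, fun h' ↦ by linarith, fun _ ↦ h⟩
  · have hf : y ∈ frontier O := by rw [D.oO.frontier_eq]; exact ⟨hy, h⟩
    have := D.fU y ⟨hf, hb⟩
    exact ⟨this.ge, fun _ ↦ hf, fun h' ↦ by linarith⟩

lemma inj (D : LD N O U G R σ) {y z : Yn N} (hy : y ∈ closure O ∩ ball 0 R) (hz : z ∈ closure O ∩ ball 0 R)
    (h : ∀ i, i ≠ Fin.last N → y i = z i) (hU : U y = U z) : y = z := by
  have e : ∀ y z : Yn N, (∀ i, i ≠ Fin.last N → y i = z i) → z = y + (z ℓ - y ℓ) • el N := fun y z h ↦ by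
    ext i
    by_cases hi : i = Fin.last N
    · subst hi; simp [el, eb]
    · simp [el, eb, Pi.single_apply, hi, h i hi]
  have key : ∀ y z : Yn N, y ∈ closure O ∩ ball 0 R → z ∈ closure O ∩ ball 0 R → (∀ i, i ≠ Fin.last N → y i = z i) → U y = U z →
      ¬ y ℓ < z ℓ := fun y z hy hz h hU hlt ↦ by
    have e' := e y z h
    have := D.monoU hy.1 hy.2 (s := z ℓ - y ℓ) (by linarith) (by rw [← e']; exact hz.2)
    rw [← e'] at this
    linarith
  have h1 := key y z hy hz h hU
  have h2 := key z y hz hy (fun i hi ↦ (h i hi).symm) hU.symm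
  rw [e y z h, le_antisymm (not_lt.1 h1) (not_lt.1 h2), sub_self, zero_smul, add_zero]

/-- the closed box -/
def bx (N : ℕ) (R : ℝ) : Set (Yn N) := {p | (∀ i, i ≠ Fin.last N → |p i| ≤ R / 8) ∧ 0 ≤ p ℓ ∧ p ℓ ≤ R / 4}

lemma exi (D : LD N O U G R σ) {p : Yn N} (hp : p ∈ bx N R) : ∃ y ∈ closure O, ‖y‖ ≤ R / 2 ∧ (∀ i, i ≠ Fin.last N → y i = p i) ∧ U y = p ℓ := by
  have R0 := D.R0
  set q : Yn N := Function.update p ℓ (R/2) with hq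
  have ql : q ℓ = R / 2 := by simp [hq]
  have qi : ∀ i, i ≠ Fin.last N → q i = p i := fun i hi ↦ by simp [hq, hi]
  have li : ∀ s : ℝ, ∀ i, i ≠ Fin.last N → (q + s • (-el N)) i = p i := fun s i hi ↦ by
    simp [el, eb, Pi.single_apply, hi, qi i hi]
  have ll : ∀ s : ℝ, (q + s • (-el N)) ℓ = R / 2 - s := fun s ↦ by simp [el, eb, ql]; ring
  have nb : ∀ s ∈ Icc 0 R, ‖q + s • (-el N)‖ ≤ R / 2 := fun s hs ↦ by
    refine (pi_norm_le_iff_of_nonneg (by linarith)).2 fun i ↦ ?_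
    by_cases hi : i = Fin.last N
    · rw [hi, ll, Real.norm_eq_abs, abs_le]; constructor <;> linarith [hs.1, hs.2]
    · rw [li s i hi]; have := hp.1 i hi; rw [Real.norm_eq_abs]; linarith
  have nb' : ∀ s ∈ Icc 0 R, q + s • (-el N) ∈ ball (𝟎 N) R := fun s hs ↦ by
    rw [mem_ball_zero_iff]; linarith [nb s hs]
  have q0 : q + (0:ℝ) • (-el N) = q := by simp
  have qn : ‖q‖ ≤ R / 2 := by simpa using nb 0 ⟨le_rfl, R0.le⟩
  have qO : q ∈ O := D.up q (by linarith) (by rw [ql]; linarith)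
  obtain ⟨s, s0, sT, sf, so⟩ := first_exit D.oO qO (d := -el N) R0.le (D.dn _ (mem_ball_zero_iff.1 (nb' R ⟨R0.le, le_rfl⟩)) (by
    rw [ll]; have := nb R ⟨R0.le, le_rfl⟩; linarith))
  have sR : ∀ t ∈ Icc 0 s, t ∈ Icc 0 R := fun t ht ↦ ⟨ht.1, ht.2.trans sT⟩
  have sn : q + s • (-el N) ∉ O := by rw [D.oO.frontier_eq] at sf; exact sf.2
  have sl : 3 * R / 8 ≤ s := by
    by_contra hc
    have h1 := nb s (sR s ⟨s0.le, le_rfl⟩)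
    exact sn (D.up _ (mem_ball_zero_iff.1 (nb' s (sR s ⟨s0.le, le_rfl⟩))) (by rw [ll]; linarith))
  have e : q = (q + s • (-el N)) + s • el N := by simp
  have hU := D.monoU (frontier_subset_closure sf) (nb' s (sR s ⟨s0.le, le_rfl⟩)) s0 (by rw [← e]; simpa using nb' 0 ⟨le_rfl, R0.le⟩)
  have hz := D.fU _ ⟨sf, nb' s (sR s ⟨s0.le, le_rfl⟩)⟩
  rw [← e, hz] at hU
  have cl : ∀ t ∈ Icc 0 s, q + t • (-el N) ∈ closure O := fun t ht ↦ by
    rcases eq_or_lt_of_le ht.2 with h | h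
    · rw [h]; exact frontier_subset_closure sf
    · exact subset_closure (so t ht.1 h)
  have cf : ContinuousOn (fun t : ℝ ↦ U (q + t • (-el N))) (Icc 0 s) := D.cU.comp (by fun_prop) fun t ht ↦ ⟨cl t ht, nb' t (sR t ht)⟩
  obtain ⟨t, ht, et⟩ := intermediate_value_Icc' s0.le cf (show p ℓ ∈ Icc _ _ from ⟨by rw [hz]; exact hp.2.1, by
    rw [q0]; have := hp.2.2; linarith⟩)
  exact ⟨_, cl t ht, nb t (sR t ht), li t, et⟩
end LD
end

section
variable {N : ℕ} {O : Set (Yn N)} {U : Yn N → ℝ} {G : Fin (N+1) → Yn N → ℝ} {R σ : ℝ}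
namespace LD

noncomputable def Ph (U : Yn N → ℝ) (y : Yn N) : Yn N := y + (U y - y ℓ) • el N

lemma Ph_last (U : Yn N → ℝ) (y : Yn N) : Ph U y ℓ = U y := by simp [Ph, el, eb]
lemma Ph_ne (U : Yn N → ℝ) (y : Yn N) {i : Fin (N+1)} (hi : i ≠ Fin.last N) : Ph U y i = y i := by simp [Ph, el, eb, hi]

lemma yext {y z : Yn N} (h : ∀ i, i ≠ Fin.last N → y i = z i) (hl : y ℓ = z ℓ) : y = z := by
  ext i
  by_cases hi : i = Fin.last N
  · rw [hi, hl]
  · exact h i hi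

lemma Qb_bx (hR : 0 < R) : Qb N (R/8) ⊆ bx N R := fun p hp ↦ by
  have h : ∀ i, |p i| < R / 8 := fun i ↦ (norm_le_pi_norm p i).trans_lt hp.1
  exact ⟨fun i _ ↦ (h i).le, hp.2.le, by have := (abs_lt.1 (h ℓ)).2; linarith⟩

/-- generic: invertible derivative of a graph map -/
lemma graph_equiv {f : Yn N → ℝ} {L : Yn N →L[ℝ] ℝ} {y : Yn N} (hf : HasFDerivAt f L y) (hL : L (el N) ≠ 0) :
    ∃ A : Yn N ≃L[ℝ] Yn N, HasFDerivAt (Ph f) (A : Yn N →L[ℝ] Yn N) y := by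
  set A0 : Yn N →L[ℝ] Yn N := ContinuousLinearMap.id ℝ _ + (L - prj ℓ).smulRight (el N)
  have h1 : HasFDerivAt (Ph f) A0 y := (hasFDerivAt_id y).add ((hf.sub (prj ℓ).hasFDerivAt).smul_const (el N))
  have inj : Function.Injective (A0 : Yn N →ₗ[ℝ] Yn N) := by
    refine (injective_iff_map_eq_zero _).2 fun x hx ↦ ?_
    have hx : x + (L x - x ℓ) • el N = 0 := hx
    have hl : L x = 0 := by have := congrFun hx ℓ; simpa [el, eb] using this
    have hi : ∀ i, i ≠ Fin.last N → x i = 0 := fun i hi ↦ by have := congrFun hx i; simpa [el, eb, hi] using this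
    have e : x = x ℓ • el N := yext (fun i h ↦ by simp [hi i h, el, eb, h]) (by simp [el, eb])
    rw [e, map_smul, smul_eq_mul] at hl
    rw [e, (mul_eq_zero.1 hl).resolve_right hL, zero_smul]
  refine ⟨(LinearEquiv.ofInjectiveEndo _ inj).toContinuousLinearEquiv, ?_⟩
  convert h1 using 1
  ext x; rfl

lemma hod (D : LD N O U G R σ) : ∃ Ψ : Yn N → Yn N, (∀ p ∈ bx N R, Ψ p ∈ closure O ∧ ‖Ψ p‖ ≤ R / 2 ∧ (∀ i, i ≠ Fin.last N → Ψ p i = p i) ∧ U (Ψ p) = p ℓ) ∧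
    ContinuousOn Ψ (bx N R) ∧ ∀ p ∈ Qb N (R/8), ContDiffAt ℝ ⊤∞ Ψ p := by
  classical
  have R0 := D.R0
  choose! Ψ h1 h2 h3 h4 using fun p ↦ D.exi (p := p)
  have hK : ∀ p ∈ bx N R, Ψ p ∈ closure O ∩ ball 0 R := fun p hp ↦ ⟨h1 p hp, by rw [mem_ball_zero_iff]; linarith [h2 p hp]⟩
  have PΨ : ∀ p ∈ bx N R, Ph U (Ψ p) = p := fun p hp ↦ yext (fun i hi ↦ by rw [Ph_ne _ _ hi, h3 p hp i hi]) (by rw [Ph_last, h4 p hp])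
  have Pc : ContinuousOn (Ph U) (closure O ∩ ball 0 R) :=
    continuousOn_id.add ((D.cU.sub (continuous_apply ℓ).continuousOn).smul continuousOn_const)
  have Pi : ∀ y ∈ closure O ∩ ball 0 R, ∀ z ∈ closure O ∩ ball 0 R, Ph U y = Ph U z → y = z := fun y hy z hz h ↦
    D.inj hy hz (fun i hi ↦ by rw [← Ph_ne U y hi, ← Ph_ne U z hi, h]) (by rw [← Ph_last U y, ← Ph_last U z, h])
  have cΨ : ContinuousOn Ψ (bx N R) := by
    set K : Set (Yn N) := closure O ∩ closedBall 0 (R/2) with hKd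
    have KR : K ⊆ closure O ∩ ball 0 R := fun y hy ↦ ⟨hy.1, by have := mem_closedBall_zero_iff.1 hy.2; rw [mem_ball_zero_iff]; linarith⟩
    have cK : IsCompact K := (isCompact_closedBall (𝟎 N) (R/2)).inter_left isClosed_closure
    have : CompactSpace K := isCompact_iff_compactSpace.1 cK
    have emb := Continuous.isClosedEmbedding (continuousOn_iff_continuous_domRestrict.1 (Pc.mono KR))
      (fun y z h ↦ Subtype.ext (Pi _ (KR y.2) _ (KR z.2) h))
    let ψ : bx N R → K := fun p ↦ ⟨Ψ p, h1 p p.2, mem_closedBall_zero_iff.2 (h2 p p.2)⟩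
    have : Continuous ψ := emb.isInducing.continuous_iff.2 (by
      have : K.domRestrict (Ph U) ∘ ψ = Subtype.val := funext fun p ↦ PΨ p p.2
      rw [this]; exact continuous_subtype_val)
    exact continuousOn_iff_continuous_domRestrict.2 (continuous_subtype_val.comp this)
  refine ⟨Ψ, fun p hp ↦ ⟨h1 p hp, h2 p hp, h3 p hp, h4 p hp⟩, cΨ, ?_⟩
  have ΨO : ∀ p ∈ Qb N (R/8), Ψ p ∈ O ∩ ball 0 R := fun p hp ↦ ⟨(D.U_nonneg (hK p (Qb_bx R0 hp)).1 (hK p (Qb_bx R0 hp)).2).2.2 (by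
    rw [h4 p (Qb_bx R0 hp)]; exact hp.2), (hK p (Qb_bx R0 hp)).2⟩
  have sub : O ∩ ball 0 R ⊆ closure O ∩ ball 0 R := inter_subset_inter_left _ subset_closure
  let e : OpenPartialHomeomorph (Yn N) (Yn N) :=
    { toFun := Ph U
      invFun := Ψ
      source := (O ∩ ball 0 R) ∩ Ph U ⁻¹' (Qb N (R/8))
      target := Qb N (R/8)
      map_source' := fun y hy ↦ hy.2
      map_target' := fun p hp ↦ ⟨ΨO p hp, by rw [mem_preimage, PΨ p (Qb_bx R0 hp)]; exact hp⟩
      left_inv' := fun y hy ↦ Pi _ (hK _ (Qb_bx R0 hy.2)) _ (sub hy.1) (PΨ _ (Qb_bx R0 hy.2))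
      right_inv' := fun p hp ↦ PΨ p (Qb_bx R0 hp)
      open_source := (Pc.mono sub).isOpen_inter_preimage (D.oO.inter isOpen_ball) (Qb_open N _)
      open_target := Qb_open N _
      continuousOn_toFun := (Pc.mono sub).mono inter_subset_left
      continuousOn_invFun := cΨ.mono (Qb_bx R0) }
  intro p hp
  have hO := ΨO p hp
  have sm := D.dff hO.1 hO.2
  have hd := (sm.differentiableAt (by simp)).hasFDerivAt
  obtain ⟨A, hA⟩ := graph_equiv hd (by
    rw [D.dU _ hO]; have := (abs_le.1 (D.gn _ (sub hO))).1; intro h; rw [h] at this; linarith)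
  exact e.contDiffAt_symm (show p ∈ e.target from hp) hA (contDiffAt_id.add ((sm.sub (prj ℓ).contDiff.contDiffAt).smul contDiffAt_const))

end LD
end

section
variable {N : ℕ} {O : Set (Yn N)} {U : Yn N → ℝ} {G : Fin (N+1) → Yn N → ℝ} {R σ : ℝ}
namespace LD

noncomputable def cl (N : ℕ) (R : ℝ) (p : Yn N) : Yn N := fun i ↦
  if i = Fin.last N then max 0 (min (R/4) (p i)) else max (-(R/8)) (min (R/8) (p i))

lemma cl_mem (hR : 0 < R) (p : Yn N) : cl N R p ∈ bx N R := by
  refine ⟨fun i hi ↦ ?_, ?_, ?_⟩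
  · simp only [cl, if_neg hi]
    exact abs_le.2 ⟨le_max_left _ _, max_le (by linarith) (min_le_left _ _)⟩
  · simp only [cl, if_true]; exact le_max_left _ _
  · simp only [cl, if_true]; exact max_le (by linarith) (min_le_left _ _)

lemma cl_id {p : Yn N} (hp : p ∈ bx N R) : cl N R p = p := by
  ext i
  by_cases hi : i = Fin.last N
  · subst hi; simp only [cl, if_true]; rw [min_eq_right hp.2.2, max_eq_right hp.2.1]
  · simp only [cl, if_neg hi]; have := abs_le.1 (hp.1 i hi); rw [min_eq_right this.2, max_eq_right this.1]

lemma cl_uc : UniformContinuous (cl N R) := by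
  refine LipschitzWith.uniformContinuous (K := 1) (LipschitzWith.of_dist_le_mul fun x y ↦ ?_)
  rw [NNReal.coe_one, one_mul]
  refine (dist_pi_le_iff dist_nonneg).2 fun i ↦ ?_
  refine le_trans ?_ (dist_le_pi_dist x y i)
  simp only [cl, Real.dist_eq]
  split_ifs
  · exact (abs_max_sub_max_le_max _ _ _ _).trans (max_le (by simp) ((abs_min_sub_min_le_max _ _ _ _).trans (by simp)))
  · exact (abs_max_sub_max_le_max _ _ _ _).trans (max_le (by simp) ((abs_min_sub_min_le_max _ _ _ _).trans (by simp)))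

lemma bx_cpt : IsCompact (bx N R) := by
  refine Metric.isCompact_of_isClosed_isBounded ?_ ((isBounded_closedBall (x := (𝟎 N)) (r := |R|)).subset fun p hp ↦ ?_)
  · simp only [bx, setOf_and, setOf_forall]
    refine IsClosed.inter (isClosed_iInter fun i ↦ isClosed_iInter fun _ ↦ isClosed_le ?_ continuous_const) (IsClosed.inter (isClosed_le continuous_const ?_) (isClosed_le ?_ continuous_const)) <;> fun_prop
  · rw [mem_closedBall_zero_iff]
    have := hp.2.1.trans hp.2.2
    refine (pi_norm_le_iff_of_nonneg (abs_nonneg _)).2 fun i ↦ ?_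
    have h := le_abs_self R
    by_cases hi : i = Fin.last N
    · rw [hi, Real.norm_eq_abs, abs_of_nonneg hp.2.1]; linarith [hp.2.2]
    · have := hp.1 i hi; rw [Real.norm_eq_abs]; linarith

lemma cl_comp {X : Type*} [NormedAddCommGroup X] (hR : 0 < R) {f : Yn N → X} (hf : ContinuousOn f (bx N R)) :
    UniformContinuous (fun p ↦ f (cl N R p)) ∧ ∃ M, ∀ p, ‖f (cl N R p)‖ ≤ M := by
  constructor
  · have h1 := bx_cpt.uniformContinuousOn_of_continuous hf
    have h2 : UniformContinuousOn (f ∘ cl N R) univ := h1.comp (uniformContinuousOn_univ.2 cl_uc) fun p _ ↦ cl_mem hR p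
    exact uniformContinuousOn_univ.1 h2
  · obtain ⟨M, hM⟩ := bx_cpt.exists_bound_of_continuousOn hf
    exact ⟨M, fun p ↦ hM _ (cl_mem hR p)⟩

lemma Gs (D : LD N O U G R σ) {y : Yn N} (hy : y ∈ O ∩ ball 0 R) (i : Fin (N+1)) : ContDiffAt ℝ ⊤∞ (G i) y := by
  have h1 : ContDiffAt ℝ ⊤∞ (fun z ↦ fderiv ℝ U z (eb i)) y := ((D.dff hy.1 hy.2).fderiv_right (by simp)).clm_apply contDiffAt_const
  refine h1.congr_of_eventuallyEq ?_
  filter_upwards [(D.oO.inter isOpen_ball).mem_nhds hy] with z hz using (D.dU z hz i).symm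

lemma ext_v (D : LD N O U G R σ) : ∃ V : Yn N → ℝ, ContDiff ℝ ⊤∞ V ∧ ∃ ρ, 0 < ρ ∧ (∀ p ∈ Qb N ρ,
    ∃ y ∈ O, ‖y‖ ≤ R / 2 ∧ (∀ i, i ≠ Fin.last N → y i = p i) ∧ U y = p ℓ ∧ y ℓ = V p ∧ 5 / 6 ≤ fderiv ℝ V p (el N)) := by
  have R0 := D.R0
  obtain ⟨Ψ, hΨ, cΨ, sΨ⟩ := D.hod
  have hK : ∀ p ∈ bx N R, Ψ p ∈ closure O ∩ ball 0 R := fun p hp ↦ ⟨(hΨ p hp).1, by rw [mem_ball_zero_iff]; linarith [(hΨ p hp).2.1]⟩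
  have QB := Qb_bx (N := N) R0
  have ΨO : ∀ p ∈ Qb N (R/8), Ψ p ∈ O ∩ ball 0 R := fun p hp ↦ ⟨(D.U_nonneg (hK p (QB hp)).1 (hK p (QB hp)).2).2.2 (by
    rw [(hΨ p (QB hp)).2.2.2]; exact hp.2), (hK p (QB hp)).2⟩
  have cGΨ : ∀ i, ContinuousOn (fun p ↦ G i (Ψ p)) (bx N R) := fun i ↦ (D.cG i).comp cΨ hK
  have gnb : ∀ p ∈ bx N R, |G ℓ (Ψ p) - 1| ≤ 1 / 10 := fun p hp ↦ D.gn _ (hK p hp)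
  have gp : ∀ p ∈ bx N R, 9 / 10 ≤ G ℓ (Ψ p) ∧ G ℓ (Ψ p) ≤ 11 / 10 := fun p hp ↦ by
    have := abs_le.1 (gnb p hp); constructor <;> linarith
  have ev : ∀ {X : Type} (f : Yn N → X), ∀ p ∈ Qb N (R/8), (fun q ↦ f (cl N R q)) =ᶠ[nhds p] f := fun f p hp ↦ by
    filter_upwards [(Qb_open N (R/8)).mem_nhds hp] with q hq
    rw [cl_id (QB hq)]
  let v : Yn N → ℝ := fun p ↦ Ψ (cl N R p) ℓ
  let b : Yn N → ℝ := fun p ↦ G ℓ (Ψ (cl N R p)) - 1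
  let c : Yn N → ℝ := fun p ↦ (G ℓ (Ψ (cl N R p)))⁻¹ - 1
  let a : Fin N → Yn N → ℝ := fun j p ↦ G j.castSucc (Ψ (cl N R p))
  let H : Yn N → ℝ := fun p ↦ 2 * σ * cl N R p ℓ
  let Bn : Yn N → ℝ := fun y ↦ 1 + H y - ∑ j, a j y * a j y - (1 + b y) ^ 2
  obtain ⟨uv, Mv, hMv⟩ := cl_comp R0 (f := fun p ↦ Ψ p ℓ) ((continuous_apply _).comp_continuousOn cΨ)
  obtain ⟨ub, Mb, hMb⟩ := cl_comp R0 (f := fun p ↦ G ℓ (Ψ p) - 1) ((cGΨ _).sub continuousOn_const)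
  obtain ⟨uc, Mc, hMc⟩ := cl_comp R0 (f := fun p ↦ (G ℓ (Ψ p))⁻¹ - 1) (((cGΨ _).inv₀ fun p hp ↦ by have := (gp p hp).1; intro h; linarith).sub continuousOn_const)
  have ua := fun j : Fin N ↦ (cl_comp R0 (f := fun p ↦ G j.castSucc (Ψ p)) (cGΨ _)).1
  choose Ma hMa using fun j : Fin N ↦ (cl_comp R0 (f := fun p ↦ G j.castSucc (Ψ p)) (cGΨ _)).2
  obtain ⟨uH, MH, hMH⟩ := cl_comp R0 (f := fun p : Yn N ↦ 2 * σ * p ℓ) (by fun_prop)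
  have Ma0 : ∀ j, 0 ≤ Ma j := fun j ↦ (norm_nonneg _).trans (hMa j 0)
  have Mv0 : 0 ≤ Mv := (norm_nonneg _).trans (hMv 0)
  have Mb0 : 0 ≤ Mb := (norm_nonneg _).trans (hMb 0)
  have Mc0 : 0 ≤ Mc := (norm_nonneg _).trans (hMc 0)
  have MH0 : 0 ≤ MH := (norm_nonneg _).trans (hMH 0)
  have Ms0 : 0 ≤ ∑ j, Ma j := Finset.sum_nonneg fun j _ ↦ Ma0 j
  have sΨ' : ∀ p ∈ Qb N (R/8), ∀ i, ContDiffAt ℝ ⊤∞ (fun q ↦ G i (Ψ q)) p := fun p hp i ↦ (D.Gs (ΨO p hp) i).comp p (sΨ p hp)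
  have hL : ∀ p ∈ Qb N (R/8), ∀ i, fderiv ℝ Ψ p (eb i) = (if i = Fin.last N then (𝟎 N) else eb i)
      + ((if i = Fin.last N then 1 else - G i (Ψ p)) / G ℓ (Ψ p)) • el N := by
    intro p hp i
    have hd := ((sΨ p hp).differentiableAt (by simp)).hasFDerivAt
    set L := fderiv ℝ Ψ p
    have g0 : G ℓ (Ψ p) ≠ 0 := by have := (gp p (QB hp)).1; intro h; linarith
    have ne : ∀ j, j ≠ Fin.last N → ∀ x, L x j = x j := fun j hj x ↦ by
      have h1 : HasFDerivAt (fun q ↦ Ψ q j) ((prj j).comp L) p := (prj j).hasFDerivAt.comp p hd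
      have h2 : HasFDerivAt (fun q ↦ Ψ q j) (prj j) p := (prj j).hasFDerivAt.congr_of_eventuallyEq (by
        filter_upwards [(Qb_open N (R/8)).mem_nhds hp] with q hq using (hΨ q (QB hq)).2.2.1 j hj)
      exact congrArg (fun M : Yn N →L[ℝ] ℝ ↦ M x) (h1.unique h2)
    have la : ∀ x, fderiv ℝ U (Ψ p) (L x) = x ℓ := fun x ↦ by
      have hO := ΨO p hp
      have h1 : HasFDerivAt (fun q ↦ U (Ψ q)) ((fderiv ℝ U (Ψ p)).comp L) p := ((D.dff hO.1 hO.2).differentiableAt (by simp)).hasFDerivAt.comp p hd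
      have h2 : HasFDerivAt (fun q ↦ U (Ψ q)) (prj ℓ) p := (prj _).hasFDerivAt.congr_of_eventuallyEq (by
        filter_upwards [(Qb_open N (R/8)).mem_nhds hp] with q hq using (hΨ q (QB hq)).2.2.2)
      exact congrArg (fun M : Yn N →L[ℝ] ℝ ↦ M x) (h1.unique h2)
    have dec : L (eb i) = (if i = Fin.last N then (𝟎 N) else eb i) + (L (eb i) ℓ) • el N := yext (fun j hj ↦ by
      rw [ne j hj]
      by_cases hi : i = Fin.last N
      · subst hi; simp [el, eb, hj]
      · simp [el, eb, hj, hi]) (by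
      by_cases hi : i = Fin.last N
      · subst hi; simp [el, eb]
      · simp [el, eb, hi, Ne.symm hi])
    have h := la (eb i)
    rw [dec, map_add, map_smul, D.dU _ (ΨO p hp)] at h
    rw [dec]
    congr 2
    rw [eq_div_iff g0]
    by_cases hi : i = Fin.last N
    · subst hi; simpa [eb] using h
    · simp only [if_neg hi] at h ⊢
      rw [D.dU _ (ΨO p hp)] at h
      have e0 : (eb i : Yn N) ℓ = 0 := by simp [eb, Ne.symm hi]
      rw [e0, smul_eq_mul] at h
      linarith
  have Hd : HD N (R/8) (Mv + Mb + Mc + MH + ∑ j, Ma j) v b c H Bn a :=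
    { r0 := by positivity
      bv := fun y ↦ (hMv y).trans (by linarith)
      bb := fun y ↦ (hMb y).trans (by linarith)
      bc := fun y ↦ (hMc y).trans (by linarith)
      ba := fun j y ↦ (hMa j y).trans (by
        have := Finset.single_le_sum (f := Ma) (fun j _ ↦ Ma0 j) (Finset.mem_univ j); linarith)
      bH := fun y ↦ (hMH y).trans (by linarith)
      cv := uv.continuous
      ub := ub
      uc := uc
      ua := ua
      cH := uH.continuous
      hbc := fun y ↦ by
        have := (gp _ (cl_mem R0 y)).1
        show (1 + (_ - 1)) * (1 + (_ - 1)) = (1:ℝ)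
        rw [add_sub_cancel, add_sub_cancel, mul_inv_cancel₀ (by intro h; linarith)]
      b1 := fun y ↦ by have := (gp _ (cl_mem R0 y)).1; show 1 / 2 ≤ 1 + (_ - 1); linarith
      b2 := fun y ↦ by have := (gp _ (cl_mem R0 y)).2; show 1 + (_ - 1) ≤ (2:ℝ); linarith
      Hinv := fun y z h ↦ by show 2 * σ * cl N R y ℓ = 2 * σ * cl N R z ℓ; simp only [cl, h]
      hB := fun y ↦ rfl
      B0 := fun y hy ↦ by
        have hm := cl_mem R0 y
        have h0 : cl N R y ℓ = 0 := by simp only [cl, if_true, hy]; rw [min_eq_right (by linarith), max_self]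
        have hU : U (Ψ (cl N R y)) = 0 := by rw [(hΨ _ hm).2.2.2, h0]
        have hf := D.fG _ ⟨(D.U_nonneg (hK _ hm).1 (hK _ hm).2).2.1 hU, (hK _ hm).2⟩
        rw [Fin.sum_univ_castSucc] at hf
        show 1 + 2 * σ * cl N R y ℓ - ∑ j : Fin N, G j.castSucc (Ψ (cl N R y)) * G j.castSucc (Ψ (cl N R y)) - (1 + (G ℓ (Ψ (cl N R y)) - 1)) ^ 2 = 0
        simp_rw [← sq]
        rw [h0, add_sub_cancel]; linarith
      dv := fun p hp ↦ by
        have e := ev (fun q ↦ Ψ q ℓ) p hp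
        have hd := ((sΨ p hp).differentiableAt (by simp)).hasFDerivAt
        have h1 : HasFDerivAt v ((prj ℓ).comp (fderiv ℝ Ψ p)) p := ((prj _).hasFDerivAt.comp p hd).congr_of_eventuallyEq e
        refine ⟨h1.differentiableAt, fun j ↦ ?_, ?_⟩
        · rw [h1.fderiv]
          show fderiv ℝ Ψ p (eb j.castSucc) ℓ = -(G j.castSucc (Ψ (cl N R p)) * (1 + (_ - 1)))
          rw [hL p hp, cl_id (QB hp), if_neg (Fin.castSucc_ne_last j), if_neg (Fin.castSucc_ne_last j), add_sub_cancel]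
          simp [el, eb, (Fin.castSucc_ne_last j).symm]; ring
        · rw [h1.fderiv]
          show fderiv ℝ Ψ p (eb ℓ) ℓ = 1 + ((G ℓ (Ψ (cl N R p)))⁻¹ - 1)
          rw [hL p hp, cl_id (QB hp), if_pos rfl, if_pos rfl, add_sub_cancel]
          simp [el, eb]
      dB := fun p hp ↦ by
        have g0 : G ℓ (Ψ p) ≠ 0 := by have := (gp p (QB hp)).1; intro h; linarith
        have hd := ((sΨ p hp).differentiableAt (by simp)).hasFDerivAt
        have hg : ∀ i, HasFDerivAt (fun q ↦ G i (Ψ q)) ((fderiv ℝ (G i) (Ψ p)).comp (fderiv ℝ Ψ p)) p := fun i ↦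
          ((D.Gs (ΨO p hp) i).differentiableAt (by simp)).hasFDerivAt.comp p hd
        have ha : ∀ j, HasFDerivAt (a j) ((fderiv ℝ (G j.castSucc) (Ψ p)).comp (fderiv ℝ Ψ p)) p := fun j ↦
          (hg j.castSucc).congr_of_eventuallyEq (ev (fun q ↦ G j.castSucc (Ψ q)) p hp)
        have hb : HasFDerivAt b ((fderiv ℝ (G ℓ) (Ψ p)).comp (fderiv ℝ Ψ p)) p :=
          ((hg ℓ).sub_const 1).congr_of_eventuallyEq (ev (fun q ↦ G ℓ (Ψ q) - 1) p hp)
        have hH : HasFDerivAt H ((2 * σ) • prj ℓ) p :=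
          ((prj ℓ).hasFDerivAt.const_mul (2*σ)).congr_of_eventuallyEq (ev (fun q ↦ 2 * σ * q ℓ) p hp)
        have hBd := ((hH.const_add 1).sub (HasFDerivAt.fun_sum (u := Finset.univ) fun j _ ↦ (ha j).mul (ha j))).sub ((hb.const_add 1).pow 2)
        refine ⟨fun j ↦ (ha j).differentiableAt, HasFDerivAt.differentiableAt hBd, ?_⟩
        have eB : fderiv ℝ Bn p = _ := HasFDerivAt.fderiv hBd
        have lapp := D.lap _ (ΨO p hp)
        rw [Fin.sum_univ_castSucc] at lapp
        have ea : ∀ j, a j p = G j.castSucc (Ψ p) := fun j ↦ (ev (fun q ↦ G j.castSucc (Ψ q)) p hp).eq_of_nhds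
        have eb' : 1 + b p = G ℓ (Ψ p) := by
          show 1 + (G ℓ (Ψ (cl N R p)) - 1) = _; rw [cl_id (QB hp)]; ring
        rw [eB]
        simp only [fun j ↦ (ha j).fderiv, ContinuousLinearMap.sub_apply, ContinuousLinearMap.sum_apply, ContinuousLinearMap.add_apply, ContinuousLinearMap.smul_apply,
          ContinuousLinearMap.comp_apply, hL p hp, ea, eb', if_true, if_neg (Fin.castSucc_ne_last _), map_add, map_smul, smul_eq_mul, zero_add]
        have e1 : (prj ℓ : Yn N →L[ℝ] ℝ) (eb ℓ) = 1 := by simp [prj_ap, eb]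
        rw [e1]
        have e2 : ∀ j : Fin N, -2 * ((fderiv ℝ (G j.castSucc) (Ψ p)) (eb j.castSucc) + -G j.castSucc (Ψ p) / G ℓ (Ψ p) * (fderiv ℝ (G j.castSucc) (Ψ p)) (el N))
            = -2 * (fderiv ℝ (G j.castSucc) (Ψ p)) (eb j.castSucc) + (G j.castSucc (Ψ p) * (1 / G ℓ (Ψ p) * (fderiv ℝ (G j.castSucc) (Ψ p)) (el N)) +
              G j.castSucc (Ψ p) * (1 / G ℓ (Ψ p) * (fderiv ℝ (G j.castSucc) (Ψ p)) (el N))) := fun j ↦ by ring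
        simp_rw [e2]
        rw [Finset.sum_add_distrib, ← Finset.mul_sum]
        have e3 : G ℓ (Ψ p) * (1 / G ℓ (Ψ p)) = 1 := by field_simp
        linear_combination (-2) * lapp - 2 * (fderiv ℝ (G ℓ) (Ψ p)) (el N) * e3 }
  have sv : ContDiffOn ℝ ⊤∞ v (Qb N (R/8)) := fun p hp ↦
    (((prj ℓ).contDiff.contDiffAt.comp p (sΨ p hp)).congr_of_eventuallyEq (ev (fun q ↦ Ψ q ℓ) p hp)).contDiffWithinAt
  obtain ⟨W, w1, w2, w3⟩ := Hd.words (σ := σ) (fun p hp ↦ by show 2 * σ * cl N R p ℓ = _; rw [cl_id (QB hp)]) sv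
    (fun p hp ↦ (((sΨ' p hp ℓ).sub contDiffAt_const).congr_of_eventuallyEq (ev (fun q ↦ G ℓ (Ψ q) - 1) p hp)).contDiffWithinAt)
    (fun p hp ↦ ((((sΨ' p hp ℓ).inv (by have := (gp p (QB hp)).1; intro h; linarith)).sub contDiffAt_const).congr_of_eventuallyEq (ev (fun q ↦ (G ℓ (Ψ q))⁻¹ - 1) p hp)).contDiffWithinAt)
    (fun j p hp ↦ ((sΨ' p hp j.castSucc).congr_of_eventuallyEq (ev (fun q ↦ G j.castSucc (Ψ q)) p hp)).contDiffWithinAt)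
  obtain ⟨V, cV, hV⟩ := words_ext sv w1 w2 w3 (ρ := R/16) (by positivity) (by linarith)
  refine ⟨V, cV, R/16, by positivity, fun p hp ↦ ?_⟩
  have hp8 : p ∈ Qb N (R/8) := ⟨hp.1.trans (by linarith), hp.2⟩
  have hΨp := hΨ p (QB hp8)
  refine ⟨Ψ p, (ΨO p hp8).1, hΨp.2.1, hΨp.2.2.1, hΨp.2.2.2, ?_, ?_⟩
  · rw [hV p hp.1 hp.2]; show _ = Ψ (cl N R p) _; rw [cl_id (QB hp8)]
  · have : V =ᶠ[nhds p] v := by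
      filter_upwards [(Qb_open N (R/16)).mem_nhds hp] with q hq using hV q hq.1 hq.2
    rw [this.fderiv_eq, (Hd.dv p hp8).2.2]
    show _ ≤ 1 + ((G ℓ (Ψ (cl N R p)))⁻¹ - 1)
    rw [cl_id (QB hp8), add_sub_cancel]
    have := gp p (QB hp8)
    rw [le_inv_comm₀ (by norm_num) (by linarith)]; linarith
end LD
end

lemma glob_ext {E : Type*} [NormedAddCommGroup E] [NormedSpace ℝ E] [FiniteDimensional ℝ E] {f : E → ℝ} {x : E} {ε : ℝ} (h0 : 0 < ε)
    (hf : ContDiffOn ℝ ⊤∞ f (ball x ε)) : ∃ F : E → ℝ, ContDiff ℝ ⊤∞ F ∧ ∀ y ∈ ball x (ε/3), F y = f y := by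
  let b : ContDiffBump x := ⟨ε/3, ε/2, by positivity, by linarith⟩
  refine ⟨fun y ↦ b y * f y, contDiff_iff_contDiffAt.2 fun y ↦ ?_, fun y hy ↦ by
    show b y * f y = f y
    rw [b.one_of_mem_closedBall (ball_subset_closedBall hy), one_mul]⟩
  by_cases hy : y ∈ ball x ε
  · exact b.contDiffAt.mul (hf.contDiffAt (isOpen_ball.mem_nhds hy))
  · have : (fun y ↦ b y * f y) =ᶠ[nhds y] fun _ ↦ 0 := by
      have hy' : ε / 2 < dist y x := by rw [mem_ball, not_lt] at hy; linarith
      filter_upwards [(isOpen_lt continuous_const (continuous_id.dist continuous_const)).mem_nhds hy'] with z hz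
      show b z * f z = 0
      rw [b.zero_of_le_dist (show ε/2 ≤ dist z x from le_of_lt hz), zero_mul]
    exact contDiffAt_const.congr_of_eventuallyEq this

section
variable {N : ℕ} {O : Set (Yn N)} {U : Yn N → ℝ} {G : Fin (N+1) → Yn N → ℝ} {R σ : ℝ}
namespace LD

lemma zero_fr (D : LD N O U G R σ) : (𝟎 N) ∈ frontier O := by
  rw [D.oO.frontier_eq]
  refine ⟨?_, D.zero_notMem⟩
  have cf : Continuous fun s : ℝ ↦ s • el N := by fun_prop
  refine mem_closure_of_tendsto (f := fun s : ℝ ↦ s • el N) (b := nhdsWithin 0 (Ioi 0)) ?_ ?_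
  · have := (cf.tendsto 0).mono_left (nhdsWithin_le_nhds (s := Ioi 0)); rwa [zero_smul] at this
  · filter_upwards [self_mem_nhdsWithin, mem_nhdsWithin_of_mem_nhds (Iio_mem_nhds D.R0)] with s hs hs'
    have hs : 0 < s := hs
    have hs' : s < R := hs'
    have e : ‖s • el N‖ = s := by rw [norm_smul, show ‖el N‖ = 1 by simp [el, eb, Pi.norm_single]]; simp [abs_of_pos hs]
    exact D.up _ (by rwa [e]) (by rw [e]; simp [el, eb]; linarith)

lemma loc (D : LD N O U G R σ) : ∃ ε > 0, ∃ w : Yn N → ℝ, ContDiff ℝ ⊤∞ w ∧ fderiv ℝ w 0 ≠ 0 ∧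
    ∀ y, ‖y‖ < ε → (y ∈ O ↔ 0 < w y) ∧ (y ∈ O → w y = U y) := by
  have R0 := D.R0
  have z0 := D.zero_fr
  have zc := frontier_subset_closure z0
  have zb : (𝟎 N) ∈ ball 0 R := by simpa using R0
  have U0 : U 0 = 0 := D.fU 0 ⟨z0, zb⟩
  obtain ⟨V, cV, ρ, ρ0, hV⟩ := D.ext_v
  have cdV : Continuous fun p ↦ fderiv ℝ V p (el N) := ((cV.fderiv_right (m := ⊤∞) (by simp)).clm_apply contDiff_const).continuous
  have cf : Continuous fun s : ℝ ↦ s • el N := by fun_prop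
  have inQ : ∀ᶠ s in nhdsWithin (0:ℝ) (Ioi 0), s • el N ∈ Qb N ρ ∧ 0 < s ∧ s < R / 2:= by
    filter_upwards [self_mem_nhdsWithin, mem_nhdsWithin_of_mem_nhds (Iio_mem_nhds ρ0), mem_nhdsWithin_of_mem_nhds (Iio_mem_nhds (half_pos R0))] with s hs hs' hR
    have hs : 0 < s := hs
    have e : ‖s • el N‖ = s := by rw [norm_smul, show ‖el N‖ = 1 by simp [el, eb, Pi.norm_single]]; simp [abs_of_pos hs]
    exact ⟨⟨by rw [e]; exact hs', by simpa [el, eb] using hs⟩, hs, hR⟩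
  have t0 : Filter.Tendsto (fun s : ℝ ↦ s • el N) (nhdsWithin 0 (Ioi 0)) (nhds 0) := by
    have := (cf.tendsto 0).mono_left (nhdsWithin_le_nhds (s := Ioi 0)); rwa [zero_smul] at this
  have dV0 : 5 / 6 ≤ fderiv ℝ V 0 (el N) := ge_of_tendsto ((cdV.tendsto 0).comp t0) (inQ.mono fun s hs ↦ by
    obtain ⟨y, -, -, -, -, -, h⟩ := hV _ hs.1; exact h)
  have V0 : V 0 = 0 := by
    refine tendsto_nhds_unique ((cV.continuous.tendsto 0).comp t0) ?_
    have ts : Filter.Tendsto (fun s : ℝ ↦ 10 / 9 * s) (nhdsWithin 0 (Ioi 0)) (nhds 0) := by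
      have := ((show Continuous fun s : ℝ ↦ 10 / 9 * s by fun_prop).tendsto 0).mono_left (nhdsWithin_le_nhds (s := Ioi 0)); rwa [mul_zero] at this
    refine tendsto_of_tendsto_of_tendsto_of_le_of_le' tendsto_const_nhds ts (inQ.mono fun s hs ↦ ?_) (inQ.mono fun s hs ↦ ?_)
    all_goals
      obtain ⟨y, yO, yn, yi, yU, yV, -⟩ := hV _ hs.1
      have ys : y = V (s • el N) • el N := yext (fun i hi ↦ by rw [yi i hi]; simp [el, eb, hi]) (by rw [yV]; simp [el, eb])
      have yb : y ∈ ball (𝟎 N) R := by rw [mem_ball_zero_iff]; linarith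
      have Vp : 0 < V (s • el N) := by
        rcases lt_trichotomy (V (s • el N)) 0 with h | h | h
        · have e : y + (-V (s • el N)) • el N = 0 := by rw [ys, ← add_smul]; simp
          have := D.mono0 yO yb (s := -V (s • el N)) (by linarith) (by rw [e]; exact zb)
          rw [e] at this
          exact absurd this D.zero_notMem
        · rw [h, zero_smul] at ys; rw [ys] at yO; exact absurd yO D.zero_notMem
        · exact h
    · exact Vp.le
    · have := D.monoU zc zb Vp (by rw [zero_add, ← ys]; exact yb)
      rw [zero_add, ← ys, U0, yU] at this
      have e : (s • el N) ℓ = s := by simp [el, eb]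
      rw [e] at this
      show V (s • el N) ≤ _
      linarith
  have sP : ContDiff ℝ ⊤∞ (Ph V) := contDiff_id.add ((cV.sub (prj ℓ).contDiff).smul contDiff_const)
  obtain ⟨A, hA⟩ := graph_equiv ((cV.differentiable (by simp)) 0).hasFDerivAt (by intro h; rw [h] at dV0; norm_num at dV0)
  have P0 : Ph V 0 = 0 := by simp [Ph, V0]
  let e := sP.contDiffAt.toOpenPartialHomeomorph (Ph V) hA (by simp)
  have ec : (e : Yn N → Yn N) = Ph V := rfl
  have es : (𝟎 N) ∈ e.source := ContDiffAt.mem_toOpenPartialHomeomorph_source sP.contDiffAt hA (by simp)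
  have et : (𝟎 N) ∈ e.target := by have := e.map_source es; rwa [ec, P0] at this
  have e0 : e.symm 0 = 0 := by have := e.left_inv es; rwa [ec, P0] at this
  have ce : ContinuousAt e.symm 0 := e.continuousAt_symm et
  have A1 : ∀ᶠ y in nhds (𝟎 N), y ∈ e.target ∧ ‖e.symm y‖ < ρ ∧ 0 < fderiv ℝ V (e.symm y) (el N) ∧ ‖y‖ < R := by
    have h1 := ce.norm.eventually_lt (continuousAt_const (y := ρ)) (by rw [e0]; simpa using ρ0)
    have h2 := (continuousAt_const (y := (0:ℝ))).eventually_lt ((ContinuousAt.comp (x := (𝟎 N)) (f := e.symm) (g := fun p ↦ fderiv ℝ V p (el N)) cdV.continuousAt ce)) (by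
      show 0 < fderiv ℝ V (e.symm 0) (el N); rw [e0]; linarith)
    filter_upwards [e.open_target.mem_nhds et, h1, h2, isOpen_ball.mem_nhds zb] with y h h' h'' h3 using ⟨h, h', h'', mem_ball_zero_iff.1 h3⟩
  have A2 : ∀ᶠ y in nhdsWithin (𝟎 N) (closure O ∩ ball 0 R), Ph U y ∈ e.source ∧ ‖Ph U y‖ < ρ := by
    have Pc : ContinuousOn (Ph U) (closure O ∩ ball 0 R) :=
      continuousOn_id.add ((D.cU.sub (continuous_apply ℓ).continuousOn).smul continuousOn_const)
    have c := (Pc 0 ⟨zc, zb⟩).tendsto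
    rw [show Ph U 0 = 0 by simp [Ph, U0]] at c
    filter_upwards [c (e.open_source.mem_nhds es), c (isOpen_ball.mem_nhds (mem_ball_self ρ0))] with y h h' using ⟨h, mem_ball_zero_iff.1 h'⟩
  obtain ⟨ε1, ε10, hε1⟩ := Metric.eventually_nhds_iff.1 A1
  obtain ⟨ε2, ε20, hε2⟩ := Metric.eventually_nhds_iff.1 (eventually_nhdsWithin_iff.1 A2)
  obtain ⟨w, sw, ew⟩ := glob_ext (x := (𝟎 N)) (f := fun y ↦ e.symm y ℓ) ε10 (fun y hy ↦ by
    have h := hε1 (mem_ball.1 hy)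
    obtain ⟨B, hB⟩ := graph_equiv ((cV.differentiable (by simp)) (e.symm y)).hasFDerivAt (ne_of_gt h.2.2.1)
    have h2 : ContDiffAt ℝ ⊤∞ e.symm y := e.contDiffAt_symm h.1 hB sP.contDiffAt
    exact ((prj ℓ).contDiff.contDiffAt.comp y h2).contDiffWithinAt)
  refine ⟨min (ε1/3) ε2, by positivity, w, sw, fun h ↦ ?_, fun y hy ↦ ?_⟩
  · have h1 : HasFDerivAt w (0 : Yn N →L[ℝ] ℝ) (Ph V 0) := by rw [P0, ← h]; exact ((sw.differentiable (by simp)) 0).hasFDerivAt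
    have h2 := h1.comp (𝟎 N) hA
    have h3 : HasFDerivAt (w ∘ Ph V) (prj ℓ) (𝟎 N) := (prj ℓ).hasFDerivAt.congr_of_eventuallyEq (by
      filter_upwards [e.open_source.mem_nhds es, (sP.continuous.continuousAt (x := (𝟎 N))) (isOpen_ball.mem_nhds (show Ph V 0 ∈ ball (𝟎 N) (ε1/3) by rw [P0]; exact mem_ball_self (by positivity)))] with p hp hp'
      rw [Function.comp, ew _ hp', ← ec, e.left_inv hp]; rfl)
    have h4 := congrArg (fun M : Yn N →L[ℝ] ℝ ↦ M (el N)) (h2.unique h3)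
    simp [prj_ap, el, eb] at h4
  · have hy1 : y ∈ ball (𝟎 N) (ε1/3) := mem_ball_zero_iff.2 (hy.trans_le (min_le_left _ _))
    have g1 := hε1 (show dist y 0 < ε1 by have := mem_ball.1 hy1; linarith)
    have yb : y ∈ ball (𝟎 N) R := mem_ball_zero_iff.2 g1.2.2.2
    rw [ew y hy1]
    have fw : y ∈ O → e.symm y ℓ = U y := fun yO ↦ by
      have g2 := hε2 (show dist y 0 < ε2 by rw [dist_zero_right]; exact hy.trans_le (min_le_right _ _)) ⟨subset_closure yO, yb⟩
      obtain ⟨z, zO, zn, zi, zU, zV, -⟩ := hV (Ph U y) ⟨g2.2, by rw [Ph_last]; exact D.pos yO yb⟩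
      have ezy : z = y := D.inj ⟨subset_closure zO, by rw [mem_ball_zero_iff]; linarith⟩ ⟨subset_closure yO, yb⟩ (fun i hi ↦ by
        rw [zi i hi, Ph_ne _ _ hi]) (by rw [zU, Ph_last])
      have : e (Ph U y) = y := by
        rw [ec]; exact yext (fun i hi ↦ by rw [Ph_ne _ _ hi, Ph_ne _ _ hi]) (by rw [Ph_last, ← zV, ezy])
      have h5 := e.left_inv g2.1
      rw [this] at h5
      rw [h5, Ph_last]
    refine ⟨⟨fun yO ↦ by rw [fw yO]; exact D.pos yO yb, fun h ↦ ?_⟩, fw⟩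
    obtain ⟨z, zO, zn, zi, zU, zV, -⟩ := hV (e.symm y) ⟨g1.2.1, h⟩
    have h5 := e.right_inv g1.1
    rw [ec] at h5
    have : z = y := yext (fun i hi ↦ by rw [zi i hi, ← h5, Ph_ne _ _ hi, h5]) (by rw [zV, ← h5, Ph_last, h5])
    rwa [← this]
end LD
end

section
variable {N : ℕ}

lemma mean_val {O : Set (Yn N)} {w φ Ψ : Yn N → ℝ} {G : Fin (N+1) → Yn N → ℝ}
    (dw : ∀ y ∈ O, DifferentiableAt ℝ w y) (dG : ∀ i, ∀ y ∈ O, DifferentiableAt ℝ (G i) y)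
    (wG : ∀ y ∈ O, ∀ i, fderiv ℝ w y (eb i) = G i y) (lap : ∀ y ∈ O, ∑ i, fderiv ℝ (G i) y (eb i) = 0)
    {x : Yn N} {r : ℝ} (r0 : 0 < r) (hr : closedBall x r ⊆ O) (dφ : Differentiable ℝ φ) (dΨ : Differentiable ℝ Ψ)
    (hΨ : ∀ z i, fderiv ℝ Ψ z (eb i) = z i * φ z) (hΨ0 : ∀ z i, |z i| = r → Ψ z = 0) :
    ∫ z in Icc (fun _ ↦ -r) (fun _ ↦ r), w (x + z) * φ z = w x * ∫ z in Icc (fun _ : Fin (N+1) ↦ -r) (fun _ ↦ r), φ z := by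
  let τ : Yn (N+1) →L[ℝ] Yn N := ContinuousLinearMap.pi fun i ↦ prj i.succ
  let T : Yn (N+1) → Yn N := fun p ↦ x + p 0 • τ p
  let a : Yn (N+1) := Fin.cons 0 fun _ ↦ -r
  let b : Yn (N+1) := Fin.cons 1 fun _ ↦ r
  have hab : a ≤ b := fun i ↦ by refine Fin.cases ?_ (fun i ↦ ?_) i <;> simp [a, b]; linarith
  have τa : ∀ p i, τ p i = p i.succ := fun p i ↦ rfl
  have TO : ∀ p ∈ Icc a b, T p ∈ O := fun p hp ↦ hr (by
    have h0 : 0 ≤ p 0 ∧ p 0 ≤ 1 := ⟨hp.1 0, hp.2 0⟩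
    rw [mem_closedBall, dist_eq_norm, add_sub_cancel_left, norm_smul, Real.norm_eq_abs, abs_of_nonneg h0.1]
    have : ‖τ p‖ ≤ r := (pi_norm_le_iff_of_nonneg r0.le).2 fun i ↦ abs_le.2 ⟨hp.1 i.succ, hp.2 i.succ⟩
    nlinarith [norm_nonneg (τ p)])
  have cT : Continuous T := by fun_prop
  have dT : ∀ p, HasFDerivAt T (p 0 • τ + (prj (0 : Fin (N+2))).smulRight (τ p)) p := fun p ↦
    ((prj (0 : Fin (N+2))).hasFDerivAt.smul τ.hasFDerivAt).const_add x
  let F : Fin (N+2) → Yn (N+1) → ℝ := Fin.cons (fun p ↦ w (T p) * φ (τ p)) fun i p ↦ -(G i (T p) * Ψ (τ p))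
  have d0 : ∀ p ∈ Icc a b, HasFDerivAt (F 0) (w (T p) • (fderiv ℝ φ (τ p)).comp τ + φ (τ p) • (fderiv ℝ w (T p)).comp (p 0 • τ + (prj (0 : Fin (N+2))).smulRight (τ p))) p := fun p hp ↦
    ((dw _ (TO p hp)).hasFDerivAt.comp p (dT p)).mul ((dφ (τ p)).hasFDerivAt.comp p τ.hasFDerivAt)
  have dS : ∀ p ∈ Icc a b, ∀ i : Fin (N+1), HasFDerivAt (F i.succ) (-(G i (T p) • (fderiv ℝ Ψ (τ p)).comp τ + Ψ (τ p) • (fderiv ℝ (G i) (T p)).comp (p 0 • τ + (prj (0 : Fin (N+2))).smulRight (τ p)))) p := fun p hp i ↦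
    (((dG i _ (TO p hp)).hasFDerivAt.comp p (dT p)).mul ((dΨ (τ p)).hasFDerivAt.comp p τ.hasFDerivAt)).neg
  have dF : ∀ p ∈ Icc a b, ∀ i, DifferentiableAt ℝ (F i) p := fun p hp i ↦ by
    refine Fin.cases ?_ (fun i ↦ ?_) i
    · exact (d0 p hp).differentiableAt
    · exact (dS p hp i).differentiableAt
  have τ0 : τ (Pi.single 0 1) = 0 := by ext i; rw [τa]; simp
  have τs : ∀ i : Fin (N+1), τ (Pi.single i.succ 1) = eb i := fun i ↦ by
    ext j; rw [τa]; simp [eb, Pi.single_apply]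
  have dv : ∀ p ∈ Icc a b, ∑ i, fderiv ℝ (F i) p (Pi.single i 1) = 0 := fun p hp ↦ by
    rw [Fin.sum_univ_succ, (d0 p hp).fderiv]
    have e : ∀ i : Fin (N+1), fderiv ℝ (F i.succ) p (Pi.single i.succ 1) = -(G i (T p) * (τ p i * φ (τ p))) - p 0 * Ψ (τ p) * fderiv ℝ (G i) (T p) (eb i) := fun i ↦ by
      rw [(dS p hp i).fderiv]
      simp [τs, hΨ, prj_ap]; ring
    simp_rw [e]
    rw [Finset.sum_sub_distrib, ← Finset.mul_sum, lap _ (TO p hp)]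
    simp only [add_apply, smul_apply, ContinuousLinearMap.comp_apply, τ0, ContinuousLinearMap.smulRight_apply, prj_ap]
    rw [clm_sum (fderiv ℝ w (T p))]
    simp [wG _ (TO p hp), prj_ap, Finset.mul_sum]
    rw [← sub_eq_add_neg, sub_eq_zero]
    exact Finset.sum_congr rfl fun i _ ↦ by ring
  have I0 : (fun p ↦ ∑ i, fderiv ℝ (F i) p (Pi.single i 1)) =ᵐ[volume.restrict (Icc a b)] fun _ ↦ 0 :=
    (ae_restrict_iff' measurableSet_Icc).2 (Filter.Eventually.of_forall dv)
  have H := integral_divergence_of_hasFDerivAt_off_countable' a b hab F (fun i x ↦ fderiv ℝ (F i) x)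
    ∅ countable_empty (fun i p hp ↦ (dF p hp i).continuousAt.continuousWithinAt)
    (fun p hp i ↦ (dF p ⟨fun j ↦ (hp.1 j (mem_univ j)).1.le, fun j ↦ (hp.1 j (mem_univ j)).2.le⟩ i).hasFDerivAt)
    (IntegrableOn.congr_fun_ae integrableOn_zero I0.symm)
  rw [integral_congr_ae I0, integral_zero, Fin.sum_univ_succ, Finset.sum_eq_zero, add_zero] at H
  · have e1 : ∀ z : Yn N, F 0 ((0 : Fin (N+2)).insertNth (b 0) z) = w (x + z) * φ z := fun z ↦ by
      simp [F, T, b]; rfl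
    have e2 : ∀ z : Yn N, F 0 ((0 : Fin (N+2)).insertNth (a 0) z) = w x * φ z := fun z ↦ by
      simp [F, T, a]; exact Or.inl rfl
    simp_rw [e1, e2] at H
    rw [integral_const_mul] at H
    exact (sub_eq_zero.1 H.symm)
  · intro i _
    have key : ∀ c, |c| = r → ∀ z : Yn N, F i.succ (i.succ.insertNth c z) = 0 := fun c hc z ↦ by
      have : Ψ (τ (i.succ.insertNth c z)) = 0 := hΨ0 _ i (by rw [τa]; simpa using hc)
      simp [F, this]
    simp only [key (b i.succ) (by simp [b, abs_of_pos r0]), key (a i.succ) (by simp [a, abs_of_pos r0]), integral_zero, sub_zero]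

open scoped Convolution in
lemma harm_smooth {O : Set (Yn N)} (oO : IsOpen O) {w : Yn N → ℝ} {G : Fin (N+1) → Yn N → ℝ}
    (dw : ∀ y ∈ O, DifferentiableAt ℝ w y) (dG : ∀ i, ∀ y ∈ O, DifferentiableAt ℝ (G i) y)
    (wG : ∀ y ∈ O, ∀ i, fderiv ℝ w y (eb i) = G i y) (lap : ∀ y ∈ O, ∑ i, fderiv ℝ (G i) y (eb i) = 0) :
    ContDiffOn ℝ ⊤∞ w O := by
  intro x0 hx0
  obtain ⟨r', r0', hr'⟩ := Metric.isOpen_iff.1 oO x0 hx0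
  obtain ⟨r, r0, rr⟩ : ∃ r, 0 < r ∧ 2 * r < r' := ⟨r'/3, by positivity, by linarith⟩
  have hr : closedBall x0 (2 * r) ⊆ O := (closedBall_subset_ball rr).trans hr'
  let h : ℝ → ℝ := fun t ↦ Real.smoothTransition (1 - t / r^2)
  have sh : ContDiff ℝ ⊤∞ h := Real.smoothTransition.contDiff.comp (by fun_prop)
  have h0 : ∀ t, r^2 ≤ t → h t = 0 := fun t ht ↦ Real.smoothTransition.zero_of_nonpos (by
    rw [sub_nonpos, one_le_div (by positivity)]; exact ht)
  let s : Yn N → ℝ := fun z ↦ ∑ i, z i ^ 2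
  have ss : ContDiff ℝ ⊤∞ s := by fun_prop
  have ds : ∀ z, HasFDerivAt s (∑ i, (2 * z i) • prj i) z := fun z ↦ by
    refine HasFDerivAt.fun_sum fun i _ ↦ ?_
    have := ((prj i).hasFDerivAt (x := z)).pow 2
    simpa [prj_ap] using this
  have s1 : ∀ z : Yn N, ∀ i, r ≤ |z i| → r^2 ≤ s z := fun z i hi ↦ by
    have h1 : z i ^ 2 ≤ s z := Finset.single_le_sum (f := fun i ↦ z i ^ 2) (fun j _ ↦ sq_nonneg _) (Finset.mem_univ i)
    rw [← sq_abs] at h1; nlinarith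
  let q : ℝ → ℝ := fun t ↦ (∫ u in (r^2)..t, h u) / 2
  have dq : ∀ t, HasDerivAt q (h t / 2) t := fun t ↦ (sh.continuous.integral_hasStrictDerivAt _ t).hasDerivAt.div_const 2
  have q0 : ∀ t, r^2 ≤ t → q t = 0 := fun t ht ↦ by
    have : ∫ u in (r^2)..t, h u = ∫ u in (r^2)..t, (0:ℝ) := intervalIntegral.integral_congr fun u hu ↦ h0 u (by rw [uIcc_of_le ht] at hu; exact hu.1)
    simp [q, this]
  let φ : Yn N → ℝ := fun z ↦ h (s z)
  have sφ : ContDiff ℝ ⊤∞ φ := sh.comp ss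
  have dΨ : ∀ z, HasFDerivAt (fun z ↦ q (s z)) ((h (s z) / 2) • ∑ i, (2 * z i) • prj i) z := fun z ↦ (dq (s z)).comp_hasFDerivAt z (ds z)
  have φ0 : ∀ z, z ∉ Icc (fun _ : Fin (N+1) ↦ -r) (fun _ ↦ r) → φ z = 0 := fun z hz ↦ by
    by_contra hc
    refine hz ⟨fun i ↦ ?_, fun i ↦ ?_⟩ <;> by_contra hi <;> exact hc (h0 _ (s1 z i (by
      simp only [not_le] at hi; first | exact (by linarith : r ≤ -z i).trans (neg_le_abs _) | exact hi.le.trans (le_abs_self _))))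
  have cφ : HasCompactSupport φ := HasCompactSupport.intro isCompact_Icc φ0
  have φp : 0 < ∫ z, φ z := sφ.continuous.integral_pos_of_hasCompactSupport_nonneg_nonzero (x := (𝟎 N)) cφ
    (fun z ↦ Real.smoothTransition.nonneg _) (by simp [φ, h, s, Real.smoothTransition.one_of_one_le])
  let w' : Yn N → ℝ := (closedBall x0 (2 * r)).indicator w
  have Lw : LocallyIntegrable w' := ((ContinuousOn.integrableOn_compact (isCompact_closedBall x0 (2*r)) fun y hy ↦ (dw y (hr hy)).continuousAt.continuousWithinAt).integrable_indicator measurableSet_closedBall).locallyIntegrable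
  have sc := cφ.contDiff_convolution_right (ContinuousLinearMap.mul ℝ ℝ) Lw sφ
  have key : ∀ x ∈ ball x0 r, w x = (w' ⋆[ContinuousLinearMap.mul ℝ ℝ, volume] φ) x / ∫ z, φ z := fun x hx ↦ by
    have bs : closedBall x r ⊆ closedBall x0 (2 * r) := closedBall_subset_closedBall' (by have := mem_ball.1 hx; linarith)
    have m := mean_val dw dG wG lap r0 (bs.trans hr) (sφ.differentiable (by simp)) (fun z ↦ (dΨ z).differentiableAt)
      (fun z i ↦ by rw [(dΨ z).fderiv]; simp [prj_ap, eb, Pi.single_apply, φ]; ring) (fun z i hi ↦ q0 _ (s1 z i hi.ge))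
    rw [eq_div_iff φp.ne', ← setIntegral_eq_integral_of_forall_compl_eq_zero (s := Icc (fun _ : Fin (N+1) ↦ -r) (fun _ ↦ r)) (fun z hz ↦ φ0 z hz), ← m, convolution_def,
      ← integral_add_left_eq_self (μ := volume) (fun t ↦ ContinuousLinearMap.mul ℝ ℝ (w' t) (φ (x - t))) x]
    refine Eq.trans ?_ (setIntegral_eq_integral_of_forall_compl_eq_zero (s := Icc (fun _ : Fin (N+1) ↦ -r) (fun _ ↦ r)) fun z hz ↦ ?_)
    · refine setIntegral_congr_fun measurableSet_Icc fun z hz ↦ ?_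
      have zb : x + z ∈ closedBall x0 (2 * r) := bs (by
        rw [mem_closedBall, dist_eq_norm, add_sub_cancel_left]
        exact (pi_norm_le_iff_of_nonneg r0.le).2 fun i ↦ abs_le.2 ⟨hz.1 i, hz.2 i⟩)
      simp [w', indicator_of_mem zb, φ, s]
    · have := φ0 z hz
      simp only [φ, s] at this
      simp [φ, s, this]
  refine (ContDiffAt.congr_of_eventuallyEq (sc.div_const (∫ z, φ z)).contDiffAt ?_).contDiffWithinAt
  filter_upwards [isOpen_ball.mem_nhds (mem_ball_self r0)] with x hx using key x hx

lemma poi_smooth {O : Set (Yn N)} (oO : IsOpen O) {w : Yn N → ℝ} {G : Fin (N+1) → Yn N → ℝ} {σ : ℝ}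
    (dw : ∀ y ∈ O, DifferentiableAt ℝ w y) (dG : ∀ i, ∀ y ∈ O, DifferentiableAt ℝ (G i) y)
    (wG : ∀ y ∈ O, ∀ i, fderiv ℝ w y (eb i) = G i y) (lap : ∀ y ∈ O, ∑ i, fderiv ℝ (G i) y (eb i) = σ) :
    ContDiffOn ℝ ⊤∞ w O := by
  have dq : ∀ z, HasFDerivAt (fun z : Yn N ↦ σ / 2 * z 0 ^ 2) ((σ * z 0) • prj 0) z := fun z ↦ by
    have := (((prj (0 : Fin (N+1))).hasFDerivAt (x := z)).pow 2).const_mul (σ / 2)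
    exact this.congr_fderiv (by ext v; simp [prj_ap]; ring)
  have sq : ContDiff ℝ ⊤∞ fun z : Yn N ↦ σ / 2 * z 0 ^ 2 := by fun_prop
  have := harm_smooth oO (w := fun z ↦ w z - σ / 2 * z 0 ^ 2) (G := fun i z ↦ G i z - if i = 0 then σ * z 0 else 0)
    (fun y hy ↦ (dw y hy).sub (dq y).differentiableAt) (fun i y hy ↦ (dG i y hy).sub (by split_ifs <;> fun_prop))
    (fun y hy i ↦ by
      rw [fderiv_fun_sub (dw y hy) (dq y).differentiableAt, sub_apply, wG y hy, (dq y).fderiv]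
      simp [prj_ap, eb, Pi.single_apply, eq_comm]) (fun y hy ↦ by
      have e : ∀ i, fderiv ℝ (fun z ↦ G i z - if i = 0 then σ * z 0 else 0) y (eb i) = fderiv ℝ (G i) y (eb i) - if i = 0 then σ else 0 := fun i ↦ by
        rw [fderiv_fun_sub (dG i y hy) (by split_ifs <;> fun_prop), sub_apply]
        congr 1
        split_ifs with hi
        · have := ((prj (0 : Fin (N+1))).hasFDerivAt (x := y)).const_mul σ
          rw [show fderiv ℝ (fun z : Yn N ↦ σ * z 0) y = _ from this.fderiv, hi]
          simp [prj_ap, eb]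
        · simp
      simp_rw [e]
      rw [Finset.sum_sub_distrib, lap y hy]; simp)
  simpa using this.add sq.contDiffOn
end

structure RD (N : ℕ) (O : Set (Yn N)) (U : Yn N → ℝ) (G : Fin (N+1) → Yn N → ℝ) (R σ : ℝ) : Prop where
  R0 : 0 < R
  oO : IsOpen O
  cU : ContinuousOn U (closure O ∩ ball 0 R)
  cG : ∀ i, ContinuousOn (G i) (closure O ∩ ball 0 R)
  df : ∀ y ∈ O ∩ ball 0 R, DifferentiableAt ℝ U y
  dG : ∀ i, ∀ y ∈ O ∩ ball 0 R, DifferentiableAt ℝ (G i) y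
  dU : ∀ y ∈ O ∩ ball 0 R, ∀ i, fderiv ℝ U y (eb i) = G i y
  lap : ∀ y ∈ O ∩ ball 0 R, ∑ i, fderiv ℝ (G i) y (eb i) = σ
  fU : ∀ y ∈ frontier O ∩ ball 0 R, U y = 0
  fG : ∀ y ∈ frontier O ∩ ball 0 R, ∑ i, G i y ^ 2 = 1
  z0 : (𝟎 N) ∈ frontier O
  fl : ∀ ε > 0, ∃ s > 0, ∀ y : Yn N, ‖y‖ < s → (ε * ‖y‖ < y ℓ → y ∈ O) ∧ (y ℓ < -(ε * ‖y‖) → y ∉ O)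

namespace RD
variable {N : ℕ} {O : Set (Yn N)} {U : Yn N → ℝ} {G : Fin (N+1) → Yn N → ℝ} {R σ : ℝ}

lemma mv (D : RD N O U G R σ) {y d : Yn N} {b : ℝ} (h : 0 < b) (hb : ∀ s ∈ Icc 0 b, y + s • d ∈ closure O ∩ ball 0 R)
    (ho : ∀ s ∈ Ioo 0 b, y + s • d ∈ O) : ∃ s ∈ Ioo 0 b, U (y + b • d) - U y = b * ∑ i, d i * G i (y + s • d) := by
  obtain ⟨s, hs, e⟩ := exists_hasDerivAt_eq_slope (fun s : ℝ ↦ U (y + s • d)) (fun s ↦ ∑ i, d i * G i (y + s • d)) h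
    (D.cU.comp (by fun_prop) hb) fun s hs ↦ by
      have h1 := hb s (Ioo_subset_Icc_self hs)
      have h3 : HasDerivAt (fun s : ℝ ↦ y + s • d) d s := by
        simpa using ((hasDerivAt_id s).smul_const d).const_add y
      have := (D.df _ ⟨ho s hs, h1.2⟩).hasFDerivAt.comp_hasDerivAt s h3
      have e : fderiv ℝ U (y + s • d) d = ∑ i, d i * G i (y + s • d) := by
        rw [clm_sum (fderiv ℝ U (y + s • d))]; simp [D.dU _ ⟨ho s hs, h1.2⟩, prj_ap, mul_comm]
      rwa [e] at this
  refine ⟨s, hs, ?_⟩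
  rw [e]; simp; field_simp

lemma near (D : RD N O U G R σ) (i) {δ : ℝ} (hδ : 0 < δ) : ∃ ρ > 0, ∀ y ∈ closure O ∩ ball 0 R, ‖y‖ < ρ → |G i y - G i 0| < δ := by
  obtain ⟨ρ, h0, h⟩ := Metric.continuousWithinAt_iff.1 (D.cG i 0 ⟨frontier_subset_closure D.z0, mem_ball_self D.R0⟩) δ hδ
  exact ⟨ρ, h0, fun y hy hn ↦ by simpa [Real.dist_eq] using h hy (by simpa using hn)⟩

lemma tan (D : RD N O U G R σ) {j : Fin (N+1)} (hj : j ≠ Fin.last N) : G j 0 = 0 := by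
  have R0 := D.R0
  have U0 : U 0 = 0 := D.fU 0 ⟨D.z0, mem_ball_self R0⟩
  have Gn : |G ℓ 0| ≤ 1 := by
    rw [← sq_le_one_iff_abs_le_one, ← D.fG 0 ⟨D.z0, mem_ball_self R0⟩]
    exact Finset.single_le_sum (f := fun i ↦ G i 0 ^ 2) (fun i _ ↦ sq_nonneg _) (Finset.mem_univ _)
  by_contra hc
  obtain ⟨ε, e0, e1, e2⟩ : ∃ ε > 0, ε ≤ 1/4 ∧ 13 * ε < |G j 0| :=
    ⟨min (1/4) (|G j 0| / 26), by positivity, min_le_left _ _, by have := min_le_right (1/4) (|G j 0| / 26); have := abs_pos.2 hc; linarith⟩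
  obtain ⟨ρ1, p1, h1⟩ := D.near j e0
  obtain ⟨ρ2, p2, h2⟩ := D.near ℓ one_pos
  obtain ⟨ρ3, p3, h3⟩ := D.fl ε e0
  obtain ⟨t, t0, tR, t1, t2, t3⟩ : ∃ t > 0, t < R ∧ t < ρ1 ∧ t < ρ2 ∧ t < ρ3 := by
    have := lt_min (lt_min R0 p1) (lt_min p2 p3)
    obtain ⟨t, h, h'⟩ := exists_between this
    simp only [lt_min_iff] at h'
    exact ⟨t, h, h'.1.1, h'.1.2, h'.2.1, h'.2.2⟩
  have nv : ∀ a b : ℝ, |b| ≤ a → ‖a • eb j + b • el N‖ = a := fun a b hab ↦ by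
    refine le_antisymm ((pi_norm_le_iff_of_nonneg ((abs_nonneg b).trans hab)).2 fun i ↦ ?_) ?_
    · by_cases hi : i = j
      · subst hi; simp [el, eb, hj, abs_of_nonneg ((abs_nonneg b).trans hab)]
      · by_cases hl : i = Fin.last N
        · subst hl; simpa [el, eb, hi] using hab
        · simp [el, eb, hi, hl]; exact (abs_nonneg b).trans hab
    · have := norm_le_pi_norm (a • eb j + b • el N) j
      simpa [el, eb, hj, abs_of_nonneg ((abs_nonneg b).trans hab)] using this
  have ln : ∀ a b : ℝ, (a • eb j + b • el N) ℓ = b := fun a b ↦ by simp [el, eb, hj.symm]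
  let d : Yn N := (1:ℝ) • eb j + (2 * ε) • el N
  have ds : ∀ s : ℝ, 0 + s • d = s • eb j + (2 * ε * s) • el N := fun s ↦ by simp only [d]; module
  have dO : ∀ s ∈ Ioc 0 t, 0 + s • d ∈ O := fun s hs ↦ by
    have := nv s (2 * ε * s) (by rw [abs_of_nonneg (by have := hs.1; positivity)]; nlinarith [hs.1])
    rw [ds]; refine (h3 _ (by rw [this]; linarith [hs.2])).1 ?_
    rw [this, ln]; nlinarith [hs.1]
  have dn : ∀ s ∈ Icc 0 t, ‖0 + s • d‖ = s := fun s hs ↦ by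
    rw [ds, nv _ _ (by rw [abs_of_nonneg (by have := hs.1; positivity)]; nlinarith [hs.1])]
  obtain ⟨s, hs, A⟩ := D.mv (y := 0) (d := d) t0 (fun s hs ↦ ⟨by
      rcases hs.1.eq_or_lt with h | h
      · rw [← h, zero_smul, add_zero]; exact frontier_subset_closure D.z0
      · exact subset_closure (dO s ⟨h, hs.2⟩), by rw [mem_ball_zero_iff, dn s hs]; linarith [hs.2]⟩) fun s hs ↦ dO s ⟨hs.1, hs.2.le⟩
  have q : ∀ s : ℝ, 0 + t • d + s • -el N = t • eb j + (2 * ε * t - s) • el N := fun s ↦ by simp only [d]; module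
  have qn : ∀ s ∈ Icc 0 (4 * ε * t), ‖0 + t • d + s • -el N‖ = t := fun s hs ↦ by
    rw [q, nv _ _ (by rw [abs_le]; constructor <;> nlinarith [hs.1, hs.2])]
  obtain ⟨v, v0, v1, v2, v3⟩ := first_exit D.oO (y := 0 + t • d) (d := -el N) (dO t ⟨t0, le_rfl⟩) (T := 4 * ε * t) (by positivity) (by
    refine (h3 _ (by rw [qn _ ⟨by positivity, le_rfl⟩]; exact t3)).2 ?_
    rw [qn _ ⟨by positivity, le_rfl⟩, q, ln]; nlinarith)
  have qb : ∀ s ∈ Icc 0 v, ‖0 + t • d + s • -el N‖ = t := fun s hs ↦ qn s ⟨hs.1, hs.2.trans v1⟩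
  obtain ⟨s', hs', B⟩ := D.mv (y := 0 + t • d) (d := -el N) v0 (fun s hs ↦ ⟨by
      rcases hs.2.eq_or_lt with h | h
      · rw [h]; exact frontier_subset_closure v2
      · exact subset_closure (v3 s hs.1 h), by rw [mem_ball_zero_iff, qb s hs]; exact tR⟩) fun s hs ↦ v3 s hs.1.le hs.2
  rw [D.fU _ ⟨v2, by rw [mem_ball_zero_iff, qb v ⟨v0.le, le_rfl⟩]; exact tR⟩] at B
  rw [U0] at A
  have sA : ∀ z, ∑ i, d i * G i z = G j z + 2 * ε * G ℓ z := fun z ↦ by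
    simp only [d, Pi.add_apply, Pi.smul_apply, el, eb, add_mul, Finset.sum_add_distrib, smul_eq_mul, mul_assoc, ← Finset.mul_sum]
    simp [Pi.single_apply]
  have sB : ∀ z, ∑ i, (-el N) i * G i z = -G ℓ z := fun z ↦ by simp [el, eb, Pi.single_apply]
  rw [sA] at A
  rw [sB] at B
  have n1 := dn s ⟨hs.1.le, hs.2.le⟩
  have n2 := qb s' ⟨hs'.1.le, hs'.2.le⟩
  have c1 : 0 + s • d ∈ closure O ∩ ball 0 R := ⟨subset_closure (dO s ⟨hs.1, hs.2.le⟩), by rw [mem_ball_zero_iff, n1]; linarith [hs.2]⟩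
  have c2 : 0 + t • d + s' • -el N ∈ closure O ∩ ball 0 R := ⟨subset_closure (v3 s' hs'.1.le hs'.2), by rw [mem_ball_zero_iff, n2]; exact tR⟩
  have g1 := h1 _ c1 (by rw [n1]; linarith [hs.2])
  have g2 := h2 _ c1 (by rw [n1]; linarith [hs.2])
  have g3 := h2 _ c2 (by rw [n2]; exact t2)
  generalize G j (0 + s • d) = a1 at *
  generalize G ℓ (0 + s • d) = a2 at *
  generalize G ℓ (0 + t • d + s' • -el N) = a3 at *
  have k2 : |a2| ≤ 2 := by have := abs_sub_abs_le_abs_sub a2 (G ℓ 0); linarith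
  have k3 : |a3| ≤ 2 := by have := abs_sub_abs_le_abs_sub a3 (G ℓ 0); linarith
  have k4 : t * (a1 + 2 * ε * a2) = v * a3 := by linarith
  have k5 : t * |a1 + 2 * ε * a2| ≤ t * (8 * ε) := by
    rw [← abs_of_pos t0, ← abs_mul, k4, abs_mul, abs_of_pos t0, abs_of_pos v0]; nlinarith [abs_nonneg a3]
  have k6 := le_of_mul_le_mul_left k5 t0
  have k7 : |a1| ≤ 12 * ε := by
    have := abs_add_le (a1 + 2 * ε * a2) (-(2 * ε * a2))
    rw [add_neg_cancel_right, abs_neg, abs_mul, abs_of_pos (by positivity : 0 < 2 * ε)] at this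
    nlinarith
  have := abs_sub_abs_le_abs_sub (G j 0) a1
  rw [abs_sub_comm] at this
  linarith

lemma ld (D : RD N O U G R σ) (h : G ℓ 0 = 1) : ∃ R', LD N O U G R' σ := by
  have R0 := D.R0
  obtain ⟨ρ2, p2, h2⟩ := D.near ℓ (show (0:ℝ) < 1/10 by norm_num)
  obtain ⟨ρ3, p3, h3⟩ := D.fl (1/4) (by norm_num)
  let r := min R (min ρ2 ρ3)
  have r1 : r ≤ R := min_le_left _ _
  have r2 : r ≤ ρ2 := (min_le_right _ _).trans (min_le_left _ _)
  have r3 : r ≤ ρ3 := (min_le_right _ _).trans (min_le_right _ _)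
  have sub : ∀ S : Set (Yn N), S ∩ ball 0 r ⊆ S ∩ ball 0 R := fun S ↦ inter_subset_inter_right _ (ball_subset_ball r1)
  exact ⟨r, by positivity, D.oO, D.cU.mono (sub _), fun i ↦ (D.cG i).mono (sub _),
    (poi_smooth (D.oO.inter isOpen_ball) D.df D.dG D.dU D.lap).mono (sub _),
    fun y hy ↦ D.dU y (sub _ hy), fun y hy ↦ D.lap y (sub _ hy), fun y hy ↦ D.fU y (sub _ hy), fun y hy ↦ D.fG y (sub _ hy),
    fun y hy ↦ by have := h2 y (sub _ hy) ((mem_ball_zero_iff.1 hy.2).trans_le r2); rw [h] at this; exact this.le,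
    fun y hy hl ↦ (h3 y (hy.trans_le r3)).1 (by linarith), fun y hy hl ↦ (h3 y (hy.trans_le r3)).2 (by linarith)⟩

lemma fin (D : RD N O U G R σ) : ∃ ε > 0, ∃ w : Yn N → ℝ, ContDiff ℝ ⊤∞ w ∧ fderiv ℝ w 0 ≠ 0 ∧ ∃ s : ℝ,
    ∀ y, ‖y‖ < ε → (y ∈ O ↔ 0 < w y) ∧ (y ∈ O → s * w y = U y) := by
  have h := D.fG 0 ⟨D.z0, mem_ball_self D.R0⟩
  rw [Finset.sum_eq_single ℓ (fun j _ hj ↦ by rw [D.tan hj]; simp) (by simp), sq_eq_one_iff] at h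
  rcases h with h | h
  · obtain ⟨R', L⟩ := D.ld h
    obtain ⟨ε, e0, w, sw, dw, hw⟩ := L.loc
    exact ⟨ε, e0, w, sw, dw, 1, by simpa using hw⟩
  · have D' : RD N O (fun y ↦ -U y) (fun i y ↦ -G i y) R (-σ) := ⟨D.R0, D.oO, D.cU.neg, fun i ↦ (D.cG i).neg, fun y hy ↦ (D.df y hy).neg,
      fun i y hy ↦ (D.dG i y hy).neg, fun y hy i ↦ by rw [fderiv_fun_neg, neg_apply, D.dU y hy],
      fun y hy ↦ by simp_rw [fderiv_fun_neg, neg_apply]; rw [Finset.sum_neg_distrib, D.lap y hy],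
      fun y hy ↦ by rw [D.fU y hy, neg_zero], fun y hy ↦ by simpa using D.fG y hy, D.z0, D.fl⟩
    obtain ⟨R', L⟩ := D'.ld (by rw [h, neg_neg])
    obtain ⟨ε, e0, w, sw, dw, hw⟩ := L.loc
    exact ⟨ε, e0, w, sw, dw, -1, fun y hy ↦ ⟨(hw y hy).1, fun hO ↦ by rw [(hw y hy).2 hO]; ring⟩⟩
end RD

lemma taylor_unif {Z : Type*} [NormedAddCommGroup Z] [NormedSpace ℝ Z] {ψ : Z → ℝ} {z0 : Z} {m : ℕ} (h : ContDiffAt ℝ ((m + 1 : ℕ) : ℕ∞) ψ z0) :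
    ∃ C ≥ 0, ∃ r > 0, ∀ z, dist z z0 < r → ∀ v, ‖v‖ < r →
    |ψ (z + v) - ∑ k ∈ Finset.range (m + 1), (k.factorial : ℝ)⁻¹ • (iteratedFDeriv ℝ k ψ z fun _ ↦ v)| ≤ C * ‖v‖ ^ (m + 1) := by
  have c0 : ContinuousAt (iteratedFDeriv ℝ (m+1) ψ) z0 := (h.iteratedFDeriv_right (i := m + 1) (m := 0) (by simp)).continuousAt
  let C := ‖iteratedFDeriv ℝ (m+1) ψ z0‖ + 1
  obtain ⟨r, r0, hr⟩ := Metric.eventually_nhds_iff.1 ((h.eventually (by simp)).and (c0.norm.eventually_lt (continuousAt_const (y := C)) (by simp [C])))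
  refine ⟨C, by positivity, r / 2, by positivity, fun z hz v hv ↦ ?_⟩
  have seg : ∀ t ∈ Icc (0:ℝ) 1, dist (z + t • v) z0 < r := fun t ht ↦ by
    have h1 : ‖t • v‖ ≤ ‖v‖ := by rw [norm_smul, Real.norm_of_nonneg ht.1]; nlinarith [ht.2, norm_nonneg v]
    have := dist_triangle (z + t • v) z z0
    rw [dist_eq_norm (z + t • v) z, add_sub_cancel_left] at this
    linarith
  rw [map_add_eq_sum_add_integral_iteratedFDeriv (f := ψ) (n := m) (x := z) (y := v) fun t ht ↦ by exact_mod_cast (hr (seg t ht)).1, add_sub_cancel_left, smul_eq_mul, abs_mul]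
  have I : ‖∫ t in (0:ℝ)..1, (1 - t) ^ m • (iteratedFDeriv ℝ (m+1) ψ (z + t • v) fun _ ↦ v)‖ ≤ (C * ‖v‖ ^ (m+1)) * |1 - 0| :=
    intervalIntegral.norm_integral_le_of_norm_le_const fun t ht ↦ by
      rw [uIoc_of_le zero_le_one] at ht
      have h1 := (iteratedFDeriv ℝ (m+1) ψ (z + t • v)).le_opNorm fun _ ↦ v
      rw [Finset.prod_const, Finset.card_univ, Fintype.card_fin] at h1
      rw [norm_smul, norm_pow, Real.norm_of_nonneg (by linarith [ht.2])]
      have h2 : (1 - t) ^ m ≤ 1 := pow_le_one₀ (by linarith [ht.2]) (by linarith [ht.1])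
      have h3 := (hr (seg t ⟨ht.1.le, ht.2⟩)).2
      calc _ ≤ 1 * (C * ‖v‖ ^ (m+1)) := mul_le_mul h2 (h1.trans (by gcongr)) (norm_nonneg _) zero_le_one
        _ = _ := one_mul _
  rw [sub_zero, abs_one, mul_one, Real.norm_eq_abs] at I
  have h5 : |((m.factorial : ℝ))⁻¹| ≤ 1 := by
    rw [abs_of_nonneg (by positivity)]; exact inv_le_one_of_one_le₀ (by exact_mod_cast m.factorial_pos)
  exact (mul_le_mul h5 I (abs_nonneg _) zero_le_one).trans (one_mul _).le

section
variable {n : ℕ} [NeZero n]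

noncomputable def nE (n : ℕ) [NeZero n] : En n := EuclideanSpace.single (lastIdx n) 1

noncomputable def pz (n : ℕ) [NeZero n] : En n →L[ℝ] En n :=
  ContinuousLinearMap.id ℝ _ - (EuclideanSpace.proj (lastIdx n) : En n →L[ℝ] ℝ).smulRight (nE n)

lemma pz_ap (y : En n) (i : Fin n) : pz n y i = if i = lastIdx n then 0 else y i := by
  simp [pz, nE]; split_ifs with h <;> simp [h]

lemma pz_add (y : En n) : pz n y + xn y • nE n = y := by simp [pz, xn]

lemma pz_norm (y : En n) : ‖pz n y‖ = xpn y := by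
  rw [EuclideanSpace.norm_eq, xpn]; congr 1
  rw [← Finset.add_sum_erase _ _ (Finset.mem_univ (lastIdx n)), pz_ap, if_pos rfl]
  simp only [norm_zero, ne_eq, OfNat.ofNat_ne_zero, not_false_eq_true, zero_pow, zero_add]
  exact Finset.sum_congr rfl fun i hi ↦ by rw [pz_ap, if_neg (Finset.ne_of_mem_erase hi), Real.norm_eq_abs, sq_abs]

lemma poly_of {k : ℕ} (M : ContinuousMultilinearMap ℝ (fun _ : Fin k ↦ En n) ℝ) :
    ∃ P : MvPolynomial (Fin n) ℝ, P.IsHomogeneous k ∧ pderiv (lastIdx n) P = 0 ∧ ∀ y, peval P y = M fun _ ↦ pz n y := by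
  let Y : Fin n → MvPolynomial (Fin n) ℝ := fun i ↦ if i = lastIdx n then 0 else X i
  have hY : ∀ i, (Y i).IsHomogeneous 1 := fun i ↦ by
    simp only [Y]; split_ifs
    · exact isHomogeneous_zero _ _ _
    · exact isHomogeneous_X _ _
  have pY : ∀ i, pderiv (lastIdx n) (Y i) = 0 := fun i ↦ by
    simp only [Y]; split_ifs with h
    · simp
    · exact pderiv_X_of_ne h
  refine ⟨∑ κ : Fin k → Fin n, C (M fun l ↦ EuclideanSpace.single (κ l) 1) * ∏ l, Y (κ l), ?_, ?_, fun y ↦ ?_⟩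
  · refine IsHomogeneous.sum _ _ _ fun κ _ ↦ IsHomogeneous.C_mul ?_ _
    simpa using IsHomogeneous.prod Finset.univ (fun l ↦ Y (κ l)) (fun _ ↦ 1) fun l _ ↦ hY _
  · rw [map_sum]
    refine Finset.sum_eq_zero fun κ _ ↦ ?_
    have : ∀ s : Finset (Fin k), pderiv (lastIdx n) (∏ l ∈ s, Y (κ l)) = 0 := fun s ↦ by
      induction s using Finset.induction_on with
      | empty => simp
      | insert a s ha ih => rw [Finset.prod_insert ha, pderiv_mul, ih, pY]; simp
    rw [pderiv_mul, this]; simp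
  · have e : pz n y = ∑ i, pz n y i • (EuclideanSpace.single i 1 : En n) := by
      ext j; simp [Finset.sum_apply, Pi.single_apply]
    have eY : ∀ i, eval (fun i ↦ y i) (Y i) = pz n y i := fun i ↦ by
      simp only [Y, pz_ap]; split_ifs <;> simp
    rw [e, ContinuousMultilinearMap.map_sum, peval, map_sum]
    refine Finset.sum_congr rfl fun κ _ ↦ ?_
    rw [ContinuousMultilinearMap.map_smul_univ, map_mul, eval_C, map_prod, smul_eq_mul, mul_comm]
    simp_rw [eY]
end

section
variable {n : ℕ} [NeZero n]

lemma nE_norm : ‖nE n‖ = 1 := by simp [nE]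
lemma xpn_le (y : En n) : xpn y ≤ ‖y‖ := by
  rw [xpn, EuclideanSpace.norm_eq]
  refine Real.sqrt_le_sqrt ?_
  simp only [Real.norm_eq_abs, sq_abs]
  exact Finset.sum_le_sum_of_subset_of_nonneg (Finset.erase_subset _ _) fun i _ _ ↦ sq_nonneg _

lemma graph_loc {Q : Type*} [NormedAddCommGroup Q] [NormedSpace ℝ Q] [CompleteSpace Q] {F : Q × En n → ℝ} (hF : ContDiff ℝ ⊤∞ F) {p0 : Q} (h0 : F (p0, 0) = 0)
    (hd : 0 < fderiv ℝ F (p0, 0) (0, nE n)) (m : ℕ) :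
    ∃ K ≥ 0, ∃ r > 0, ∀ p, dist p p0 < r → F (p, 0) = 0 → (∀ y, fderiv ℝ F (p, 0) (0, pz n y) = 0) →
    ∃ P : MvPolynomial (Fin n) ℝ, P.totalDegree ≤ m ∧ coeff 0 P = 0 ∧ pderiv (lastIdx n) P = 0 ∧
      (∀ i, coeff (Finsupp.single i 1) P = 0) ∧ ∀ y : En n, ‖y‖ < r →
        (peval P y + K * xpn y ^ (m + 1) < xn y → 0 < F (p, y)) ∧ (xn y < peval P y - K * xpn y ^ (m + 1) → F (p, y) < 0) := by
  let L : (Q × En n) × ℝ →L[ℝ] Q × En n := ((ContinuousLinearMap.fst ℝ _ _).comp (ContinuousLinearMap.fst ℝ _ _)).prod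
    ((ContinuousLinearMap.snd ℝ _ _).comp (ContinuousLinearMap.fst ℝ _ _) + (ContinuousLinearMap.snd ℝ _ _).smulRight (nE n))
  have hL : ∀ q, L q = (q.1.1, q.1.2 + q.2 • nE n) := fun q ↦ rfl
  have dF : Differentiable ℝ F := hF.differentiable (by simp)
  have hf : ContDiffAt ℝ ((m + 1 : ℕ) : ℕ∞) (F ∘ L) ((p0, 0), 0) := ((hF.comp L.contDiff).of_le (by exact_mod_cast le_top)).contDiffAt
  have fd : ∀ u, fderiv ℝ (F ∘ L) u = (fderiv ℝ F (L u)).comp L := fun u ↦ ((dF _).hasFDerivAt.comp u L.hasFDerivAt).fderiv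
  have L0 : L ((p0, 0), 0) = (p0, 0) := by simp [hL]
  have inv : (fderiv ℝ (F ∘ L) ((p0, 0), 0) ∘L .inr ℝ (Q × En n) ℝ).IsInvertible := by
    refine ⟨ContinuousLinearEquiv.unitsEquivAut ℝ (Units.mk0 _ hd.ne'), ?_⟩
    ext; simp [fd, L0, hL]
  have ne : (((m + 1 : ℕ) : ℕ∞) : WithTop ℕ∞) ≠ 0 := by simp
  obtain ⟨ψ, cψ, ψ0, eψ⟩ : ∃ ψ : Q × En n → ℝ, ContDiffAt ℝ ((m + 1 : ℕ) : ℕ∞) ψ (p0, 0) ∧ ψ (p0, 0) = 0 ∧ ∀ᶠ x in nhds (p0, 0), (F ∘ L) (x, ψ x) = 0 := by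
    refine ⟨hf.implicitFunction ne inv, hf.contDiffAt_implicitFunction ne inv, hf.implicitFunction_apply_self ne inv, ?_⟩
    have := hf.eventually_apply_implicitFunction ne inv
    simpa [L0, h0] using this
  have cD : Continuous fun q ↦ fderiv ℝ F q (0, nE n) := (hF.continuous_fderiv (by simp)).clm_apply continuous_const
  obtain ⟨c, c0, hc⟩ := Metric.eventually_nhds_iff.1 (continuousAt_const.eventually_lt (cD.continuousAt (x := (p0, 0))) hd)
  obtain ⟨C, C0, r1, r10, hT⟩ := taylor_unif cψ
  obtain ⟨r2, r20, h2⟩ := Metric.eventually_nhds_iff.1 ((eψ.and (cψ.eventually (by simp))).and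
    (cψ.continuousAt.abs.eventually_lt (continuousAt_const (y := c / 2)) (by simp [ψ0, c0])))
  let r := min (c / 2) (min r1 r2)
  have rc : r ≤ c / 2 := min_le_left _ _
  have rr1 : r ≤ r1 := (min_le_right _ _).trans (min_le_left _ _)
  have rr2 : r ≤ r2 := (min_le_right _ _).trans (min_le_right _ _)
  have r0 : 0 < r := lt_min (by positivity) (lt_min r10 r20)
  refine ⟨C, C0, r, r0, fun p hp Fp dp ↦ ?_⟩
  have mono : ∀ y : En n, ‖y‖ < r → ∀ s t : ℝ, |s| < c / 2 → |t| < c / 2 → s < t → F (p, y + s • nE n) < F (p, y + t • nE n) := by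
    intro y hy s t hs ht st
    have hd' : ∀ a : ℝ, HasDerivAt (fun a ↦ F (p, y + a • nE n)) (fderiv ℝ F (p, y + a • nE n) (0, nE n)) a := fun a ↦
      (dF (p, y + a • nE n)).hasFDerivAt.comp_hasDerivAt a ((hasDerivAt_const a p).prodMk (by simpa using ((hasDerivAt_id a).smul_const (nE n)).const_add y))
    refine strictMonoOn_of_deriv_pos (convex_Icc s t) (fun a _ ↦ (hd' a).continuousAt.continuousWithinAt) (fun a ha ↦ ?_) (left_mem_Icc.2 st.le) (right_mem_Icc.2 st.le) st
    rw [interior_Icc] at ha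
    rw [(hd' a).deriv]
    refine hc ?_
    rw [Prod.dist_eq]
    refine max_lt (hp.trans_le (rc.trans (by linarith))) ?_
    rw [dist_zero_right]
    have : |a| < c / 2 := abs_lt.2 ⟨by linarith [(abs_lt.1 hs).1, ha.1], by linarith [(abs_lt.1 ht).2, ha.2]⟩
    calc _ ≤ ‖y‖ + |a| := (norm_add_le _ _).trans (by rw [norm_smul, nE_norm, mul_one, Real.norm_eq_abs])
      _ < c := by linarith
  have near : ∀ y : En n, ‖y‖ < r → dist (p, y) (p0, (0 : En n)) < r := fun y hy ↦ by
    rw [Prod.dist_eq]; exact max_lt hp (by simpa using hy)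
  have near2 : ∀ y : En n, ‖y‖ < r → (F (p, y + ψ (p, y) • nE n) = 0 ∧ ContDiffAt ℝ ((m + 1 : ℕ) : ℕ∞) ψ (p, y)) ∧ |ψ (p, y)| < c / 2 := fun y hy ↦
    h2 ((near y hy).trans_le rr2)
  have z0 : ‖(0 : En n)‖ < r := by simpa
  have ψp : ψ (p, 0) = 0 := by
    have hh := near2 0 z0
    by_contra hne
    rcases lt_or_gt_of_ne hne with h | h
    · have := mono 0 z0 _ 0 hh.2 (by simpa) h
      rw [hh.1.1] at this; simp [Fp] at this
    · have := mono 0 z0 0 _ (by simpa) hh.2 h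
      rw [hh.1.1] at this; simp [Fp] at this
  have dψ : ∀ y, fderiv ℝ ψ (p, 0) (0, pz n y) = 0 := by
    intro y
    have e1 : HasDerivAt (fun t : ℝ ↦ ψ (p, t • pz n y)) (fderiv ℝ ψ (p, 0) (0, pz n y)) 0 := by
      have h3 : HasFDerivAt ψ (fderiv ℝ ψ (p, 0)) (p, (0:ℝ) • pz n y) := by
        rw [zero_smul]; exact ((near2 0 z0).1.2.differentiableAt (by simp)).hasFDerivAt
      exact h3.comp_hasDerivAt 0 ((hasDerivAt_const (0:ℝ) p).prodMk (by simpa using (hasDerivAt_id (0:ℝ)).smul_const (pz n y)))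
    have e2 : HasDerivAt (fun t : ℝ ↦ F (p, t • pz n y + ψ (p, t • pz n y) • nE n)) (fderiv ℝ F (p, 0) (0, pz n y + fderiv ℝ ψ (p, 0) (0, pz n y) • nE n)) 0 := by
      have h3 : HasFDerivAt F (fderiv ℝ F (p, 0)) (p, (0:ℝ) • pz n y + ψ (p, (0:ℝ) • pz n y) • nE n) := by
        rw [zero_smul, ψp, zero_smul, add_zero]; exact (dF _).hasFDerivAt
      exact h3.comp_hasDerivAt 0 ((hasDerivAt_const (0:ℝ) p).prodMk ((by simpa using (hasDerivAt_id (0:ℝ)).smul_const (pz n y) : HasDerivAt (fun t : ℝ ↦ t • pz n y) (pz n y) 0).add (e1.smul_const _)))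
    have e3 : (fun t : ℝ ↦ F (p, t • pz n y + ψ (p, t • pz n y) • nE n)) =ᶠ[nhds 0] fun _ ↦ 0 := by
      have : ∀ᶠ t : ℝ in nhds 0, ‖t • pz n y‖ < r :=
        (continuous_id.smul continuous_const).norm.continuousAt.eventually_lt continuousAt_const (by simpa)
      filter_upwards [this] with t ht using (near2 _ ht).1.1
    have e4 := e2.unique ((hasDerivAt_const (0:ℝ) (0:ℝ)).congr_of_eventuallyEq e3)
    have e5 : ((0 : Q), pz n y + fderiv ℝ ψ (p, 0) (0, pz n y) • nE n) = (0, pz n y) + fderiv ℝ ψ (p, 0) (0, pz n y) • (0, nE n) := by simp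
    rw [e5, map_add, map_smul, dp, zero_add, smul_eq_mul] at e4
    exact (mul_eq_zero.1 e4).resolve_right (hc ((near 0 z0).trans_le (rc.trans (by linarith)))).ne'
  choose P hP1 hP2 hP3 using fun k ↦ poly_of (n := n) ((iteratedFDeriv ℝ k ψ (p, 0)).compContinuousLinearMap fun _ ↦ ContinuousLinearMap.inr ℝ Q (En n))
  have cz : ∀ d : Fin n →₀ ℕ, d.degree < 2 → coeff d (∑ k ∈ Finset.Icc 2 m, MvPolynomial.C ((k.factorial : ℝ)⁻¹) * P k) = 0 := fun d hd ↦ by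
    rw [coeff_sum]
    exact Finset.sum_eq_zero fun k hk ↦ by rw [coeff_C_mul, (hP1 k).coeff_eq_zero (by have := (Finset.mem_Icc.1 hk).1; omega), mul_zero]
  refine ⟨∑ k ∈ Finset.Icc 2 m, MvPolynomial.C ((k.factorial : ℝ)⁻¹) * P k, ?_, cz 0 (by simp), ?_, fun i ↦ cz _ (by simp), fun y hy ↦ ?_⟩
  · exact totalDegree_finsetSum_le fun k hk ↦ (((hP1 k).C_mul _).totalDegree_le).trans (Finset.mem_Icc.1 hk).2
  · rw [map_sum]; exact Finset.sum_eq_zero fun k _ ↦ by rw [pderiv_mul, hP2]; simp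
  have hpz : ‖pz n y‖ < r := by rw [pz_norm]; exact (xpn_le y).trans_lt hy
  have T := hT (p, 0) ((near 0 z0).trans_le rr1) (0, pz n y) (by simpa using hpz.trans_le rr1)
  have T2 : ∑ k ∈ Finset.range (m + 1), (k.factorial : ℝ)⁻¹ • (iteratedFDeriv ℝ k ψ (p, 0) fun _ ↦ (0, pz n y)) = peval (∑ k ∈ Finset.Icc 2 m, MvPolynomial.C ((k.factorial : ℝ)⁻¹) * P k) y := by
    have h4 : ∀ k, peval (P k) y = iteratedFDeriv ℝ k ψ (p, 0) fun _ ↦ (0, pz n y) := fun k ↦ by rw [hP3]; rfl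
    rw [peval, map_sum]; symm
    refine (Finset.sum_congr rfl fun k _ ↦ ?_).trans (Finset.sum_subset (fun k hk ↦ ?_) fun k hk hk2 ↦ ?_)
    · rw [map_mul, eval_C, smul_eq_mul, ← h4]; rfl
    · simp at hk ⊢; omega
    · have : k = 0 ∨ k = 1 := by simp at hk hk2; omega
      rcases this with rfl | rfl
      · simp [ψp]
      · simp [iteratedFDeriv_one_apply, dψ]
  rw [T2] at T
  have e6 : ‖((0 : Q), pz n y)‖ = xpn y := by simp [pz_norm, Prod.norm_def, xpn, Real.sqrt_nonneg]
  rw [e6, Prod.mk_add_mk, add_zero, zero_add] at T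
  have hh := near2 _ hpz
  have hx : |xn y| < c / 2 := ((PiLp.norm_apply_le y (lastIdx n)).trans_lt hy).trans_le rc
  have T3 := abs_le.1 T
  constructor <;> intro h
  · have := mono _ hpz _ (xn y) hh.2 hx (by linarith)
    rwa [hh.1.1, pz_add] at this
  · have := mono _ hpz (xn y) _ hx hh.2 (by linarith)
    rwa [hh.1.1, pz_add] at this
end

section
variable {n : ℕ} [NeZero n]

def GD (F : En n → ℝ) (m : ℕ) (K r : ℝ) : Prop := ∃ P : MvPolynomial (Fin n) ℝ, P.totalDegree ≤ m ∧ coeff 0 P = 0 ∧ pderiv (lastIdx n) P = 0 ∧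
      (∀ i, coeff (Finsupp.single i 1) P = 0) ∧ ∀ y : En n, ‖y‖ < r →
        (peval P y + K * xpn y ^ (m + 1) < xn y → 0 < F y) ∧ (xn y < peval P y - K * xpn y ^ (m + 1) → F y < 0)

lemma GD.mono {F : En n → ℝ} {m : ℕ} {K r K' r' : ℝ} (h : GD F m K r) (hK : K ≤ K') (hr : r' ≤ r) : GD F m K' r' := by
  obtain ⟨P, a, b, c, d, e⟩ := h
  refine ⟨P, a, b, c, d, fun y hy ↦ ?_⟩
  have h1 : K * xpn y ^ (m + 1) ≤ K' * xpn y ^ (m + 1) := mul_le_mul_of_nonneg_right hK (pow_nonneg (Real.sqrt_nonneg _) _)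
  exact ⟨fun h ↦ (e y (hy.trans_le hr)).1 (by linarith), fun h ↦ (e y (hy.trans_le hr)).2 (by linarith)⟩

lemma line_d {E : Type*} [NormedAddCommGroup E] [NormedSpace ℝ E] {f : E → ℝ} {x : E} (h : DifferentiableAt ℝ f x) (v : E) : HasDerivAt (fun t : ℝ ↦ f (x + t • v)) (fderiv ℝ f x v) 0 := by
  have h3 : HasFDerivAt f (fderiv ℝ f x) (x + (0:ℝ) • v) := by
    rw [zero_smul, add_zero]; exact h.hasFDerivAt
  exact h3.comp_hasDerivAt 0 ((by simpa using (hasDerivAt_id (0:ℝ)).smul_const v : HasDerivAt (fun t : ℝ ↦ t • v) v 0).const_add x)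

set_option maxHeartbeats 1000000 in
lemma bd_loc {w : En n → ℝ} (hw : ContDiff ℝ ⊤∞ w) {x0 : En n} (h : fderiv ℝ w x0 ≠ 0) {Ω : Set (En n)} {ε : ℝ} (ε0 : 0 < ε)
    (hΩ : ∀ y, dist y x0 < ε → (y ∈ Ω ↔ 0 < w y)) (m : ℕ) {α : ℝ} (a0 : 0 < α) (a1 : α ≤ 1) :
    ∃ K ≥ 0, ∃ r > 0, ∀ x1, dist x1 x0 < r → x1 ∈ frontier Ω → BoundaryPtCmα m α K r Ω x1 := by
  have cD : Continuous (fderiv ℝ w) := hw.continuous_fderiv (by simp)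
  obtain ⟨d, d0, hd⟩ := Metric.eventually_nhds_iff.1 (cD.continuousAt.eventually_ne h)
  let F : (En n × (En n →L[ℝ] En n)) × En n → ℝ := fun q ↦ w (q.1.1 + q.1.2 q.2)
  have hF : ContDiff ℝ ⊤∞ F := hw.comp (by fun_prop)
  have dF : ∀ p v, fderiv ℝ F (p, 0) (0, v) = fderiv ℝ w p.1 (p.2 v) := fun p v ↦ by
    have e1 := line_d (hF.differentiable (by simp) (p, 0)) (0, v)
    have e2 := line_d (hw.differentiable (by simp) p.1) (p.2 v)
    refine e1.unique (e2.congr_of_eventuallyEq (.of_forall fun t ↦ ?_))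
    simp [F]
  let Z : Set (En n × (En n →L[ℝ] En n)) := {q | dist q.1 x0 ≤ d / 2 ∧ (∀ y, ‖q.2 y‖ = ‖y‖) ∧ w q.1 = 0 ∧ (∀ y, fderiv ℝ w q.1 (q.2 (pz n y)) = 0) ∧ 0 ≤ fderiv ℝ w q.1 (q.2 (nE n))}
  have cZ : IsCompact Z := by
    have : ProperSpace (En n →L[ℝ] En n) := FiniteDimensional.proper ℝ _
    refine ((isCompact_closedBall x0 (d / 2)).prod (isCompact_closedBall (0 : En n →L[ℝ] En n) 1)).of_isClosed_subset ?_ fun q hq ↦ ⟨hq.1, ?_⟩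
    · have c1 : ∀ y : En n, Continuous fun q : En n × (En n →L[ℝ] En n) ↦ q.2 y := fun y ↦ by fun_prop
      have c2 : ∀ y, Continuous fun q : En n × (En n →L[ℝ] En n) ↦ fderiv ℝ w q.1 (q.2 y) := fun y ↦ (cD.comp continuous_fst).clm_apply (c1 y)
      exact (isClosed_le (continuous_fst.dist continuous_const) continuous_const).and
        ((isClosed_iInter fun y ↦ isClosed_eq (c1 y).norm continuous_const : IsClosed (⋂ y : En n, {q : En n × (En n →L[ℝ] En n) | ‖q.2 y‖ = ‖y‖}) ) |> fun hh ↦ (by simpa only [ofPred_forall] using hh : IsClosed {q : En n × (En n →L[ℝ] En n) | ∀ y, ‖q.2 y‖ = ‖y‖}).and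
        ((isClosed_eq (hw.continuous.comp continuous_fst) continuous_const).and
        ((by simpa only [ofPred_forall] using isClosed_iInter fun y ↦ isClosed_eq (c2 (pz n y)) continuous_const : IsClosed {q : En n × (En n →L[ℝ] En n) | ∀ y, fderiv ℝ w q.1 (q.2 (pz n y)) = 0}).and
          (isClosed_le continuous_const (c2 _)))))
    · rw [mem_closedBall_zero_iff]
      exact ContinuousLinearMap.opNorm_le_bound _ zero_le_one fun y ↦ by rw [hq.2.1, one_mul]
  obtain ⟨K, K0, r, r0, hg⟩ : ∃ K ≥ 0, ∃ r > 0, ∀ q ∈ Z, GD (fun y ↦ F (q, y)) m K r := by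
    refine cZ.induction_on (p := fun S ↦ ∃ K ≥ 0, ∃ r > 0, ∀ q ∈ S, GD (fun y ↦ F (q, y)) m K r) ⟨0, le_rfl, 1, one_pos, by simp⟩ ?_ ?_ fun q hq ↦ ?_
    · rintro S T hST ⟨K, K0, r, r0, hh⟩
      exact ⟨K, K0, r, r0, fun q hq ↦ hh q (hST hq)⟩
    · rintro S T ⟨K, K0, r, r0, hh⟩ ⟨K', K0', r', r0', hh'⟩
      exact ⟨max K K', le_max_of_le_left K0, min r r', lt_min r0 r0', fun q hq ↦ hq.elim
        (fun hq ↦ (hh q hq).mono (le_max_left _ _) (min_le_left _ _)) fun hq ↦ (hh' q hq).mono (le_max_right _ _) (min_le_right _ _)⟩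
    · have pos : 0 < fderiv ℝ F (q, 0) (0, nE n) := by
        rw [dF]
        refine lt_of_le_of_ne hq.2.2.2.2 fun h0 ↦ hd (show dist q.1 x0 < d by linarith [hq.1]) ?_
        have inj : Function.Injective q.2 := (injective_iff_map_eq_zero _).2 fun y hy ↦ by rw [← norm_eq_zero, ← hq.2.1 y, hy, norm_zero]
        ext v
        obtain ⟨y, rfl⟩ := (LinearMap.injective_iff_surjective (f := q.2.toLinearMap)).1 inj v
        show fderiv ℝ w q.1 (q.2 y) = 0
        rw [← pz_add y, map_add, map_add, hq.2.2.2.1, map_smul, map_smul, ← h0]; simp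
      obtain ⟨K, K0, r, r0, hh⟩ := graph_loc hF (p0 := q) (by simpa [F] using hq.2.2.1) pos m
      refine ⟨Z ∩ ball q r, inter_mem_nhdsWithin _ (ball_mem_nhds _ r0), K, K0, r, r0, fun p hp ↦ ?_⟩
      exact hh p hp.2 (by simpa [F] using hp.1.2.2.1) fun y ↦ by rw [dF]; exact hp.1.2.2.2.1 y
  let ρ := min (min r 1) (min (ε / 2) (d / 2))
  have ρ0 : 0 < ρ := by positivity
  have q1 : ρ ≤ r := (min_le_left _ _).trans (min_le_left _ _)
  have q2 : ρ ≤ 1 := (min_le_left _ _).trans (min_le_right _ _)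
  have q3 : ρ ≤ ε / 2 := (min_le_right _ _).trans (min_le_left _ _)
  have q4 : ρ ≤ d / 2 := (min_le_right _ _).trans (min_le_right _ _)
  refine ⟨K, K0, ρ, ρ0, fun x1 hx1 fx ↦ ?_⟩
  have nb : ∀ᶠ y in nhds x1, dist y x0 < ε := (continuous_id.dist continuous_const).continuousAt.eventually_lt continuousAt_const (by simp; linarith)
  have w0 : w x1 = 0 := by
    rcases lt_trichotomy (w x1) 0 with h | h | h
    · refine absurd ((mem_closure_iff_frequently.1 fx.1)) (Filter.not_frequently.2 ?_)
      filter_upwards [nb, hw.continuous.continuousAt.eventually_lt continuousAt_const h] with y hy h2 h3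
      exact lt_asymm h2 ((hΩ y hy).1 h3)
    · exact h
    · refine absurd (mem_interior_iff_mem_nhds.2 ?_) fx.2
      filter_upwards [nb, continuousAt_const.eventually_lt hw.continuous.continuousAt h] with y hy h2
      exact (hΩ y hy).2 h2
  let g := (InnerProductSpace.toDual ℝ (En n)).symm (fderiv ℝ w x1)
  have hgi : ∀ v, fderiv ℝ w x1 v = inner ℝ g v := fun v ↦ (InnerProductSpace.toDual_symm_apply).symm
  have g0 : ‖g‖ ≠ 0 := by
    rw [LinearIsometryEquiv.norm_map, norm_ne_zero_iff]; exact hd (by linarith)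
  let ν := ‖g‖⁻¹ • g
  have hν : ‖nE n‖ = ‖ν‖ := by rw [nE_norm, norm_smul, norm_inv, norm_norm, inv_mul_cancel₀ g0]
  let R := (Submodule.span ℝ {nE n - ν})ᗮ.reflection
  have hR : R (nE n) = ν := Submodule.reflection_sub hν
  have gν : g = ‖g‖ • R (nE n) := by rw [hR, smul_smul, mul_inv_cancel₀ g0, one_smul]
  have hgR : ∀ v, fderiv ℝ w x1 (R v) = ‖g‖ * xn v := fun v ↦ by
    rw [hgi, gν, inner_smul_left, LinearIsometryEquiv.inner_map_map, ← gν]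
    simp [nE, xn, EuclideanSpace.inner_single_left]
  have zz : (x1, (R.toContinuousLinearEquiv : En n →L[ℝ] En n)) ∈ Z := by
    refine ⟨by show dist x1 x0 ≤ _; linarith, fun y ↦ R.norm_map y, w0, fun y ↦ (hgR _).trans ?_, (hgR (nE n)).ge.trans' ?_⟩
    · simp [xn, pz_ap]
    · simp [xn, nE]
  obtain ⟨P, a, b, c, e, f⟩ := hg _ zz
  refine ⟨(R.toIsometryEquiv.trans (IsometryEquiv.addLeft x1)).symm, P, ?_, a, b, c, fun _ ↦ e, fun y hy h1 ↦ ?_, fun y hy h1 ↦ ?_⟩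
  · rw [IsometryEquiv.symm_apply_eq]; show x1 = x1 + R 0; simp
  all_goals
    have hpow : K * xpn y ^ (m + 1) ≤ K * xpn y ^ ((m : ℝ) + α) := by
      refine mul_le_mul_of_nonneg_left ?_ K0
      rw [← Real.rpow_natCast]
      exact Real.rpow_le_rpow_of_exponent_ge' (Real.sqrt_nonneg _) ((xpn_le y).trans (hy.le.trans q2)) (by positivity) (by push_cast; linarith)
    have hnear : dist (x1 + R y) x0 < ε := by
      have := dist_triangle (x1 + R y) x1 x0
      rw [dist_eq_norm (x1 + R y) x1, add_sub_cancel_left, R.norm_map] at this; linarith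
  · exact (hΩ _ hnear).2 ((f y (hy.trans_le q1)).1 (by linarith))
  · exact fun hm ↦ lt_asymm ((hΩ _ hnear).1 hm) ((f y (hy.trans_le q1)).2 (by linarith))
end

lemma poly1 {n : ℕ} {P : MvPolynomial (Fin n) ℝ} (h : P.totalDegree ≤ 1) (h0 : coeff 0 P = 0) (h1 : ∀ i, coeff (Finsupp.single i 1) P = 0) : P = 0 := by
  ext d
  rw [coeff_zero]
  by_cases hd : 1 < ∑ i ∈ d.support, d i
  · exact coeff_eq_zero_of_totalDegree_lt (h.trans_lt hd)
  by_cases d0 : d = 0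
  · rw [d0, h0]
  obtain ⟨i, hi⟩ := Finsupp.ne_iff.1 d0
  have e : d = Finsupp.single i 1 := by
    have mi : i ∈ d.support := by simpa using hi
    rw [← Finset.add_sum_erase _ _ mi] at hd
    simp only [Finsupp.coe_zero, Pi.zero_apply] at hi
    ext j
    by_cases hj : j = i
    · subst hj; simp; omega
    · rw [Finsupp.single_eq_of_ne hj]
      by_contra hne
      have := Finset.single_le_sum (f := fun i ↦ d i) (fun _ _ ↦ Nat.zero_le _) (Finset.mem_erase.2 ⟨hj, by simpa using hne⟩ : j ∈ d.support.erase i)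
      omega
  rw [e, h1]

section
variable {N : ℕ} [NeZero (N+1)] {Ω : Set (En (N+1))} {u : En (N+1) → ℝ} {Du : En (N+1) → En (N+1)}

noncomputable def tA (L : En (N+1) ≃ₗᵢ[ℝ] En (N+1)) : Yn N ≃L[ℝ] En (N+1) :=
  (EuclideanSpace.equiv (Fin (N+1)) ℝ).symm.trans L.toContinuousLinearEquiv

noncomputable def oB (L : En (N+1) ≃ₗᵢ[ℝ] En (N+1)) : OrthonormalBasis (Fin (N+1)) ℝ (En (N+1)) := (EuclideanSpace.basisFun _ ℝ).map L

lemma tA_eb (L : En (N+1) ≃ₗᵢ[ℝ] En (N+1)) (i) : tA L (eb i) = oB L i := by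
  simp [tA, oB, eb]

lemma lap_inv (L : En (N+1) ≃ₗᵢ[ℝ] En (N+1)) (x) : ∑ i, fderiv ℝ (fderiv ℝ u) x (oB L i) (oB L i) = lapAt u x := by
  have h1 := congrFun (InnerProductSpace.laplacian_eq_iteratedFDeriv_orthonormalBasis u (oB L)) x
  have h2 := congrFun (InnerProductSpace.laplacian_eq_iteratedFDeriv_orthonormalBasis u (EuclideanSpace.basisFun _ ℝ)) x
  rw [h1] at h2
  simpa [iteratedFDeriv_two_apply, lapAt] using h2

lemma tr (heq : ∀ x ∈ Ω ∩ ball (0 : En (N+1)) 1, DifferentiableAt ℝ u x ∧ (∀ i, fderiv ℝ u x (EuclideanSpace.single i 1) = Du x i) ∧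
      DifferentiableAt ℝ (fderiv ℝ u) x ∧ lapAt u x = 1) (hO : IsOpen Ω) (L : En (N+1) ≃ₗᵢ[ℝ] En (N+1)) (x0) {y} (hy : x0 + tA L y ∈ Ω ∩ ball 0 1) :
    DifferentiableAt ℝ (fun y ↦ u (x0 + tA L y)) y ∧ (∀ i, DifferentiableAt ℝ (fun y ↦ inner ℝ (Du (x0 + tA L y)) (oB L i)) y) ∧
    (∀ i, fderiv ℝ (fun y ↦ u (x0 + tA L y)) y (eb i) = inner ℝ (Du (x0 + tA L y)) (oB L i)) ∧
    ∑ i, fderiv ℝ (fun y ↦ inner ℝ (Du (x0 + tA L y)) (oB L i)) y (eb i) = 1 := by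
  have hD : ∀ x ∈ Ω ∩ ball (0 : En (N+1)) 1, ∀ v, fderiv ℝ u x v = inner ℝ (Du x) v := fun x hx v ↦ by
    conv_lhs => rw [← (EuclideanSpace.basisFun _ ℝ).sum_repr v]
    rw [map_sum, PiLp.inner_apply]
    refine Finset.sum_congr rfl fun i _ ↦ ?_
    rw [map_smul, EuclideanSpace.basisFun_apply, (heq x hx).2.1]; simp
  have hT : HasFDerivAt (fun y ↦ x0 + tA L y) (tA L : Yn N →L[ℝ] En (N+1)) y := ((tA L : Yn N →L[ℝ] En (N+1)).hasFDerivAt).const_add x0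
  obtain ⟨d1, -, d2, l⟩ := heq _ hy
  have k1 := d1.hasFDerivAt.comp y hT
  have k2 : ∀ i, HasFDerivAt (fun y ↦ inner ℝ (Du (x0 + tA L y)) (oB L i)) ((ContinuousLinearMap.apply ℝ ℝ (oB L i)).comp ((fderiv ℝ (fderiv ℝ u) (x0 + tA L y)).comp (tA L : Yn N →L[ℝ] En (N+1)))) y := fun i ↦ by
    refine ((ContinuousLinearMap.apply ℝ ℝ (oB L i)).hasFDerivAt.comp y (d2.hasFDerivAt.comp y hT)).congr_of_eventuallyEq ?_
    filter_upwards [hT.continuousAt.preimage_mem_nhds ((hO.inter isOpen_ball).mem_nhds hy)] with z hz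
    exact (hD _ hz _).symm
  refine ⟨k1.differentiableAt, fun i ↦ (k2 i).differentiableAt, fun i ↦ ?_, ?_⟩
  · rw [← hD _ hy, ← tA_eb]; exact congrArg (· (eb i)) k1.fderiv
  · rw [← l, ← lap_inv L]
    refine Finset.sum_congr rfl fun i _ ↦ ?_
    rw [(k2 i).fderiv, ← tA_eb]; rfl

lemma loc_in (heq : ∀ x ∈ Ω ∩ ball (0 : En (N+1)) 1, DifferentiableAt ℝ u x ∧ (∀ i, fderiv ℝ u x (EuclideanSpace.single i 1) = Du x i) ∧
      DifferentiableAt ℝ (fderiv ℝ u) x ∧ lapAt u x = 1) (hO : IsOpen Ω) : ContDiffOn ℝ ⊤∞ u (Ω ∩ ball 0 1) := by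
  let L := LinearIsometryEquiv.refl ℝ (En (N+1))
  have cT : Continuous fun y ↦ 0 + tA L y := by fun_prop
  have := poi_smooth (O := (fun y ↦ 0 + tA L y) ⁻¹' (Ω ∩ ball 0 1)) ((hO.inter isOpen_ball).preimage cT) (fun y hy ↦ (tr heq hO L 0 hy).1)
    (fun i y hy ↦ (tr heq hO L 0 hy).2.1 i) (fun y hy ↦ (tr heq hO L 0 hy).2.2.1) (fun y hy ↦ (tr heq hO L 0 hy).2.2.2)
  refine (this.comp ((tA L).symm.contDiff.contDiffOn) fun x hx ↦ ?_).congr fun x hx ↦ ?_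
  · simpa using hx
  · simp

lemma loc_bd {α : ℝ} (a0 : 0 < α) (hO : IsOpen Ω) (hu : ContinuousOn u (closure Ω ∩ ball 0 1)) (hDu : ContinuousOn Du (closure Ω ∩ ball 0 1))
    (heq : ∀ x ∈ Ω ∩ ball (0 : En (N+1)) 1, DifferentiableAt ℝ u x ∧ (∀ i, fderiv ℝ u x (EuclideanSpace.single i 1) = Du x i) ∧
      DifferentiableAt ℝ (fderiv ℝ u) x ∧ lapAt u x = 1)
    (hbd : ∀ x ∈ frontier Ω ∩ ball (0 : En (N+1)) 1, u x = 0 ∧ ‖Du x‖ = 1) (hreg : BoundaryCmα 1 α Ω) {x0} (hx : x0 ∈ frontier Ω ∩ ball (0 : En (N+1)) 1) :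
    ∃ ε > 0, ∃ w, ContDiff ℝ ⊤∞ w ∧ fderiv ℝ w x0 ≠ 0 ∧ ∃ s : ℝ, ∀ x, dist x x0 < ε → (x ∈ Ω ↔ 0 < w x) ∧ (x ∈ Ω → s * w x = u x) := by
  obtain ⟨K, r, K0, r0, hb⟩ := hreg {x0} isCompact_singleton (by simpa using hx)
  obtain ⟨φ, P, φ0, p1, p2, -, p3, i1, i2⟩ := hb x0 rfl
  have P0 := poly1 p1 p2 (p3 le_rfl)
  subst P0
  have s0 : φ.symm 0 = x0 := by rw [← φ0, φ.symm_apply_apply]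
  let L := φ.symm.toRealLinearIsometryEquiv
  have hL : ∀ y, φ.symm y = x0 + L y := fun y ↦ by simp [L, s0]
  let T : Yn N ≃ₜ En (N+1) := (tA L).toHomeomorph.trans (Homeomorph.addLeft x0)
  have hT : ∀ y, T y = x0 + tA L y := fun y ↦ rfl
  have hT2 : ∀ y, T y = φ.symm (WithLp.toLp 2 y) := fun y ↦ by rw [hL]; rfl
  have T0 : T 0 = x0 := by simp [hT]
  obtain ⟨R, R0, hR⟩ := Metric.mem_nhds_iff.1 (T.continuous.continuousAt.preimage_mem_nhds (by rw [T0]; exact isOpen_ball.mem_nhds hx.2) : T ⁻¹' ball 0 1 ∈ nhds 0)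
  have mc : MapsTo T (closure (T ⁻¹' Ω) ∩ ball 0 R) (closure Ω ∩ ball 0 1) := fun y hy ↦ ⟨by rw [← T.preimage_closure] at hy; exact hy.1, hR hy.2⟩
  have mf : ∀ y ∈ frontier (T ⁻¹' Ω) ∩ ball 0 R, T y ∈ frontier Ω ∩ ball 0 1 := fun y hy ↦ ⟨by rw [← T.preimage_frontier] at hy; exact hy.1, hR hy.2⟩
  have t := fun y (hy : y ∈ T ⁻¹' Ω ∩ ball 0 R) ↦ tr heq hO L x0 (y := y) ⟨hy.1, hR hy.2⟩
  have D : RD N (T ⁻¹' Ω) (fun y ↦ u (x0 + tA L y)) (fun i y ↦ inner ℝ (Du (x0 + tA L y)) (oB L i)) R 1 :=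
    { R0 := R0
      oO := hO.preimage T.continuous
      cU := hu.comp T.continuous.continuousOn mc
      cG := fun i ↦ (hDu.comp T.continuous.continuousOn mc).inner continuousOn_const
      df := fun y hy ↦ (t y hy).1
      dG := fun i y hy ↦ (t y hy).2.1 i
      dU := fun y hy ↦ (t y hy).2.2.1
      lap := fun y hy ↦ (t y hy).2.2.2
      fU := fun y hy ↦ (hbd _ (mf y hy)).1
      fG := fun y hy ↦ by
        have h1 := (oB L).sum_sq_norm_inner_left (Du (T y))
        rw [(hbd _ (mf y hy)).2] at h1
        simpa [hT] using h1
      z0 := by rw [← T.preimage_frontier, mem_preimage, T0]; exact hx.1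
      fl := fun ε ε0 ↦ by
        obtain ⟨C, C0, hC⟩ : ∃ C > 0, ∀ y : Yn N, ‖(WithLp.toLp 2 y : En (N+1))‖ ≤ C * ‖y‖ :=
          ((EuclideanSpace.equiv (Fin (N+1)) ℝ).symm : Yn N →L[ℝ] En (N+1)).bound
        have ct : ContinuousAt (fun s : ℝ ↦ K * C * (C * s) ^ α) 0 := by
          have : ContinuousAt (fun t : ℝ ↦ t ^ α) (C * 0) := Real.continuousAt_rpow_const _ _ (Or.inr a0.le)
          exact continuousAt_const.mul (this.comp (f := fun s : ℝ ↦ C * s) (by fun_prop))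
        obtain ⟨s, hs0, hs⟩ := Metric.eventually_nhds_iff.1 (ct.eventually_lt (continuousAt_const (y := ε)) (by simp [Real.zero_rpow a0.ne', ε0]))
        refine ⟨min s (r / C), by positivity, fun y hy ↦ ?_⟩
        set z : En (N+1) := WithLp.toLp 2 y with hz
        have zr : ‖z‖ < r := (hC y).trans_lt (by rw [mul_comm, ← lt_div_iff₀ C0]; exact hy.trans_le (min_le_right _ _))
        have xz : xn z = y ℓ := rfl
        have e1 : K * xpn z ^ (((1:ℕ) : ℝ) + α) ≤ ε * ‖y‖ := by
          calc _ ≤ K * (C * ‖y‖) ^ (((1:ℕ) : ℝ) + α) := mul_le_mul_of_nonneg_left (Real.rpow_le_rpow (Real.sqrt_nonneg _) ((xpn_le z).trans (hC y)) (by positivity)) K0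
            _ = (K * C * (C * ‖y‖) ^ α) * ‖y‖ := by
              rw [Real.rpow_add_of_nonneg (by positivity) (by positivity) a0.le]; simp; ring
            _ ≤ _ := mul_le_mul_of_nonneg_right (hs (by simpa using hy.trans_le (min_le_left _ _))).le (norm_nonneg _)
        have pz0 : peval (0 : MvPolynomial (Fin (N+1)) ℝ) z = 0 := by simp [peval]
        refine ⟨fun h ↦ ?_, fun h ↦ ?_⟩
        · rw [mem_preimage, hT2]; exact i1 z zr (by rw [pz0]; linarith)
        · rw [mem_preimage, hT2]; exact i2 z zr (by rw [pz0]; linarith) }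
  obtain ⟨ε, ε0, w, cw, dw, s, hw⟩ := D.fin
  have cS : ContDiff ℝ ⊤∞ fun x ↦ (tA L).symm (x - x0) := (tA L).symm.contDiff.comp (contDiff_id.sub contDiff_const)
  obtain ⟨δ, δ0, hδ⟩ := Metric.eventually_nhds_iff.1 (cS.continuous.norm.continuousAt.eventually_lt (continuousAt_const (y := ε)) (by simpa using ε0) : ∀ᶠ x in nhds x0, ‖(tA L).symm (x - x0)‖ < ε)
  refine ⟨δ, δ0, fun x ↦ w ((tA L).symm (x - x0)), cw.comp cS, fun h0 ↦ dw ?_, s, fun x hx ↦ ?_⟩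
  · have e : w = (fun x ↦ w ((tA L).symm (x - x0))) ∘ fun y ↦ x0 + tA L y := by funext y; simp
    have hd : DifferentiableAt ℝ (fun x ↦ w ((tA L).symm (x - x0))) (x0 + tA L 0) := (cw.comp cS).differentiable (by simp) _
    rw [e, fderiv_comp (f := fun y ↦ x0 + tA L y) 0 hd (by fun_prop), map_zero, add_zero, h0]; simp
  · have := hw _ (hδ hx)
    have e : x0 + tA L ((tA L).symm (x - x0)) = x := by simp
    simpa only [mem_preimage, hT, e] using this
end

lemma BoundaryPtCmα.mono {n : ℕ} [NeZero n] {m : ℕ} {α K r K' r' : ℝ} {Ω : Set (En n)} {x} (h : BoundaryPtCmα m α K r Ω x) (hK : K ≤ K') (hr : r' ≤ r) :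
    BoundaryPtCmα m α K' r' Ω x := by
  obtain ⟨φ, P, a, b, c, d, e, f, g⟩ := h
  have h1 : ∀ y : En n, K * xpn y ^ ((m:ℝ) + α) ≤ K' * xpn y ^ ((m:ℝ) + α) := fun y ↦ mul_le_mul_of_nonneg_right hK (Real.rpow_nonneg (Real.sqrt_nonneg _) _)
  exact ⟨φ, P, a, b, c, d, e, fun y hy h ↦ f y (hy.trans_le hr) (by linarith [h1 y]), fun y hy h ↦ g y (hy.trans_le hr) (by linarith [h1 y])⟩

theorem fin_6 (n : ℕ) [NeZero n] (α : ℝ) (hα0 : 0 < α)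
    (Ω : Set (En n)) (u : En n → ℝ) (Du : En n → En n)
    (hΩo : IsOpen Ω)
    (hu : ContinuousOn u (closure Ω ∩ ball 0 1))
    (hDu : ContinuousOn Du (closure Ω ∩ ball 0 1))
    (heq : ∀ x ∈ Ω ∩ ball (0 : En n) 1,
      DifferentiableAt ℝ u x ∧
      (∀ i, fderiv ℝ u x (EuclideanSpace.single i 1) = Du x i) ∧
      DifferentiableAt ℝ (fderiv ℝ u) x ∧ lapAt u x = 1)
    (hbd : ∀ x ∈ frontier Ω ∩ ball (0 : En n) 1, u x = 0 ∧ ‖Du x‖ = 1)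
    (hreg : BoundaryCmα 1 α Ω) :
    SmoothUpToBoundary Ω u ∧ BoundarySmooth Ω := by
  obtain ⟨N, rfl⟩ : ∃ N, n = N + 1 := ⟨n - 1, by have := NeZero.pos n; omega⟩
  have key := fun x (hx : x ∈ frontier Ω ∩ ball (0 : En (N+1)) 1) ↦ loc_bd hα0 hΩo hu hDu heq hbd hreg hx
  refine ⟨fun x hx ↦ ?_, fun m _ β b0 b1 S cS hS ↦ ?_⟩
  · by_cases hxo : x ∈ Ω
    · obtain ⟨ε, ε0, hε⟩ := Metric.isOpen_iff.1 (hΩo.inter isOpen_ball) x ⟨hxo, hx.2⟩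
      obtain ⟨F, cF, hF⟩ := glob_ext ε0 ((loc_in heq hΩo).mono hε)
      exact ⟨ε / 3, by positivity, F, cF, fun y hy ↦ hF y hy.2⟩
    · obtain ⟨ε, ε0, w, cw, -, s, hw⟩ := key x ⟨⟨hx.1, by rwa [hΩo.interior_eq]⟩, hx.2⟩
      exact ⟨ε, ε0, fun y ↦ s * w y, contDiff_const.mul cw, fun y hy ↦ (hw y hy.2).2 hy.1⟩
  · refine cS.induction_on (p := fun S' ↦ ∃ K r₀ : ℝ, 0 ≤ K ∧ 0 < r₀ ∧ ∀ x₀ ∈ S', BoundaryPtCmα m β K r₀ Ω x₀) ⟨0, 1, le_rfl, one_pos, by simp⟩ ?_ ?_ fun x hx ↦ ?_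
    · rintro S T hST ⟨K, r, K0, r0, hh⟩
      exact ⟨K, r, K0, r0, fun q hq ↦ hh q (hST hq)⟩
    · rintro S T ⟨K, r, K0, r0, hh⟩ ⟨K', r', K0', r0', hh'⟩
      exact ⟨max K K', min r r', le_max_of_le_left K0, lt_min r0 r0', fun q hq ↦ hq.elim
        (fun hq ↦ (hh q hq).mono (le_max_left _ _) (min_le_left _ _)) fun hq ↦ (hh' q hq).mono (le_max_right _ _) (min_le_right _ _)⟩
    · obtain ⟨ε, ε0, w, cw, dw, s, hw⟩ := key x (hS hx)
      obtain ⟨K, K0, r, r0, h⟩ := bd_loc cw dw ε0 (fun y hy ↦ (hw y hy).1) m b0 b1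
      exact ⟨S ∩ ball x r, inter_mem_nhdsWithin _ (ball_mem_nhds _ r0), K, r, K0, r0, fun y hy ↦ h y hy.2 (hS hy.1).1⟩

/-- Theorem 1.8: higher regularity of the free boundary for the one-phase
problem `Δu = 1` in `Ω ∩ B₁`, `u = 0`, `|Du| = 1` on `∂Ω ∩ B₁`: if `∂Ω ∩ B₁ ∈ C^{1,α}` then
`u ∈ C^∞(Ω̄ ∩ B₁)` and `∂Ω ∩ B₁ ∈ C^∞`. -/
theorem stmt_6 (n : ℕ) [NeZero n] (hn : 2 ≤ n) (α : ℝ) (hα0 : 0 < α) (hα1 : α < 1)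
    (Ω : Set (En n)) (u : En n → ℝ) (Du : En n → En n)
    (hΩo : IsOpen Ω) (hΩc : IsConnected Ω) (hΩb : IsBounded Ω)
    -- `u` is continuous on `Ω̄ ∩ B₁` and `C¹` up to `∂Ω ∩ B₁`, with gradient `Du`
    (hu : ContinuousOn u (closure Ω ∩ ball 0 1))
    (hDu : ContinuousOn Du (closure Ω ∩ ball 0 1))
    -- `Δu = 1` in `Ω ∩ B₁`
    (heq : ∀ x ∈ Ω ∩ ball (0 : En n) 1,
      DifferentiableAt ℝ u x ∧
      (∀ i, fderiv ℝ u x (EuclideanSpace.single i 1) = Du x i) ∧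
      DifferentiableAt ℝ (fderiv ℝ u) x ∧ lapAt u x = 1)
    -- `u = 0` and `|Du| = 1` on `∂Ω ∩ B₁`
    (hbd : ∀ x ∈ frontier Ω ∩ ball (0 : En n) 1, u x = 0 ∧ ‖Du x‖ = 1)
    -- `∂Ω ∩ B₁ ∈ C^{1,α}`
    (hreg : BoundaryCmα 1 α Ω) :
    SmoothUpToBoundary Ω u ∧ BoundarySmooth Ω := by
  exact fin_6 n α hα0 Ω u Du hΩo hu hDu heq hbd hreg
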